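/- Let n ≥ 2 and let Ω be a bounded connected open set in ℝⁿ with smooth boundary. Then the first nonzero Neumann eigenvalue of the bi-harmonic operator satisfies Υ₁(Ω) ≤ Υ₁(B_Ω), where B_Ω is an open ball in ℝⁿ with the same Lebesgue volume as Ω. Moreover, equality holds if and only if Ω is itself a ball of that volume. -/

import Mathlib

open MeasureTheory Set

noncomputable section

/-- The Laplacian of `f` (sum of second partial derivatives), with all derivatives
taken within the set `S`. -/
def lapWithin {n : ℕ} (S : Set (EuclideanSpace ℝ (Fin n)))
    (f : EuclideanSpace ℝ (Fin n) → ℝ) (x : EuclideanSpace ℝ (Fin n)) : ℝ :=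
  ∑ i : Fin n, fderivWithin ℝ
    (fun y => fderivWithin ℝ f S y (EuclideanSpace.single i 1)) S x (EuclideanSpace.single i 1)

/-- A bounded open set in `ℝⁿ` with smooth boundary, presented by a smooth defining
function which is negative exactly on the set, vanishes exactly on the boundary, and has
nonvanishing gradient on the boundary. -/
structure SmoothDomain (n : ℕ) where
  carrier : Set (EuclideanSpace ℝ (Fin n))
  defining : EuclideanSpace ℝ (Fin n) → ℝ
  isOpen : IsOpen carrier
  isBounded : Bornology.IsBounded carrier
  smooth_defining : ContDiff ℝ (⊤ : ℕ∞) defining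
  carrier_eq : carrier = {x | defining x < 0}
  frontier_eq : frontier carrier = {x | defining x = 0}
  grad_ne_zero : ∀ x ∈ frontier carrier, gradient defining x ≠ 0

/-- The outward unit normal vector field on the boundary of a smooth domain. -/
def SmoothDomain.normal {n : ℕ} (D : SmoothDomain n) (x : EuclideanSpace ℝ (Fin n)) :
    EuclideanSpace ℝ (Fin n) :=
  ‖gradient D.defining x‖⁻¹ • gradient D.defining x

/-- The outward normal derivative `∂f/∂n` of `f`, computed within the closure of the domain. -/
def SmoothDomain.normalDeriv {n : ℕ} (D : SmoothDomain n)
    (f : EuclideanSpace ℝ (Fin n) → ℝ) (x : EuclideanSpace ℝ (Fin n)) : ℝ :=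
  fderivWithin ℝ f (closure D.carrier) x (D.normal x)

/-- `Υ` is a Neumann eigenvalue of the bi-harmonic operator `Δ²` on `D`:
there is a nonzero function `u`, smooth on the closure of `D`, with `Δ²u = Υ·u` in `D` and
`∂u/∂n = ∂(Δu)/∂n = 0` on `∂D`. -/
def IsBiharmonicNeumannEigenvalue {n : ℕ} (D : SmoothDomain n) (Υ : ℝ) : Prop :=
  ∃ u : EuclideanSpace ℝ (Fin n) → ℝ,
    ContDiffOn ℝ (⊤ : ℕ∞) u (closure D.carrier) ∧
    (∃ x ∈ closure D.carrier, u x ≠ 0) ∧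
    (∀ x ∈ D.carrier,
      lapWithin (closure D.carrier) (lapWithin (closure D.carrier) u) x = Υ * u x) ∧
    (∀ x ∈ frontier D.carrier, D.normalDeriv u x = 0) ∧
    (∀ x ∈ frontier D.carrier, D.normalDeriv (lapWithin (closure D.carrier) u) x = 0)

namespace BNS
open MeasureTheory Set Filter Topology

/-- standard basis vector -/
noncomputable def ee {n : ℕ} (i : Fin n) : EuclideanSpace ℝ (Fin n) := EuclideanSpace.single i (1:ℝ)

/-- divergence -/
noncomputable def dv {n : ℕ} (F : EuclideanSpace ℝ (Fin n) → EuclideanSpace ℝ (Fin n))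
    (x : EuclideanSpace ℝ (Fin n)) : ℝ := ∑ i, (fderiv ℝ F x (ee i)) i

section A1
variable {n : ℕ}
local notation "E" => EuclideanSpace ℝ (Fin n)

lemma sum_smul_ee (v : E) : ∑ i, (v i) • (ee i : E) = v := by
  ext j
  simp [ee, Pi.single_apply]

lemma clm_eq_sum {G : Type*} [NormedAddCommGroup G] [NormedSpace ℝ G] (l : E →L[ℝ] G) (v : E) :
    l v = ∑ i, v i • l (ee i) := by
  conv_lhs => rw [← sum_smul_ee v]
  simp [map_sum]

lemma ee_apply (i j : Fin n) : (ee i : E) j = if j = i then 1 else 0 := by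
  simp [ee, PiLp.single_apply]

lemma norm_ee (i : Fin n) : ‖(ee i : E)‖ = 1 := by simp [ee]

lemma dv_smul {a : E → ℝ} {F : E → E} {x : E} (ha : DifferentiableAt ℝ a x)
    (hF : DifferentiableAt ℝ F x) :
    dv (fun y => a y • F y) x = a x * dv F x + fderiv ℝ a x (F x) := by
  unfold dv
  rw [fderiv_fun_smul ha hF, clm_eq_sum (fderiv ℝ a x) (F x), Finset.mul_sum,
    ← Finset.sum_add_distrib]
  refine Finset.sum_congr rfl fun i _ => ?_
  simp [mul_comm]

lemma dv_add {F G : E → E} {x : E} (hF : DifferentiableAt ℝ F x)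
    (hG : DifferentiableAt ℝ G x) :
    dv (fun y => F y + G y) x = dv F x + dv G x := by
  unfold dv
  rw [fderiv_fun_add hF hG, ← Finset.sum_add_distrib]
  simp

lemma dv_continuousOn {F : E → E} {U : Set E} (hU : IsOpen U) (hF : ContDiffOn ℝ 1 F U) :
    ContinuousOn (dv F) U := by
  have h := hF.continuousOn_fderiv_of_isOpen hU le_rfl
  unfold dv
  refine continuousOn_finsetSum _ fun i _ => ?_
  have h2 : ContinuousOn (fun x => fderiv ℝ F x (ee i)) U := h.clm_apply continuousOn_const
  exact (EuclideanSpace.proj i : E →L[ℝ] ℝ).continuous.comp_continuousOn h2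

lemma dv_congr {F G : E → E} {x : E} (h : F =ᶠ[𝓝 x] G) : dv F x = dv G x := by
  unfold dv; rw [h.fderiv_eq]

lemma integral_dv_compact {F : E → E} (hF : ContDiff ℝ 1 F) (hc : HasCompactSupport F) :
    ∫ x, dv F x = 0 := by
  unfold dv
  have key : ∀ i : Fin n, (fun x => (fderiv ℝ F x (ee i)) i)
      = fun x => fderiv ℝ (fun y => F y i) x (ee i) := by
    intro i; funext x
    have := ((EuclideanSpace.proj i : E →L[ℝ] ℝ).hasFDerivAt.comp x
      (hF.differentiable one_ne_zero x).hasFDerivAt).fderiv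
    have h2 : ((EuclideanSpace.proj i : E →L[ℝ] ℝ) ∘ F) = fun y => F y i := rfl
    rw [h2] at this
    rw [this]; rfl
  have hG : ∀ i : Fin n, ContDiff ℝ 1 (fun y => F y i) := fun i =>
    (EuclideanSpace.proj i : E →L[ℝ] ℝ).contDiff.comp hF
  have hGc : ∀ i : Fin n, HasCompactSupport (fun y => F y i) := fun i =>
    hc.comp_left (g := fun v : E => v i) rfl
  have hitg : ∀ i : Fin n, Integrable (fun x => fderiv ℝ (fun y => F y i) x (ee i)) := fun i =>
    (((hG i).continuous_fderiv one_ne_zero).clm_apply continuous_const).integrable_of_hasCompactSupport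
      ((hGc i).fderiv_apply ℝ _)
  simp_rw [fun x i => congrFun (key i) x]
  rw [integral_finsetSum _ fun i _ => hitg i]
  refine Finset.sum_eq_zero fun i _ => ?_
  have := integral_mul_fderiv_eq_neg_fderiv_mul_of_integrable (μ := (volume : Measure E))
    (f := fun _ => (1:ℝ)) (g := fun y => F y i) (v := ee i) (by simp) (by simpa using hitg i)
    (by simpa using (hG i).continuous.integrable_of_hasCompactSupport (hGc i))
    (fun _ _ => differentiableAt_const _) (fun x _ => (hG i).differentiable one_ne_zero x)
  simpa using this

variable (D : SmoothDomain n)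

lemma rho_cd : ContDiff ℝ (⊤ : ℕ∞) D.defining := D.smooth_defining
lemma rho_cd1 : ContDiff ℝ 1 D.defining := D.smooth_defining.of_le (by exact_mod_cast le_top)
lemma rho_diff : Differentiable ℝ D.defining := (rho_cd1 D).differentiable one_ne_zero
lemma rho_cont : Continuous D.defining := D.smooth_defining.continuous
lemma mem_carrier {x : E} : x ∈ D.carrier ↔ D.defining x < 0 := by
  rw [D.carrier_eq]; rfl
lemma closure_eq : closure D.carrier = {x | D.defining x ≤ 0} := by
  rw [closure_eq_self_union_frontier, D.frontier_eq, D.carrier_eq]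
  ext x; simp [le_iff_lt_or_eq]
lemma mem_clos {x : E} : x ∈ closure D.carrier ↔ D.defining x ≤ 0 := by
  rw [closure_eq]; rfl
lemma mem_front {x : E} : x ∈ frontier D.carrier ↔ D.defining x = 0 := by
  rw [D.frontier_eq]; rfl
lemma compact_clos : IsCompact (closure D.carrier) := D.isBounded.isCompact_closure
lemma fderiv_rho_ne {x : E} (hx : D.defining x = 0) : fderiv ℝ D.defining x ≠ 0 := by
  intro h
  exact D.grad_ne_zero x ((mem_front D).2 hx) (by simp [gradient, h])
lemma vol_lt_top : volume D.carrier < ⊤ := D.isBounded.measure_lt_top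
lemma meas_carrier : MeasurableSet D.carrier := D.isOpen.measurableSet
instance fin_restrict : IsFiniteMeasure (volume.restrict D.carrier) :=
  ⟨by simpa using vol_lt_top D⟩

/-- core identity -/
lemma core_identity {F : E → E} (hF : ContDiffOn ℝ 1 F D.carrier) {χ : ℝ → ℝ}
    (hχ : ContDiff ℝ 1 χ) {ε : ℝ} (hε : 0 < ε) (h0 : ∀ s, -ε ≤ s → χ s = 0) :
    ∫ x in D.carrier, χ (D.defining x) * dv F x =
      - ∫ x in D.carrier, deriv χ (D.defining x) * fderiv ℝ D.defining x (F x) := by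
  set ρ := D.defining with hρ
  set ψ : E → ℝ := fun x => χ (ρ x) with hψ
  have hψc : ContDiff ℝ 1 ψ := hχ.comp (rho_cd1 D)
  have hout : ∀ x, x ∉ D.carrier → ∀ᶠ y in 𝓝 x, ψ y = 0 := by
    intro x hx
    have : -ε < ρ x := by
      rw [mem_carrier] at hx; push Not at hx; linarith
    filter_upwards [(rho_cont D).continuousAt.eventually (lt_mem_nhds this)] with y hy
    exact h0 _ hy.le
  set G : E → E := fun x => ψ x • F x with hG
  have hGc : ContDiff ℝ 1 G := by
    rw [contDiff_iff_contDiffAt]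
    intro x
    by_cases hx : x ∈ D.carrier
    · exact hψc.contDiffAt.smul (hF.contDiffAt (D.isOpen.mem_nhds hx))
    · refine (contDiffAt_const (c := (0:E))).congr_of_eventuallyEq ?_
      filter_upwards [hout x hx] with y hy
      simp [hG, hy]
  have hGs : HasCompactSupport G := by
    refine HasCompactSupport.intro (compact_clos D) fun x hx => ?_
    have : x ∉ D.carrier := fun h => hx (subset_closure h)
    simp [hG, (hout x this).self_of_nhds]
  have hdv0 : ∀ x, x ∉ D.carrier → dv G x = 0 := by
    intro x hx
    have : G =ᶠ[𝓝 x] fun _ => (0:E) := by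
      filter_upwards [hout x hx] with y hy
      simp [hG, hy]
    rw [dv_congr this]; simp [dv]
  have hdv : ∀ x ∈ D.carrier, dv G x = ψ x * dv F x + deriv χ (ρ x) * fderiv ℝ ρ x (F x) := by
    intro x hx
    rw [hG, dv_smul (hψc.differentiable one_ne_zero x)
      ((hF.contDiffAt (D.isOpen.mem_nhds hx)).differentiableAt one_ne_zero)]
    congr 1
    have := ((hχ.differentiable one_ne_zero (ρ x)).hasDerivAt.comp_hasFDerivAt x
      ((rho_diff D) x).hasFDerivAt).fderiv
    have h2 : χ ∘ D.defining = ψ := rfl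
    rw [h2] at this
    rw [this, ← hρ]; simp
  have h1 := integral_dv_compact hGc hGs
  rw [← setIntegral_eq_integral_of_forall_compl_eq_zero (s := D.carrier) hdv0,
    setIntegral_congr_fun (meas_carrier D) hdv] at h1
  -- integrability of each term
  have hcs : ∀ f : E → ℝ, ContinuousOn f D.carrier → ∀ η : ℝ → ℝ, Continuous η →
      (∀ s, -(ε/2) ≤ s → η s = 0) →
      IntegrableOn (fun x => η (ρ x) * f x) D.carrier := by
    intro f hf η hη hη0
    set S : Set E := {x | ρ x ≤ -(ε/2)} with hS
    have hSsub : S ⊆ D.carrier := fun x hx => by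
      rw [mem_carrier]; have : ρ x ≤ -(ε/2) := hx; linarith
    have hSc : IsCompact S := (compact_clos D).of_isClosed_subset
      (isClosed_le (rho_cont D) continuous_const) (hSsub.trans subset_closure)
    have hi : IntegrableOn (fun x => η (ρ x) * f x) S :=
      ContinuousOn.integrableOn_compact hSc
        (((hη.comp (rho_cont D)).continuousOn).mul (hf.mono hSsub))
    refine hi.of_forall_sdiff_eq_zero (meas_carrier D) ?_
    intro x hx
    have : -(ε/2) ≤ ρ x := by
      by_contra h; push Not at h; exact hx.2 h.le
    rw [hη0 _ this, zero_mul]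
  have hd0 : ∀ s, -(ε/2) ≤ s → deriv χ s = 0 := by
    intro s hs
    have : χ =ᶠ[𝓝 s] fun _ => 0 := by
      filter_upwards [lt_mem_nhds (show -ε < s by linarith)] with y hy
      exact h0 y hy.le
    rw [this.deriv_eq]; simp
  have i1 := hcs (dv F) (dv_continuousOn D.isOpen hF) χ hχ.continuous
    (fun s hs => h0 s (by linarith))
  have i2 := hcs (fun x => fderiv ℝ ρ x (F x))
    ((((rho_cd1 D).continuous_fderiv one_ne_zero).continuousOn).clm_apply hF.continuousOn)
    (deriv χ) (hχ.continuous_deriv le_rfl) hd0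
  rw [integral_add i1 i2] at h1
  linarith

end A1
end BNS

namespace BNS
open MeasureTheory Set Filter Topology

/-- cutoff profile: `0` for `s ≥ -1`, `1` for `s ≤ -2`. -/
noncomputable def cutη (s : ℝ) : ℝ := Real.smoothTransition (-s - 1)

lemma cutη_cd : ContDiff ℝ 1 cutη := by
  unfold cutη
  exact (Real.smoothTransition.contDiff (n := 1)).comp ((contDiff_id.neg).sub contDiff_const)
lemma cutη_zero {s : ℝ} (h : -1 ≤ s) : cutη s = 0 :=
  Real.smoothTransition.zero_of_nonpos (by linarith)
lemma cutη_one {s : ℝ} (h : s ≤ -2) : cutη s = 1 :=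
  Real.smoothTransition.one_of_one_le (by linarith)
lemma cutη_nonneg (s : ℝ) : 0 ≤ cutη s := Real.smoothTransition.nonneg _
lemma cutη_le (s : ℝ) : cutη s ≤ 1 := Real.smoothTransition.le_one _
lemma dcutη_zero {s : ℝ} (h : -1 < s ∨ s < -2) : deriv cutη s = 0 := by
  rcases h with h | h
  · have : cutη =ᶠ[𝓝 s] fun _ => 0 := by
      filter_upwards [lt_mem_nhds h] with y hy
      exact cutη_zero hy.le
    rw [this.deriv_eq]; simp
  · have : cutη =ᶠ[𝓝 s] fun _ => 1 := by
      filter_upwards [gt_mem_nhds h] with y hy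
      exact cutη_one hy.le
    rw [this.deriv_eq]; simp
lemma dcutη_bdd : ∃ C : ℝ, 0 < C ∧ ∀ s, |deriv cutη s| ≤ C := by
  obtain ⟨C, hC⟩ := isCompact_Icc.exists_bound_of_continuousOn (s := Icc (-2:ℝ) (-1))
    (cutη_cd.continuous_deriv le_rfl).continuousOn
  refine ⟨max C 1, by positivity, fun s => ?_⟩
  by_cases hs : s ∈ Icc (-2:ℝ) (-1)
  · exact (hC s hs).trans (le_max_left _ _)
  · rw [dcutη_zero, abs_zero]; · positivity
    by_contra h; push Not at h; exact hs ⟨h.2, h.1⟩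

lemma abs_arctan_le (x : ℝ) : |Real.arctan x| ≤ |x| := by
  have := convex_univ.norm_image_sub_le_of_norm_deriv_le (f := Real.arctan) (C := 1) (s := univ)
    (x := 0) (y := x) (fun y _ => Real.differentiableAt_arctan y) (fun y _ => by
      rw [Real.deriv_arctan, Real.norm_of_nonneg (by positivity), div_le_one (by positivity)]
      nlinarith [sq_nonneg y]) (mem_univ _) (mem_univ _)
  simpa using this

section A2
variable {n : ℕ}
local notation "E" => EuclideanSpace ℝ (Fin n)
variable (D : SmoothDomain n)

lemma cont_intOn {f : E → ℝ} (hf : ContinuousOn f (closure D.carrier)) :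
    IntegrableOn f D.carrier :=
  (hf.integrableOn_compact (compact_clos D)).mono_set subset_closure

lemma tendsto_cut {x : E} (hx : x ∈ D.carrier) :
    ∀ᶠ k : ℕ in atTop, ((k:ℝ)+1) * D.defining x < -2 := by
  have hx' := (mem_carrier D).1 hx
  have : Tendsto (fun k : ℕ => ((k:ℝ)+1) * D.defining x) atTop atBot :=
    Tendsto.atTop_mul_const_of_neg hx'
      (tendsto_natCast_atTop_atTop.atTop_add tendsto_const_nhds)
  exact this.eventually (eventually_lt_atBot _)

lemma core_k {F : E → E} (hF : ContDiffOn ℝ 1 F D.carrier) (k : ℕ) :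
    ∫ x in D.carrier, cutη (((k:ℝ)+1) * D.defining x) * dv F x =
      - ∫ x in D.carrier, (((k:ℝ)+1) * deriv cutη (((k:ℝ)+1) * D.defining x))
        * fderiv ℝ D.defining x (F x) := by
  have hk : (0:ℝ) < (k:ℝ)+1 := by positivity
  have h := core_identity D hF (χ := fun s => cutη (((k:ℝ)+1) * s))
    (cutη_cd.comp (contDiff_const.mul contDiff_id)) (ε := ((k:ℝ)+1)⁻¹) (by positivity) (by
      intro s hs
      apply cutη_zero
      have := mul_le_mul_of_nonneg_left hs hk.le
      rw [mul_neg, mul_inv_cancel₀ hk.ne'] at this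
      linarith)
  rw [h]
  congr 2
  funext x
  congr 1
  have := (((cutη_cd.differentiable one_ne_zero) (((k:ℝ)+1) * D.defining x)).hasDerivAt.comp
    (D.defining x) ((hasDerivAt_id (D.defining x)).const_mul ((k:ℝ)+1))).deriv
  simp only [Function.comp_def] at this
  rw [this]; ring

lemma core_tendsto {F : E → E}
    (hi : IntegrableOn (dv F) D.carrier) :
    Tendsto (fun k : ℕ => ∫ x in D.carrier, cutη (((k:ℝ)+1) * D.defining x) * dv F x) atTop
      (𝓝 (∫ x in D.carrier, dv F x)) := by
  refine tendsto_integral_of_dominated_convergence (fun x => ‖dv F x‖) ?_ hi.norm ?_ ?_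
  · intro k
    have : Continuous (fun x => cutη (((k:ℝ)+1) * D.defining x)) :=
      cutη_cd.continuous.comp (continuous_const.mul (rho_cont D))
    exact this.aestronglyMeasurable.mul hi.aestronglyMeasurable
  · intro k
    refine Eventually.of_forall fun x => ?_
    rw [norm_mul]
    refine mul_le_of_le_one_left (norm_nonneg _) ?_
    rw [Real.norm_of_nonneg (cutη_nonneg _)]; exact cutη_le _
  · filter_upwards [ae_restrict_mem (meas_carrier D)] with x hx
    refine tendsto_const_nhds.congr' ?_
    filter_upwards [tendsto_cut D hx] with k hk
    rw [cutη_one hk.le, one_mul]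

/-- DIV0 -/
lemma div0 {F : E → E} (hF : ContDiffOn ℝ 1 F D.carrier) (hi : IntegrableOn (dv F) D.carrier)
    {C : ℝ} (hC : ∀ x ∈ D.carrier, |fderiv ℝ D.defining x (F x)| ≤ C * |D.defining x|) :
    ∫ x in D.carrier, dv F x = 0 := by
  have h1 := core_tendsto D hi
  simp_rw [core_k D hF] at h1
  obtain ⟨C', hC', hb⟩ := dcutη_bdd
  have hcF : ContinuousOn (fun x => fderiv ℝ D.defining x (F x)) D.carrier :=
    (((rho_cd1 D).continuous_fderiv one_ne_zero).continuousOn).clm_apply hF.continuousOn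
  have h2 : Tendsto (fun k : ℕ => ∫ x in D.carrier,
      (((k:ℝ)+1) * deriv cutη (((k:ℝ)+1) * D.defining x)) * fderiv ℝ D.defining x (F x)) atTop
      (𝓝 (∫ x in D.carrier, (0:ℝ))) := by
    refine tendsto_integral_of_dominated_convergence (fun x => 2 * C' * |C|) ?_
      (integrable_const _) ?_ ?_
    · intro k
      have : Continuous (fun x => ((k:ℝ)+1) * deriv cutη (((k:ℝ)+1) * D.defining x)) :=
        continuous_const.mul ((cutη_cd.continuous_deriv le_rfl).comp
          (continuous_const.mul (rho_cont D)))
      exact this.aestronglyMeasurable.mul (hcF.aestronglyMeasurable (meas_carrier D))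
    · intro k
      filter_upwards [ae_restrict_mem (meas_carrier D)] with x hx
      by_cases hz : ((k:ℝ)+1) * D.defining x < -2
      · rw [dcutη_zero (Or.inr hz)]; simp; positivity
      · push Not at hz
        have hk : (0:ℝ) < (k:ℝ)+1 := by positivity
        have hx' := (mem_carrier D).1 hx
        have h3 : ((k:ℝ)+1) * |D.defining x| ≤ 2 := by rw [abs_of_neg hx']; linarith
        have h4 : |fderiv ℝ D.defining x (F x)| ≤ |C| * |D.defining x| :=
          (hC x hx).trans (by gcongr; exact le_abs_self C)
        rw [norm_mul, norm_mul, Real.norm_of_nonneg hk.le, Real.norm_eq_abs, Real.norm_eq_abs]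
        calc ((k:ℝ)+1) * |deriv cutη (((k:ℝ)+1) * D.defining x)| * |fderiv ℝ D.defining x (F x)|
            ≤ ((k:ℝ)+1) * C' * (|C| * |D.defining x|) := by gcongr; exact hb _
          _ = (((k:ℝ)+1) * |D.defining x|) * (C' * |C|) := by ring
          _ ≤ 2 * (C' * |C|) := by gcongr
          _ = _ := by ring
    · filter_upwards [ae_restrict_mem (meas_carrier D)] with x hx
      refine tendsto_const_nhds.congr' ?_
      filter_upwards [tendsto_cut D hx] with k hk
      rw [dcutη_zero (Or.inr hk)]; simp
  have := tendsto_nhds_unique h1 h2.neg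
  simpa using this

lemma grad_cd : ContDiff ℝ (⊤ : ℕ∞) (gradient D.defining) := by
  unfold gradient
  exact ((InnerProductSpace.toDual ℝ E).symm.toContinuousLinearEquiv.contDiff).comp
    (D.smooth_defining.fderiv_right (m := (⊤ : ℕ∞)) (by exact_mod_cast le_top))

lemma fderiv_eq_inner (x v : E) : fderiv ℝ D.defining x v = inner ℝ (gradient D.defining x) v := by
  simp [gradient]

lemma strip_grad : ∃ c > 0, ∀ x ∈ closure D.carrier, -c ≤ D.defining x →
    c ≤ ‖gradient D.defining x‖ := by
  have hcont : Continuous (fun x => |D.defining x| + ‖gradient D.defining x‖) :=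
    (rho_cont D).abs.add (grad_cd D).continuous.norm
  obtain ⟨m, hm, h⟩ := (compact_clos D).exists_forall_le' (a := (0:ℝ)) hcont.continuousOn (by
    intro x hx
    by_cases h0 : D.defining x = 0
    · have := D.grad_ne_zero x ((mem_front D).2 h0)
      have : 0 < ‖gradient D.defining x‖ := norm_pos_iff.2 this
      positivity
    · have : 0 < |D.defining x| := abs_pos.2 h0
      positivity)
  refine ⟨m/2, by positivity, fun x hx h2 => ?_⟩
  have h3 := h x hx
  have h4 := (mem_clos D).1 hx
  rw [abs_of_nonpos h4] at h3
  linarith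

/-- strip estimate -/
lemma strip_est : ∃ C > 0, ∃ ε₀ > 0, ∀ ε, 0 < ε → ε ≤ ε₀ → ∀ φ : E → ℝ, ContDiff ℝ 1 φ →
    ∫ x in {x | x ∈ D.carrier ∧ -ε < D.defining x}, φ x ^ 2 ≤
      C * ε * ∫ x in D.carrier, (φ x ^ 2 + ‖fderiv ℝ φ x‖ ^ 2) := by
  obtain ⟨c, hc, hgrad⟩ := strip_grad D
  set N := gradient D.defining with hN
  have hN1 : ContDiff ℝ 1 N := (grad_cd D).of_le (by exact_mod_cast le_top)
  have hdvN : Continuous (dv N) := by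
    have := dv_continuousOn isOpen_univ hN1.contDiffOn
    rwa [continuousOn_univ] at this
  obtain ⟨M1, hM1⟩ := (compact_clos D).exists_bound_of_continuousOn hN1.continuous.continuousOn
  obtain ⟨M2, hM2⟩ := (compact_clos D).exists_bound_of_continuousOn hdvN.continuousOn
  set M := max (max M1 M2) 1 with hM
  have hMpos : 0 < M := by positivity
  have hM1' : ∀ x ∈ D.carrier, ‖N x‖ ≤ M := fun x hx =>
    (hM1 x (subset_closure hx)).trans ((le_max_left _ _).trans (le_max_left _ _))
  have hM2' : ∀ x ∈ D.carrier, |dv N x| ≤ M := fun x hx =>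
    (hM2 x (subset_closure hx)).trans ((le_max_right _ _).trans (le_max_left _ _))
  refine ⟨2 / c^2 * (4 * M), by positivity, c, hc, fun ε hε hεc φ hφ => ?_⟩
  set ρ := D.defining with hρ
  set b : E → ℝ := fun x => ε * Real.arctan (ρ x / ε) with hb
  have hb1 : ContDiff ℝ 1 b :=
    contDiff_const.mul (Real.contDiff_arctan.comp ((rho_cd1 D).div_const ε))
  have hbb : ∀ x, |b x| ≤ 2 * ε := fun x => by
    rw [hb]; simp only; rw [abs_mul, abs_of_pos hε]
    have h1 := Real.arctan_lt_pi_div_two (ρ x / ε)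
    have h2 := Real.neg_pi_div_two_lt_arctan (ρ x / ε)
    have h3 := Real.pi_le_four
    have : |Real.arctan (ρ x / ε)| ≤ 2 := abs_le.2 ⟨by linarith, by linarith⟩
    nlinarith
  have hb' : ∀ x v, fderiv ℝ b x v = (1 + (ρ x / ε)^2)⁻¹ * fderiv ℝ ρ x v := by
    intro x v
    have h1 : HasFDerivAt (fun x => ρ x * ε⁻¹) (ε⁻¹ • fderiv ℝ ρ x) x :=
      (rho_diff D x).hasFDerivAt.mul_const' ε⁻¹ |>.congr_fderiv (by ext; simp [mul_comm, hρ])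
    have h2 := ((Real.hasDerivAt_arctan (ρ x * ε⁻¹)).comp_hasFDerivAt x h1).const_mul ε
    have h3 : b = fun x => ε * (Real.arctan ∘ fun x => ρ x * ε⁻¹) x := by
      funext x; simp [hb, div_eq_mul_inv]
    rw [h3, h2.fderiv]
    simp [div_eq_mul_inv]
    field_simp
  have hφd : Differentiable ℝ φ := hφ.differentiable one_ne_zero
  set a : E → ℝ := fun x => b x * φ x ^ 2 with ha
  have ha1 : ContDiff ℝ 1 a := hb1.mul (hφ.pow 2)
  set F : E → E := fun x => a x • N x with hF
  have hF1 : ContDiff ℝ 1 F := ha1.smul hN1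
  have hdvF : ∀ x, dv F x = b x * (φ x ^ 2 * dv N x + 2 * φ x * fderiv ℝ φ x (N x))
      + (1 + (ρ x / ε)^2)⁻¹ * ‖N x‖^2 * φ x ^ 2 := by
    intro x
    rw [hF, dv_smul (ha1.differentiable one_ne_zero x) (hN1.differentiable one_ne_zero x)]
    have h1 : fderiv ℝ a x = b x • ((2 * φ x) • fderiv ℝ φ x) + (φ x ^ 2) • fderiv ℝ b x := by
      have h2 : HasFDerivAt (fun x => φ x ^ 2) ((2 * φ x) • fderiv ℝ φ x) x := by
        simpa using (hφd x).hasFDerivAt.pow 2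
      exact ((hb1.differentiable one_ne_zero x).hasFDerivAt.mul h2).fderiv
    rw [h1]
    simp only [_root_.add_apply, _root_.smul_apply, smul_eq_mul, hb']
    have h2 : fderiv ℝ ρ x (N x) = ‖N x‖^2 := by
      rw [fderiv_eq_inner D x (N x), ← hN, real_inner_self_eq_norm_sq]
    rw [h2]; simp only [ha]; ring
  have hdvFc : Continuous (dv F) := by
    have := dv_continuousOn isOpen_univ hF1.contDiffOn
    rwa [continuousOn_univ] at this
  obtain ⟨P, hP⟩ := (compact_clos D).exists_bound_of_continuousOn (hφ.continuous.pow 2).continuousOn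
  have hz := div0 D hF1.contDiffOn (cont_intOn D hdvFc.continuousOn) (C := P * M^2) (by
    intro x hx
    rw [hF]; simp only [map_smul, smul_eq_mul]
    rw [fderiv_eq_inner D x (N x), ← hN, real_inner_self_eq_norm_sq, ha]
    simp only
    have h1 : |b x| ≤ |ρ x| := by
      rw [hb]; simp only [abs_mul, abs_of_pos hε]
      have h2 : |Real.arctan (ρ x / ε)| ≤ |ρ x / ε| := abs_arctan_le _
      rw [abs_div, abs_of_pos hε] at h2
      calc ε * |Real.arctan (ρ x / ε)| ≤ ε * (|ρ x| / ε) := by gcongr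
        _ = |ρ x| := by field_simp
    have h2 : |φ x ^ 2| ≤ P := hP x (subset_closure hx)
    have h3 := hM1' x hx
    rw [abs_mul, abs_mul, abs_of_nonneg (sq_nonneg ‖N x‖)]
    calc |b x| * |φ x ^ 2| * ‖N x‖^2 ≤ |ρ x| * P * M^2 := by
          have hP0 : 0 ≤ P := (abs_nonneg _).trans h2
          gcongr
      _ = P * M^2 * |ρ x| := by ring)
  have hA : Continuous (fun x => b x * (φ x ^ 2 * dv N x + 2 * φ x * fderiv ℝ φ x (N x))) := by
    refine hb1.continuous.mul (((hφ.continuous.pow 2).mul hdvN).add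
      ((continuous_const.mul hφ.continuous).mul
        ((hφ.continuous_fderiv one_ne_zero).clm_apply hN1.continuous)))
  have hB : Continuous (fun x => (1 + (ρ x / ε)^2)⁻¹ * ‖N x‖^2 * φ x ^ 2) := by
    refine ((Continuous.inv₀ (continuous_const.add (((rho_cont D).div_const ε).pow 2))
      (fun x => (by positivity : (0:ℝ) < 1 + (ρ x / ε)^2).ne')).mul (hN1.continuous.norm.pow 2)).mul (hφ.continuous.pow 2)
  simp_rw [hdvF] at hz
  rw [integral_add (cont_intOn D hA.continuousOn) (cont_intOn D hB.continuousOn)] at hz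
  have hC : Continuous (fun x => φ x ^ 2 + ‖fderiv ℝ φ x‖ ^ 2) :=
    (hφ.continuous.pow 2).add ((hφ.continuous_fderiv one_ne_zero).norm.pow 2)
  have hAle : - ∫ x in D.carrier, b x * (φ x ^ 2 * dv N x + 2 * φ x * fderiv ℝ φ x (N x)) ≤
      (4 * M * ε) * ∫ x in D.carrier, (φ x ^ 2 + ‖fderiv ℝ φ x‖ ^ 2) := by
    rw [← integral_neg, ← integral_const_mul]
    refine setIntegral_mono_on (cont_intOn D hA.neg.continuousOn)
      (cont_intOn D (continuous_const.mul hC).continuousOn) (meas_carrier D) fun x hx => ?_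
    have h1 : |fderiv ℝ φ x (N x)| ≤ ‖fderiv ℝ φ x‖ * M :=
      ((fderiv ℝ φ x).le_opNorm _).trans (by gcongr; exact hM1' x hx)
    have h2 := hM2' x hx
    have h3 := hbb x
    set d := ‖fderiv ℝ φ x‖
    calc -(b x * (φ x ^ 2 * dv N x + 2 * φ x * fderiv ℝ φ x (N x)))
        ≤ |b x| * (φ x ^ 2 * |dv N x| + 2 * |φ x| * |fderiv ℝ φ x (N x)|) := by
          refine (neg_le_abs _).trans ?_
          rw [abs_mul]
          gcongr
          refine (abs_add_le _ _).trans ?_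
          simp [abs_mul]
      _ ≤ (2 * ε) * (φ x ^ 2 * M + 2 * |φ x| * (d * M)) := by gcongr
      _ ≤ 4 * M * ε * (φ x ^ 2 + d ^ 2) := by
          have h4 : 2 * |φ x| * d ≤ φ x ^2 + d^2 := by
            have := sq_nonneg (|φ x| - d); rw [← sq_abs (φ x)]; nlinarith
          have h5 : 0 ≤ M * ε := by positivity
          nlinarith [mul_le_mul_of_nonneg_left h4 h5, mul_nonneg h5 (sq_nonneg d)]
  have hmS : MeasurableSet {x | x ∈ D.carrier ∧ -ε < ρ x} :=
    (D.isOpen.inter (isOpen_lt continuous_const (rho_cont D))).measurableSet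
  have hSsub : {x | x ∈ D.carrier ∧ -ε < ρ x} ⊆ D.carrier := fun x hx => hx.1
  have hfin : ∫ x in {x | x ∈ D.carrier ∧ -ε < ρ x}, φ x ^ 2 ≤
      2 / c^2 * ∫ x in D.carrier, (1 + (ρ x / ε)^2)⁻¹ * ‖N x‖^2 * φ x ^ 2 := by
    calc ∫ x in {x | x ∈ D.carrier ∧ -ε < ρ x}, φ x ^ 2
        ≤ ∫ x in {x | x ∈ D.carrier ∧ -ε < ρ x},
            2 / c^2 * ((1 + (ρ x / ε)^2)⁻¹ * ‖N x‖^2 * φ x ^ 2) := by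
          refine setIntegral_mono_on
            ((cont_intOn D (hφ.continuous.pow 2).continuousOn).mono_set hSsub)
            ((cont_intOn D (continuous_const.mul hB).continuousOn).mono_set hSsub) hmS ?_
          intro x hx
          have hx0 := (mem_carrier D).1 hx.1
          have h1 : c ≤ ‖N x‖ := hgrad x (subset_closure hx.1) (by linarith [hx.2])
          have h2 : (ρ x / ε)^2 ≤ 1 := by
            rw [sq_le_one_iff_abs_le_one, abs_div, abs_of_pos hε, div_le_one hε, abs_of_neg hx0]
            linarith [hx.2]
          have h3 : (1/2:ℝ) ≤ (1 + (ρ x / ε)^2)⁻¹ := by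
            rw [one_div]; gcongr; linarith
          have h4 : c^2 ≤ ‖N x‖^2 := by gcongr
          calc φ x ^ 2 = 2 / c^2 * (1/2 * c^2 * φ x ^2) := by field_simp
            _ ≤ _ := by gcongr
      _ ≤ ∫ x in D.carrier, 2 / c^2 * ((1 + (ρ x / ε)^2)⁻¹ * ‖N x‖^2 * φ x ^ 2) := by
          refine setIntegral_mono_set (cont_intOn D (continuous_const.mul hB).continuousOn) ?_
            (Eventually.of_forall hSsub)
          exact Eventually.of_forall fun x => by positivity
      _ = _ := by rw [integral_const_mul]
  refine hfin.trans ?_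
  have h6 : ∫ x in D.carrier, (1 + (ρ x / ε)^2)⁻¹ * ‖N x‖^2 * φ x ^ 2 ≤
      (4 * M * ε) * ∫ x in D.carrier, (φ x ^ 2 + ‖fderiv ℝ φ x‖ ^ 2) := by linarith
  calc _ ≤ 2 / c^2 * ((4 * M * ε) * ∫ x in D.carrier, (φ x ^ 2 + ‖fderiv ℝ φ x‖ ^ 2)) := by
        gcongr
    _ = _ := by ring

lemma strip_vol : ∃ C > 0, ∃ ε₀ > 0, ∀ ε, 0 < ε → ε ≤ ε₀ →
    volume.real {x | x ∈ D.carrier ∧ -ε < D.defining x} ≤ C * ε := by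
  obtain ⟨C, hC, ε₀, hε₀, h⟩ := strip_est D
  refine ⟨C * (volume.real D.carrier + 1), by positivity, ε₀, hε₀, fun ε h1 h2 => ?_⟩
  have := h ε h1 h2 (fun _ => 1) contDiff_const
  simp at this
  refine this.trans ?_
  have : 0 ≤ C * ε := by positivity
  nlinarith

/-- DIV -/
lemma div_thm {F : E → E} (hF : ContDiffOn ℝ 1 F D.carrier)
    (hFc : ContinuousOn F (closure D.carrier)) (hi : IntegrableOn (dv F) D.carrier)
    (h0 : ∀ x ∈ frontier D.carrier, fderiv ℝ D.defining x (F x) = 0) :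
    ∫ x in D.carrier, dv F x = 0 := by
  have h1 := core_tendsto D hi
  simp_rw [core_k D hF] at h1
  obtain ⟨C', hC', hb⟩ := dcutη_bdd
  obtain ⟨C, hC, ε₀, hε₀, hs⟩ := strip_vol D
  set g : E → ℝ := fun x => fderiv ℝ D.defining x (F x) with hg
  have hgc : ContinuousOn g (closure D.carrier) :=
    (((rho_cd1 D).continuous_fderiv one_ne_zero).continuousOn).clm_apply hFc
  have hsmall : ∀ δ > 0, ∃ ε > 0, ∀ x ∈ D.carrier, -ε < D.defining x → |g x| ≤ δ := by
    intro δ hδ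
    have hS : IsCompact {x ∈ closure D.carrier | δ ≤ |g x|} := by
      refine (compact_clos D).of_isClosed_subset ?_ (fun x hx => hx.1)
      exact (hgc.abs).preimage_isClosed_of_isClosed (compact_clos D).isClosed isClosed_Ici
    obtain ⟨m, hm, hm'⟩ := hS.exists_forall_le' (a := (0:ℝ)) (f := fun x => - D.defining x)
      (rho_cont D).neg.continuousOn (by
        intro x hx
        rcases ((mem_clos D).1 hx.1).lt_or_eq with h | h
        · linarith
        · have := h0 x ((mem_front D).2 h)
          have h2 : δ ≤ |g x| := hx.2
          rw [hg] at h2; simp only [this, abs_zero] at h2; linarith)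
    refine ⟨m, hm, fun x hx hx2 => ?_⟩
    by_contra h; push Not at h
    have := hm' x ⟨subset_closure hx, h.le⟩
    linarith
  have h2 : Tendsto (fun k : ℕ => - ∫ x in D.carrier,
      (((k:ℝ)+1) * deriv cutη (((k:ℝ)+1) * D.defining x)) * g x) atTop (𝓝 0) := by
    rw [← neg_zero]
    refine Tendsto.neg ?_
    rw [Metric.tendsto_atTop]
    intro r hr
    obtain ⟨ε, hε, hsm⟩ := hsmall (r / (2 * (3 * C' * C))) (by positivity)
    obtain ⟨K, hK⟩ := exists_nat_gt (3 / min ε ε₀)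
    refine ⟨K, fun k hk => ?_⟩
    have hk1 : (0:ℝ) < (k:ℝ)+1 := by positivity
    have hkK : (K:ℝ) ≤ k := by exact_mod_cast hk
    have hmin : 0 < min ε ε₀ := lt_min hε hε₀
    have hkk : 3 / ((k:ℝ)+1) ≤ min ε ε₀ := by
      rw [div_le_iff₀ hk1]; rw [div_lt_iff₀ hmin] at hK; nlinarith
    set S := {x | x ∈ D.carrier ∧ -(3 / ((k:ℝ)+1)) < D.defining x} with hSdef
    have hSsub : S ⊆ D.carrier := fun x hx => hx.1
    have hSm : MeasurableSet S :=
      (D.isOpen.inter (isOpen_lt continuous_const (rho_cont D))).measurableSet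
    have heq : ∫ x in D.carrier, (((k:ℝ)+1) * deriv cutη (((k:ℝ)+1) * D.defining x)) * g x
        = ∫ x in S, (((k:ℝ)+1) * deriv cutη (((k:ℝ)+1) * D.defining x)) * g x := by
      refine setIntegral_eq_of_subset_of_forall_sdiff_eq_zero (meas_carrier D) hSsub ?_
      intro x hx
      have : D.defining x ≤ -(3 / ((k:ℝ)+1)) := by
        by_contra h; push Not at h; exact hx.2 ⟨hx.1, h⟩
      rw [dcutη_zero (Or.inr _)]
      · simp
      · have h3 := mul_le_mul_of_nonneg_left this hk1.le
        rw [mul_neg, mul_div_cancel₀ _ hk1.ne'] at h3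
        linarith
    rw [dist_zero_right, heq]
    have hvolS : volume S < ⊤ := (measure_mono hSsub).trans_lt (vol_lt_top D)
    have hle := norm_setIntegral_le_of_norm_le_const
      (f := fun x => (((k:ℝ)+1) * deriv cutη (((k:ℝ)+1) * D.defining x)) * g x)
      (C := ((k:ℝ)+1) * C' * (r / (2 * (3 * C' * C)))) hvolS (by
        intro x hx
        have h3 := hsm x hx.1 (by have := hx.2; have := hkk.trans (min_le_left _ _); linarith)
        rw [norm_mul, norm_mul, Real.norm_of_nonneg hk1.le, Real.norm_eq_abs, Real.norm_eq_abs]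
        gcongr
        exact hb _)
    have hv := hs (3 / ((k:ℝ)+1)) (by positivity) (hkk.trans (min_le_right _ _))
    calc _ ≤ ((k:ℝ)+1) * C' * (r / (2 * (3 * C' * C))) * volume.real S := hle
      _ ≤ ((k:ℝ)+1) * C' * (r / (2 * (3 * C' * C))) * (C * (3 / ((k:ℝ)+1))) := by gcongr
      _ = r / 2 := by field_simp
      _ < r := by linarith
  exact tendsto_nhds_unique h1 h2

end A2
end BNS

namespace BNS
open MeasureTheory Set Filter Topology

/-- gradient within a set -/
noncomputable def gW {n : ℕ} (S : Set (EuclideanSpace ℝ (Fin n)))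
    (f : EuclideanSpace ℝ (Fin n) → ℝ) (x : EuclideanSpace ℝ (Fin n)) :
    EuclideanSpace ℝ (Fin n) :=
  (InnerProductSpace.toDual ℝ (EuclideanSpace ℝ (Fin n))).symm (fderivWithin ℝ f S x)

section A3
variable {n : ℕ}
local notation "E" => EuclideanSpace ℝ (Fin n)
variable (D : SmoothDomain n)

lemma sign_along {x v : E} (hx : D.defining x = 0) (hv : fderiv ℝ D.defining x v < 0) :
    ∃ t₀ : ℝ, 0 < t₀ ∧ ∀ t : ℝ, 0 < t → t ≤ t₀ → D.defining (x + t • v) < 0 ∧ 0 < D.defining (x - t • v) := by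
  have h1 : HasDerivAt (fun t : ℝ => D.defining (x + t • v)) (fderiv ℝ D.defining x v) 0 := by
    have hl : HasDerivAt (fun t : ℝ => x + t • v) v 0 := by
      simpa using ((hasDerivAt_id (0:ℝ)).smul_const v).const_add x
    have := (rho_diff D (x + (0:ℝ) • v)).hasFDerivAt.comp_hasDerivAt (0:ℝ) hl
    simpa [Function.comp_def] using this
  have h2 := (hasDerivAt_iff_tendsto_slope.1 h1).eventually (gt_mem_nhds hv)
  rw [eventually_nhdsWithin_iff, Metric.eventually_nhds_iff] at h2
  obtain ⟨δ, hδ, h3⟩ := h2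
  refine ⟨δ/2, by positivity, fun t ht ht2 => ⟨?_, ?_⟩⟩
  · have := h3 (y := t) (by rw [dist_zero_right, Real.norm_of_nonneg ht.le]; linarith) ht.ne'
    rw [slope_def_field] at this
    simp only [zero_smul, add_zero, hx, sub_zero] at this
    by_contra h; push Not at h
    exact absurd (div_nonneg h ht.le) (not_le.2 this)
  · have := h3 (y := -t) (by rw [dist_zero_right, norm_neg, Real.norm_of_nonneg ht.le]; linarith)
      (by simpa using ht.ne')
    rw [slope_def_field] at this
    simp only [zero_smul, add_zero, hx, sub_zero, neg_smul, ← sub_eq_add_neg] at this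
    by_contra h; push Not at h
    exact absurd (div_nonneg_of_nonpos h (by linarith : -t ≤ 0)) (not_le.2 this)

lemma exists_neg_dir {x : E} (hx : D.defining x = 0) : ∃ v, fderiv ℝ D.defining x v < 0 := by
  by_contra h
  push Not at h
  apply fderiv_rho_ne D hx
  ext v
  have h1 := h v
  have h2 := h (-v)
  simp only [map_neg] at h2
  simp; linarith

lemma interior_closure_carrier : interior (closure D.carrier) = D.carrier := by
  refine Subset.antisymm ?_ (interior_maximal subset_closure D.isOpen)
  intro x hx
  by_contra hc
  have hx0 : D.defining x = 0 := le_antisymm ((mem_clos D).1 (interior_subset hx))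
    (by rw [mem_carrier] at hc; push Not at hc; exact hc)
  obtain ⟨v, hv⟩ := exists_neg_dir D hx0
  obtain ⟨t₀, ht₀, h⟩ := sign_along D hx0 hv
  have hcont : Tendsto (fun t : ℝ => x - t • v) (𝓝[>] 0) (𝓝 x) := by
    have : Continuous (fun t : ℝ => x - t • v) := by fun_prop
    have h0 := this.tendsto 0
    simp only [zero_smul, sub_zero] at h0
    exact h0.mono_left nhdsWithin_le_nhds
  have h1 := hcont.eventually (mem_interior_iff_mem_nhds.1 hx)
  have h2 : ∀ᶠ t : ℝ in 𝓝[>] 0, t ∈ Ioc 0 t₀ := Ioc_mem_nhdsGT ht₀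
  obtain ⟨t, ht1, ht2⟩ := (h1.and h2).exists
  have := (mem_clos D).1 ht1
  linarith [(h t ht2.1 ht2.2).2]

lemma uniqueDiff : UniqueDiffOn ℝ (closure D.carrier) := by
  intro x hx
  rcases ((mem_clos D).1 hx).lt_or_eq with h | h
  · exact uniqueDiffWithinAt_of_mem_nhds
      (mem_of_superset (D.isOpen.mem_nhds ((mem_carrier D).2 h)) subset_closure)
  refine ⟨?_, subset_closure hx⟩
  have key : ∀ w, fderiv ℝ D.defining x w < 0 →
      w ∈ Submodule.span ℝ (tangentConeAt ℝ (closure D.carrier) x) := by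
    intro w hw
    obtain ⟨t₀, ht₀, h1⟩ := sign_along D h hw
    have h2 : (x + t₀ • w) - x ∈ tangentConeAt ℝ (closure D.carrier) x := by
      refine mem_tangentConeAt_of_openSegment_subset ?_
      rintro y ⟨a, b, ha, hb, hab, rfl⟩
      rw [mem_clos]
      have : a • x + b • (x + t₀ • w) = x + (b * t₀) • w := by
        have : a = 1 - b := by linarith
        rw [this, smul_add, sub_smul, smul_smul, one_smul]; abel
      rw [this]
      exact (h1 (b * t₀) (by positivity) (by nlinarith)).1.le
    rw [add_sub_cancel_left] at h2
    have h3 := Submodule.smul_mem _ (t₀⁻¹) (Submodule.subset_span (R := ℝ) h2)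
    rwa [smul_smul, inv_mul_cancel₀ ht₀.ne', one_smul] at h3
  obtain ⟨v, hv⟩ := exists_neg_dir D h
  have : (Submodule.span ℝ (tangentConeAt ℝ (closure D.carrier) x)) = ⊤ := by
    rw [Submodule.eq_top_iff']
    intro w
    rcases lt_trichotomy (fderiv ℝ D.defining x w) 0 with h1 | h1 | h1
    · exact key w h1
    · have h2 := Submodule.sub_mem _ (key (w + v) (by rw [map_add, h1, zero_add]; exact hv)) (key v hv)
      simpa using h2
    · have h2 := Submodule.neg_mem _ (key (-w) (by rw [map_neg]; linarith))
      simpa using h2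
  rw [this]; exact dense_univ

lemma clos_nhds {x : E} (hx : x ∈ D.carrier) : closure D.carrier ∈ 𝓝 x :=
  mem_of_superset (D.isOpen.mem_nhds hx) subset_closure

lemma fdW_eq {f : E → ℝ} {x : E} (hx : x ∈ D.carrier) :
    fderivWithin ℝ f (closure D.carrier) x = fderiv ℝ f x :=
  fderivWithin_of_mem_nhds (clos_nhds D hx)

lemma gW_inner {S : Set E} (f : E → ℝ) (x v : E) : inner ℝ (gW S f x) v = fderivWithin ℝ f S x v := by
  simp [gW]

lemma gW_norm {S : Set E} (f : E → ℝ) (x : E) : ‖gW S f x‖ = ‖fderivWithin ℝ f S x‖ := by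
  simp [gW]

lemma gW_apply {S : Set E} (f : E → ℝ) (x : E) (i : Fin n) :
    gW S f x i = fderivWithin ℝ f S x (ee i) := by
  rw [← gW_inner, real_inner_comm, ee, EuclideanSpace.inner_single_left]; simp

lemma gW_cd {f : E → ℝ} {k m : WithTop ℕ∞} (hf : ContDiffOn ℝ k f (closure D.carrier))
    (hmk : m + 1 ≤ k) : ContDiffOn ℝ m (gW (closure D.carrier) f) (closure D.carrier) :=
  ((InnerProductSpace.toDual ℝ E).symm.toContinuousLinearEquiv.contDiff).comp_contDiffOn
    (hf.fderivWithin (uniqueDiff D) hmk)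

lemma lapW_eq_sum {f : E → ℝ} (x : E) : lapWithin (closure D.carrier) f x =
    ∑ i, fderivWithin ℝ (fun y => gW (closure D.carrier) f y i) (closure D.carrier) x (ee i) := by
  unfold lapWithin
  simp_rw [gW_apply]; rfl

lemma gWi_cd {f : E → ℝ} {k m : WithTop ℕ∞} (hf : ContDiffOn ℝ k f (closure D.carrier))
    (hmk : m + 1 ≤ k) (i : Fin n) :
    ContDiffOn ℝ m (fun y => gW (closure D.carrier) f y i) (closure D.carrier) :=
  ((EuclideanSpace.proj i : E →L[ℝ] ℝ).contDiff).comp_contDiffOn (gW_cd D hf hmk)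

lemma lapW_cd {f : E → ℝ} {k m : WithTop ℕ∞} (hf : ContDiffOn ℝ k f (closure D.carrier))
    (hmk : m + 1 + 1 ≤ k) : ContDiffOn ℝ m (lapWithin (closure D.carrier) f) (closure D.carrier) := by
  have : lapWithin (closure D.carrier) f = fun x => ∑ i, fderivWithin ℝ
    (fun y => gW (closure D.carrier) f y i) (closure D.carrier) x (ee i) := by
    funext x; exact lapW_eq_sum D x
  rw [this]
  refine ContDiffOn.sum fun i _ => ?_
  exact ((gWi_cd D hf hmk i).fderivWithin (uniqueDiff D) le_rfl).clm_apply contDiffOn_const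

lemma dv_gW {f : E → ℝ} (hf : ContDiffOn ℝ 2 f (closure D.carrier)) {x : E} (hx : x ∈ D.carrier) :
    dv (gW (closure D.carrier) f) x = lapWithin (closure D.carrier) f x := by
  rw [lapW_eq_sum]
  unfold dv
  refine Finset.sum_congr rfl fun i _ => ?_
  rw [fdW_eq D hx]
  have h1 : DifferentiableAt ℝ (gW (closure D.carrier) f) x :=
    ((gW_cd D hf (m := 1) (by norm_num)).contDiffAt (clos_nhds D hx)).differentiableAt one_ne_zero
  have := ((EuclideanSpace.proj i : E →L[ℝ] ℝ).hasFDerivAt.comp x h1.hasFDerivAt).fderiv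
  have h2 : ((EuclideanSpace.proj i : E →L[ℝ] ℝ) ∘ gW (closure D.carrier) f)
    = fun y => gW (closure D.carrier) f y i := rfl
  rw [h2] at this
  rw [this]; rfl

lemma normalDeriv_zero {f : E → ℝ} {x : E} (hx : x ∈ frontier D.carrier)
    (h : D.normalDeriv f x = 0) :
    fderivWithin ℝ f (closure D.carrier) x (gradient D.defining x) = 0 := by
  unfold SmoothDomain.normalDeriv SmoothDomain.normal at h
  rw [map_smul, smul_eq_mul] at h
  rcases mul_eq_zero.1 h with h | h
  · exact absurd h (by simpa using D.grad_ne_zero x hx)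
  · exact h

lemma normalDeriv_of {f : E → ℝ} {x : E}
    (h : fderivWithin ℝ f (closure D.carrier) x (gradient D.defining x) = 0) :
    D.normalDeriv f x = 0 := by
  unfold SmoothDomain.normalDeriv SmoothDomain.normal
  rw [map_smul, h, smul_zero]

/-- Green's formula -/
lemma green {f φ : E → ℝ} (hf : ContDiffOn ℝ 2 f (closure D.carrier))
    (hφ : ContDiffOn ℝ 1 φ (closure D.carrier))
    (hb : ∀ x ∈ frontier D.carrier,
      φ x * fderivWithin ℝ f (closure D.carrier) x (gradient D.defining x) = 0) :
    ∫ x in D.carrier, inner ℝ (gW (closure D.carrier) φ x) (gW (closure D.carrier) f x) =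
      - ∫ x in D.carrier, φ x * lapWithin (closure D.carrier) f x := by
  set K := closure D.carrier
  have g1 := gW_cd D hf (m := 1) (by norm_num)
  have g2 := gW_cd D hφ (m := 0) (by norm_num)
  have l1 := lapW_cd D hf (m := 0) (by norm_num)
  have hsub : D.carrier ⊆ K := subset_closure
  have hdv : ∀ x ∈ D.carrier, dv (fun y => φ y • gW K f y) x
      = inner ℝ (gW K φ x) (gW K f x) + φ x * lapWithin K f x := by
    intro x hx
    rw [dv_smul ((hφ.contDiffAt (clos_nhds D hx)).differentiableAt one_ne_zero)
      ((g1.contDiffAt (clos_nhds D hx)).differentiableAt one_ne_zero), dv_gW D hf hx, gW_inner,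
      fdW_eq D hx]
    ring
  have c1 : ContinuousOn (fun x => inner ℝ (gW K φ x) (gW K f x)) K :=
    g2.continuousOn.inner g1.continuousOn
  have c2 : ContinuousOn (fun x => φ x * lapWithin K f x) K := hφ.continuousOn.mul l1.continuousOn
  have := div_thm D (F := fun y => φ y • gW K f y) ((hφ.smul g1).mono hsub)
    (hφ.smul g1).continuousOn
    ((cont_intOn D (c1.add c2)).congr_fun (fun x hx => (hdv x hx).symm) (meas_carrier D))
    (by
      intro x hx
      rw [fderiv_eq_inner, inner_smul_right, real_inner_comm, gW_inner]
      exact hb x hx)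
  rw [setIntegral_congr_fun (meas_carrier D) hdv,
    integral_add (cont_intOn D c1) (cont_intOn D c2)] at this
  linarith

end A3
end BNS

namespace BNS
open Set Filter Topology

section B1

/-- entire power series -/
noncomputable def ps (a : ℕ → ℝ) (s : ℝ) : ℝ := ∑' k, a k * s ^ k
/-- coefficient shift -/
def psh (a : ℕ → ℝ) (k : ℕ) : ℝ := (k + 1) * a (k + 1)

/-- factorially bounded coefficients -/
def FB (a : ℕ → ℝ) : Prop := ∃ C, ∀ k, |a k| ≤ C / (k.factorial : ℝ)

lemma FB.psh {a : ℕ → ℝ} (h : FB a) : FB (psh a) := by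
  obtain ⟨C, hC⟩ := h
  refine ⟨C, fun k => ?_⟩
  unfold BNS.psh
  have h1 := hC (k+1)
  rw [Nat.factorial_succ] at h1
  push_cast at h1
  have hk : (0:ℝ) < (k:ℝ)+1 := by positivity
  have hf : (0:ℝ) < (k.factorial : ℝ) := by positivity
  rw [abs_mul, abs_of_pos hk]
  calc ((k:ℝ)+1) * |a (k+1)| ≤ ((k:ℝ)+1) * (C / (((k:ℝ)+1) * k.factorial)) := by gcongr
    _ = C / k.factorial := by field_simp

lemma FB.summable {a : ℕ → ℝ} (h : FB a) (s : ℝ) : Summable fun k => a k * s ^ k := by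
  obtain ⟨C, hC⟩ := h
  have h1 : Summable fun k : ℕ => C * (|s| ^ k / (k.factorial : ℝ)) :=
    (Real.summable_pow_div_factorial |s|).mul_left C
  refine Summable.of_norm_bounded h1 fun k => ?_
  rw [norm_mul, norm_pow, Real.norm_eq_abs, Real.norm_eq_abs]
  calc |a k| * |s|^k ≤ C / k.factorial * |s|^k := by gcongr; exact hC k
    _ = _ := by ring

lemma FB.hasDerivAt {a : ℕ → ℝ} (h : FB a) (s : ℝ) : HasDerivAt (ps a) (ps (BNS.psh a) s) s := by
  set r := |s| + 1 with hr
  have hr0 : 0 < r := by positivity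
  obtain ⟨C, hC⟩ := h.psh
  have hu : Summable fun k : ℕ => |a k * (k * r ^ (k-1))| := by
    rw [← summable_nat_add_iff 1]
    have h1 : Summable fun k : ℕ => C * (r ^ k / (k.factorial : ℝ)) :=
      (Real.summable_pow_div_factorial r).mul_left C
    refine Summable.of_norm_bounded h1 fun k => ?_
    have h2 : a (k+1) * (((k+1 : ℕ):ℝ) * r ^ (k + 1 - 1)) = BNS.psh a k * r^k := by
      unfold BNS.psh; simp only [Nat.add_sub_cancel]; push_cast; ring
    rw [h2, Real.norm_eq_abs, abs_abs, abs_mul, abs_of_pos (pow_pos hr0 k)]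
    calc |BNS.psh a k| * r^k ≤ C / k.factorial * r^k := by gcongr; exact hC k
      _ = _ := by ring
  have hd := hasDerivAt_tsum_of_isPreconnected (𝕜 := ℝ) (u := fun k : ℕ => |a k * (k * r ^ (k-1))|)
    (t := Metric.ball (0:ℝ) r) (g := fun k y => a k * y ^ k)
    (g' := fun k y => a k * (k * y ^ (k-1))) (y₀ := 0) (y := s) hu Metric.isOpen_ball
    (convex_ball _ _).isPreconnected (fun k y _ => (hasDerivAt_pow k y).const_mul _)
    (fun k y hy => by
      rw [Real.norm_eq_abs, abs_mul, abs_mul, abs_mul, abs_mul, abs_pow, abs_pow]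
      have : |y| ≤ |r| := by
        rw [Metric.mem_ball, dist_zero_right, Real.norm_eq_abs] at hy
        rw [abs_of_pos hr0]; exact hy.le
      gcongr)
    (by simpa using hr0) (h.summable 0) (by simp [hr])
  have he : ∑' k : ℕ, a k * (k * s ^ (k-1)) = ps (BNS.psh a) s := by
    have hs : Summable fun k : ℕ => a k * (k * s ^ (k-1)) := by
      rw [← summable_nat_add_iff 1]
      refine (h.psh.summable s).congr fun k => ?_
      unfold BNS.psh; simp only [Nat.add_sub_cancel]; push_cast; ring
    rw [hs.tsum_eq_zero_add]
    simp only [Nat.cast_zero, zero_mul, mul_zero, zero_add]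
    unfold ps
    refine tsum_congr fun k => ?_
    unfold BNS.psh; simp only [Nat.add_sub_cancel]; push_cast; ring
  rw [he] at hd
  exact hd

/-- the Bessel type coefficients -/
noncomputable def bc (n : ℕ) : ℕ → ℝ
  | 0 => 1
  | k+1 => - bc n k / ((k+1) * (4 * k + 2 * n + 4))

lemma bc_FB (n : ℕ) : FB (bc n) := by
  refine ⟨1, fun k => ?_⟩
  induction k with
  | zero => simp [bc]
  | succ k ih =>
    rw [bc, Nat.factorial_succ]
    push_cast
    have hk : (0:ℝ) < (k:ℝ)+1 := by positivity
    have hd : (1:ℝ) ≤ 4 * k + 2 * n + 4 := by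
      have : (0:ℝ) ≤ 4 * k + 2 * n := by positivity
      linarith
    rw [abs_div, abs_neg, abs_of_pos (show (0:ℝ) < ((k:ℝ)+1) * (4 * k + 2 * n + 4) by positivity)]
    have hf : (0:ℝ) < (k.factorial : ℝ) := by positivity
    calc |bc n k| / (((k:ℝ)+1) * (4 * k + 2 * n + 4))
        ≤ (1 / k.factorial) / (((k:ℝ)+1) * 1) := by gcongr
      _ = _ := by field_simp

lemma bc_ode (n : ℕ) (s : ℝ) :
    4 * s * ps (psh (psh (bc n))) s + (2 * n + 4) * ps (psh (bc n)) s + ps (bc n) s = 0 := by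
  have h0 := (bc_FB n).summable s
  have h1 := (bc_FB n).psh.summable s
  have h2 := (bc_FB n).psh.psh.summable s
  have e1 : s * ps (psh (psh (bc n))) s = ∑' k : ℕ, (k * psh (bc n) k) * s ^ k := by
    have hs : Summable fun k : ℕ => ((k:ℝ) * psh (bc n) k) * s ^ k := by
      rw [← summable_nat_add_iff 1]
      refine (h2.mul_left s).congr fun k => ?_
      simp only [psh]; push_cast; ring
    rw [hs.tsum_eq_zero_add]
    simp only [Nat.cast_zero, zero_mul, zero_add]
    unfold ps
    rw [← tsum_mul_left]
    refine tsum_congr fun k => ?_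
    simp only [psh]; push_cast; ring
  have hs : Summable fun k : ℕ => ((k:ℝ) * psh (bc n) k) * s ^ k := by
    rw [← summable_nat_add_iff 1]
    refine (h2.mul_left s).congr fun k => ?_
    simp only [psh]; push_cast; ring
  rw [mul_assoc, e1]
  unfold ps
  rw [← tsum_mul_left, ← tsum_mul_left, ← (hs.mul_left 4).tsum_add (h1.mul_left _),
    ← ((hs.mul_left 4).add (h1.mul_left _)).tsum_add h0]
  convert tsum_zero with k
  have : bc n (k+1) = - bc n k / ((k+1) * (4 * k + 2 * n + 4)) := by rw [bc]
  simp only [psh, this]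
  have h4 : (4 * (k:ℝ) + 2 * n + 4) ≠ 0 := by positivity
  have h5 : ((k:ℝ)+1) ≠ 0 := by positivity
  field_simp
  ring

/-- The radial data for the first Neumann eigenfunctions of the ball of radius `R`. -/
structure Radial (n : ℕ) (R : ℝ) where
  p : ℝ
  L : ℝ → ℝ
  L' : ℝ → ℝ
  L'' : ℝ → ℝ
  p_pos : 0 < p
  hL : ∀ s, HasDerivAt L (L' s) s
  hL' : ∀ s, HasDerivAt L' (L'' s) s
  cL'' : Continuous L''
  ode : ∀ s, 4 * s * L'' s + (2 * n + 4) * L' s + p * L s = 0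
  q_pos : ∀ s, 0 ≤ s → s < R^2 → 0 < L s + 2 * s * L' s
  q_zero : L (R^2) + 2 * R^2 * L' (R^2) = 0
  L_pos : ∀ s, 0 ≤ s → s ≤ R^2 → 0 < L s

lemma sqrt_mul_deriv {L L' : ℝ → ℝ} (hL : ∀ s, HasDerivAt L (L' s) s) {s : ℝ} (hs : 0 < s) :
    HasDerivAt (fun s => √s * L s) ((L s + 2 * s * L' s) / (2 * √s)) s := by
  have h1 := (Real.hasDerivAt_sqrt hs.ne').mul (hL s)
  refine h1.congr_deriv ?_
  have hp : 0 < √s := Real.sqrt_pos.2 hs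
  have : s = √s * √s := (Real.mul_self_sqrt hs.le).symm
  field_simp
  rw [Real.sq_sqrt hs.le]; ring

lemma sqrt_mul_mono {L L' : ℝ → ℝ} (hL : ∀ s, HasDerivAt L (L' s) s) {T : ℝ}
    (hq : ∀ s, 0 ≤ s → s < T → 0 < L s + 2 * s * L' s) :
    StrictMonoOn (fun s => √s * L s) (Icc 0 T) := by
  have hc : Continuous L := continuous_iff_continuousAt.2 fun s => (hL s).continuousAt
  refine strictMonoOn_of_deriv_pos (convex_Icc 0 T) (Real.continuous_sqrt.mul hc).continuousOn ?_
  intro s hs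
  rw [interior_Icc] at hs
  rw [(sqrt_mul_deriv hL hs.1).deriv]
  have := hq s hs.1.le hs.2
  have hp : 0 < √s := Real.sqrt_pos.2 hs.1
  positivity

lemma L_pos_of {L L' : ℝ → ℝ} (hL : ∀ s, HasDerivAt L (L' s) s) (h0 : 0 < L 0) {T : ℝ}
    (hq : ∀ s, 0 ≤ s → s < T → 0 < L s + 2 * s * L' s) (s : ℝ) (hs : 0 ≤ s) (hsT : s ≤ T) :
    0 < L s := by
  rcases hs.eq_or_lt with rfl | hs'
  · exact h0
  have := sqrt_mul_mono hL hq ⟨le_rfl, hs.trans hsT⟩ ⟨hs, hsT⟩ hs'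
  simp only [Real.sqrt_zero, zero_mul] at this
  exact (pos_iff_pos_of_mul_pos this).1 (Real.sqrt_pos.2 hs')

lemma exists_q_nonpos {n : ℕ} (hn : 1 ≤ n) {L L' L'' : ℝ → ℝ}
    (hL : ∀ s, HasDerivAt L (L' s) s) (hL' : ∀ s, HasDerivAt L' (L'' s) s) (h0 : L 0 = 1)
    (ode : ∀ s, 4 * s * L'' s + (2 * n + 4) * L' s + L s = 0) :
    ∃ s, 0 ≤ s ∧ L s + 2 * s * L' s ≤ 0 := by
  by_contra hcon
  push Not at hcon
  have hLpos : ∀ s, 0 ≤ s → 0 < L s := fun s hs =>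
    L_pos_of hL (by rw [h0]; exact one_pos) (T := s) (fun t ht _ => hcon t ht) s hs le_rfl
  set s0 : ℝ := 2 * n + 1 with hs0
  have hs0p : 0 < s0 := by positivity
  set c := √s0 * L s0 with hc
  have hcp : 0 < c := mul_pos (Real.sqrt_pos.2 hs0p) (hLpos _ hs0p.le)
  have hmono : ∀ s, s0 ≤ s → c ≤ √s * L s := fun s hs =>
    (sqrt_mul_mono hL (T := s) (fun t ht _ => hcon t ht)).monotoneOn ⟨hs0p.le, hs⟩
      ⟨hs0p.le.trans hs, le_rfl⟩ hs
  have hqd : ∀ s, HasDerivAt (fun s => L s + 2 * s * L' s) (3 * L' s + 2 * s * L'' s) s := by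
    intro s
    have h1 : HasDerivAt (fun s : ℝ => 2 * s) 2 s := by
      simpa using (hasDerivAt_id s).const_mul 2
    exact ((hL s).add (h1.mul (hL' s))).congr_deriv (by ring)
  have hanti : AntitoneOn (fun s => (L s + 2 * s * L' s) + c / 2 * √s) (Ici s0) := by
    have hder : ∀ s, 0 < s → HasDerivAt (fun s => (L s + 2 * s * L' s) + c / 2 * √s)
        ((3 * L' s + 2 * s * L'' s) + c / 2 * (1 / (2 * √s))) s := fun s hs =>
      (hqd s).add ((Real.hasDerivAt_sqrt hs.ne').const_mul _)
    refine antitoneOn_of_deriv_nonpos (convex_Ici s0) ?_ ?_ ?_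
    · intro s hs; exact (hder s (hs0p.trans_le hs)).continuousAt.continuousWithinAt
    · intro s hs; rw [interior_Ici] at hs
      exact (hder s (hs0p.trans hs)).differentiableAt.differentiableWithinAt
    · intro s hs; rw [interior_Ici] at hs
      have hs' : s0 < s := hs
      have hsp := hs0p.trans hs'
      rw [(hder s hsp).deriv]
      have hq := hcon s hsp.le
      have hl := hLpos s hsp.le
      have hm := hmono s hs'.le
      have hsq := Real.sqrt_pos.2 hsp
      have hode := ode s
      have h5 : c / 2 * (1 / (2 * √s)) ≤ L s / 4 := by
        rw [mul_one_div, div_le_iff₀ (by positivity)]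
        nlinarith
      have hn0 : (0:ℝ) ≤ n := Nat.cast_nonneg n
      have h6 : 2 * s * (3 * L' s + 2 * s * L'' s) ≤ 2 * s * (- L s / 4) := by
        have e : 2 * s * (3 * L' s + 2 * s * L'' s)
          = - (n-1) * (L s + 2 * s * L' s) + (n - 1 - s) * L s := by
          have : 4 * s * L'' s = - (2 * n + 4) * L' s - L s := by linarith
          have h7 : 2 * s * (2 * s * L'' s) = s * (4 * s * L'' s) := by ring
          rw [mul_add, h7, this]; ring
        rw [e]
        have hn1' : (1:ℝ) ≤ n := by exact_mod_cast hn
        have : 0 ≤ ((n:ℝ)-1) * (L s + 2 * s * L' s) := mul_nonneg (by linarith) hq.le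
        nlinarith
      have h7 := le_of_mul_le_mul_left h6 (by positivity : 0 < 2 * s)
      linarith
  have hT : Tendsto (fun s : ℝ => c / 2 * √s) atTop atTop :=
    Real.tendsto_sqrt_atTop.const_mul_atTop (by positivity)
  obtain ⟨s, hs1, hs2⟩ := ((hT.eventually_gt_atTop
    ((L s0 + 2 * s0 * L' s0) + c / 2 * √s0)).and (eventually_ge_atTop s0)).exists
  have h1 := hanti (mem_Ici.2 le_rfl) hs2 hs2
  have h2 := hcon s (hs0p.le.trans hs2)
  simp only at h1
  linarith

lemma exists_radial {n : ℕ} (hn : 1 ≤ n) {R : ℝ} (hR : 0 < R) : Nonempty (Radial n R) := by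
  set L := ps (bc n)
  set L' := ps (psh (bc n))
  set L'' := ps (psh (psh (bc n)))
  have hL : ∀ s, HasDerivAt L (L' s) s := (bc_FB n).hasDerivAt
  have hL' : ∀ s, HasDerivAt L' (L'' s) s := (bc_FB n).psh.hasDerivAt
  have hL'' : Continuous L'' := continuous_iff_continuousAt.2 fun s =>
    ((bc_FB n).psh.psh.hasDerivAt s).continuousAt
  have cL : Continuous L := continuous_iff_continuousAt.2 fun s => (hL s).continuousAt
  have cL' : Continuous L' := continuous_iff_continuousAt.2 fun s => (hL' s).continuousAt
  have h0 : L 0 = 1 := by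
    show ps (bc n) 0 = 1
    unfold ps
    rw [tsum_eq_single 0 (fun k hk => by simp [hk])]
    simp [bc]
  have hode : ∀ s, 4 * s * L'' s + (2 * n + 4) * L' s + L s = 0 := bc_ode n
  have hqc : Continuous (fun s => L s + 2 * s * L' s) := by fun_prop
  set Z : Set ℝ := {s | 0 ≤ s ∧ L s + 2 * s * L' s ≤ 0}
  have hZc : IsClosed Z := isClosed_Ici.inter (isClosed_le hqc continuous_const)
  have hZne : Z.Nonempty := exists_q_nonpos hn hL hL' h0 hode
  have hZb : BddBelow Z := ⟨0, fun s hs => hs.1⟩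
  set k := sInf Z with hk
  have hkZ : k ∈ Z := hZc.csInf_mem hZne hZb
  have hqpos : ∀ s, 0 ≤ s → s < k → 0 < L s + 2 * s * L' s := by
    intro s hs hsk
    by_contra h; push Not at h
    exact absurd (csInf_le hZb ⟨hs, h⟩) (not_le.2 hsk)
  have hk0 : 0 < k := by
    rcases hkZ.1.eq_or_lt with h | h
    · have := hkZ.2
      rw [← h] at this; simp [h0] at this; linarith
    · exact h
  have hqk : L k + 2 * k * L' k = 0 := by
    refine le_antisymm hkZ.2 ?_
    have : Tendsto (fun s => L s + 2 * s * L' s) (𝓝[<] k) (𝓝 (L k + 2 * k * L' k)) :=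
      (hqc.tendsto k).mono_left nhdsWithin_le_nhds
    refine ge_of_tendsto this ?_
    filter_upwards [Ico_mem_nhdsLT hk0] with s hs
    exact (hqpos s hs.1 hs.2).le
  set p := k / R^2 with hp
  have hpp : 0 < p := by positivity
  have hpR : p * R^2 = k := by rw [hp]; field_simp
  have hm : ∀ s, HasDerivAt (fun s => p * s) p s := fun s => by
    simpa using (hasDerivAt_id s).const_mul p
  refine ⟨⟨p, fun s => L (p * s), fun s => p * L' (p * s), fun s => p^2 * L'' (p * s), hpp,
    fun s => ?_, fun s => ?_, ?_, fun s => ?_, fun s hs hs2 => ?_, ?_, fun s hs hs2 => ?_⟩⟩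
  · exact ((hL (p * s)).comp s (hm s)).congr_deriv (by ring)
  · exact (((hL' (p * s)).comp s (hm s)).const_mul p).congr_deriv (by ring)
  · fun_prop
  · have := hode (p * s); linear_combination p * this
  · have := hqpos (p * s) (by positivity) (by rw [← hpR]; gcongr)
    linarith
  · have := hqk; rw [← hpR] at this; linarith
  · exact L_pos_of hL (by rw [h0]; exact one_pos) hqpos (p * s) (by positivity)
      (by rw [← hpR]; gcongr)
end B1
end BNS

namespace BNS
open MeasureTheory Set Filter Topology

section B2
variable {n : ℕ}
local notation "E" => EuclideanSpace ℝ (Fin n)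

/-- `⟪e, x - c⟫ M(|x-c|²)` -/
noncomputable def hh (e c : E) (M : ℝ → ℝ) (x : E) : ℝ := inner ℝ e (x - c) * M (‖x - c‖^2)
/-- its gradient -/
noncomputable def hg (e c : E) (M M' : ℝ → ℝ) (x : E) : E :=
  M (‖x - c‖^2) • e + (2 * inner ℝ e (x - c) * M' (‖x - c‖^2)) • (x - c)

lemma hasFDerivAt_nsq (c x : E) :
    HasFDerivAt (fun x : E => ‖x - c‖^2) ((2:ℝ) • innerSL ℝ (x - c)) x := by
  have h := ((hasFDerivAt_id x).sub_const c).norm_sq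
  refine h.congr_fderiv ?_
  ext v; simp

lemma hasFDerivAt_radial {M M' : ℝ → ℝ} (hM : ∀ s, HasDerivAt M (M' s) s) (c x : E) :
    HasFDerivAt (fun x : E => M (‖x - c‖^2)) ((2 * M' (‖x - c‖^2)) • innerSL ℝ (x - c)) x := by
  refine ((hM _).comp_hasFDerivAt x (hasFDerivAt_nsq c x)).congr_fderiv ?_
  ext v; simp; ring

lemma hasFDerivAt_lin (e c x : E) :
    HasFDerivAt (fun x : E => inner ℝ e (x - c)) (innerSL ℝ e) x := by
  have := (innerSL ℝ e).hasFDerivAt.comp x ((hasFDerivAt_id x).sub_const c)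
  exact this

lemma hasFDerivAt_hh {M M' : ℝ → ℝ} (hM : ∀ s, HasDerivAt M (M' s) s) (e c x : E) :
    HasFDerivAt (hh e c M) (innerSL ℝ (hg e c M M' x)) x := by
  refine ((hasFDerivAt_lin e c x).mul (hasFDerivAt_radial hM c x)).congr_fderiv ?_
  ext v
  simp [hg, inner_add_left, inner_smul_left]
  ring

lemma hg_continuous {M M' : ℝ → ℝ} (hM : Continuous M) (hM' : Continuous M') (e c : E) :
    Continuous (hg e c M M') := by
  unfold hg; fun_prop

lemma hh_cd {M M' : ℝ → ℝ} (hM : ∀ s, HasDerivAt M (M' s) s) (hM' : Continuous M') (e c : E) :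
    ContDiff ℝ 1 (hh e c M) := by
  rw [contDiff_one_iff_fderiv]
  refine ⟨fun x => (hasFDerivAt_hh hM e c x).differentiableAt, ?_⟩
  have : fderiv ℝ (hh e c M) = fun x => innerSL ℝ (hg e c M M' x) := by
    funext x; exact (hasFDerivAt_hh hM e c x).fderiv
  rw [this]
  have hc : Continuous M := continuous_iff_continuousAt.2 fun s => (hM s).continuousAt
  exact (innerSL ℝ).continuous.comp (hg_continuous hc hM' e c)

lemma norm_hg_sq (M M' : ℝ → ℝ) (e c x : E) : ‖hg e c M M' x‖^2 =
    M (‖x - c‖^2)^2 * ‖e‖^2 + 4 * M (‖x-c‖^2) * M' (‖x-c‖^2) * (inner ℝ e (x-c))^2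
      + 4 * (inner ℝ e (x-c))^2 * M' (‖x-c‖^2)^2 * ‖x-c‖^2 := by
  unfold hg
  rw [norm_add_sq_real, norm_smul, norm_smul, inner_smul_left, inner_smul_right]
  simp only [mul_pow, Real.norm_eq_abs, sq_abs, conj_trivial]
  ring

lemma inner_hg (M M' : ℝ → ℝ) (e c x : E) : inner ℝ (hg e c M M' x) (x - c) =
    inner ℝ e (x - c) * (M (‖x-c‖^2) + 2 * ‖x-c‖^2 * M' (‖x-c‖^2)) := by
  unfold hg
  rw [inner_add_left, inner_smul_left, inner_smul_left, real_inner_self_eq_norm_sq]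
  simp only [conj_trivial]; ring

lemma sum_inner_sq (y : E) : ∑ i, (inner ℝ (ee i : E) y)^2 = ‖y‖^2 := by
  rw [EuclideanSpace.norm_sq_eq]
  simp [ee, EuclideanSpace.inner_single_left]

lemma sum_hh_sq (M : ℝ → ℝ) (c x : E) : ∑ i, (hh (ee i) c M x)^2 = ‖x-c‖^2 * M (‖x-c‖^2)^2 := by
  simp only [hh, mul_pow]
  rw [← Finset.sum_mul, sum_inner_sq]

lemma sum_hg_sq (M M' : ℝ → ℝ) (c x : E) : ∑ i, ‖hg (ee i) c M M' x‖^2 =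
    (n - 1) * M (‖x-c‖^2)^2 + (M (‖x-c‖^2) + 2 * ‖x-c‖^2 * M' (‖x-c‖^2))^2 := by
  simp only [norm_hg_sq, norm_ee]
  rw [Finset.sum_add_distrib, Finset.sum_add_distrib]
  have h0 : ∑ i, 4 * M (‖x-c‖^2) * M' (‖x-c‖^2) * (inner ℝ (ee i : E) (x-c))^2 =
      (4 * M (‖x-c‖^2) * M' (‖x-c‖^2)) * ∑ i, (inner ℝ (ee i : E) (x-c))^2 := by
    rw [Finset.mul_sum]
  rw [h0, sum_inner_sq]
  have : ∑ i, 4 * (inner ℝ (ee i : E) (x-c))^2 * M' (‖x-c‖^2)^2 * ‖x-c‖^2 =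
      (4 * M' (‖x-c‖^2)^2 * ‖x-c‖^2) * ∑ i, (inner ℝ (ee i : E) (x-c))^2 := by
    rw [Finset.mul_sum]; refine Finset.sum_congr rfl fun i _ => by ring
  rw [this, sum_inner_sq]
  simp
  ring

lemma dv_const (e : E) (x : E) : dv (fun _ => e) x = 0 := by simp [dv]
lemma dv_sub_const (c x : E) : dv (fun x => x - c) x = n := by
  unfold dv
  have : fderiv ℝ (fun x : E => x - c) x = ContinuousLinearMap.id ℝ E := by
    rw [fderiv_sub_const]; exact fderiv_id
  rw [this]; simp [ee_apply]

lemma dv_hg {R : ℝ} (rd : Radial n R) (e c x : E) :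
    dv (hg e c rd.L rd.L') x = - rd.p * hh e c rd.L x := by
  have d1 := hasFDerivAt_radial rd.hL c x
  have d2 := hasFDerivAt_radial rd.hL' c x
  have d3 := hasFDerivAt_lin e c x
  have d4 : HasFDerivAt (fun x : E => 2 * inner ℝ e (x - c) * rd.L' (‖x-c‖^2)) _ x :=
    (d3.const_mul 2).mul d2
  have d5 : DifferentiableAt ℝ (fun x : E => x - c) x := by fun_prop
  unfold hg
  have e1 : DifferentiableAt ℝ (fun x : E => rd.L (‖x-c‖^2) • e) x :=
    d1.differentiableAt.smul (differentiableAt_const e)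
  have e2 : DifferentiableAt ℝ (fun x : E => (2 * inner ℝ e (x - c) * rd.L' (‖x-c‖^2)) • (x - c)) x :=
    d4.differentiableAt.smul d5
  rw [dv_add e1 e2,
    dv_smul d1.differentiableAt (differentiableAt_const e), dv_smul d4.differentiableAt d5,
    d1.fderiv, d4.fderiv, dv_const, dv_sub_const]
  have ode := rd.ode (‖x-c‖^2)
  simp only [smul_apply, add_apply, smul_eq_mul, coe_innerSL_apply, real_inner_self_eq_norm_sq,
    hh]
  rw [real_inner_comm e (x-c)]
  linear_combination (inner ℝ e (x-c)) * ode

lemma radial_contL {R : ℝ} (rd : Radial n R) : Continuous rd.L :=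
  continuous_iff_continuousAt.2 fun s => (rd.hL s).continuousAt
lemma radial_contL' {R : ℝ} (rd : Radial n R) : Continuous rd.L' :=
  continuous_iff_continuousAt.2 fun s => (rd.hL' s).continuousAt

lemma cd1_of_deriv {M M' : ℝ → ℝ} (hM : ∀ s, HasDerivAt M (M' s) s) (hM' : Continuous M') :
    ContDiff ℝ 1 M := by
  rw [contDiff_one_iff_deriv]
  exact ⟨fun s => (hM s).differentiableAt, by
    rw [show deriv M = M' from funext fun s => (hM s).deriv]; exact hM'⟩

lemma hg_cd {R : ℝ} (rd : Radial n R) (e c : E) : ContDiff ℝ 1 (hg e c rd.L rd.L') := by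
  have h1 := cd1_of_deriv rd.hL (radial_contL' rd)
  have h2 := cd1_of_deriv rd.hL' rd.cL''
  have h3 : ContDiff ℝ 1 (fun x : E => ‖x - c‖^2) := (contDiff_id.sub contDiff_const).norm_sq ℝ
  have h4 : ContDiff ℝ 1 (fun x : E => x - c) := contDiff_id.sub contDiff_const
  unfold hg
  exact ((h1.comp h3).smul contDiff_const).add
    (((contDiff_const.mul (contDiff_const.inner ℝ h4)).mul (h2.comp h3)).smul h4)

/-- the ball as a smooth domain -/
noncomputable def ballDomain (c : E) {R : ℝ} (hR : 0 < R) : SmoothDomain n where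
  carrier := Metric.ball c R
  defining := fun x => ‖x - c‖^2 - R^2
  isOpen := Metric.isOpen_ball
  isBounded := Metric.isBounded_ball
  smooth_defining := ((contDiff_id.sub contDiff_const).norm_sq ℝ).sub contDiff_const
  carrier_eq := by
    ext x
    simp only [Metric.mem_ball, dist_eq_norm, mem_setOf_eq, sub_neg]
    rw [sq_lt_sq₀ (norm_nonneg _) hR.le]
  frontier_eq := by
    rw [frontier_ball c hR.ne']
    ext x
    simp only [Metric.mem_sphere, dist_eq_norm, mem_setOf_eq, sub_eq_zero]
    rw [sq_eq_sq₀ (norm_nonneg _) hR.le]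
  grad_ne_zero := by
    intro x hx h
    rw [frontier_ball c hR.ne', Metric.mem_sphere, dist_eq_norm] at hx
    have h1 := ((hasFDerivAt_nsq c x).sub_const (R^2)).fderiv
    have h2 : fderiv ℝ (fun x : E => ‖x - c‖^2 - R^2) x (x - c) = 0 := by
      have : fderiv ℝ (fun x : E => ‖x - c‖^2 - R^2) x (x - c)
        = inner ℝ (gradient (fun x : E => ‖x - c‖^2 - R^2) x) (x - c) := by simp [gradient]
      rw [this, h]; simp
    rw [h1] at h2
    simp only [smul_apply, coe_innerSL_apply, real_inner_self_eq_norm_sq, smul_eq_mul, hx] at h2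
    have : 0 < R^2 := by positivity
    linarith

lemma fderiv_ball (c : E) {R : ℝ} (hR : 0 < R) (x v : E) :
    fderiv ℝ (ballDomain c hR).defining x v = 2 * inner ℝ (x - c) v := by
  have h1 := ((hasFDerivAt_nsq c x).sub_const (R^2)).fderiv
  show fderiv ℝ (fun x : E => ‖x - c‖^2 - R^2) x v = _
  rw [h1]; simp only [smul_apply, coe_innerSL_apply, smul_eq_mul]

/-- energy identity on the ball -/
lemma ball_energy {R : ℝ} (hR : 0 < R) (rd : Radial n R) (e c : E) :
    ∫ x in Metric.ball c R, ‖hg e c rd.L rd.L' x‖^2 =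
      rd.p * ∫ x in Metric.ball c R, (hh e c rd.L x)^2 := by
  have hc1 := hh_cd rd.hL (radial_contL' rd) e c
  have hc2 := hg_cd rd e c
  set F : E → E := fun x => hh e c rd.L x • hg e c rd.L rd.L' x with hF
  have hF1 : ContDiff ℝ 1 F := hc1.smul hc2
  have hdv : ∀ x, dv F x = ‖hg e c rd.L rd.L' x‖^2 - rd.p * (hh e c rd.L x)^2 := by
    intro x
    rw [hF, dv_smul (hc1.differentiable one_ne_zero x) (hc2.differentiable one_ne_zero x),
      dv_hg, (hasFDerivAt_hh rd.hL e c x).fderiv]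
    simp only [coe_innerSL_apply, real_inner_self_eq_norm_sq]; ring
  have hdc : Continuous (dv F) := by
    have := dv_continuousOn isOpen_univ hF1.contDiffOn
    rwa [continuousOn_univ] at this
  have := div_thm (ballDomain c hR) (F := F) hF1.contDiffOn hF1.continuous.continuousOn
    (cont_intOn _ hdc.continuousOn) (by
      intro x hx
      rw [fderiv_ball, hF]
      have hx' : ‖x - c‖ = R := by
        have h : x ∈ frontier (Metric.ball c R) := hx
        rw [frontier_ball c hR.ne', Metric.mem_sphere, dist_eq_norm] at h
        exact h
      rw [inner_smul_right, real_inner_comm, inner_hg, hx', rd.q_zero]; ring)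
  simp_rw [hdv] at this
  have c1 : Continuous fun x => ‖hg e c rd.L rd.L' x‖^2 := hc2.continuous.norm.pow 2
  have c2 : Continuous fun x => rd.p * (hh e c rd.L x)^2 := continuous_const.mul (hc1.continuous.pow 2)
  rw [integral_sub (cont_intOn _ c1.continuousOn) (cont_intOn _ c2.continuousOn),
    integral_const_mul] at this
  exact sub_eq_zero.1 this

end B2
end BNS

namespace BNS
open MeasureTheory Set Filter Topology

section B3
variable {n : ℕ}
local notation "E" => EuclideanSpace ℝ (Fin n)

noncomputable def eA {R : ℝ} (rd : Radial n R) : ℝ := R * rd.L (R^2)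
/-- Weinberger extension -/
noncomputable def eM {R : ℝ} (rd : Radial n R) (s : ℝ) : ℝ :=
  if s ≤ R^2 then rd.L s else eA rd / √s
noncomputable def eM' {R : ℝ} (rd : Radial n R) (s : ℝ) : ℝ :=
  if s ≤ R^2 then rd.L' s else - eA rd / (2 * s * √s)

variable {R : ℝ} (rd : Radial n R)

lemma eA_pos (hR : 0 < R) : 0 < eA rd := mul_pos hR (rd.L_pos _ (sq_nonneg _) le_rfl)

lemma eM_of_le {s : ℝ} (h : s ≤ R^2) : eM rd s = rd.L s := if_pos h
lemma eM'_of_le {s : ℝ} (h : s ≤ R^2) : eM' rd s = rd.L' s := if_pos h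
lemma eM_of_ge (hR : 0 < R) {s : ℝ} (h : R^2 ≤ s) : eM rd s = eA rd / √s := by
  rcases h.eq_or_lt with h | h
  · rw [← h, eM_of_le rd le_rfl, Real.sqrt_sq hR.le, eA]; field_simp
  · exact if_neg (not_le.2 h)
lemma eM'_of_ge (hR : 0 < R) {s : ℝ} (h : R^2 ≤ s) : eM' rd s = - eA rd / (2 * s * √s) := by
  rcases h.eq_or_lt with h | h
  · rw [← h, eM'_of_le rd le_rfl, Real.sqrt_sq hR.le, eA]
    have := rd.q_zero
    field_simp
    linarith
  · exact if_neg (not_le.2 h)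

lemma tail_deriv {s a : ℝ} (hs : 0 < s) : HasDerivAt (fun s => a / √s) (- a / (2 * s * √s)) s := by
  have hp : 0 < √s := Real.sqrt_pos.2 hs
  refine ((hasDerivAt_const s a).div (Real.hasDerivAt_sqrt hs.ne') hp.ne').congr_deriv ?_
  rw [Real.sq_sqrt hs.le]; field_simp; ring

lemma eM_deriv (hR : 0 < R) (s : ℝ) : HasDerivAt (eM rd) (eM' rd s) s := by
  have hT : 0 < R^2 := by positivity
  rcases lt_trichotomy s (R^2) with h | h | h
  · rw [eM'_of_le rd h.le]
    exact (rd.hL s).congr_of_eventuallyEq ((eventually_lt_nhds h).mono fun t ht => eM_of_le rd ht.le)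
  · subst h
    have h1 : HasDerivWithinAt (eM rd) (eM' rd (R^2)) (Iic (R^2)) (R^2) := by
      rw [eM'_of_le rd le_rfl]
      exact (rd.hL _).hasDerivWithinAt.congr (fun t ht => eM_of_le rd ht) (eM_of_le rd le_rfl)
    have h2 : HasDerivWithinAt (eM rd) (eM' rd (R^2)) (Ici (R^2)) (R^2) := by
      rw [eM'_of_ge rd hR le_rfl]
      exact (tail_deriv hT).hasDerivWithinAt.congr (fun t ht => eM_of_ge rd hR ht)
        (eM_of_ge rd hR le_rfl)
    have := h1.union h2
    rwa [Iic_union_Ici, hasDerivWithinAt_univ] at this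
  · rw [eM'_of_ge rd hR h.le]
    exact (tail_deriv (hT.trans h)).congr_of_eventuallyEq
      ((eventually_gt_nhds h).mono fun t ht => eM_of_ge rd hR ht.le)

lemma eM_cont (hR : 0 < R) : Continuous (eM rd) :=
  continuous_iff_continuousAt.2 fun s => (eM_deriv rd hR s).continuousAt

lemma eM'_cont (hR : 0 < R) : Continuous (eM' rd) := by
  have hT : 0 < R^2 := by positivity
  rw [← continuousOn_univ, ← Iic_union_Ici (a := R^2)]
  refine ContinuousOn.union_of_isClosed ?_ ?_ isClosed_Iic isClosed_Ici
  · exact (radial_contL' rd).continuousOn.congr fun t ht => eM'_of_le rd ht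
  · refine ContinuousOn.congr (f := fun s => - eA rd / (2 * s * √s)) ?_ fun t ht => eM'_of_ge rd hR ht
    refine ContinuousOn.div continuousOn_const (by fun_prop) ?_
    intro s hs
    have h0 : 0 < s := hT.trans_le hs
    have : 0 < √s := Real.sqrt_pos.2 h0
    positivity

lemma eM_nonneg (hR : 0 < R) {s : ℝ} (hs : 0 ≤ s) : 0 ≤ eM rd s := by
  rcases le_total s (R^2) with h | h
  · rw [eM_of_le rd h]; exact (rd.L_pos s hs h).le
  · rw [eM_of_ge rd hR h]; exact div_nonneg (eA_pos rd hR).le (Real.sqrt_nonneg _)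

lemma sqrt_eM_of_ge (hR : 0 < R) {s : ℝ} (h : R^2 ≤ s) : √s * eM rd s = eA rd := by
  have hT : 0 < R^2 := by positivity
  rw [eM_of_ge rd hR h]
  have : 0 < √s := Real.sqrt_pos.2 (hT.trans_le h)
  field_simp

lemma sqrt_eM_le (hR : 0 < R) {s : ℝ} (hs : 0 ≤ s) : √s * eM rd s ≤ eA rd := by
  rcases le_total s (R^2) with h | h
  · have := (sqrt_mul_mono rd.hL rd.q_pos).monotoneOn (a := s) (b := R^2) ⟨hs, h⟩ ⟨sq_nonneg _, le_rfl⟩ h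
    simp only [Real.sqrt_sq hR.le] at this
    rw [eM_of_le rd h]; exact this
  · exact (sqrt_eM_of_ge rd hR h).le

lemma gsq_le (hR : 0 < R) {s : ℝ} (hs : 0 ≤ s) : s * eM rd s ^2 ≤ eA rd ^2 := by
  have h1 := sqrt_eM_le rd hR hs
  have h0 : 0 ≤ √s * eM rd s := mul_nonneg (Real.sqrt_nonneg _) (eM_nonneg rd hR hs)
  have := pow_le_pow_left₀ h0 h1 2
  rwa [mul_pow, Real.sq_sqrt hs] at this

lemma gsq_eq (hR : 0 < R) {s : ℝ} (hs : R^2 ≤ s) : s * eM rd s ^2 = eA rd ^2 := by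
  have := sqrt_eM_of_ge rd hR hs
  rw [← this, mul_pow, Real.sq_sqrt ((sq_nonneg R).trans hs)]

noncomputable def eN (s : ℝ) : ℝ := (n - 1) * eM rd s ^2 + (eM rd s + 2 * s * eM' rd s)^2

lemma eN_of_ge (hR : 0 < R) {s : ℝ} (h : R^2 ≤ s) : eN rd s = (n-1) * eA rd ^2 / s := by
  have hT : 0 < R^2 := by positivity
  have hs := hT.trans_le h
  have hp : 0 < √s := Real.sqrt_pos.2 hs
  have h1 : eM rd s + 2 * s * eM' rd s = 0 := by
    rw [eM_of_ge rd hR h, eM'_of_ge rd hR h]; field_simp; ring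
  have h2 : eM rd s ^2 = eA rd ^2 / s := by
    rw [eM_of_ge rd hR h, div_pow, Real.sq_sqrt hs.le]
  rw [eN, h1, h2]; ring

lemma eN_anti (hn : 2 ≤ n) (hR : 0 < R) : StrictAntiOn (eN rd) (Ici 0) := by
  have hT : 0 < R^2 := by positivity
  have hn1 : (0:ℝ) < n - 1 := by
    have : (2:ℝ) ≤ n := by exact_mod_cast hn
    linarith
  have h1 : StrictAntiOn (eN rd) (Icc 0 (R^2)) := by
    have hd : ∀ s, HasDerivAt (fun s => ((n:ℝ)-1) * rd.L s ^2 + (rd.L s + 2 * s * rd.L' s)^2)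
        (((n:ℝ)-1) * (2 * rd.L s * rd.L' s) + 2 * (rd.L s + 2 * s * rd.L' s) *
          (rd.L' s + (2 * rd.L' s + 2 * s * rd.L'' s))) s := by
      intro s
      have a := (((rd.hL s).pow 2).const_mul ((n:ℝ)-1))
      have b := (((rd.hL s).add (((hasDerivAt_id s).const_mul 2).mul (rd.hL' s))).pow 2)
      refine (a.add b).congr_deriv ?_
      simp
    have : StrictAntiOn (fun s => ((n:ℝ)-1) * rd.L s ^2 + (rd.L s + 2 * s * rd.L' s)^2) (Icc 0 (R^2)) := by
      refine strictAntiOn_of_deriv_neg (convex_Icc _ _)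
        (fun s _ => (hd s).continuousAt.continuousWithinAt) ?_
      intro s hs
      rw [interior_Icc] at hs
      rw [(hd s).deriv]
      have e1 := rd.ode s
      have e2 := rd.q_pos s hs.1.le hs.2
      have e3 := rd.L_pos s hs.1.le hs.2.le
      have e4 : ((n:ℝ)-1) * (2 * rd.L s * rd.L' s) + 2 * (rd.L s + 2 * s * rd.L' s) *
          (rd.L' s + (2 * rd.L' s + 2 * s * rd.L'' s)) =
          - (rd.p * rd.L s * (rd.L s + 2 * s * rd.L' s)) - 4 * s * ((n-1) * rd.L' s ^2) := by
        linear_combination (rd.L s + 2 * s * rd.L' s) * e1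
      rw [e4]
      have e5 : 0 < rd.p * rd.L s * (rd.L s + 2 * s * rd.L' s) := mul_pos (mul_pos rd.p_pos e3) e2
      have e6 : 0 ≤ 4 * s * ((n-1) * rd.L' s ^2) :=
        mul_nonneg (by linarith [hs.1]) (mul_nonneg hn1.le (sq_nonneg _))
      linarith
    refine this.congr fun s hs => ?_
    simp only [eN, eM_of_le rd hs.2, eM'_of_le rd hs.2]
  have h2 : StrictAntiOn (eN rd) (Ici (R^2)) := by
    intro s hs t ht hst
    rw [eN_of_ge rd hR hs, eN_of_ge rd hR ht]
    have := eA_pos rd hR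
    exact div_lt_div_of_pos_left (by positivity) (hT.trans_le hs) hst
  have := h1.union h2 (isGreatest_Icc hT.le) isLeast_Ici
  rwa [Icc_union_Ici_eq_Ici hT.le] at this

/-- potential -/
noncomputable def eG (s : ℝ) : ℝ := ∫ t in (0:ℝ)..s, eM rd t / 2

lemma eG_deriv (hR : 0 < R) (s : ℝ) : HasDerivAt (eG rd) (eM rd s / 2) s :=
  intervalIntegral.integral_hasDerivAt_right
    ((eM_cont rd hR).div_const 2 |>.intervalIntegrable _ _)
    ((eM_cont rd hR).div_const 2 |>.stronglyMeasurableAtFilter _ _)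
    ((eM_cont rd hR).div_const 2).continuousAt

lemma eG_nonneg (hR : 0 < R) {s : ℝ} (hs : 0 ≤ s) : 0 ≤ eG rd s :=
  intervalIntegral.integral_nonneg hs fun t ht => div_nonneg (eM_nonneg rd hR ht.1) (by norm_num)

lemma eG_ge (hR : 0 < R) {s : ℝ} (hs : 0 ≤ s) : eA rd * (√s - R) ≤ eG rd s := by
  have hT : 0 < R^2 := by positivity
  have hA := eA_pos rd hR
  rcases le_total s (R^2) with h | h
  · have : √s ≤ R := by rw [Real.sqrt_le_left hR.le]; exact h
    have h2 : eA rd * (√s - R) ≤ 0 := mul_nonpos_of_nonneg_of_nonpos hA.le (by linarith)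
    exact h2.trans (eG_nonneg rd hR hs)
  · have hd : ∀ t, 0 < t → HasDerivAt (fun t => eG rd t - eA rd * √t)
        (eM rd t / 2 - eA rd * (1 / (2 * √t))) t := fun t ht =>
      (eG_deriv rd hR t).sub ((Real.hasDerivAt_sqrt ht.ne').const_mul _)
    have hm : MonotoneOn (fun t => eG rd t - eA rd * √t) (Ici (R^2)) := by
      refine monotoneOn_of_deriv_nonneg (convex_Ici _)
        (fun t ht => (hd t (hT.trans_le ht)).continuousAt.continuousWithinAt)
        (fun t ht => ?_) (fun t ht => ?_)
      · rw [interior_Ici] at ht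
        exact (hd t (hT.trans ht)).differentiableAt.differentiableWithinAt
      · rw [interior_Ici] at ht
        rw [(hd t (hT.trans ht)).deriv, eM_of_ge rd hR (le_of_lt ht)]
        have : 0 < √t := Real.sqrt_pos.2 (hT.trans ht)
        apply le_of_eq; field_simp; ring
    have := hm (mem_Ici.2 le_rfl) (mem_Ici.2 h) h
    simp only [Real.sqrt_sq hR.le] at this
    have h3 := eG_nonneg rd hR hT.le
    linarith

/-- choice of center -/
lemma exists_center (hR : 0 < R) (D : SmoothDomain n) (hv : 0 < volume D.carrier) :
    ∃ c : E, ∀ e : E, ∫ x in D.carrier, hh e c (eM rd) x = 0 := by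
  have hA := eA_pos rd hR
  set μ := volume.restrict D.carrier with hμ
  obtain ⟨K, hK⟩ := D.isBounded.subset_closedBall (0:E)
  have gd : ∀ x c : E, HasFDerivAt (fun c : E => eG rd (‖x - c‖^2))
      (- (eM rd (‖x-c‖^2)) • innerSL ℝ (x - c)) c := by
    intro x c
    have h := hasFDerivAt_radial (eG_deriv rd hR) x c
    have : (fun c : E => eG rd (‖x - c‖^2)) = fun c : E => eG rd (‖c - x‖^2) := by
      funext c; rw [norm_sub_rev]
    rw [this]
    refine h.congr_fderiv ?_
    ext v
    rw [norm_sub_rev c x]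
    simp [inner_sub_left]; ring
  have hGc : Continuous (eG rd) := continuous_iff_continuousAt.2 fun s => (eG_deriv rd hR s).continuousAt
  have hMc := eM_cont rd hR
  have hitg : ∀ c : E, Integrable (fun x : E => eG rd (‖x-c‖^2)) μ := fun c =>
    cont_intOn D (by fun_prop)
  have hΦ : ∀ c : E, HasFDerivAt (fun c : E => ∫ x, eG rd (‖x-c‖^2) ∂μ)
      (∫ x, (- (eM rd (‖x-c‖^2)) • innerSL ℝ (x - c) : E →L[ℝ] ℝ) ∂μ) c := by
    intro c
    refine hasFDerivAt_integral_of_dominated_of_fderiv_le (bound := fun _ => eA rd) (s := univ)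
      (F := fun c x => eG rd (‖x-c‖^2))
      (F' := fun c x => - (eM rd (‖x-c‖^2)) • innerSL ℝ (x - c)) univ_mem ?_ (hitg c) ?_ ?_ ?_ ?_
    · exact Eventually.of_forall fun c => (hitg c).aestronglyMeasurable
    · refine Continuous.aestronglyMeasurable ?_
      have q1 : Continuous fun x : E => -(eM rd (‖x-c‖^2)) := by fun_prop
      have q2 : Continuous fun x : E => innerSL ℝ (x - c) :=
        (innerSL ℝ).continuous.comp (continuous_id.sub continuous_const)
      exact q1.smul q2
    · refine Eventually.of_forall fun x c _ => ?_
      rw [norm_smul, innerSL_apply_norm, norm_neg, Real.norm_of_nonneg (eM_nonneg rd hR (sq_nonneg _))]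
      have := sqrt_eM_le rd hR (sq_nonneg ‖x - c‖)
      rw [Real.sqrt_sq (norm_nonneg _)] at this
      linarith
    · exact integrable_const _
    · exact Eventually.of_forall fun x c _ => gd x c
  have hcont : Continuous (fun c : E => ∫ x, eG rd (‖x-c‖^2) ∂μ) :=
    continuous_iff_continuousAt.2 fun c => (hΦ c).continuousAt
  have hvr : 0 < (volume D.carrier).toReal := ENNReal.toReal_pos hv.ne' (vol_lt_top D).ne
  have hlow : ∀ c : E, (volume D.carrier).toReal * (eA rd * (‖c‖ - K - R)) ≤ ∫ x, eG rd (‖x-c‖^2) ∂μ := by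
    intro c
    have : ∫ x, (eA rd * (‖c‖ - K - R)) ∂μ ≤ ∫ x, eG rd (‖x-c‖^2) ∂μ := by
      refine setIntegral_mono_on (integrable_const _) (hitg c) (meas_carrier D) fun x hx => ?_
      have h1 := eG_ge rd hR (sq_nonneg ‖x-c‖)
      rw [Real.sqrt_sq (norm_nonneg _)] at h1
      have h2 : ‖x‖ ≤ K := by simpa using hK hx
      have h3 : ‖c‖ ≤ ‖x - c‖ + ‖x‖ := by
        rw [norm_sub_rev]; simpa using norm_add_le (c - x) x
      refine le_trans (mul_le_mul_of_nonneg_left ?_ hA.le) h1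
      linarith
    simpa [hμ, Measure.real] using this
  have htend : Tendsto (fun c : E => ∫ x, eG rd (‖x-c‖^2) ∂μ) (cocompact E) atTop := by
    refine tendsto_atTop_mono hlow ?_
    refine Tendsto.const_mul_atTop hvr (Tendsto.const_mul_atTop hA ?_)
    simp only [sub_eq_add_neg]
    exact tendsto_atTop_add_const_right _ _ (tendsto_atTop_add_const_right _ _ tendsto_norm_cocompact_atTop)
  obtain ⟨c, hc⟩ := hcont.exists_forall_le htend
  refine ⟨c, fun e => ?_⟩
  have hmin : IsLocalMin (fun c : E => ∫ x, eG rd (‖x-c‖^2) ∂μ) c := Eventually.of_forall hc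
  have h0 := hmin.hasFDerivAt_eq_zero (hΦ c)
  have hci : Integrable (fun x => (- (eM rd (‖x-c‖^2)) • innerSL ℝ (x - c) : E →L[ℝ] ℝ)) μ := by
    have : Continuous (fun x => (- (eM rd (‖x-c‖^2)) • innerSL ℝ (x - c) : E →L[ℝ] ℝ)) := by
      have q1 : Continuous fun x : E => -(eM rd (‖x-c‖^2)) := by fun_prop
      have q2 : Continuous fun x : E => innerSL ℝ (x - c) :=
        (innerSL ℝ).continuous.comp (continuous_id.sub continuous_const)
      exact q1.smul q2
    exact (this.continuousOn.integrableOn_compact (compact_clos D)).mono_set subset_closure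
  have h1 := ContinuousLinearMap.integral_apply hci e
  rw [h0] at h1
  have h2 : (fun x => (- (eM rd (‖x-c‖^2)) • innerSL ℝ (x - c) : E →L[ℝ] ℝ) e) = fun x => - hh e c (eM rd) x := by
    funext x
    simp only [smul_apply, coe_innerSL_apply, hh, smul_eq_mul]
    rw [real_inner_comm]; ring
  rw [h2, integral_neg] at h1
  simpa using h1.symm

lemma sum_int (D : SmoothDomain n) (f : Fin n → E → ℝ) (hf : ∀ i, Continuous (f i)) :
    ∑ i, ∫ x in D.carrier, f i x = ∫ x in D.carrier, ∑ i, f i x :=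
  (integral_finsetSum _ fun i _ => cont_intOn D (hf i).continuousOn).symm

/-- mass transplantation -/
lemma swap_le {A B : Set E} (hA : MeasurableSet A) (hB : MeasurableSet B) (hAB : volume A = volume B)
    (hfin : volume A ≠ ⊤) {f : E → ℝ} {a : ℝ} (hfA : IntegrableOn f A) (hfB : IntegrableOn f B)
    (h1 : ∀ x ∈ A \ B, a ≤ f x) (h2 : ∀ x ∈ B \ A, f x ≤ a) :
    ∫ x in B, f x ≤ ∫ x in A, f x ∧
    ((∀ x ∈ B \ A, f x < a) → ∫ x in B, f x = ∫ x in A, f x → volume (B \ A) = 0 ∧ volume (A \ B) = 0) := by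
  have hfinB : volume B ≠ ⊤ := hAB ▸ hfin
  have hd : volume (A \ B) = volume (B \ A) := by
    have e1 := measure_inter_add_sdiff (μ := volume) A hB
    have e2 := measure_inter_add_sdiff (μ := volume) B hA
    rw [inter_comm, ← hAB, ← e1, inter_comm] at e2
    have hf : volume (A ∩ B) ≠ ⊤ := ne_top_of_le_ne_top hfin (measure_mono inter_subset_left)
    rw [inter_comm B A] at e2
    exact ((ENNReal.add_right_inj hf).1 e2).symm
  have fA : volume (A \ B) ≠ ⊤ := ne_top_of_le_ne_top hfin (measure_mono sdiff_subset)
  have fB : volume (B \ A) ≠ ⊤ := ne_top_of_le_ne_top hfinB (measure_mono sdiff_subset)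
  have integrable_constB : ∀ a : ℝ, Integrable (fun _ => a) (volume.restrict (B \ A)) :=
    fun a => integrableOn_const fB
  have i1 := integral_inter_add_sdiff hB hfA
  have i2 := integral_inter_add_sdiff hA hfB
  rw [inter_comm] at i2
  have j1 : ∫ x in A \ B, a ≤ ∫ x in A \ B, f x :=
    setIntegral_mono_on (integrableOn_const fA) (hfA.mono_set sdiff_subset) (hA.diff hB) h1
  have j2 : ∫ x in B \ A, f x ≤ ∫ x in B \ A, a :=
    setIntegral_mono_on (hfB.mono_set sdiff_subset) (integrableOn_const fB) (hB.diff hA) h2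
  have j3 : ∫ x in A \ B, a = ∫ x in B \ A, a := by simp [Measure.real, hd]
  refine ⟨by linarith, fun hlt heq => ?_⟩
  have j4 : ∫ x in B \ A, (a - f x) = 0 := by
    rw [integral_sub (integrable_constB a) (hfB.mono_set sdiff_subset)]; linarith
  have : volume (B \ A) = 0 := by
    rw [setIntegral_eq_zero_iff_of_nonneg_ae] at j4
    · have h5 : ∀ᵐ x ∂(volume.restrict (B \ A)), False := by
        filter_upwards [j4, ae_restrict_mem (hB.diff hA)] with x hx hx2
        have := hlt x hx2
        simp at hx; linarith
      simpa [ae_iff] using h5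
    · filter_upwards [ae_restrict_mem (hB.diff hA)] with x hx2
      have := hlt x hx2
      simp; linarith
    · exact (integrable_constB a).sub (hfB.mono_set sdiff_subset)
  exact ⟨this, hd.trans this⟩

theorem weinberger (hn : 2 ≤ n) (hR : 0 < R) (D : SmoothDomain n)
    (hvol : volume D.carrier = volume (Metric.ball (0:E) R)) {μ : ℝ} (hμ0 : 0 ≤ μ)
    (hμ : ∀ φ : E → ℝ, ContDiff ℝ 1 φ → ∫ x in D.carrier, φ x = 0 →
      μ * ∫ x in D.carrier, φ x ^2 ≤ ∫ x in D.carrier, ‖fderiv ℝ φ x‖^2) :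
    μ ≤ rd.p ∧ (μ = rd.p → ∃ c' : E, D.carrier = Metric.ball c' R) := by
  have hT : 0 < R^2 := by positivity
  have hv : 0 < volume D.carrier := by rw [hvol]; exact Metric.measure_ball_pos _ _ hR
  obtain ⟨c, hc⟩ := exists_center rd hR D hv
  have hMc := eM_cont rd hR
  have hMc' := eM'_cont rd hR
  have hNc : Continuous (eN rd) := by unfold eN; fun_prop
  have hvol' : volume D.carrier = volume (Metric.ball c R) := by
    rw [hvol]; simp [Measure.addHaar_ball_center]
  set Bd := ballDomain c hR
  have hBd : Bd.carrier = Metric.ball c R := rfl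
  have g1 : Continuous fun x : E => ‖x-c‖^2 * eM rd (‖x-c‖^2)^2 := by fun_prop
  have g2 : Continuous fun x : E => eN rd (‖x-c‖^2) := by fun_prop
  have s1 : ∫ x in D.carrier, ‖x-c‖^2 * eM rd (‖x-c‖^2)^2 = ∑ i, ∫ x in D.carrier, (hh (ee i) c (eM rd) x)^2 := by
    rw [sum_int D (fun i x => (hh (ee i) c (eM rd) x)^2) fun i => (hh_cd (eM_deriv rd hR) hMc' (ee i) c).continuous.pow 2]
    simp only [sum_hh_sq]
  have s2 : ∫ x in D.carrier, eN rd (‖x-c‖^2) = ∑ i, ∫ x in D.carrier, ‖fderiv ℝ (hh (ee i) c (eM rd)) x‖^2 := by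
    have : ∀ i, ∀ x, ‖fderiv ℝ (hh (ee i) c (eM rd)) x‖^2 = ‖hg (ee i) c (eM rd) (eM' rd) x‖^2 := by
      intro i x; rw [(hasFDerivAt_hh (eM_deriv rd hR) (ee i) c x).fderiv, innerSL_apply_norm]
    simp only [this]
    rw [sum_int D (fun i x => ‖hg (ee i) c (eM rd) (eM' rd) x‖^2) fun i => (hg_continuous hMc hMc' (ee i) c).norm.pow 2]
    simp only [sum_hg_sq, eN]
  have s3 : μ * ∫ x in D.carrier, ‖x-c‖^2 * eM rd (‖x-c‖^2)^2 ≤ ∫ x in D.carrier, eN rd (‖x-c‖^2) := by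
    rw [s1, s2, Finset.mul_sum]
    exact Finset.sum_le_sum fun i _ => hμ _ (hh_cd (eM_deriv rd hR) hMc' (ee i) c) (hc _)
  have hin : ∀ x ∈ Metric.ball c R, ‖x-c‖^2 ≤ R^2 := by
    intro x hx; rw [Metric.mem_ball, dist_eq_norm] at hx
    exact pow_le_pow_left₀ (norm_nonneg _) hx.le 2
  have s4 : ∫ x in Metric.ball c R, eN rd (‖x-c‖^2) =
      rd.p * ∫ x in Metric.ball c R, ‖x-c‖^2 * eM rd (‖x-c‖^2)^2 := by
    have e1 : ∫ x in Metric.ball c R, eN rd (‖x-c‖^2) =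
        ∑ i, ∫ x in Metric.ball c R, ‖hg (ee i) c rd.L rd.L' x‖^2 := by
      rw [← hBd, sum_int Bd (fun i x => ‖hg (ee i) c rd.L rd.L' x‖^2) fun i => (hg_continuous (radial_contL rd) (radial_contL' rd) (ee i) c).norm.pow 2]
      refine setIntegral_congr_fun measurableSet_ball fun x hx => ?_
      simp only [sum_hg_sq, eN, eM_of_le rd (hin x hx), eM'_of_le rd (hin x hx)]
    have e2 : ∫ x in Metric.ball c R, ‖x-c‖^2 * eM rd (‖x-c‖^2)^2 =
        ∑ i, ∫ x in Metric.ball c R, (hh (ee i) c rd.L x)^2 := by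
      rw [← hBd, sum_int Bd (fun i x => (hh (ee i) c rd.L x)^2) fun i => (hh_cd rd.hL (radial_contL' rd) (ee i) c).continuous.pow 2]
      refine setIntegral_congr_fun measurableSet_ball fun x hx => ?_
      simp only [sum_hh_sq, eM_of_le rd (hin x hx)]
    rw [e1, e2, Finset.mul_sum]
    exact Finset.sum_congr rfl fun i _ => ball_energy hR rd (ee i) c
  have hout : ∀ x, x ∉ Metric.ball c R → R^2 ≤ ‖x-c‖^2 := by
    intro x hx; rw [Metric.mem_ball, dist_eq_norm, not_lt] at hx
    exact pow_le_pow_left₀ hR.le hx 2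
  have hin' : ∀ x ∈ Metric.ball c R, ‖x-c‖^2 < R^2 := by
    intro x hx; rw [Metric.mem_ball, dist_eq_norm] at hx
    exact pow_lt_pow_left₀ hx (norm_nonneg _) two_ne_zero
  have s5 := (swap_le (a := eA rd ^2) (meas_carrier D) (measurableSet_ball (x := c) (ε := R)) hvol'
    (vol_lt_top D).ne (cont_intOn D g1.continuousOn) (cont_intOn Bd g1.continuousOn)
    (fun x hx => (gsq_eq rd hR (hout x hx.2)).ge) (fun x hx => gsq_le rd hR (sq_nonneg _))).1
  have anti := eN_anti rd hn hR
  obtain ⟨s6, s7⟩ := (swap_le (f := fun x => - eN rd (‖x-c‖^2)) (a := - eN rd (R^2)) (meas_carrier D)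
    (measurableSet_ball (x := c) (ε := R)) hvol'
    (vol_lt_top D).ne (cont_intOn D g2.neg.continuousOn) (cont_intOn Bd g2.neg.continuousOn)
    (fun x hx => neg_le_neg (anti.antitoneOn hT.le (mem_Ici.2 (sq_nonneg _)) (hout x hx.2)))
    (fun x hx => neg_le_neg (anti.antitoneOn (mem_Ici.2 (sq_nonneg _)) hT.le (hin x hx.1))))
  rw [integral_neg, integral_neg] at s6 s7
  set I := ∫ x in Metric.ball c R, ‖x-c‖^2 * eM rd (‖x-c‖^2)^2 with hI
  have Ipos : 0 < I := by
    rw [hI, setIntegral_pos_iff_support_of_nonneg_ae]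
    · have : Metric.ball c R \ {c} ⊆ (Function.support fun x : E => ‖x-c‖^2 * eM rd (‖x-c‖^2)^2) ∩ Metric.ball c R := by
        intro x hx
        refine ⟨?_, hx.1⟩
        rw [Function.mem_support, eM_of_le rd (hin x hx.1)]
        have := rd.L_pos _ (sq_nonneg ‖x-c‖) (hin x hx.1)
        have h2 : ‖x - c‖ ≠ 0 := by rw [norm_ne_zero_iff, sub_ne_zero]; exact hx.2
        positivity
      refine lt_of_lt_of_le ?_ (measure_mono this)
      have : Nontrivial E := by
        have : Nonempty (Fin n) := ⟨⟨0, by omega⟩⟩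
        infer_instance
      rw [measure_sdiff_null (measure_singleton c)]
      exact Metric.measure_ball_pos _ _ hR
    · exact Eventually.of_forall fun x => mul_nonneg (sq_nonneg _) (sq_nonneg _)
    · exact cont_intOn Bd g1.continuousOn
  have key : μ * I ≤ rd.p * I := by
    rw [← s4]
    have := mul_le_mul_of_nonneg_left s5 hμ0
    linarith
  refine ⟨le_of_mul_le_mul_right key Ipos, fun heq => ⟨c, ?_⟩⟩
  have hh1 : ∫ x in Metric.ball c R, eN rd (‖x-c‖^2) = ∫ x in D.carrier, eN rd (‖x-c‖^2) := by
    have := mul_le_mul_of_nonneg_left s5 hμ0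
    rw [heq] at this s3
    linarith
  obtain ⟨z1, z2⟩ := s7 (fun x hx => neg_lt_neg (anti (mem_Ici.2 (sq_nonneg _)) hT.le (hin' x hx.1))) (by rw [hh1])
  have sub : ∀ A C : SmoothDomain n, volume (A.carrier \ C.carrier) = 0 → A.carrier ⊆ C.carrier := by
    intro A C h
    rw [← interior_closure_carrier C]
    refine interior_maximal ?_ A.isOpen
    have ho : IsOpen (A.carrier \ closure C.carrier) := A.isOpen.sdiff isClosed_closure
    have h0 : volume (A.carrier \ closure C.carrier) = 0 :=
      measure_mono_null (sdiff_subset_sdiff_right subset_closure) h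
    rw [ho.measure_eq_zero_iff (μ := volume)] at h0
    exact sdiff_eq_empty.1 h0
  exact Subset.antisymm (sub D Bd z2) (sub Bd D z1)

end B3
end BNS

namespace BNS
open MeasureTheory Set Filter Topology

section C1
variable {n : ℕ}
local notation "E" => EuclideanSpace ℝ (Fin n)

lemma zero_of_int_sq (D : SmoothDomain n) {f : E → ℝ} (hf : ContinuousOn f (closure D.carrier))
    (h : ∫ x in D.carrier, f x ^2 ≤ 0) : ∀ x ∈ closure D.carrier, f x = 0 := by
  have h0 : ∫ x in D.carrier, f x ^2 = 0 := le_antisymm h (integral_nonneg fun x => sq_nonneg _)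
  rw [setIntegral_eq_zero_iff_of_nonneg_ae (Eventually.of_forall fun x => sq_nonneg _)
    (cont_intOn D (hf.pow 2))] at h0
  have h1 : ∀ x ∈ D.carrier, f x ^2 = 0 := by
    have := Measure.eqOn_open_of_ae_eq h0 D.isOpen ((hf.mono subset_closure).pow 2) continuousOn_const
    exact this
  intro x hx
  have h2 : EqOn f (fun _ => 0) D.carrier := fun x hx => by simpa using h1 x hx
  exact h2.of_subset_closure hf continuousOn_const subset_closure subset_rfl hx

lemma int_gW_sq (D : SmoothDomain n) {f : E → ℝ} (hf : ContDiffOn ℝ 2 f (closure D.carrier))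
    {μ : ℝ} (hl : ∀ x ∈ D.carrier, lapWithin (closure D.carrier) f x = - μ * f x)
    (hb : ∀ x ∈ frontier D.carrier, f x * fderivWithin ℝ f (closure D.carrier) x (gradient D.defining x) = 0) :
    ∫ x in D.carrier, ‖gW (closure D.carrier) f x‖^2 = μ * ∫ x in D.carrier, f x ^2 := by
  have h1 := green D hf (hf.of_le (by norm_num)) hb
  simp only [real_inner_self_eq_norm_sq] at h1
  rw [h1, ← integral_const_mul, ← integral_neg]
  refine setIntegral_congr_fun (meas_carrier D) fun x hx => ?_
  simp only [hl x hx]; ring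

/-- A biharmonic Neumann eigenfunction is a Neumann eigenfunction. -/
lemma reduce (D : SmoothDomain n) {Υ : ℝ} (hΥ : 0 < Υ) (h : IsBiharmonicNeumannEigenvalue D Υ) :
    ∃ u : E → ℝ, ContDiffOn ℝ (⊤:ℕ∞) u (closure D.carrier) ∧ (∃ x ∈ closure D.carrier, u x ≠ 0) ∧
      (∀ x ∈ closure D.carrier, lapWithin (closure D.carrier) u x = - √Υ * u x) ∧
      (∀ x ∈ frontier D.carrier,
        fderivWithin ℝ u (closure D.carrier) x (gradient D.defining x) = 0) := by
  obtain ⟨u, hu, hne, heq, hn1, hn2⟩ := h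
  set K := closure D.carrier with hK
  set m := √Υ with hm
  have hmp : 0 < m := Real.sqrt_pos.2 hΥ
  have hmm : m * m = Υ := Real.mul_self_sqrt hΥ.le
  have hu' : ∀ k : ℕ, ContDiffOn ℝ k u K := fun k => hu.of_le (by exact_mod_cast le_top)
  have hL : ContDiffOn ℝ 2 (lapWithin K u) K := lapW_cd D (hu' 4) (by norm_num)
  refine ⟨u, hu, hne, ?_, fun x hx => normalDeriv_zero D hx (hn1 x hx)⟩
  set w : E → ℝ := fun x => lapWithin K u x + m * u x with hw
  have hwc : ContDiffOn ℝ 2 w K := hL.add (contDiffOn_const.mul (hu' 2))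
  have hfd : ∀ (a b : E → ℝ), DifferentiableOn ℝ a K → DifferentiableOn ℝ b K → ∀ y ∈ K,
      fderivWithin ℝ (fun x => a x + m * b x) K y = fderivWithin ℝ a K y + m • fderivWithin ℝ b K y := by
    intro a b ha hb y hy
    have := ((ha y hy).hasFDerivWithinAt.add ((hb y hy).hasFDerivWithinAt.const_mul m))
    exact this.fderivWithin (uniqueDiff D y hy)
  have hlw : ∀ x ∈ D.carrier, lapWithin K w x = - (-m) * w x := by
    intro x hx
    have hxK : x ∈ K := subset_closure hx
    have e1 : lapWithin K w x = lapWithin K (lapWithin K u) x + m * lapWithin K u x := by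
      unfold lapWithin
      rw [Finset.mul_sum, ← Finset.sum_add_distrib]
      refine Finset.sum_congr rfl fun i _ => ?_
      have h2 : ∀ y ∈ K, fderivWithin ℝ w K y (EuclideanSpace.single i 1) =
          fderivWithin ℝ (lapWithin K u) K y (EuclideanSpace.single i 1) +
            m * fderivWithin ℝ u K y (EuclideanSpace.single i 1) := by
        intro y hy
        rw [hw, hfd _ _ (hL.differentiableOn (by norm_num)) ((hu' 1).differentiableOn (by norm_num)) y hy]
        simp
      have h3 : fderivWithin ℝ (fun y => fderivWithin ℝ w K y (EuclideanSpace.single i 1)) K x =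
          fderivWithin ℝ (fun y => fderivWithin ℝ (lapWithin K u) K y (EuclideanSpace.single i 1) +
            m * fderivWithin ℝ u K y (EuclideanSpace.single i 1)) K x :=
        fderivWithin_congr h2 (h2 x hxK)
      rw [h3]
      have d1 : DifferentiableOn ℝ (fun y => fderivWithin ℝ (lapWithin K u) K y (EuclideanSpace.single i 1)) K := by
        have := (gWi_cd D hL (m := 1) (by norm_num) i).differentiableOn (by norm_num)
        simp only [gW_apply] at this; exact this
      have d2 : DifferentiableOn ℝ (fun y => fderivWithin ℝ u K y (EuclideanSpace.single i 1)) K := by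
        have := (gWi_cd D (hu' 2) (m := 1) (by norm_num) i).differentiableOn (by norm_num)
        simp only [gW_apply] at this; exact this
      rw [hfd _ _ d1 d2 x hxK]
      simp; rfl
    rw [e1, heq x hx, hw, ← hmm]; ring
  have h1 := int_gW_sq D hwc hlw (by
    intro x hx
    have hxK : x ∈ K := frontier_subset_closure hx
    rw [hw, hfd _ _ (hL.differentiableOn (by norm_num)) ((hu' 1).differentiableOn (by norm_num)) x hxK]
    simp only [add_apply, smul_apply]
    rw [normalDeriv_zero D hx (hn1 x hx), normalDeriv_zero D hx (hn2 x hx)]; simp)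
  have h2 : 0 ≤ ∫ x in D.carrier, ‖gW K w x‖^2 := integral_nonneg fun x => sq_nonneg _
  have h3 : ∫ x in D.carrier, w x ^2 ≤ 0 := by
    by_contra hc; push Not at hc
    rw [h1] at h2
    nlinarith
  have h4 := zero_of_int_sq D hwc.continuousOn h3
  intro x hx
  have := h4 x hx
  simp only [hw] at this
  linarith

/-- the normal of any ball-shaped domain is radial -/
lemma neumann_ball (B : SmoothDomain n) {c : E} {R : ℝ} (hR : 0 < R) (hB : B.carrier = Metric.ball c R)
    {x : E} (hx : x ∈ frontier B.carrier) : ∃ k : ℝ, x - c = k • gradient B.defining x := by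
  have hx' : ‖x - c‖ = R := by
    rw [hB, frontier_ball c hR.ne', Metric.mem_sphere, dist_eq_norm] at hx; exact hx
  set g := gradient B.defining x with hg
  set y := x - c with hy
  have hρ := (mem_front B).1 hx
  have h1 : ∀ v, inner ℝ y v < 0 → inner ℝ g v ≤ 0 := by
    intro v hv
    by_contra hc; push Not at hc
    have h2 : fderiv ℝ B.defining x (-v) < 0 := by
      rw [fderiv_eq_inner B, ← hg, inner_neg_right]; linarith
    obtain ⟨t₀, ht₀, h3⟩ := sign_along B hρ h2
    have h3' : fderiv ℝ (ballDomain c hR).defining x v < 0 := by rw [fderiv_ball]; linarith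
    obtain ⟨t₁, ht₁, h4⟩ := sign_along (ballDomain c hR) (x := x) (by
      show ‖x - c‖^2 - R^2 = 0
      rw [hx']; ring) h3'
    have ht : 0 < min t₀ t₁ := lt_min ht₀ ht₁
    have h5 := (h3 _ ht (min_le_left _ _)).2
    have h6 := (h4 _ ht (min_le_right _ _)).1
    rw [← mem_carrier] at h6
    have h7 : x + min t₀ t₁ • v ∈ B.carrier := by rw [hB]; exact h6
    rw [mem_carrier] at h7
    simp only [smul_neg, sub_neg_eq_add] at h5
    linarith
  have hyy : inner ℝ y y = R^2 := by rw [real_inner_self_eq_norm_sq, hx']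
  set a := inner ℝ g y / R^2 with ha
  have hgy : inner ℝ g y = a * R^2 := by rw [ha]; field_simp
  have hz : g = a • y := by
    rw [← sub_eq_zero, ← norm_eq_zero, ← sq_eq_zero_iff]
    set z := g - a • y with hz
    have hyz : inner ℝ y z = 0 := by
      rw [hz, inner_sub_right, inner_smul_right, hyy, real_inner_comm, hgy]; ring
    have hgz : inner ℝ g z = ‖z‖^2 := by
      have : g = z + a • y := by rw [hz]; abel
      rw [this, inner_add_left, inner_smul_left, hyz, real_inner_self_eq_norm_sq]; simp
    have h8 : ∀ ε > 0, ‖z‖^2 ≤ ε * (a * R^2) := by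
      intro ε hε
      have := h1 (z - ε • y) (by
        rw [inner_sub_right, inner_smul_right, hyz, hyy, zero_sub, neg_lt_zero]; positivity)
      rw [inner_sub_right, inner_smul_right, hgz, hgy] at this
      linarith
    refine le_antisymm ?_ (sq_nonneg _)
    refine le_of_forall_pos_le_add fun η hη => ?_
    rcases le_or_gt (a * R^2) 0 with h | h
    · have := h8 1 one_pos; linarith
    · have := h8 (η / (a * R^2)) (by positivity)
      rw [div_mul_cancel₀ _ h.ne'] at this
      linarith
  have ha0 : a ≠ 0 := by
    rintro h0
    have := B.grad_ne_zero x hx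
    rw [← hg, hz, h0, zero_smul] at this
    exact this rfl
  exact ⟨a⁻¹, by rw [hz, smul_smul, inv_mul_cancel₀ ha0, one_smul]⟩

lemma hyper_null {e : E} (he : e ≠ 0) (c : E) : volume {x : E | inner ℝ e (x - c) = 0} = 0 := by
  have h1 : volume (((innerSL ℝ e : E →L[ℝ] ℝ).ker : Submodule ℝ E) : Set E) = 0 := by
    apply Measure.addHaar_submodule
    intro h
    have : e ∈ ((innerSL ℝ e : E →L[ℝ] ℝ).ker : Submodule ℝ E) := by rw [h]; trivial
    simp at this
    exact he this
  have h2 : {x : E | inner ℝ e (x - c) = 0} =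
      (fun x => x - c) ⁻¹' (((innerSL ℝ e : E →L[ℝ] ℝ).ker : Submodule ℝ E) : Set E) := by
    ext x; simp [inner_sub_right]
  rw [h2]
  simp_rw [sub_eq_add_neg]
  rw [measure_preimage_add_right, h1]

end C1
end BNS

namespace BNS
open MeasureTheory Set Filter Topology

section C2
variable {n : ℕ}
local notation "E" => EuclideanSpace ℝ (Fin n)

lemma clos_ball (c : E) {R : ℝ} (hR : 0 < R) :
    closure (ballDomain c hR).carrier = Metric.closedBall c R := closure_ball c hR.ne'

lemma lip_bound {c : E} {R : ℝ} (hR : 0 < R) {v : E → ℝ}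
    (hv : ContDiffOn ℝ 1 v (closure (ballDomain c hR).carrier)) {e : E} (he : ‖e‖ = 1)
    (h0 : ∀ x ∈ closure (ballDomain c hR).carrier, inner ℝ e (x - c) = 0 → v x = 0) :
    ∃ C : ℝ, 0 < C ∧ ∀ x ∈ closure (ballDomain c hR).carrier, |v x| ≤ C * |inner ℝ e (x - c)| := by
  set D := ballDomain c hR
  have hc : ContinuousOn (fderivWithin ℝ v (closure D.carrier)) (closure D.carrier) :=
    hv.continuousOn_fderivWithin (uniqueDiff D) le_rfl
  obtain ⟨C, hC⟩ := (compact_clos D).exists_bound_of_continuousOn hc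
  have hconv : Convex ℝ (closure D.carrier) := by rw [clos_ball]; exact convex_closedBall _ _
  refine ⟨max C 1, lt_max_of_lt_right one_pos, fun x hx => ?_⟩
  set y := x - inner ℝ e (x - c) • e with hy
  have hyc : y - c = (x - c) - inner ℝ e (x - c) • e := by rw [hy]; abel
  have hee : inner ℝ e e = 1 := by rw [real_inner_self_eq_norm_sq, he]; norm_num
  have hyz : inner ℝ e (y - c) = 0 := by
    rw [hyc, inner_sub_right, inner_smul_right, hee]; ring
  have hyK : y ∈ closure D.carrier := by
    rw [clos_ball, Metric.mem_closedBall, dist_eq_norm] at hx ⊢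
    refine le_trans ?_ hx
    rw [← sq_le_sq₀ (norm_nonneg _) (norm_nonneg _)]
    have : x - c = (y - c) + inner ℝ e (x - c) • e := by rw [hyc]; abel
    have h3 : ‖x - c‖^2 = ‖y - c‖^2 + ‖inner ℝ e (x - c) • e‖^2 := by
      conv_lhs => rw [this]
      rw [norm_add_sq_real, inner_smul_right, real_inner_comm e (y - c), hyz]; ring
    rw [h3]; nlinarith [sq_nonneg ‖inner ℝ e (x - c) • e‖]
  have := hconv.norm_image_sub_le_of_norm_fderivWithin_le (hv.differentiableOn one_ne_zero) hC hyK hx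
  rw [h0 y hyK hyz, sub_zero, Real.norm_eq_abs] at this
  refine this.trans ?_
  have h4 : x - y = inner ℝ e (x - c) • e := by rw [hy]; abel
  rw [h4, norm_smul, he, mul_one, Real.norm_eq_abs]
  exact mul_le_mul_of_nonneg_right (le_max_left _ _) (abs_nonneg _)

lemma psi_deriv {δ : ℝ} (hδ : 0 < δ) (s : ℝ) :
    HasDerivAt (fun s => s / (s^2 + δ)) ((δ - s^2) / (s^2+δ)^2) s := by
  have h : s^2 + δ ≠ 0 := by positivity
  refine ((hasDerivAt_id s).div (((hasDerivAt_id s).pow 2).add_const δ) h).congr_deriv ?_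
  simp; ring

lemma picone_delta {c : E} {R : ℝ} (hR : 0 < R) (rd : Radial n R) {v : E → ℝ}
    (hv : ContDiffOn ℝ 1 v (closure (ballDomain c hR).carrier)) {e : E} {C : ℝ} (hC0 : 0 ≤ C)
    (hC : ∀ x ∈ Metric.ball c R, v x ^2 ≤ C * hh e c rd.L x ^2) {δ : ℝ} (hδ : 0 < δ) :
    rd.p * (∫ x in Metric.ball c R, v x ^2) -
      (rd.p * C * δ * volume.real (Metric.ball c R) + C * ∫ x in Metric.ball c R, ‖hg e c rd.L rd.L' x‖^2 *
        (δ / (hh e c rd.L x ^2 + δ)))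
      ≤ ∫ x in Metric.ball c R, ‖gW (closure (ballDomain c hR).carrier) v x‖^2 := by
  set D := ballDomain c hR with hD
  have hDc : D.carrier = Metric.ball c R := rfl
  set K := closure D.carrier with hK
  set h := hh e c rd.L with hh'
  set G := hg e c rd.L rd.L' with hG
  have hc1 : ContDiff ℝ 1 h := hh_cd rd.hL (radial_contL' rd) e c
  have hc2 : ContDiff ℝ 1 G := hg_cd rd e c
  have hpos : ∀ x, 0 < h x ^2 + δ := fun x => by positivity
  set ψ : ℝ → ℝ := fun s => s / (s^2 + δ) with hψ
  have hψc : ContDiff ℝ 1 ψ := contDiff_id.div ((contDiff_id.pow 2).add contDiff_const)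
    (fun s => by positivity)
  set F : E → E := fun x => (v x ^2 * ψ (h x)) • G x with hF
  have hF1 : ContDiffOn ℝ 1 F K := ((hv.pow 2).mul (hψc.comp hc1).contDiffOn).smul hc2.contDiffOn
  have hdv : ∀ x ∈ D.carrier, dv F x = 2 * v x * ψ (h x) * inner ℝ (gW K v x) (G x)
      + v x ^2 * ((δ - h x ^2)/(h x ^2+δ)^2) * ‖G x‖^2 - rd.p * (v x ^2 * ψ (h x) * h x) := by
    intro x hx
    have dv' : HasFDerivAt v (fderiv ℝ v x) x :=
      ((hv.contDiffAt (clos_nhds D hx)).differentiableAt one_ne_zero).hasFDerivAt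
    have dh : HasFDerivAt h _ x := hasFDerivAt_hh rd.hL e c x
    have d1 : HasFDerivAt (fun x => v x ^2 * ψ (h x)) _ x :=
      (dv'.pow 2).mul ((psi_deriv hδ (h x)).comp_hasFDerivAt x dh)
    rw [hF, dv_smul d1.differentiableAt (hc2.differentiable one_ne_zero x), d1.fderiv, dv_hg, gW_inner,
      fdW_eq D hx]
    simp only [add_apply, smul_apply, coe_innerSL_apply, smul_eq_mul, hψ]
    rw [real_inner_self_eq_norm_sq]
    simp
    ring
  have gc : ContinuousOn (gW K v) K := (gW_cd D hv (m := 0) (by norm_num)).continuousOn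
  have hcv := hv.continuousOn
  have ch : ContinuousOn h K := hc1.continuous.continuousOn
  have cG : ContinuousOn G K := hc2.continuous.continuousOn
  have cψ : ContinuousOn (fun x => ψ (h x)) K := (hψc.continuous.comp hc1.continuous).continuousOn
  have cψ' : ContinuousOn (fun x => (δ - h x ^2)/(h x ^2+δ)^2) K :=
    ContinuousOn.div (by fun_prop) (by fun_prop) fun x _ => by have := hpos x; positivity
  have cdv : ContinuousOn (fun x => 2 * v x * ψ (h x) * inner ℝ (gW K v x) (G x)
      + v x ^2 * ((δ - h x ^2)/(h x ^2+δ)^2) * ‖G x‖^2 - rd.p * (v x ^2 * ψ (h x) * h x)) K := by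
    have i1 : ContinuousOn (fun x => inner ℝ (gW K v x) (G x)) K := gc.inner cG
    have i2 := cG.norm
    exact ((((continuousOn_const.mul hcv).mul cψ).mul i1).add (((hcv.pow 2).mul cψ').mul (i2.pow 2))).sub
      (continuousOn_const.mul (((hcv.pow 2).mul cψ).mul ch))
  have idv : IntegrableOn (dv F) D.carrier :=
    (cont_intOn D cdv).congr_fun (fun x hx => (hdv x hx).symm) (meas_carrier D)
  have hdiv := div_thm D (hF1.mono subset_closure) hF1.continuousOn idv (by
      intro x hx
      rw [fderiv_ball, hF]
      have hx' : ‖x - c‖ = R := by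
        have h : x ∈ frontier (Metric.ball c R) := hx
        rw [frontier_ball c hR.ne', Metric.mem_sphere, dist_eq_norm] at h
        exact h
      rw [inner_smul_right, real_inner_comm, inner_hg, hx', rd.q_zero]; ring)
  -- pointwise
  have cq : ContinuousOn (fun x => ‖G x‖^2 * (δ / (h x ^2 + δ))) K :=
    (cG.norm.pow 2).mul (ContinuousOn.div continuousOn_const (by fun_prop) fun x _ => (hpos x).ne')
  have hpt : ∀ x ∈ D.carrier, rd.p * v x ^2 - (rd.p * C * δ + C * (‖G x‖^2 * (δ / (h x ^2 + δ))))
      + dv F x ≤ ‖gW K v x‖^2 := by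
    intro x hx
    have hp := hpos x
    have hCx := hC x hx
    rw [hdv x hx]
    have s1 : 0 ≤ ‖gW K v x - (v x * ψ (h x)) • G x‖^2 := sq_nonneg _
    rw [norm_sub_sq_real, inner_smul_right, norm_smul, mul_pow, Real.norm_eq_abs, sq_abs] at s1
    have s2 : (δ - h x ^2)/(h x ^2+δ)^2 = δ / (h x ^2+δ)^2 - ψ (h x) ^2 := by
      simp only [hψ]; field_simp
    have s3 : v x ^2 * ψ (h x) * h x = v x ^2 - v x ^2 * (δ / (h x ^2 + δ)) := by
      simp only [hψ]; field_simp; ring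
    have s4 : v x ^2 / (h x ^2 + δ) ≤ C := by
      rw [div_le_iff₀ hp]
      nlinarith
    have s5 : v x ^2 * (δ / (h x ^2 + δ)) ≤ C * δ := by
      have : v x ^2 * (δ / (h x ^2 + δ)) = v x ^2 / (h x ^2 + δ) * δ := by ring
      rw [this]; exact mul_le_mul_of_nonneg_right s4 hδ.le
    have s6 : v x ^2 * (δ / (h x ^2+δ)^2) * ‖G x‖^2 ≤ C * (‖G x‖^2 * (δ / (h x ^2 + δ))) := by
      have : v x ^2 * (δ / (h x ^2+δ)^2) * ‖G x‖^2 = v x ^2 / (h x ^2 + δ) * (‖G x‖^2 * (δ / (h x ^2 + δ))) := by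
        field_simp
      rw [this]; exact mul_le_mul_of_nonneg_right s4 (by positivity)
    have s7 := mul_le_mul_of_nonneg_left s5 rd.p_pos.le
    rw [s2, s3]
    nlinarith
  have i1 : IntegrableOn (fun x => rd.p * v x ^2) D.carrier := cont_intOn D (by fun_prop)
  have i2 : IntegrableOn (fun x => rd.p * C * δ + C * (‖G x‖^2 * (δ / (h x ^2 + δ)))) D.carrier :=
    cont_intOn D (by fun_prop)
  have i3 : IntegrableOn (fun x => ‖gW K v x‖^2) D.carrier := cont_intOn D (gc.norm.pow 2)
  have := setIntegral_mono_on ((i1.sub i2).add idv) i3 (meas_carrier D) hpt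
  have i12 : IntegrableOn (fun x => rd.p * v x ^2 - (rd.p * C * δ + C * (‖G x‖^2 * (δ / (h x ^2 + δ)))))
    D.carrier := i1.sub i2
  simp only [Pi.add_apply, Pi.sub_apply] at this
  rw [integral_add i12 idv, hdiv, add_zero, integral_sub i1 i2, integral_add (integrable_const _)
    ((cont_intOn D cq).const_mul C), integral_const_mul, integral_const_mul, integral_const] at this
  simp only [smul_eq_mul, measureReal_restrict_apply_univ] at this
  rw [hDc, integral_const_mul C] at this
  linarith

lemma picone {c : E} {R : ℝ} (hR : 0 < R) (rd : Radial n R) {v : E → ℝ}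
    (hv : ContDiffOn ℝ 1 v (closure (ballDomain c hR).carrier)) {e : E} (he : ‖e‖ = 1)
    (h0 : ∀ x ∈ closure (ballDomain c hR).carrier, inner ℝ e (x - c) = 0 → v x = 0) :
    rd.p * ∫ x in Metric.ball c R, v x ^2
      ≤ ∫ x in Metric.ball c R, ‖gW (closure (ballDomain c hR).carrier) v x‖^2 := by
  set D := ballDomain c hR with hD
  obtain ⟨C, hC, hb⟩ := lip_bound hR hv he h0
  have hT : (0:ℝ) ≤ R^2 := sq_nonneg _
  obtain ⟨s₀, hs₀, hmin⟩ := isCompact_Icc.exists_isMinOn (nonempty_Icc.2 hT) (radial_contL rd).continuousOn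
  set m := rd.L s₀ with hm
  have hmp : 0 < m := rd.L_pos _ hs₀.1 hs₀.2
  have hbd : ∀ x ∈ Metric.ball c R, v x ^2 ≤ (C/m)^2 * hh e c rd.L x ^2 := by
    intro x hx
    have h1 := hb x (subset_closure hx)
    rw [Metric.mem_ball, dist_eq_norm] at hx
    have h2 : m ≤ rd.L (‖x-c‖^2) := hmin ⟨sq_nonneg _, pow_le_pow_left₀ (norm_nonneg _) hx.le 2⟩
    have h3 : |inner ℝ e (x - c)| * m ≤ |hh e c rd.L x| := by
      rw [hh, abs_mul, abs_of_pos (hmp.trans_le h2)]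
      exact mul_le_mul_of_nonneg_left h2 (abs_nonneg _)
    have h4 : |v x| ≤ C/m * |hh e c rd.L x| := by
      refine h1.trans ?_
      rw [div_mul_eq_mul_div, le_div_iff₀ hmp, mul_assoc]
      exact mul_le_mul_of_nonneg_left h3 hC.le
    have := pow_le_pow_left₀ (abs_nonneg _) h4 2
    rwa [mul_pow, sq_abs, sq_abs] at this
  set δ : ℕ → ℝ := fun k => 1 / ((k:ℝ)+1) with hδ
  have hδp : ∀ k, 0 < δ k := fun k => by positivity
  have hδ0 : Tendsto δ atTop (𝓝 0) := tendsto_one_div_add_atTop_nhds_zero_nat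
  have key := fun k => picone_delta hR rd hv (C := (C/m)^2) (sq_nonneg _) hbd (hδp k)
  have hgc : Continuous (fun x => ‖hg e c rd.L rd.L' x‖^2) := (hg_cd rd e c).continuous.norm.pow 2
  have hhc : Continuous (hh e c rd.L) := (hh_cd rd.hL (radial_contL' rd) e c).continuous
  have lim1 : Tendsto (fun k => ∫ x in Metric.ball c R, ‖hg e c rd.L rd.L' x‖^2 *
        (δ k / (hh e c rd.L x ^2 + δ k))) atTop (𝓝 (∫ x in Metric.ball c R, (0:ℝ))) := by
    refine tendsto_integral_of_dominated_convergence (fun x => ‖hg e c rd.L rd.L' x‖^2) ?_ ?_ ?_ ?_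
    · intro k
      refine Continuous.aestronglyMeasurable ?_
      exact hgc.mul (continuous_const.div (by fun_prop) fun x => by have := hδp k; positivity)
    · exact cont_intOn D hgc.continuousOn
    · intro k
      refine Eventually.of_forall fun x => ?_
      have := hδp k
      rw [Real.norm_of_nonneg (by positivity)]
      refine mul_le_of_le_one_right (by positivity) ?_
      rw [div_le_one (by positivity)]
      nlinarith [sq_nonneg (hh e c rd.L x)]
    · have hne : ∀ᵐ x ∂(volume : Measure E), inner ℝ e (x - c) ≠ 0 := by
        rw [ae_iff]; simp only [not_not]
        exact hyper_null (by rintro rfl; simp at he) c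
      filter_upwards [ae_restrict_of_ae hne, ae_restrict_mem (measurableSet_ball (x := c) (ε := R))] with x hx hxb
      rw [Metric.mem_ball, dist_eq_norm] at hxb
      have hL := rd.L_pos _ (sq_nonneg ‖x-c‖) (pow_le_pow_left₀ (norm_nonneg _) hxb.le 2)
      have hh0 : hh e c rd.L x ≠ 0 := mul_ne_zero hx hL.ne'
      have : Tendsto (fun k => ‖hg e c rd.L rd.L' x‖^2 * (δ k / (hh e c rd.L x ^2 + δ k))) atTop
          (𝓝 (‖hg e c rd.L rd.L' x‖^2 * (0 / (hh e c rd.L x ^2 + 0)))) :=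
        tendsto_const_nhds.mul (hδ0.div (tendsto_const_nhds.add hδ0) (by simpa using hh0))
      simpa using this
  rw [integral_zero] at lim1
  have lim2 : Tendsto (fun k => rd.p * (∫ x in Metric.ball c R, v x ^2) -
      (rd.p * (C/m)^2 * δ k * volume.real (Metric.ball c R) + (C/m)^2 * ∫ x in Metric.ball c R, ‖hg e c rd.L rd.L' x‖^2 *
        (δ k / (hh e c rd.L x ^2 + δ k)))) atTop (𝓝 (rd.p * (∫ x in Metric.ball c R, v x ^2) -
      (rd.p * (C/m)^2 * 0 * volume.real (Metric.ball c R) + (C/m)^2 * 0))) :=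
    tendsto_const_nhds.sub (((hδ0.const_mul _).mul_const _).add (lim1.const_mul _))
  have := le_of_tendsto' lim2 key
  simpa using this

end C2
end BNS

namespace BNS
open MeasureTheory Set Filter Topology

section C3
variable {n : ℕ}
local notation "E" => EuclideanSpace ℝ (Fin n)

noncomputable def refl (e : E) : E ≃ₗᵢ[ℝ] E := (Submodule.span ℝ {e})ᗮ.reflection

lemma refl_refl (e y : E) : refl e (refl e y) = y := Submodule.reflection_reflection _ y
lemma refl_self (e : E) : refl e e = -e := Submodule.reflection_orthogonalComplement_singleton_eq_neg e
lemma refl_fix {e y : E} (h : inner ℝ e y = 0) : refl e y = y :=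
  Submodule.reflection_mem_subspace_eq_self (Submodule.mem_orthogonal_singleton_iff_inner_right.2 h)
lemma refl_inner (e y z : E) : inner ℝ (refl e y) z = inner ℝ y (refl e z) := by
  rw [← (refl e).inner_map_map, refl_refl]

/-- affine reflection -/
noncomputable def sg (e c : E) (x : E) : E := c + refl e (x - c)

lemma sg_sg (e c x : E) : sg e c (sg e c x) = x := by simp [sg, refl_refl]
lemma sg_sub (e c x : E) : sg e c x - c = refl e (x - c) := by simp [sg]
lemma sg_fix {e c x : E} (h : inner ℝ e (x - c) = 0) : sg e c x = x := by
  rw [sg, refl_fix h]; abel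
lemma sg_mem {e c x : E} {R : ℝ} (hR : 0 < R) (hx : x ∈ closure (ballDomain c hR).carrier) :
    sg e c x ∈ closure (ballDomain c hR).carrier := by
  rw [clos_ball, Metric.mem_closedBall, dist_eq_norm] at hx ⊢
  rwa [sg_sub, LinearIsometryEquiv.norm_map]
lemma sg_hasFDeriv (e c x : E) :
    HasFDerivAt (sg e c) ((refl e).toContinuousLinearEquiv : E →L[ℝ] E) x := by
  have h := ((refl e).toContinuousLinearEquiv : E →L[ℝ] E).hasFDerivAt.comp x ((hasFDerivAt_id x).sub_const c)
  exact h.const_add c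
lemma sg_cd (e c : E) : ContDiff ℝ (⊤:ℕ∞) (sg e c) :=
  contDiff_const.add ((refl e).contDiff.comp (contDiff_id.sub contDiff_const))
lemma sg_mp (e c : E) : MeasurePreserving (sg e c) volume volume :=
  (measurePreserving_add_left volume c).comp
    ((refl e).measurePreserving.comp (measurePreserving_sub_right volume c))
lemma sg_emb (e c : E) : MeasurableEmbedding (sg e c) :=
  (Homeomorph.mk (Equiv.mk (sg e c) (sg e c) (sg_sg e c) (sg_sg e c)) (sg_cd e c).continuous
    (sg_cd e c).continuous).measurableEmbedding

lemma sg_int (e c : E) (R : ℝ) (f : E → ℝ) :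
    ∫ x in Metric.ball c R, f (sg e c x) = ∫ x in Metric.ball c R, f x := by
  have h := (sg_mp e c).setIntegral_preimage_emb (sg_emb e c) f (Metric.ball c R)
  have : sg e c ⁻¹' Metric.ball c R = Metric.ball c R := by
    ext x; simp only [mem_preimage, Metric.mem_ball, dist_eq_norm, sg_sub, LinearIsometryEquiv.norm_map]
  rwa [this] at h

lemma sg_gW {c : E} {R : ℝ} (hR : 0 < R) {f : E → ℝ}
    (hf : DifferentiableOn ℝ f (closure (ballDomain c hR).carrier)) (e : E) {x : E}
    (hx : x ∈ closure (ballDomain c hR).carrier) :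
    gW (closure (ballDomain c hR).carrier) (f ∘ sg e c) x =
      refl e (gW (closure (ballDomain c hR).carrier) f (sg e c x)) := by
  set K := closure (ballDomain c hR).carrier
  have h1 := (hf _ (sg_mem (e := e) hR hx)).hasFDerivWithinAt.comp x
    (sg_hasFDeriv e c x).hasFDerivWithinAt (fun y hy => sg_mem hR hy)
  have h2 := h1.fderivWithin (uniqueDiff (ballDomain c hR) x hx)
  refine ext_inner_right ℝ fun w => ?_
  rw [gW_inner, h2, refl_inner, gW_inner]
  rfl

lemma case_i {c : E} {R : ℝ} (hR : 0 < R) (rd : Radial n R) {u : E → ℝ} {μ : ℝ}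
    (hu : ContDiffOn ℝ 1 u (closure (ballDomain c hR).carrier))
    (hw : ∀ φ, ContDiffOn ℝ 1 φ (closure (ballDomain c hR).carrier) →
      ∫ x in Metric.ball c R, inner ℝ (gW (closure (ballDomain c hR).carrier) φ x)
        (gW (closure (ballDomain c hR).carrier) u x) = μ * ∫ x in Metric.ball c R, φ x * u x)
    {e : E} (he : ‖e‖ = 1) (hne : ∃ x ∈ closure (ballDomain c hR).carrier, u x ≠ u (sg e c x)) :
    rd.p ≤ μ := by
  set D := ballDomain c hR with hD
  set K := closure D.carrier with hK
  have hDc : D.carrier = Metric.ball c R := rfl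
  have hsm : MapsTo (sg e c) K K := fun x hx => sg_mem hR hx
  have hcomp : ∀ φ : E → ℝ, ContDiffOn ℝ 1 φ K → ContDiffOn ℝ 1 (φ ∘ sg e c) K := fun φ hφ =>
    hφ.comp ((sg_cd e c).of_le (by exact_mod_cast le_top)).contDiffOn hsm
  have hw' : ∀ φ, ContDiffOn ℝ 1 φ K →
      ∫ x in Metric.ball c R, inner ℝ (gW K φ x) (gW K (u ∘ sg e c) x)
        = μ * ∫ x in Metric.ball c R, φ x * (u ∘ sg e c) x := by
    intro φ hφ
    rw [← sg_int e c R, ← sg_int e c R (fun x => φ x * (u ∘ sg e c) x)]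
    simp only [Function.comp_apply, sg_sg]
    have := hw (φ ∘ sg e c) (hcomp φ hφ)
    refine Eq.trans ?_ this
    refine setIntegral_congr_fun measurableSet_ball fun x hx => ?_
    have hxK : x ∈ K := subset_closure hx
    rw [sg_gW hR (hφ.differentiableOn one_ne_zero) e hxK,
      sg_gW hR (hu.differentiableOn one_ne_zero) e (hsm hxK), sg_sg, refl_inner]
  set v : E → ℝ := fun x => u x - (u ∘ sg e c) x with hv
  have hvc : ContDiffOn ℝ 1 v K := hu.sub (hcomp u hu)
  have hgv : ∀ x ∈ K, gW K v x = gW K u x - gW K (u ∘ sg e c) x := by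
    intro x hx
    have h1 := ((hu.differentiableOn one_ne_zero x hx).hasFDerivWithinAt.sub
      ((hcomp u hu).differentiableOn one_ne_zero x hx).hasFDerivWithinAt)
    refine ext_inner_right ℝ fun w => ?_
    rw [inner_sub_left, gW_inner, gW_inner, gW_inner]
    have : fderivWithin ℝ v K x = _ := h1.fderivWithin (uniqueDiff D x hx)
    rw [this]; rfl
  have gc : ∀ φ : E → ℝ, ContDiffOn ℝ 1 φ K → ContinuousOn (gW K φ) K := fun φ hφ =>
    (gW_cd D hφ (m := 0) (by norm_num)).continuousOn
  have hen : ∫ x in Metric.ball c R, ‖gW K v x‖^2 = μ * ∫ x in Metric.ball c R, v x ^2 := by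
    have e1 : ∫ x in Metric.ball c R, ‖gW K v x‖^2 = ∫ x in Metric.ball c R,
        (inner ℝ (gW K v x) (gW K u x) - inner ℝ (gW K v x) (gW K (u ∘ sg e c) x)) := by
      refine setIntegral_congr_fun measurableSet_ball fun x hx => ?_
      rw [← inner_sub_right, ← hgv x (subset_closure hx), real_inner_self_eq_norm_sq]
    have i1 : IntegrableOn (fun x => inner ℝ (gW K v x) (gW K u x)) D.carrier :=
      cont_intOn D ((gc v hvc).inner (gc u hu))
    have i2 : IntegrableOn (fun x => inner ℝ (gW K v x) (gW K (u ∘ sg e c) x)) D.carrier :=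
      cont_intOn D ((gc v hvc).inner (gc _ (hcomp u hu)))
    have i3 : IntegrableOn (fun x => v x * u x) D.carrier :=
      cont_intOn D (hvc.continuousOn.mul hu.continuousOn)
    have i4 : IntegrableOn (fun x => v x * (u ∘ sg e c) x) D.carrier :=
      cont_intOn D (hvc.continuousOn.mul (hcomp u hu).continuousOn)
    rw [hDc] at i1 i2 i3 i4
    rw [e1, integral_sub i1 i2, hw v hvc, hw' v hvc, ← mul_sub, ← integral_sub i3 i4]
    congr 1
    refine setIntegral_congr_fun measurableSet_ball fun x hx => ?_
    simp only [hv]; ring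
  have hp := picone hR rd hvc he (fun x hx hxe => by simp [hv, sg_fix hxe])
  rw [hen] at hp
  have hpos : 0 < ∫ x in Metric.ball c R, v x ^2 := by
    by_contra hc; push Not at hc
    obtain ⟨x, hx, hne⟩ := hne
    have := zero_of_int_sq D hvc.continuousOn hc x hx
    simp only [hv, Function.comp_apply] at this
    exact hne (by linarith)
  exact le_of_mul_le_mul_right hp hpos

lemma fd_comm {f : E → ℝ} {x : E} (hf : ContDiffAt ℝ 2 f x) (a b : E) :
    fderiv ℝ (fun y => fderiv ℝ f y a) x b = fderiv ℝ (fun y => fderiv ℝ f y b) x a := by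
  have h1 : DifferentiableAt ℝ (fderiv ℝ f) x :=
    (hf.fderiv_right (m := 1) (by norm_num)).differentiableAt one_ne_zero
  rw [fderiv_clm_apply h1 (differentiableAt_const a), fderiv_clm_apply h1 (differentiableAt_const b)]
  simp
  exact (hf.isSymmSndFDerivAt (by simp)) b a

lemma lapW_eq_fd (D : SmoothDomain n) {f : E → ℝ} {x : E} (hx : x ∈ D.carrier) :
    lapWithin (closure D.carrier) f x = ∑ j, fderiv ℝ (fun y => fderiv ℝ f y (ee j)) x (ee j) := by
  unfold lapWithin
  refine Finset.sum_congr rfl fun j _ => ?_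
  rw [fdW_eq D hx]
  have : (fun y => fderivWithin ℝ f (closure D.carrier) y (EuclideanSpace.single j 1)) =ᶠ[𝓝 x]
      fun y => fderiv ℝ f y (ee j) := by
    filter_upwards [D.isOpen.mem_nhds hx] with y hy
    rw [fdW_eq D hy]; rfl
  rw [this.fderiv_eq]; rfl

lemma lap_partial (D : SmoothDomain n) {u : E → ℝ} (hu : ContDiffOn ℝ 3 u (closure D.carrier)) {μ : ℝ}
    (hl : ∀ x ∈ closure D.carrier, lapWithin (closure D.carrier) u x = - μ * u x) (i : Fin n) {x : E}
    (hx : x ∈ D.carrier) :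
    lapWithin (closure D.carrier) (fun y => gW (closure D.carrier) u y i) x =
      - μ * gW (closure D.carrier) u x i := by
  have hat : ∀ y ∈ D.carrier, ContDiffAt ℝ 3 u y := fun y hy => hu.contDiffAt (clos_nhds D hy)
  have hg : ∀ y ∈ D.carrier, gW (closure D.carrier) u y i = fderiv ℝ u y (ee i) := fun y hy => by
    rw [gW_apply, fdW_eq D hy]
  have hN : D.carrier ∈ 𝓝 x := D.isOpen.mem_nhds hx
  rw [lapW_eq_fd D hx, hg x hx]
  have e1 : ∀ j, fderiv ℝ (fun y => fderiv ℝ (fun y => gW (closure D.carrier) u y i) y (ee j)) x (ee j) =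
      fderiv ℝ (fun y => fderiv ℝ (fun z => fderiv ℝ u z (ee j)) y (ee j)) x (ee i) := by
    intro j
    have h1 : (fun y => fderiv ℝ (fun y => gW (closure D.carrier) u y i) y (ee j)) =ᶠ[𝓝 x]
        fun y => fderiv ℝ (fun z => fderiv ℝ u z (ee j)) y (ee i) := by
      filter_upwards [hN] with y hy
      have h2 : (fun y => gW (closure D.carrier) u y i) =ᶠ[𝓝 y] fun z => fderiv ℝ u z (ee i) := by
        filter_upwards [D.isOpen.mem_nhds hy] with z hz using hg z hz
      rw [h2.fderiv_eq, fd_comm ((hat y hy).of_le (by norm_num))]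
    rw [h1.fderiv_eq, fd_comm]
    have h3 := ((hat x hx).fderiv_right (m := 2) (by norm_num))
    exact h3.clm_apply contDiffAt_const
  rw [Finset.sum_congr rfl fun j _ => e1 j]
  have h2 : (fun y => - μ * u y) =ᶠ[𝓝 x]
      fun y => ∑ j, fderiv ℝ (fun z => fderiv ℝ u z (ee j)) y (ee j) := by
    filter_upwards [hN] with y hy
    rw [← hl y (subset_closure hy), lapW_eq_fd D hy]
  have h3 : fderiv ℝ (fun y => -μ * u y) x =
      fderiv ℝ (fun y => ∑ j, fderiv ℝ (fun z => fderiv ℝ u z (ee j)) y (ee j)) x := h2.fderiv_eq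
  rw [fderiv_const_mul ((hat x hx).differentiableAt (by norm_num)), fderiv_fun_sum] at h3
  · have h4 := congrArg (fun l => l (ee i)) h3
    simp only [smul_apply, smul_eq_mul, ContinuousLinearMap.sum_apply] at h4
    exact h4.symm
  · intro j _
    have h4 := ((hat x hx).fderiv_right (m := 2) (by norm_num)).clm_apply
      (contDiffAt_const (c := (ee j : E)))
    exact ((h4.fderiv_right (m := 1) (by norm_num)).clm_apply contDiffAt_const).differentiableAt one_ne_zero

theorem ball_bound (B : SmoothDomain n) {c : E} {R : ℝ} (hR : 0 < R) (hB : B.carrier = Metric.ball c R)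
    (rd : Radial n R) {Υ : ℝ} (hΥ : 0 < Υ) (h : IsBiharmonicNeumannEigenvalue B Υ) : rd.p ≤ √Υ := by
  obtain ⟨u, hu, hne, hl, hb⟩ := reduce B hΥ h
  set D := ballDomain c hR with hD
  have hDc : D.carrier = Metric.ball c R := rfl
  set μ := √Υ
  have hμ : 0 < μ := Real.sqrt_pos.2 hΥ
  have hrad : ∀ x ∈ frontier D.carrier, fderivWithin ℝ u (closure D.carrier) x (x - c) = 0 := by
    intro x hx
    have hx' : x ∈ frontier B.carrier := by rw [hB]; exact hx
    obtain ⟨k, hk⟩ := neumann_ball B hR hB hx'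
    have := hb x hx'
    rw [hB, ← hDc] at this
    rw [hk, map_smul, this, smul_zero]
  rw [hB, ← hDc] at hu hne hl
  set K := closure D.carrier with hK
  have hu' : ∀ k : ℕ, ContDiffOn ℝ k u K := fun k => hu.of_le (by exact_mod_cast le_top)
  have hu1 : ContDiffOn ℝ 1 u K := hu' 1
  have hgrad : ∀ x, gradient D.defining x = (2:ℝ) • (x - c) := by
    intro x
    refine ext_inner_right ℝ fun v => ?_
    rw [← fderiv_eq_inner, fderiv_ball, inner_smul_left]; simp
  have hb' : ∀ x ∈ frontier D.carrier, fderivWithin ℝ u K x (gradient D.defining x) = 0 := by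
    intro x hx; rw [hgrad, map_smul, hrad x hx, smul_zero]
  have hw : ∀ φ, ContDiffOn ℝ 1 φ K →
      ∫ x in Metric.ball c R, inner ℝ (gW K φ x) (gW K u x) = μ * ∫ x in Metric.ball c R, φ x * u x := by
    intro φ hφ
    have := green D (hu' 2) hφ (fun x hx => by rw [hb' x hx, mul_zero])
    refine Eq.trans this ?_
    rw [← integral_neg, ← integral_const_mul]
    refine setIntegral_congr_fun measurableSet_ball fun x hx => ?_
    rw [← hK, hl x (subset_closure hx)]; ring
  by_cases hsym : ∃ e : E, ‖e‖ = 1 ∧ ∃ x ∈ K, u x ≠ u (sg e c x)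
  · obtain ⟨e, he, hx⟩ := hsym
    exact case_i hR rd hu1 hw he hx
  push Not at hsym
  -- radial case
  have hperp1 : ∀ e : E, ‖e‖ = 1 → ∀ x ∈ K, inner ℝ e (x - c) = 0 → inner ℝ (gW K u x) e = 0 := by
    intro e he x hx hxe
    have h1 : gW K (u ∘ sg e c) x = gW K u x := by
      unfold gW
      congr 1
      exact fderivWithin_congr (fun y hy => (hsym e he y hy).symm) (hsym e he x hx).symm
    rw [sg_gW hR (hu1.differentiableOn one_ne_zero) e hx, sg_fix hxe] at h1
    have h2 : inner ℝ (gW K u x) e = - inner ℝ (gW K u x) e := by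
      conv_lhs => rw [← h1]
      rw [refl_inner, refl_self, inner_neg_right]
    linarith
  have hperp : ∀ e : E, ∀ x ∈ K, inner ℝ e (x - c) = 0 → inner ℝ (gW K u x) e = 0 := by
    intro e x hx hxe
    rcases eq_or_ne e 0 with rfl | h0
    · simp
    have hn : ‖e‖ ≠ 0 := norm_ne_zero_iff.2 h0
    have := hperp1 (‖e‖⁻¹ • e) (by rw [norm_smul, norm_inv, norm_norm, inv_mul_cancel₀ hn]) x hx
      (by rw [inner_smul_left, hxe]; simp)
    rw [inner_smul_right] at this
    exact (mul_eq_zero.1 this).resolve_left (inv_ne_zero hn)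
  have hg0 : ∀ x ∈ frontier D.carrier, gW K u x = 0 := by
    intro x hx
    have hxR : ‖x - c‖ = R := by
      have h : x ∈ frontier (Metric.ball c R) := hx
      rw [frontier_ball c hR.ne', Metric.mem_sphere, dist_eq_norm] at h
      exact h
    have hgy : inner ℝ (gW K u x) (x - c) = 0 := by rw [gW_inner]; exact hrad x hx
    have := hperp (gW K u x) x (frontier_subset_closure hx) hgy
    exact inner_self_eq_zero.1 this
  have hex : ∃ i : Fin n, ∃ x ∈ K, gW K u x i ≠ 0 := by
    by_contra hc; push Not at hc
    have hz : ∀ x ∈ K, gW K u x = 0 := fun x hx => by ext i; exact hc i x hx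
    have h1 := hw u hu1
    have h2 : ∫ x in Metric.ball c R, inner ℝ (gW K u x) (gW K u x) = 0 := by
      rw [setIntegral_congr_fun (g := fun _ => (0:ℝ)) measurableSet_ball fun x hx => by
        simp only [hz x (subset_closure hx), inner_zero_left]]
      simp
    rw [h2] at h1
    have h3 : ∫ x in D.carrier, u x ^2 ≤ 0 := by
      rcases mul_eq_zero.1 h1.symm with h | h
      · exact absurd h hμ.ne'
      · simp only [← sq] at h; exact h.le
    obtain ⟨x, hx, hxn⟩ := hne
    exact hxn (zero_of_int_sq D hu.continuousOn h3 x hx)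
  obtain ⟨i, x₀, hx₀, hne0⟩ := hex
  set v : E → ℝ := fun y => gW K u y i with hv
  have hv2 : ContDiffOn ℝ 2 v K := gWi_cd D (hu' 3) (by norm_num) i
  have hen := int_gW_sq D hv2 (μ := μ) (fun x hx => lap_partial D (hu' 3) hl i hx) (fun x hx => by
    simp only [hv]
    have : gW K u x i = 0 := by rw [hg0 x hx]; rfl
    rw [this, zero_mul])
  have hp := picone hR rd (hv2.of_le (by norm_num) : ContDiffOn ℝ 1 v K) (norm_ee i) (fun x hx hxe => by
    have h1 := hperp (ee i) x hx hxe
    simp only [hv]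
    rw [gW_apply, ← gW_inner]; exact h1)
  have hen' : ∫ x in Metric.ball c R, ‖gW K v x‖^2 = μ * ∫ x in Metric.ball c R, v x^2 := hen
  rw [← hD, ← hK, hen'] at hp
  have hpos : 0 < ∫ x in Metric.ball c R, v x ^2 := by
    by_contra hc; push Not at hc
    exact hne0 (zero_of_int_sq D hv2.continuousOn hc x₀ hx₀)
  exact le_of_mul_le_mul_right hp hpos

end C3
end BNS

namespace BNS
open MeasureTheory Set Filter Topology
section D0
variable {n : ℕ}
local notation "E" => EuclideanSpace ℝ (Fin n)

abbrev JJ (n : ℕ) := WithLp 2 (ℝ × EuclideanSpace ℝ (Fin n))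

noncomputable abbrev Lsp (D : SmoothDomain n) := Lp (JJ n) 2 (volume.restrict D.carrier)

lemma cont_bdd {V : Type*} [NormedAddCommGroup V] (D : SmoothDomain n) {f : E → V} (hf : Continuous f) :
    ∃ C, 0 ≤ C ∧ ∀ x ∈ D.carrier, ‖f x‖ ≤ C := by
  obtain ⟨C, hC⟩ := (compact_clos D).exists_bound_of_continuousOn hf.continuousOn
  exact ⟨max C 0, le_max_right _ _, fun x hx => (hC x (subset_closure hx)).trans (le_max_left _ _)⟩

lemma ae_carrier (D : SmoothDomain n) : ∀ᵐ x ∂(volume.restrict D.carrier), x ∈ D.carrier :=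
  ae_restrict_mem (meas_carrier D)

lemma cont_memLp {V : Type*} [NormedAddCommGroup V] [SecondCountableTopologyEither E V]
    (D : SmoothDomain n) {f : E → V} (hf : Continuous f) :
    MemLp f 2 (volume.restrict D.carrier) := by
  obtain ⟨C, _, hC⟩ := cont_bdd D hf
  refine MemLp.of_bound hf.aestronglyMeasurable C ?_
  filter_upwards [ae_carrier D] with x hx using hC x hx

noncomputable def lpL (D : SmoothDomain n) : C(E, JJ n) →ₗ[ℝ] Lsp D where
  toFun f := (cont_memLp D f.continuous).toLp f
  map_add' f g := by rfl
  map_smul' c f := by rfl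

lemma lpL_coe (D : SmoothDomain n) (f : C(E, JJ n)) :
    lpL D f =ᵐ[volume.restrict D.carrier] f :=
  (cont_memLp D f.continuous).coeFn_toLp

lemma vol_real (D : SmoothDomain n) : 0 ≤ (volume.real D.carrier) := measureReal_nonneg

lemma lpL_bound (D : SmoothDomain n) (f : C(E, JJ n)) {M : ℝ} (hM : ∀ x ∈ D.carrier, ‖f x‖ ≤ M)
    (hM0 : 0 ≤ M) : ‖lpL D f‖ ≤ √(volume.real D.carrier) * M := by
  have h := Lp.norm_le_of_ae_bound (f := lpL D f) (μ := volume.restrict D.carrier) hM0 (by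
    filter_upwards [lpL_coe D f, ae_carrier D] with x h1 h2
    rw [h1]; exact hM x h2)
  refine h.trans (le_of_eq ?_)
  congr 1
  rw [Real.sqrt_eq_rpow, measureUnivNNReal]
  simp [Measure.real, ENNReal.coe_toNNReal_eq_toReal]

lemma mul_memLp (D : SmoothDomain n) {m : E → JJ n →L[ℝ] JJ n} (hm : Continuous m) (f : Lsp D) :
    MemLp (fun x => m x (f x)) 2 (volume.restrict D.carrier) := by
  obtain ⟨C, hC0, hC⟩ := cont_bdd D hm
  refine MemLp.of_le_mul (c := C) (Lp.memLp f) ?_ ?_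
  · have h1 := hm.aestronglyMeasurable (μ := volume.restrict D.carrier)
    exact (ContinuousLinearMap.apply ℝ (JJ n)).flip.aestronglyMeasurable_comp₂ h1
      (Lp.aestronglyMeasurable f)
  · filter_upwards [ae_carrier D] with x hx
    exact ((m x).le_opNorm _).trans (by gcongr; exact hC x hx)

lemma mul_norm (D : SmoothDomain n) {m : E → JJ n →L[ℝ] JJ n} (hm : Continuous m) (f : Lsp D) {C : ℝ}
    (hC : ∀ x ∈ D.carrier, ‖m x‖ ≤ C) : ‖(mul_memLp D hm f).toLp _‖ ≤ C * ‖f‖ := by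
  refine Lp.norm_le_mul_norm_of_ae_le_mul ?_
  filter_upwards [ae_carrier D, (mul_memLp D hm f).coeFn_toLp] with x hx h1
  rw [h1]
  exact ((m x).le_opNorm _).trans (by gcongr; exact hC x hx)

noncomputable def mulF (D : SmoothDomain n) (m : C(E, JJ n →L[ℝ] JJ n)) (f : Lsp D) : Lsp D :=
  (mul_memLp D m.continuous f).toLp _

lemma mulF_coe (D : SmoothDomain n) (m : C(E, JJ n →L[ℝ] JJ n)) (f : Lsp D) :
    mulF D m f =ᵐ[volume.restrict D.carrier] fun x => m x (f x) :=
  (mul_memLp D m.continuous f).coeFn_toLp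

lemma mulF_add (D : SmoothDomain n) (m : C(E, JJ n →L[ℝ] JJ n)) (f g : Lsp D) :
    mulF D m (f + g) = mulF D m f + mulF D m g := by
  apply Lp.ext
  filter_upwards [mulF_coe D m (f + g), mulF_coe D m f, mulF_coe D m g, Lp.coeFn_add f g,
    Lp.coeFn_add (mulF D m f) (mulF D m g)] with x h1 h2 h3 h4 h5
  rw [h1, h5, h4, Pi.add_apply, Pi.add_apply, h2, h3, map_add]

lemma mulF_smul (D : SmoothDomain n) (m : C(E, JJ n →L[ℝ] JJ n)) (c : ℝ) (f : Lsp D) :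
    mulF D m (c • f) = c • mulF D m f := by
  apply Lp.ext
  filter_upwards [mulF_coe D m (c • f), mulF_coe D m f, Lp.coeFn_smul c f,
    Lp.coeFn_smul c (mulF D m f)] with x h1 h2 h4 h5
  rw [h1, h5, h4, Pi.smul_apply, Pi.smul_apply, h2, map_smul]

lemma mulF_add' (D : SmoothDomain n) (m m' : C(E, JJ n →L[ℝ] JJ n)) (f : Lsp D) :
    mulF D (m + m') f = mulF D m f + mulF D m' f := by
  apply Lp.ext
  filter_upwards [mulF_coe D (m + m') f, mulF_coe D m f, mulF_coe D m' f,
    Lp.coeFn_add (mulF D m f) (mulF D m' f)] with x h1 h2 h3 h5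
  rw [h1, h5, Pi.add_apply, h2, h3]; rfl

lemma mulF_smul' (D : SmoothDomain n) (c : ℝ) (m : C(E, JJ n →L[ℝ] JJ n)) (f : Lsp D) :
    mulF D (c • m) f = c • mulF D m f := by
  apply Lp.ext
  filter_upwards [mulF_coe D (c • m) f, mulF_coe D m f, Lp.coeFn_smul c (mulF D m f)] with x h1 h2 h5
  rw [h1, h5, Pi.smul_apply, h2]; rfl

noncomputable def mulOp (D : SmoothDomain n) (m : C(E, JJ n →L[ℝ] JJ n)) : Lsp D →L[ℝ] Lsp D :=
  LinearMap.mkContinuousOfExistsBound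
    { toFun := mulF D m
      map_add' := mulF_add D m
      map_smul' := mulF_smul D m }
    (by
      obtain ⟨C, hC0, hC⟩ := cont_bdd D m.continuous
      exact ⟨C, fun f => mul_norm D m.continuous f hC⟩)

noncomputable def mulL (D : SmoothDomain n) : C(E, JJ n →L[ℝ] JJ n) →ₗ[ℝ] (Lsp D →L[ℝ] Lsp D) where
  toFun m := mulOp D m
  map_add' m m' := ContinuousLinearMap.ext fun f => mulF_add' D m m' f
  map_smul' c m := ContinuousLinearMap.ext fun f => mulF_smul' D c m f

lemma mulL_coe (D : SmoothDomain n) (m : C(E, JJ n →L[ℝ] JJ n)) (f : Lsp D) :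
    mulL D m f =ᵐ[volume.restrict D.carrier] fun x => m x (f x) :=
  (mul_memLp D m.continuous f).coeFn_toLp

lemma mulL_bound (D : SmoothDomain n) (m : C(E, JJ n →L[ℝ] JJ n)) {M : ℝ}
    (hM : ∀ x ∈ D.carrier, ‖m x‖ ≤ M) (hM0 : 0 ≤ M) : ‖mulL D m‖ ≤ M :=
  ContinuousLinearMap.opNorm_le_bound _ hM0 fun f => mul_norm D m.continuous f hM

lemma mulL_lpL (D : SmoothDomain n) (m : C(E, JJ n →L[ℝ] JJ n)) (f : C(E, JJ n)) (g : C(E, JJ n))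
    (hg : ∀ x ∈ D.carrier, g x = m x (f x)) : mulL D m (lpL D f) = lpL D g := by
  apply Lp.ext
  filter_upwards [mulL_coe D m (lpL D f), lpL_coe D f, lpL_coe D g, ae_carrier D] with x h1 h2 h3 h4
  rw [h1, h2, h3, hg x h4]

lemma lpL_inner (D : SmoothDomain n) (f g : C(E, JJ n)) :
    inner ℝ (lpL D f) (lpL D g) = ∫ x in D.carrier, inner ℝ (f x) (g x) := by
  rw [L2.inner_def]
  refine integral_congr_ae ?_
  filter_upwards [lpL_coe D f, lpL_coe D g] with x h1 h2
  rw [h1, h2]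

/-- uniform first order expansion -/
lemma unif_deriv {V : Type*} [NormedAddCommGroup V] [NormedSpace ℝ V] {G : E → E → V}
    (hG : ContDiff ℝ 1 (Function.uncurry G)) {K : Set E} (hK : IsCompact K) (h₀ : E) {ε : ℝ} (hε : 0 < ε) :
    ∀ᶠ h in 𝓝 h₀, ∀ x ∈ K, ‖G h x - G h₀ x - fderiv ℝ (fun h => G h x) h₀ (h - h₀)‖ ≤ ε * ‖h - h₀‖ := by
  have hd : ∀ h x, HasFDerivAt (fun h => G h x)
      ((fderiv ℝ (Function.uncurry G) (h, x)).comp (ContinuousLinearMap.inl ℝ E E)) h := by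
    intro h x
    have h1 := (hG.differentiable one_ne_zero (h, x)).hasFDerivAt
    exact HasFDerivAt.comp (g := Function.uncurry G) (f := fun h => (h, x)) h h1
      (hasFDerivAt_prodMk_left h x)
  have hc : Continuous (fun p : E × E => (fderiv ℝ (Function.uncurry G) p).comp
      (ContinuousLinearMap.inl ℝ E E)) :=
    (hG.continuous_fderiv one_ne_zero).clm_comp continuous_const
  have hev : ∀ᶠ h in 𝓝 h₀, ∀ x ∈ K, ‖(fderiv ℝ (Function.uncurry G) (h, x)).comp
      (ContinuousLinearMap.inl ℝ E E) - (fderiv ℝ (Function.uncurry G) (h₀, x)).comp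
      (ContinuousLinearMap.inl ℝ E E)‖ < ε := by
    refine hK.eventually_forall_of_forall_eventually fun x hx => ?_
    have hc2 : Continuous (fun p : E × E => ‖(fderiv ℝ (Function.uncurry G) p).comp
      (ContinuousLinearMap.inl ℝ E E) - (fderiv ℝ (Function.uncurry G) (h₀, p.2)).comp
      (ContinuousLinearMap.inl ℝ E E)‖) :=
      (hc.sub (hc.comp (continuous_const.prodMk continuous_snd))).norm
    have := hc2.tendsto (h₀, x)
    simp only [sub_self, norm_zero] at this
    exact this.eventually (gt_mem_nhds hε)
  obtain ⟨r, hr, hb⟩ := Metric.eventually_nhds_iff_ball.1 hev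
  filter_upwards [Metric.ball_mem_nhds h₀ hr] with h hh x hx
  rw [(hd h₀ x).fderiv]
  exact (convex_ball h₀ r).norm_image_sub_le_of_norm_hasFDerivWithin_le'
    (f := fun h => G h x) (fun y hy => (hd y x).hasFDerivWithinAt)
    (fun y hy => (hb y hy x hx).le) (Metric.mem_ball_self hr) hh

def cm {V : Type*} [TopologicalSpace V] (f : E → V) (hf : Continuous f) : C(E, V) := ⟨f, hf⟩

lemma slice_cont {V : Type*} [NormedAddCommGroup V] [NormedSpace ℝ V] {G : E → E → V} {k : WithTop ℕ∞}
    (hG : ContDiff ℝ k (Function.uncurry G)) (h : E) : Continuous (G h) :=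
  hG.continuous.comp (continuous_const.prodMk continuous_id)

lemma pd_eq {V : Type*} [NormedAddCommGroup V] [NormedSpace ℝ V] {G : E → E → V}
    (hG : ContDiff ℝ 1 (Function.uncurry G)) (h x e : E) :
    fderiv ℝ (fun h => G h x) h e = fderiv ℝ (Function.uncurry G) (h, x) (e, 0) := by
  have h1 := (hG.differentiable one_ne_zero (h, x)).hasFDerivAt
  have := HasFDerivAt.comp (g := Function.uncurry G) (f := fun h => (h, x)) h h1
      (hasFDerivAt_prodMk_left h x)
  have h2 : fderiv ℝ (fun h => G h x) h = _ := this.fderiv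
  rw [h2]; rfl

lemma pd_contDiff {V : Type*} [NormedAddCommGroup V] [NormedSpace ℝ V] {G : E → E → V}
    {k m : WithTop ℕ∞} (hG : ContDiff ℝ k (Function.uncurry G)) (hm : m + 1 ≤ k) (e : E) :
    ContDiff ℝ m (Function.uncurry fun h x => fderiv ℝ (fun h => G h x) h e) := by
  have h1 : ContDiff ℝ 1 (Function.uncurry G) := hG.of_le (le_trans (by simp) hm)
  have : (Function.uncurry fun h x => fderiv ℝ (fun h => G h x) h e) =
      fun p : E × E => fderiv ℝ (Function.uncurry G) p (e, 0) := by
    ext ⟨h, x⟩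
    exact pd_eq h1 h x e
  rw [this]
  exact (hG.fderiv_right hm).clm_apply contDiff_const

noncomputable def cmc {V : Type*} [TopologicalSpace V] [Zero V] (f : E → V) : C(E, V) :=
  open Classical in if h : Continuous f then ⟨f, h⟩ else 0

lemma cmc_coe {V : Type*} [TopologicalSpace V] [Zero V] {f : E → V} (h : Continuous f) :
    (cmc f : E → V) = f := by simp [cmc, h]

section slice
variable {V Z : Type*} [NormedAddCommGroup V] [NormedSpace ℝ V] [NormedAddCommGroup Z] [NormedSpace ℝ Z]

lemma slice_hasFDeriv {D : SmoothDomain n} (P : C(E, V) →ₗ[ℝ] Z) {C : ℝ}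
    (hP : ∀ f M, 0 ≤ M → (∀ x ∈ D.carrier, ‖f x‖ ≤ M) → ‖P f‖ ≤ C * M) {G : E → E → V}
    (hG : ContDiff ℝ 1 (Function.uncurry G)) (h₀ : E) :
    HasFDerivAt (fun h => P (cmc (G h))) (∑ i, (EuclideanSpace.proj i : E →L[ℝ] ℝ).smulRight
      (P (cmc (fun x => fderiv ℝ (fun h => G h x) h₀ (ee i))))) h₀ := by
  have hGc := fun h => slice_cont hG h
  have hdc : ∀ h e, Continuous (fun x => fderiv ℝ (fun h => G h x) h e) := fun h e =>
    slice_cont (pd_contDiff hG (m := 0) (by norm_num) e) h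
  rw [hasFDerivAt_iff_isLittleO, Asymptotics.isLittleO_iff]
  intro ε hε
  have hC1 : 0 < |C| + 1 := by positivity
  filter_upwards [unif_deriv hG (compact_clos D) h₀ (div_pos hε hC1)] with h hh
  have e1 : P (cmc (G h)) - P (cmc (G h₀)) - (∑ i, (EuclideanSpace.proj i : E →L[ℝ] ℝ).smulRight
      (P (cmc (fun x => fderiv ℝ (fun h => G h x) h₀ (ee i)))) : E →L[ℝ] Z) (h - h₀) =
      P (cmc (G h) - cmc (G h₀) - cmc (fun x => fderiv ℝ (fun h => G h x) h₀ (h - h₀))) := by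
    refine Eq.trans ?_ ((LinearMap.map_sub P _ _).trans
      (congrArg (fun z => z - P _) (LinearMap.map_sub P _ _))).symm
    refine congrArg (fun z => P (cmc (G h)) - P (cmc (G h₀)) - z) ?_
    have : cmc (fun x => fderiv ℝ (fun h => G h x) h₀ (h - h₀)) =
        ∑ i, (h - h₀) i • cmc (fun x => fderiv ℝ (fun h => G h x) h₀ (ee i)) := by
      ext x
      rw [ContinuousMap.sum_apply]
      simp only [ContinuousMap.smul_apply, cmc_coe (hdc h₀ _)]
      have hs := congrArg (fderiv ℝ (fun h => G h x) h₀) (sum_smul_ee (h - h₀))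
      rw [map_sum] at hs
      simp only [map_smul] at hs
      exact hs.symm
    rw [this, map_sum, ContinuousLinearMap.sum_apply]
    simp
  rw [e1]
  refine (hP _ (ε / (|C| + 1) * ‖h - h₀‖) (by positivity) fun x hx => ?_).trans ?_
  · simp only [ContinuousMap.sub_apply, cmc_coe (hGc _), cmc_coe (hdc h₀ _)]
    exact hh x (subset_closure hx)
  · rw [← mul_assoc]
    gcongr
    rw [mul_div_assoc', div_le_iff₀ hC1]
    nlinarith [le_abs_self C]

lemma slice_contDiff_nat {D : SmoothDomain n} (P : C(E, V) →ₗ[ℝ] Z) {C : ℝ}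
    (hP : ∀ f M, 0 ≤ M → (∀ x ∈ D.carrier, ‖f x‖ ≤ M) → ‖P f‖ ≤ C * M) (k : ℕ) :
    ∀ {G : E → E → V}, ContDiff ℝ (⊤ : ℕ∞) (Function.uncurry G) →
      ContDiff ℝ k (fun h => P (cmc (G h))) := by
  induction k with
  | zero =>
    intro G hG
    rw [Nat.cast_zero, contDiff_zero]
    exact continuous_iff_continuousAt.2 fun h =>
      (slice_hasFDeriv P hP (hG.of_le (by exact_mod_cast le_top)) h).continuousAt
  | succ k ih =>
    intro G hG
    have hd := fun h => slice_hasFDeriv P hP (hG.of_le (by exact_mod_cast le_top)) h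
    push_cast
    rw [contDiff_succ_iff_hasFDerivAt]
    refine ⟨_, ?_, hd⟩
    refine ContDiff.sum fun i _ => ?_
    have := ih (pd_contDiff hG (m := (⊤ : ℕ∞)) (by exact_mod_cast le_top) (ee i))
    exact contDiff_const.smulRight this

lemma slice_contDiff {D : SmoothDomain n} (P : C(E, V) →ₗ[ℝ] Z) {C : ℝ}
    (hP : ∀ f M, 0 ≤ M → (∀ x ∈ D.carrier, ‖f x‖ ≤ M) → ‖P f‖ ≤ C * M)
    {G : E → E → V} (hG : ContDiff ℝ (⊤ : ℕ∞) (Function.uncurry G)) :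
    ContDiff ℝ (⊤ : ℕ∞) (fun h => P (cmc (G h))) :=
  contDiff_infty.2 fun k => slice_contDiff_nat P hP k hG
end slice

end D0
end BNS

namespace BNS
open MeasureTheory Set Filter Topology
section D1
variable {n : ℕ}
local notation "E" => EuclideanSpace ℝ (Fin n)

/-- coordinate maps of the jet space -/
noncomputable def p1 : JJ n →L[ℝ] ℝ := WithLp.fstL 2 ℝ ℝ E
noncomputable def p2 : JJ n →L[ℝ] E := WithLp.sndL 2 ℝ ℝ E
noncomputable def i1 : ℝ →L[ℝ] JJ n :=
  ((WithLp.prodContinuousLinearEquiv 2 ℝ ℝ E).symm : ℝ × E →L[ℝ] JJ n).comp (ContinuousLinearMap.inl ℝ ℝ E)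
noncomputable def i2 : E →L[ℝ] JJ n :=
  ((WithLp.prodContinuousLinearEquiv 2 ℝ ℝ E).symm : ℝ × E →L[ℝ] JJ n).comp (ContinuousLinearMap.inr ℝ ℝ E)

lemma p1_i1 (a : ℝ) : p1 (n := n) (i1 a) = a := rfl
lemma p1_i2 (F : E) : p1 (n := n) (i2 F) = 0 := rfl
lemma p2_i1 (a : ℝ) : p2 (n := n) (i1 a) = 0 := rfl
lemma p2_i2 (F : E) : p2 (n := n) (i2 F) = F := rfl

lemma jj_inner (v w : JJ n) : inner ℝ v w = p1 v * p1 w + inner ℝ (p2 v) (p2 w) := by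
  rw [WithLp.prod_inner_apply]
  congr 1
  exact mul_comm _ _

lemma jj_ext {v w : JJ n} (h1 : p1 v = p1 w) (h2 : p2 v = p2 w) : v = w := by
  refine ext_inner_right ℝ fun z => ?_
  rw [jj_inner, jj_inner, h1, h2]

noncomputable def jf (φ : E → ℝ) (x : E) : JJ n := i1 (φ x) + i2 (gradient φ x)

lemma p1_jf (φ : E → ℝ) (x : E) : p1 (jf φ x) = φ x := by
  rw [jf, map_add, p1_i1, p1_i2, add_zero]
lemma p2_jf (φ : E → ℝ) (x : E) : p2 (jf φ x) = gradient φ x := by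
  rw [jf, map_add, p2_i1, p2_i2, zero_add]

lemma grad_eq (φ : E → ℝ) (x : E) :
    gradient φ x = (InnerProductSpace.toDual ℝ E).symm (fderiv ℝ φ x) := rfl

lemma grad_inner (φ : E → ℝ) (x v : E) : inner ℝ (gradient φ x) v = fderiv ℝ φ x v := by
  rw [grad_eq, InnerProductSpace.toDual_symm_apply]

lemma grad_norm (φ : E → ℝ) (x : E) : ‖gradient φ x‖ = ‖fderiv ℝ φ x‖ := by
  rw [grad_eq, LinearIsometryEquiv.norm_map]

lemma grad_cont {φ : E → ℝ} (hφ : ContDiff ℝ 1 φ) : Continuous (gradient φ) :=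
  (LinearIsometryEquiv.continuous _).comp (hφ.continuous_fderiv one_ne_zero)

lemma jf_cont {φ : E → ℝ} (hφ : ContDiff ℝ 1 φ) : Continuous (jf φ) :=
  (i1.continuous.comp hφ.continuous).add (i2.continuous.comp (grad_cont hφ))

noncomputable def jL (D : SmoothDomain n) (φ : E → ℝ) : Lsp D := lpL D (cmc (jf φ))

lemma jL_inner (D : SmoothDomain n) {φ ψ : E → ℝ} (hφ : ContDiff ℝ 1 φ) (hψ : ContDiff ℝ 1 ψ) :
    inner ℝ (jL D φ) (jL D ψ) =
      ∫ x in D.carrier, (φ x * ψ x + inner ℝ (gradient φ x) (gradient ψ x)) := by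
  rw [jL, jL, lpL_inner]
  simp only [cmc_coe (jf_cont hφ), cmc_coe (jf_cont hψ), jj_inner, p1_jf, p2_jf]

lemma cmc_add {V : Type*} [NormedAddCommGroup V] {f g : E → V} (hf : Continuous f) (hg : Continuous g) :
    cmc (f + g) = cmc f + cmc g := by
  ext x; simp [cmc_coe hf, cmc_coe hg, cmc_coe (hf.add hg)]

lemma cmc_smul {V : Type*} [NormedAddCommGroup V] [NormedSpace ℝ V] {f : E → V} (c : ℝ) (hf : Continuous f) :
    cmc (c • f) = c • cmc f := by
  ext x; simp [cmc_coe hf, cmc_coe (hf.const_smul c)]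

lemma jL_add (D : SmoothDomain n) {φ ψ : E → ℝ} (hφ : ContDiff ℝ 1 φ) (hψ : ContDiff ℝ 1 ψ) :
    jL D (φ + ψ) = jL D φ + jL D ψ := by
  rw [jL, jL, jL, ← map_add, ← cmc_add (jf_cont hφ) (jf_cont hψ)]
  congr 2
  ext1 x
  refine jj_ext ?_ ?_
  · rw [Pi.add_apply, map_add, p1_jf, p1_jf, p1_jf]; rfl
  · rw [Pi.add_apply, map_add, p2_jf, p2_jf, p2_jf, grad_eq, grad_eq, grad_eq, ← map_add]
    congr 1
    exact fderiv_add (hφ.differentiable one_ne_zero x) (hψ.differentiable one_ne_zero x)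

lemma jL_smul (D : SmoothDomain n) {φ : E → ℝ} (c : ℝ) (hφ : ContDiff ℝ 1 φ) :
    jL D (c • φ) = c • jL D φ := by
  rw [jL, jL, ← map_smul, ← cmc_smul c (jf_cont hφ)]
  congr 2
  ext1 x
  refine jj_ext ?_ ?_
  · rw [Pi.smul_apply, map_smul, p1_jf, p1_jf]; rfl
  · rw [Pi.smul_apply, map_smul, p2_jf, p2_jf, grad_eq, grad_eq, ← map_smul]
    congr 1
    exact fderiv_const_smul (hφ.differentiable one_ne_zero x) c

noncomputable def jets (D : SmoothDomain n) : Submodule ℝ (Lsp D) where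
  carrier := {f | ∃ φ : E → ℝ, ContDiff ℝ 1 φ ∧ jL D φ = f}
  zero_mem' := ⟨0, contDiff_const, by
    have := jL_smul D (0:ℝ) (φ := (0 : E → ℝ)) contDiff_const
    rw [smul_zero, zero_smul] at this; exact this⟩
  add_mem' := by
    rintro _ _ ⟨φ, hφ, rfl⟩ ⟨ψ, hψ, rfl⟩
    exact ⟨φ + ψ, hφ.add hψ, jL_add D hφ hψ⟩
  smul_mem' := by
    rintro c _ ⟨φ, hφ, rfl⟩
    exact ⟨c • φ, contDiff_const.smul hφ, jL_smul D c hφ⟩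

noncomputable def HH (D : SmoothDomain n) : Submodule ℝ (Lsp D) := (jets D).topologicalClosure

noncomputable instance (D : SmoothDomain n) : (HH D).HasOrthogonalProjection :=
  haveI : CompleteSpace (HH D) := (Submodule.isClosed_topologicalClosure _).completeSpace_coe
  inferInstance

lemma jL_mem (D : SmoothDomain n) {φ : E → ℝ} (hφ : ContDiff ℝ 1 φ) : jL D φ ∈ HH D :=
  (jets D).le_topologicalClosure ⟨φ, hφ, rfl⟩

lemma HH_seq {D : SmoothDomain n} {U : Lsp D} (hU : U ∈ HH D) :
    ∃ φ : ℕ → E → ℝ, (∀ k, ContDiff ℝ 1 (φ k)) ∧ Tendsto (fun k => jL D (φ k)) atTop (𝓝 U) := by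
  have : U ∈ closure (jets D : Set (Lsp D)) := hU
  obtain ⟨f, hf, hl⟩ := mem_closure_iff_seq_limit.1 this
  choose φ h1 h2 using hf
  exact ⟨φ, h1, by simpa only [h2] using hl⟩

/-- the projection `(a,F) ↦ (a,0)` -/
noncomputable def P0 (D : SmoothDomain n) : Lsp D →L[ℝ] Lsp D := mulL D (cmc fun _ => i1.comp p1)

lemma P0_lpL (D : SmoothDomain n) {f : E → JJ n} (hf : Continuous f) :
    P0 D (lpL D (cmc f)) = lpL D (cmc fun x => i1 (p1 (f x))) := by
  refine mulL_lpL D _ _ _ fun x _ => ?_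
  have hc : Continuous fun x => (i1 (p1 (f x)) : JJ n) := i1.continuous.comp (p1.continuous.comp hf)
  rw [cmc_coe hf, cmc_coe hc, cmc_coe continuous_const]
  rfl

lemma P0_jL (D : SmoothDomain n) {φ : E → ℝ} (hφ : ContDiff ℝ 1 φ) :
    P0 D (jL D φ) = lpL D (cmc fun x => i1 (φ x)) := by
  rw [jL, P0_lpL D (jf_cont hφ)]
  simp only [p1_jf]

lemma P0_inner (D : SmoothDomain n) {φ ψ : E → ℝ} (hφ : ContDiff ℝ 1 φ) (hψ : ContDiff ℝ 1 ψ) :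
    inner ℝ (P0 D (jL D φ)) (jL D ψ) = ∫ x in D.carrier, φ x * ψ x := by
  rw [P0_jL D hφ, jL, lpL_inner]
  refine setIntegral_congr_fun (meas_carrier D) fun x _ => ?_
  have hc : Continuous fun x => (i1 (φ x) : JJ n) := i1.continuous.comp hφ.continuous
  rw [cmc_coe (jf_cont hψ), cmc_coe hc]
  rw [jj_inner, p1_jf, p1_i1, p2_i1, inner_zero_left, add_zero]

lemma mulL_mulL (D : SmoothDomain n) {m m' : E → JJ n →L[ℝ] JJ n} (hm : Continuous m) (hm' : Continuous m')
    (f : Lsp D) : mulL D (cmc m) (mulL D (cmc m') f) = mulL D (cmc fun x => (m x).comp (m' x)) f := by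
  apply Lp.ext
  filter_upwards [mulL_coe D (cmc m) (mulL D (cmc m') f), mulL_coe D (cmc m') f,
    mulL_coe D (cmc fun x => (m x).comp (m' x)) f] with x h1 h2 h3
  rw [h1, h2, h3, cmc_coe hm, cmc_coe hm', cmc_coe (hm.clm_comp hm')]
  rfl

lemma mulL_one (D : SmoothDomain n) {m : E → JJ n →L[ℝ] JJ n} (hm : Continuous m)
    (h : ∀ x, m x = ContinuousLinearMap.id ℝ _) : mulL D (cmc m) = ContinuousLinearMap.id ℝ _ := by
  ext1 f
  apply Lp.ext
  filter_upwards [mulL_coe D (cmc m) f] with x h1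
  rw [h1, cmc_coe hm, h]; rfl

/-- adjoint as a continuous linear map -/
noncomputable def adj : (E →L[ℝ] E) →L[ℝ] (E →L[ℝ] E) :=
  LinearMap.mkContinuous
    { toFun := fun A => ContinuousLinearMap.adjoint A
      map_add' := fun A B => map_add _ A B
      map_smul' := fun c A => by rw [map_smulₛₗ]; rfl } 1 (fun A => by
        change ‖ContinuousLinearMap.adjoint A‖ ≤ 1 * ‖A‖
        rw [LinearIsometryEquiv.norm_map, one_mul])

lemma adj_inner (A : E →L[ℝ] E) (x y : E) : inner ℝ (adj A x) y = inner ℝ x (A y) :=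
  ContinuousLinearMap.adjoint_inner_left A y x

lemma contDiff_det : ContDiff ℝ (⊤ : ℕ∞) (fun A : E →L[ℝ] E => A.det) := by
  let b := (EuclideanSpace.basisFun (Fin n) ℝ).toBasis
  have : (fun A : E →L[ℝ] E => A.det) = fun A => ∑ σ : Equiv.Perm (Fin n),
      ((Equiv.Perm.sign σ : ℤ) : ℝ) * ∏ i, (A (b i)) (σ i) := by
    ext A
    change LinearMap.det (A : E →ₗ[ℝ] E) = _
    rw [← LinearMap.det_toMatrix b, Matrix.det_apply']
    refine Finset.sum_congr rfl fun σ _ => ?_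
    congr 1
    refine Finset.prod_congr rfl fun i _ => ?_
    rw [LinearMap.toMatrix_apply]
    rfl
  rw [this]
  refine ContDiff.sum fun σ _ => contDiff_const.mul (contDiff_prod fun i _ => ?_)
  have h1 : ContDiff ℝ (⊤ : ℕ∞) (fun A : E →L[ℝ] E => A (b i)) := contDiff_id.clm_apply contDiff_const
  exact (EuclideanSpace.proj (σ i) : E →L[ℝ] ℝ).contDiff.comp h1

structure FlowD (D : SmoothDomain n) where
  th : E → E → E
  ti : E → E → E
  sm : ContDiff ℝ (⊤ : ℕ∞) (Function.uncurry th)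
  smi : ∀ h, ContDiff ℝ (⊤ : ℕ∞) (ti h)
  left : ∀ h x, ti h (th h x) = x
  right : ∀ h x, th h (ti h x) = x
  zero : ∀ x, th 0 x = x
  pres : ∀ h x, th h x ∈ D.carrier ↔ x ∈ D.carrier

namespace FlowD
variable {D : SmoothDomain n} (F : FlowD D)

lemma sm1 (h : E) : ContDiff ℝ (⊤ : ℕ∞) (F.th h) :=
  F.sm.comp (contDiff_const.prodMk contDiff_id)

noncomputable def dx (h x : E) : E →L[ℝ] E := fderiv ℝ (F.th h) x

lemma dx_has (h x : E) : HasFDerivAt (F.th h) (F.dx h x) x :=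
  ((F.sm1 h).differentiable (by simp) x).hasFDerivAt

lemma dx_sm : ContDiff ℝ (⊤ : ℕ∞) (Function.uncurry F.dx) := by
  have : Function.uncurry F.dx = fun p : E × E => (fderiv ℝ (Function.uncurry F.th) p).comp
      (ContinuousLinearMap.inr ℝ E E) := by
    ext1 ⟨h, x⟩
    have h1 := (F.sm.differentiable (by simp) (h, x)).hasFDerivAt
    have := HasFDerivAt.comp (g := Function.uncurry F.th) (f := fun x => (h, x)) x h1
      (hasFDerivAt_prodMk_right h x)
    exact this.fderiv
  rw [this]
  exact (F.sm.fderiv_right (m := (⊤ : ℕ∞)) (by exact_mod_cast le_top)).clm_comp contDiff_const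

lemma dx_left (h x : E) : (fderiv ℝ (F.ti h) (F.th h x)).comp (F.dx h x) = ContinuousLinearMap.id ℝ E := by
  have h1 := (((F.smi h).differentiable (by simp) (F.th h x)).hasFDerivAt).comp x (F.dx_has h x)
  have h2 : F.ti h ∘ F.th h = id := funext fun x => F.left h x
  rw [h2] at h1
  exact h1.unique (hasFDerivAt_id x)

lemma dx_right (h x : E) : (F.dx h x).comp (fderiv ℝ (F.ti h) (F.th h x)) = ContinuousLinearMap.id ℝ E := by
  have h0 : HasFDerivAt (F.th h) (F.dx h x) (F.ti h (F.th h x)) := by rw [F.left]; exact F.dx_has h x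
  have h1 := h0.comp (F.th h x) (((F.smi h).differentiable (by simp) (F.th h x)).hasFDerivAt)
  have h2 : F.th h ∘ F.ti h = id := funext fun x => F.right h x
  rw [h2] at h1
  exact h1.unique (hasFDerivAt_id _)

noncomputable def eqv (h x : E) : E ≃L[ℝ] E :=
  ContinuousLinearEquiv.equivOfInverse (F.dx h x) (fderiv ℝ (F.ti h) (F.th h x))
    (fun v => DFunLike.congr_fun (F.dx_left h x) v) (fun v => DFunLike.congr_fun (F.dx_right h x) v)

noncomputable def ai (h x : E) : E →L[ℝ] E := ContinuousLinearMap.inverse (F.dx h x)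

lemma ai_eq (h x : E) : F.ai h x = ((F.eqv h x).symm : E →L[ℝ] E) :=
  ContinuousLinearMap.inverse_equiv (F.eqv h x)

lemma ai_left (h x v : E) : F.ai h x (F.dx h x v) = v := by
  rw [ai_eq]; exact (F.eqv h x).symm_apply_apply v

lemma ai_right (h x v : E) : F.dx h x (F.ai h x v) = v := by
  rw [ai_eq]; exact (F.eqv h x).apply_symm_apply v

lemma ai_sm : ContDiff ℝ (⊤ : ℕ∞) (Function.uncurry F.ai) := by
  rw [contDiff_iff_contDiffAt]
  rintro ⟨h, x⟩
  have h1 : ContDiffAt ℝ (⊤ : ℕ∞) ContinuousLinearMap.inverse (F.dx h x) :=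
    contDiffAt_map_inverse (F.eqv h x)
  exact ContDiffAt.comp (g := ContinuousLinearMap.inverse) (f := Function.uncurry F.dx) (h, x) h1
    F.dx_sm.contDiffAt

noncomputable def jd (h x : E) : ℝ := |(F.dx h x).det|

lemma det_ne (h x : E) : (F.dx h x).det ≠ 0 := by
  have := (F.eqv h x).toLinearEquiv.isUnit_det'
  exact this.ne_zero

lemma jd_pos (h x : E) : 0 < F.jd h x := abs_pos.2 (F.det_ne h x)

lemma jd_sm : ContDiff ℝ (⊤ : ℕ∞) (Function.uncurry F.jd) := by
  rw [contDiff_iff_contDiffAt]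
  rintro ⟨h, x⟩
  have h1 : ContDiffAt ℝ (⊤ : ℕ∞) (fun p : E × E => (F.dx p.1 p.2).det) (h, x) :=
    (contDiff_det.comp F.dx_sm).contDiffAt
  exact (contDiffAt_abs (F.det_ne h x)).comp (h, x) h1

lemma cv (h : E) (g : E → ℝ) : ∫ x in D.carrier, g x = ∫ x in D.carrier, F.jd h x * g (F.th h x) := by
  have h1 : F.th h '' D.carrier = D.carrier := by
    ext y; constructor
    · rintro ⟨x, hx, rfl⟩; exact (F.pres h x).2 hx
    · intro hy
      exact ⟨F.ti h y, (F.pres h _).1 (by rwa [F.right]), F.right h y⟩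
  have h2 := integral_image_eq_integral_abs_det_fderiv_smul volume (meas_carrier D)
    (fun x _ => (F.dx_has h x).hasFDerivWithinAt)
    (fun x _ y _ hxy => by rw [← F.left h x, hxy, F.left]) g
  rw [h1] at h2
  exact h2

lemma comp_cd {φ : E → ℝ} (hφ : ContDiff ℝ 1 φ) (h : E) : ContDiff ℝ 1 (φ ∘ F.th h) :=
  hφ.comp ((F.sm1 h).of_le (by exact_mod_cast le_top))

lemma grad_comp {φ : E → ℝ} (hφ : ContDiff ℝ 1 φ) (h x : E) :
    gradient (φ ∘ F.th h) x = adj (F.dx h x) (gradient φ (F.th h x)) := by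
  refine ext_inner_right ℝ fun v => ?_
  rw [grad_inner, adj_inner, grad_inner,
    fderiv_comp x (hφ.differentiable one_ne_zero _) (F.dx_has h x).differentiableAt]
  rfl

/-- the multiplier of the transported form -/
noncomputable def bf (h x : E) : JJ n →L[ℝ] JJ n :=
  F.jd h x • (i1.comp p1 + i2.comp (((F.ai h x).comp (adj (F.ai h x))).comp p2))

lemma bf_sm : ContDiff ℝ (⊤ : ℕ∞) (Function.uncurry F.bf) := by
  refine F.jd_sm.smul (contDiff_const.add ?_)
  refine contDiff_const.clm_comp (ContDiff.clm_comp ?_ contDiff_const)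
  exact F.ai_sm.clm_comp (adj.contDiff.comp F.ai_sm)

noncomputable def jm (h x : E) : JJ n →L[ℝ] JJ n := F.jd h x • (i1.comp p1)

lemma jm_sm : ContDiff ℝ (⊤ : ℕ∞) (Function.uncurry F.jm) := F.jd_sm.smul contDiff_const

lemma adj_ai (h x v : E) : adj (F.ai h x) (adj (F.dx h x) v) = v := by
  refine ext_inner_right ℝ fun w => ?_
  rw [adj_inner, adj_inner, ai_right]

lemma bf_inner {φ ψ : E → ℝ} (hφ : ContDiff ℝ 1 φ) (hψ : ContDiff ℝ 1 ψ) (h x : E) :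
    inner ℝ (F.bf h x (jf (φ ∘ F.th h) x)) (jf (ψ ∘ F.th h) x) =
      F.jd h x * inner ℝ (jf φ (F.th h x)) (jf ψ (F.th h x)) := by
  have e : F.bf h x (jf (φ ∘ F.th h) x) = F.jd h x • (i1 (φ (F.th h x)) +
      i2 (F.ai h x (gradient φ (F.th h x)))) := by
    rw [bf, smul_apply, add_apply]
    simp only [ContinuousLinearMap.comp_apply, p1_jf, p2_jf, F.grad_comp hφ, adj_ai, Function.comp_apply]
  rw [e, inner_smul_left, jj_inner, jj_inner]
  simp only [map_add, p1_i1, p1_i2, p2_i1, p2_i2, p1_jf, p2_jf, F.grad_comp hψ, add_zero, zero_add,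
    Function.comp_apply]
  rw [real_inner_comm, adj_inner, ai_right, real_inner_comm]
  simp

lemma jm_inner (φ : E → ℝ) (ψ : E → ℝ) (h x : E) :
    inner ℝ (F.jm h x (jf (φ ∘ F.th h) x)) (jf (ψ ∘ F.th h) x) =
      F.jd h x * (φ (F.th h x) * ψ (F.th h x)) := by
  rw [jm, smul_apply, inner_smul_left, jj_inner]
  simp [p1_jf, p1_i1, p2_i1]

end FlowD
end D1
end BNS

namespace BNS
open MeasureTheory Set Filter Topology
section D1b
variable {n : ℕ}
local notation "E" => EuclideanSpace ℝ (Fin n)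

lemma jL_norm_sq (D : SmoothDomain n) {φ : E → ℝ} (hφ : ContDiff ℝ 1 φ) :
    ‖jL D φ‖ ^ 2 = ∫ x in D.carrier, ‖jf φ x‖ ^ 2 := by
  rw [← real_inner_self_eq_norm_sq, jL, lpL_inner]
  simp only [cmc_coe (jf_cont hφ), real_inner_self_eq_norm_sq]

lemma jj_norm (v : JJ n) : ‖v‖ ^ 2 = p1 v ^ 2 + ‖p2 v‖ ^ 2 := by
  rw [← real_inner_self_eq_norm_sq, jj_inner, real_inner_self_eq_norm_sq]; ring

lemma jL_sub (D : SmoothDomain n) {φ ψ : E → ℝ} (hφ : ContDiff ℝ 1 φ) (hψ : ContDiff ℝ 1 ψ) :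
    jL D (φ - ψ) = jL D φ - jL D ψ := by
  have h3 : ContDiff ℝ 1 ((-1:ℝ) • ψ) := contDiff_const.smul hψ
  have h := jL_add D hφ h3
  have h2 := jL_smul D (-1:ℝ) hψ
  have e : φ - ψ = φ + (-1:ℝ) • ψ := by ext x; simp [sub_eq_add_neg]
  rw [e, h, h2]
  simp [sub_eq_add_neg]

namespace FlowD
variable {D : SmoothDomain n} (F : FlowD D)

lemma orbit_bound : ∃ C, 0 ≤ C ∧ ∀ h ∈ Metric.ball (0 : E) 1, ∀ φ : E → ℝ, ContDiff ℝ 1 φ →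
    ‖jL D (φ ∘ F.th h)‖ ≤ C * ‖jL D φ‖ := by
  have hc : Continuous (fun p : E × E => (1 + ‖adj (F.dx p.1 p.2)‖ ^ 2) / F.jd p.1 p.2) := by
    refine Continuous.div ?_ F.jd_sm.continuous fun p => (F.jd_pos p.1 p.2).ne'
    exact continuous_const.add ((adj.continuous.comp F.dx_sm.continuous).norm.pow 2)
  obtain ⟨K, hK⟩ := ((isCompact_closedBall (0 : E) 1).prod (compact_clos D)).exists_bound_of_continuousOn
    hc.continuousOn
  refine ⟨√(max K 0), Real.sqrt_nonneg _, fun h hh φ hφ => ?_⟩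
  refine abs_le_of_sq_le_sq' ?_ (by positivity) |>.2
  rw [mul_pow, Real.sq_sqrt (le_max_right _ _), jL_norm_sq D (F.comp_cd hφ h), jL_norm_sq D hφ,
    F.cv h (fun y => ‖jf φ y‖ ^ 2), ← integral_const_mul]
  have c1 : Continuous (fun x => ‖jf (φ ∘ F.th h) x‖ ^ 2) := (jf_cont (F.comp_cd hφ h)).norm.pow 2
  have c2 : Continuous (fun x => max K 0 * (F.jd h x * ‖jf φ (F.th h x)‖ ^ 2)) :=
    continuous_const.mul ((slice_cont F.jd_sm h).mul
      (((jf_cont hφ).comp (F.sm1 h).continuous).norm.pow 2))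
  refine setIntegral_mono_on (cont_intOn D c1.continuousOn) (cont_intOn D c2.continuousOn)
    (meas_carrier D) fun x hx => ?_
  have hk := hK (h, x) ⟨Metric.ball_subset_closedBall hh, subset_closure hx⟩
  have hj := F.jd_pos h x
  have hk2 : 1 + ‖adj (F.dx h x)‖ ^ 2 ≤ max K 0 * F.jd h x := by
    have := (le_abs_self _).trans (hk.trans (le_max_left K 0))
    rwa [div_le_iff₀ hj] at this
  rw [jj_norm, jj_norm, p1_jf, p1_jf, p2_jf, p2_jf, F.grad_comp hφ, ← mul_assoc]
  have h3 := (adj (F.dx h x)).le_opNorm (gradient φ (F.th h x))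
  have h4 : ‖adj (F.dx h x) (gradient φ (F.th h x))‖ ^ 2 ≤
      ‖adj (F.dx h x)‖ ^ 2 * ‖gradient φ (F.th h x)‖ ^ 2 := by
    rw [← mul_pow]; gcongr
  have h5 := mul_le_mul_of_nonneg_right hk2
    (show 0 ≤ φ (F.th h x) ^ 2 + ‖gradient φ (F.th h x)‖ ^ 2 by positivity)
  refine le_trans ?_ h5
  simp only [Function.comp_apply]
  nlinarith [mul_nonneg (sq_nonneg ‖adj (F.dx h x)‖) (sq_nonneg (φ (F.th h x))),
    sq_nonneg ‖gradient φ (F.th h x)‖]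

noncomputable def Bh (h : E) : Lsp D →L[ℝ] Lsp D := mulL D (cmc (F.bf h))
noncomputable def Jh (h : E) : Lsp D →L[ℝ] Lsp D := mulL D (cmc (F.jm h))

lemma mulL_hP (D : SmoothDomain n) : ∀ (f : C(E, JJ n →L[ℝ] JJ n)) (M : ℝ), 0 ≤ M →
    (∀ x ∈ D.carrier, ‖f x‖ ≤ M) → ‖mulL D f‖ ≤ 1 * M := fun f M h0 h => by
  rw [one_mul]; exact mulL_bound D f h h0

lemma Bh_sm : ContDiff ℝ (⊤ : ℕ∞) F.Bh := slice_contDiff (mulL D) (mulL_hP D) F.bf_sm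
lemma Jh_sm : ContDiff ℝ (⊤ : ℕ∞) F.Jh := slice_contDiff (mulL D) (mulL_hP D) F.jm_sm

lemma mulL_jL {m : E → JJ n →L[ℝ] JJ n} (hm : Continuous m) {f : E → JJ n} (hf : Continuous f) :
    mulL D (cmc m) (lpL D (cmc f)) = lpL D (cmc fun x => m x (f x)) := by
  refine mulL_lpL D _ _ _ fun x _ => ?_
  rw [cmc_coe hm, cmc_coe hf, cmc_coe (hm.clm_apply hf)]

lemma Bh_inner {φ ψ : E → ℝ} (hφ : ContDiff ℝ 1 φ) (hψ : ContDiff ℝ 1 ψ) (h : E) :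
    inner ℝ (F.Bh h (jL D (φ ∘ F.th h))) (jL D (ψ ∘ F.th h)) = inner ℝ (jL D φ) (jL D ψ) := by
  have c1 := slice_cont F.bf_sm h
  have c2 := jf_cont (F.comp_cd hφ h)
  rw [Bh, jL, jL, mulL_jL c1 c2, lpL_inner, jL, jL, lpL_inner,
    F.cv h (fun y => inner ℝ (cmc (jf φ) y) (cmc (jf ψ) y))]
  simp only [cmc_coe (c1.clm_apply c2), cmc_coe (jf_cont hφ), cmc_coe (jf_cont hψ),
    cmc_coe (jf_cont (F.comp_cd hψ h)), F.bf_inner hφ hψ]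

lemma Jh_inner {φ ψ : E → ℝ} (hφ : ContDiff ℝ 1 φ) (hψ : ContDiff ℝ 1 ψ) (h : E) :
    inner ℝ (F.Jh h (jL D (φ ∘ F.th h))) (jL D (ψ ∘ F.th h)) = inner ℝ (P0 D (jL D φ)) (jL D ψ) := by
  have c1 := slice_cont F.jm_sm h
  have c2 := jf_cont (F.comp_cd hφ h)
  rw [P0_inner D hφ hψ, Jh, jL, jL, mulL_jL c1 c2, lpL_inner,
    F.cv h (fun y => φ y * ψ y)]
  simp only [cmc_coe (c1.clm_apply c2), cmc_coe (jf_cont (F.comp_cd hψ h)), F.jm_inner]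

lemma ti_comp {ψ : E → ℝ} (h : E) : (ψ ∘ F.ti h) ∘ F.th h = ψ := by
  ext x; simp [F.left]

lemma ti_cd {ψ : E → ℝ} (hψ : ContDiff ℝ 1 ψ) (h : E) : ContDiff ℝ 1 (ψ ∘ F.ti h) :=
  hψ.comp ((F.smi h).of_le (by exact_mod_cast le_top))

lemma Jh_P0 (h : E) (f : Lsp D) : F.Jh h (P0 D f) = F.Jh h f := by
  rw [Jh, P0, mulL_mulL D (slice_cont F.jm_sm h) continuous_const]
  congr 3

lemma dx_zero (x : E) : F.dx 0 x = ContinuousLinearMap.id ℝ E := by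
  have : F.th 0 = id := funext F.zero
  rw [dx, this, fderiv_id]

lemma bf_zero (x : E) : F.bf 0 x = ContinuousLinearMap.id ℝ _ := by
  have h1 : F.jd 0 x = 1 := by
    rw [jd, F.dx_zero]
    have : (ContinuousLinearMap.id ℝ E).det = 1 := LinearMap.det_id
    rw [this, abs_one]
  have h2 : ∀ v, F.ai 0 x v = v := fun v => by
    have := F.ai_left 0 x v
    rwa [F.dx_zero] at this
  have h3 : ∀ v, adj (F.ai 0 x) v = v := fun v => by
    refine ext_inner_right ℝ fun w => ?_
    rw [adj_inner, h2]
  ext1 v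
  rw [bf, h1, one_smul]
  refine jj_ext ?_ ?_
  · simp [p1_i1, p1_i2]
  · simp [p2_i1, p2_i2, h2, h3]

lemma Bh_zero : F.Bh 0 = ContinuousLinearMap.id ℝ _ :=
  mulL_one D (slice_cont F.bf_sm 0) F.bf_zero

/-- velocity field pulled back -/
noncomputable def yf (i : Fin n) (h x : E) : E := F.ai h x (fderiv ℝ (fun h => F.th h x) h (ee i))

lemma yf_sm (i : Fin n) : ContDiff ℝ (⊤ : ℕ∞) (Function.uncurry (F.yf i)) :=
  F.ai_sm.clm_apply (pd_contDiff F.sm (m := (⊤ : ℕ∞)) (by exact_mod_cast le_top) (ee i))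

noncomputable def wf (i : Fin n) (h x : E) : JJ n →L[ℝ] JJ n :=
  i1.comp ((innerSL ℝ (F.yf i h x)).comp p2)

lemma wf_sm (i : Fin n) : ContDiff ℝ (⊤ : ℕ∞) (Function.uncurry (F.wf i)) :=
  contDiff_const.clm_comp (((innerSL ℝ).contDiff.comp (F.yf_sm i)).clm_comp contDiff_const)

noncomputable def Wh (i : Fin n) (h : E) : Lsp D →L[ℝ] Lsp D := mulL D (cmc (F.wf i h))
lemma Wh_sm (i : Fin n) : ContDiff ℝ (⊤ : ℕ∞) (F.Wh i) :=
  slice_contDiff (mulL D) (mulL_hP D) (F.wf_sm i)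

noncomputable def Wc (h : E) : Lsp D →L[ℝ] (E →L[ℝ] Lsp D) :=
  ∑ i, (ContinuousLinearMap.smulRightL ℝ E (Lsp D) (EuclideanSpace.proj i : E →L[ℝ] ℝ)).comp (F.Wh i h)

lemma Wc_sm : ContDiff ℝ (⊤ : ℕ∞) F.Wc :=
  ContDiff.sum fun i _ => contDiff_const.clm_comp (F.Wh_sm i)

lemma Wc_apply (h : E) (f : Lsp D) : F.Wc h f =
    ∑ i, (EuclideanSpace.proj i : E →L[ℝ] ℝ).smulRight (F.Wh i h f) := by
  simp [Wc, _root_.sum_apply]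

lemma lpL_hP (D : SmoothDomain n) : ∀ (f : C(E, JJ n)) (M : ℝ), 0 ≤ M →
    (∀ x ∈ D.carrier, ‖f x‖ ≤ M) → ‖lpL D f‖ ≤ √(volume.real D.carrier) * M := fun f _ h0 h =>
  lpL_bound D f h h0

lemma orbit_jet_key {φ : E → ℝ} (hφ : ContDiff ℝ 1 φ) (h : E) (i : Fin n) :
    F.Wh i h (jL D (φ ∘ F.th h)) =
      lpL D (cmc fun x => fderiv ℝ (fun h => (i1 (φ (F.th h x)) : JJ n)) h (ee i)) := by
  rw [Wh, jL, mulL_jL (slice_cont (F.wf_sm i) h) (jf_cont (F.comp_cd hφ h))]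
  congr 2
  ext1 x
  have hθ : DifferentiableAt ℝ (fun h => F.th h x) h :=
    (F.sm.comp (contDiff_id.prodMk contDiff_const)).differentiable (by simp) h
  have h2 : HasFDerivAt (fun h => (i1 (φ (F.th h x)) : JJ n)) (i1.comp ((fderiv ℝ φ (F.th h x)).comp
      (fderiv ℝ (fun h => F.th h x) h))) h :=
    i1.hasFDerivAt.comp h (((hφ.differentiable one_ne_zero _).hasFDerivAt).comp h hθ.hasFDerivAt)
  rw [h2.fderiv]
  simp only [wf, ContinuousLinearMap.comp_apply, p2_jf, innerSL_apply_apply]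
  congr 1
  rw [real_inner_comm, F.grad_comp hφ, adj_inner, yf, F.ai_right, grad_inner]

set_option maxHeartbeats 1000000 in
lemma orbit_jet_deriv {φ : E → ℝ} (hφ : ContDiff ℝ 1 φ) (h : E) :
    HasFDerivAt (fun h => P0 D (jL D (φ ∘ F.th h))) (F.Wc h (jL D (φ ∘ F.th h))) h := by
  have hG : ContDiff ℝ 1 (Function.uncurry fun h x => (i1 (φ (F.th h x)) : JJ n)) :=
    i1.contDiff.comp (hφ.comp (F.sm.of_le (by exact_mod_cast le_top)))
  have h1 : HasFDerivAt (fun h => lpL D (cmc fun x => i1 (φ (F.th h x)))) (∑ i, (EuclideanSpace.proj i : E →L[ℝ] ℝ).smulRight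
      (lpL D (cmc fun x => fderiv ℝ (fun h => (i1 (φ (F.th h x)) : JJ n)) h (ee i)))) h :=
    slice_hasFDeriv (lpL D) (lpL_hP D) hG h
  have e2 : F.Wc h (jL D (φ ∘ F.th h)) = ∑ i, (EuclideanSpace.proj i : E →L[ℝ] ℝ).smulRight
      (lpL D (cmc fun x => fderiv ℝ (fun h => (i1 (φ (F.th h x)) : JJ n)) h (ee i))) := by
    rw [Wc_apply]
    refine Finset.sum_congr rfl fun i _ => ?_
    rw [F.orbit_jet_key hφ h i]
  rw [e2]
  exact h1.congr_of_eventuallyEq (Eventually.of_forall fun h => P0_jL D (F.comp_cd hφ h))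

set_option maxHeartbeats 1000000 in
/-- The orbit of a weak solution is smooth. -/
theorem orbit {U : Lsp D} (hU : U ∈ HH D) {σ : ℝ}
    (hE : ∀ ψ : E → ℝ, ContDiff ℝ 1 ψ → inner ℝ U (jL D ψ) = σ * inner ℝ (P0 D U) (jL D ψ)) :
    ∃ δ > 0, ∃ N : E → Lsp D, ContDiffOn ℝ (⊤ : ℕ∞) N (Metric.ball 0 δ) ∧ N 0 = U ∧
      (∀ h ∈ Metric.ball (0 : E) δ, N h ∈ HH D) ∧
      ∀ h ∈ Metric.ball (0 : E) δ, HasFDerivAt (fun h => P0 D (N h)) (F.Wc h (N h)) h := by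
  obtain ⟨φ, hφ, hlim⟩ := HH_seq hU
  obtain ⟨C, hC0, hC⟩ := F.orbit_bound
  have hdiff : ∀ k l, ∀ h ∈ Metric.ball (0 : E) 1,
      ‖jL D (φ k ∘ F.th h) - jL D (φ l ∘ F.th h)‖ ≤ C * ‖jL D (φ k) - jL D (φ l)‖ := by
    intro k l h hh
    have h1 := hC h hh (φ k - φ l) ((hφ k).sub (hφ l))
    have h2 : (φ k - φ l) ∘ F.th h = φ k ∘ F.th h - φ l ∘ F.th h := rfl
    rw [h2, jL_sub D (F.comp_cd (hφ k) h) (F.comp_cd (hφ l) h), jL_sub D (hφ k) (hφ l)] at h1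
    exact h1
  have hex : ∀ h : E, ∃ f : Lsp D, h ∈ Metric.ball (0 : E) 1 →
      Tendsto (fun k => jL D (φ k ∘ F.th h)) atTop (𝓝 f) := by
    intro h
    by_cases hh : h ∈ Metric.ball (0 : E) 1
    · have hcs := hlim.cauchySeq
      have : CauchySeq (fun k => jL D (φ k ∘ F.th h)) := by
        rw [Metric.cauchySeq_iff] at hcs ⊢
        intro ε hε
        obtain ⟨K, hK⟩ := hcs (ε / (C + 1)) (by positivity)
        refine ⟨K, fun k hk l hl => ?_⟩
        have h1 := hK k hk l hl
        rw [dist_eq_norm] at h1 ⊢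
        refine (hdiff k l h hh).trans_lt ?_
        rw [lt_div_iff₀ (by positivity)] at h1
        nlinarith [norm_nonneg (jL D (φ k) - jL D (φ l))]
      obtain ⟨f, hf⟩ := cauchySeq_tendsto_of_complete this
      exact ⟨f, fun _ => hf⟩
    · exact ⟨0, fun h => absurd h hh⟩
  choose N hN using hex
  have hNb : ∀ k, ∀ h ∈ Metric.ball (0 : E) 1,
      ‖N h - jL D (φ k ∘ F.th h)‖ ≤ C * ‖U - jL D (φ k)‖ := by
    intro k h hh
    refine le_of_tendsto_of_tendsto' ((hN h hh).sub_const _).norm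
      (((hlim.sub_const _).norm).const_mul C) fun l => hdiff l k h hh
  have hNH : ∀ h ∈ Metric.ball (0 : E) 1, N h ∈ HH D := fun h hh =>
    (Submodule.isClosed_topologicalClosure (jets D)).mem_of_tendsto (hN h hh)
      (Eventually.of_forall fun k => jL_mem D (F.comp_cd (hφ k) h))
  have h01 : (0 : E) ∈ Metric.ball (0 : E) 1 := Metric.mem_ball_self one_pos
  have hN0 : N 0 = U := by
    refine tendsto_nhds_unique (hN 0 h01) ?_
    have : ∀ k, φ k ∘ F.th 0 = φ k := fun k => by ext x; simp [F.zero]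
    simpa only [this] using hlim
  -- equation
  have heq : ∀ h ∈ Metric.ball (0 : E) 1, ∀ ψ : E → ℝ, ContDiff ℝ 1 ψ →
      inner ℝ (F.Bh h (N h)) (jL D ψ) = σ * inner ℝ (F.Jh h (N h)) (jL D ψ) := by
    intro h hh ψ hψ
    have hψ' := F.ti_cd hψ h
    have l1 : Tendsto (fun k => inner ℝ (F.Bh h (jL D (φ k ∘ F.th h))) (jL D ψ)) atTop
        (𝓝 (inner ℝ (F.Bh h (N h)) (jL D ψ))) :=
      (((F.Bh h).continuous.tendsto _).comp (hN h hh)).inner tendsto_const_nhds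
    have l2 : Tendsto (fun k => inner ℝ (F.Jh h (jL D (φ k ∘ F.th h))) (jL D ψ)) atTop
        (𝓝 (inner ℝ (F.Jh h (N h)) (jL D ψ))) :=
      (((F.Jh h).continuous.tendsto _).comp (hN h hh)).inner tendsto_const_nhds
    have e1 : ∀ k, inner ℝ (F.Bh h (jL D (φ k ∘ F.th h))) (jL D ψ) =
        inner ℝ (jL D (φ k)) (jL D (ψ ∘ F.ti h)) := fun k => by
      rw [← F.Bh_inner (hφ k) hψ' h, F.ti_comp]
    have e2 : ∀ k, inner ℝ (F.Jh h (jL D (φ k ∘ F.th h))) (jL D ψ) =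
        inner ℝ (P0 D (jL D (φ k))) (jL D (ψ ∘ F.ti h)) := fun k => by
      rw [← F.Jh_inner (hφ k) hψ' h, F.ti_comp]
    simp only [e1] at l1
    simp only [e2] at l2
    have m1 := tendsto_nhds_unique l1 (hlim.inner tendsto_const_nhds)
    have m2 := tendsto_nhds_unique l2 ((((P0 D).continuous.tendsto _).comp hlim).inner tendsto_const_nhds)
    rw [m1, m2, hE _ hψ']
  set Q : Lsp D →L[ℝ] Lsp D := (HH D).starProjection with hQ
  have hproj : ∀ f g : Lsp D, (∀ ψ : E → ℝ, ContDiff ℝ 1 ψ → inner ℝ f (jL D ψ) = inner ℝ g (jL D ψ)) →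
      Q f = Q g := by
    intro f g hfg
    rw [← sub_eq_zero, ← map_sub, hQ, Submodule.starProjection_apply_eq_zero_iff,
      Submodule.mem_orthogonal']
    intro u hu
    obtain ⟨ψ, hψ, hl⟩ := HH_seq hu
    refine tendsto_nhds_unique ((tendsto_const_nhds (x := f - g)).inner hl) ?_
    have : ∀ k, inner ℝ (f - g) (jL D (ψ k)) = 0 := fun k => by
      rw [inner_sub_left, hfg _ (hψ k), sub_self]
    simp only [this]
    exact tendsto_const_nhds
  have hQN : ∀ h ∈ Metric.ball (0 : E) 1, Q (N h) = N h := fun h hh =>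
    Submodule.starProjection_eq_self_iff.2 (hNH h hh)
  let S : E → (Lsp D →L[ℝ] Lsp D) := fun h => Q * F.Bh h * Q + (1 - Q)
  have hS : ContDiff ℝ (⊤ : ℕ∞) S :=
    ((contDiff_const.mul F.Bh_sm).mul contDiff_const).add contDiff_const
  have hS0 : S 0 = 1 := by
    have : Q * F.Bh 0 * Q = Q := by
      rw [F.Bh_zero]
      exact (HH D).isIdempotentElem_starProjection
    simp only [S, this]; abel
  have hunit : ∀ᶠ h in 𝓝 (0 : E), IsUnit (S h) := by
    refine hS.continuous.continuousAt.eventually_mem (Units.isOpen.mem_nhds ?_)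
    change IsUnit (S 0)
    rw [hS0]; exact isUnit_one
  obtain ⟨δ₀, hδ₀, hball⟩ := Metric.eventually_nhds_iff_ball.1 hunit
  set δ := min δ₀ 1 with hδ
  have hδpos : 0 < δ := lt_min hδ₀ one_pos
  have hs1 : Metric.ball (0 : E) δ ⊆ Metric.ball 0 1 := Metric.ball_subset_ball (min_le_right _ _)
  have hs0 : Metric.ball (0 : E) δ ⊆ Metric.ball 0 δ₀ := Metric.ball_subset_ball (min_le_left _ _)
  let R : E → (Lsp D →L[ℝ] Lsp D) := fun h => Ring.inverse (S h) * (σ • (Q * F.Jh h))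
  have hR : ContDiffOn ℝ (⊤ : ℕ∞) R (Metric.ball 0 δ) := by
    have hJ : ContDiff ℝ (⊤ : ℕ∞) (fun h => Q * F.Jh h) := contDiff_const.mul F.Jh_sm
    have hJ2 : ContDiff ℝ (⊤ : ℕ∞) (fun h => σ • (Q * F.Jh h)) := hJ.const_smul σ
    refine ContDiffOn.mul ?_ hJ2.contDiffOn
    intro h hh
    obtain ⟨u, hu⟩ := hball h (hs0 hh)
    have h1 : ContDiffAt ℝ (⊤ : ℕ∞) Ring.inverse (S h) := by
      rw [← hu]; exact contDiffAt_ringInverse ℝ u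
    exact (h1.comp h hS.contDiffAt).contDiffWithinAt
  have hNR : ∀ h ∈ Metric.ball (0 : E) δ, N h = R h (P0 D (N h)) := by
    intro h hh
    have h1 : S h (N h) = σ • Q (F.Jh h (N h)) := by
      have e1 : S h (N h) = Q (F.Bh h (Q (N h))) + (N h - Q (N h)) := rfl
      rw [e1, hQN h (hs1 hh), sub_self, add_zero, ← map_smul]
      refine hproj _ _ fun ψ hψ => ?_
      rw [heq h (hs1 hh) ψ hψ, real_inner_smul_left]
    have e2 : R h (P0 D (N h)) = Ring.inverse (S h) (σ • Q (F.Jh h (P0 D (N h)))) := rfl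
    rw [e2, F.Jh_P0, ← h1]
    have := Ring.inverse_mul_cancel (S h) (hball h (hs0 hh))
    exact (DFunLike.congr_fun this (N h)).symm
  -- derivative of P0 N
  have hder : ∀ h ∈ Metric.ball (0 : E) δ, HasFDerivAt (fun h => P0 D (N h)) (F.Wc h (N h)) h := by
    intro h hh
    refine hasFDerivAt_of_tendstoUniformlyOn (f := fun k h => P0 D (jL D (φ k ∘ F.th h)))
      (f' := fun k h => F.Wc h (jL D (φ k ∘ F.th h))) (g' := fun h => F.Wc h (N h)) (l := atTop)
      Metric.isOpen_ball ?_ (fun k h _ => F.orbit_jet_deriv (hφ k) h)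
      (fun h hh => ((P0 D).continuous.tendsto _).comp (hN h (hs1 hh))) hh
    obtain ⟨K, hK⟩ := (isCompact_closedBall (0 : E) 1).exists_bound_of_continuousOn
      (f := F.Wc) F.Wc_sm.continuous.continuousOn
    rw [Metric.tendstoUniformlyOn_iff]
    intro ε hε
    have hK0 : 0 ≤ K := (norm_nonneg _).trans (hK 0 (Metric.mem_closedBall_self zero_le_one))
    have l3 : Tendsto (fun k => K * (C * ‖U - jL D (φ k)‖)) atTop (𝓝 0) := by
      have := ((((tendsto_const_nhds (x := U)).sub hlim).norm).const_mul C).const_mul K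
      simpa using this
    filter_upwards [l3.eventually_lt_const hε] with k hk h hh
    rw [dist_eq_norm, ← map_sub]
    refine lt_of_le_of_lt (((F.Wc h).le_opNorm _).trans ?_) hk
    gcongr
    · exact hK h (Metric.ball_subset_closedBall (hs1 hh))
    · exact hNb k h (hs1 hh)
  have hboot : ∀ k : ℕ, ContDiffOn ℝ k (fun h => P0 D (N h)) (Metric.ball 0 δ) := by
    intro k
    induction k with
    | zero =>
      rw [Nat.cast_zero, contDiffOn_zero]
      exact fun h hh => (hder h hh).continuousAt.continuousWithinAt
    | succ k ih =>
      push_cast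
      rw [contDiffOn_succ_iff_fderiv_of_isOpen Metric.isOpen_ball]
      refine ⟨fun h hh => (hder h hh).differentiableAt.differentiableWithinAt, by simp, ?_⟩
      have hNk : ContDiffOn ℝ k N (Metric.ball 0 δ) :=
        ((hR.of_le (by exact_mod_cast le_top)).clm_apply ih).congr hNR
      refine ContDiffOn.congr ?_ fun h hh => (hder h hh).fderiv
      exact (F.Wc_sm.contDiffOn.of_le (by exact_mod_cast le_top)).clm_apply hNk
  refine ⟨δ, hδpos, N, ?_, hN0, fun h hh => hNH h (hs1 hh), hder⟩
  rw [contDiffOn_infty]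
  intro k
  exact ((hR.of_le (by exact_mod_cast le_top)).clm_apply (hboot k)).congr hNR

end FlowD
end D1b
end BNS

namespace BNS
open MeasureTheory Set Filter Topology
section D2
variable {n : ℕ}
local notation "E" => EuclideanSpace ℝ (Fin n)

lemma pert_inv {p : E → E} (hp : ContDiff ℝ (⊤ : ℕ∞) p) (hb : ∀ x, ‖fderiv ℝ p x‖ ≤ 1 / 2) :
    ∃ g : E → E, ContDiff ℝ (⊤ : ℕ∞) g ∧ (∀ x, g (x + p x) = x) ∧ ∀ y, g y + p (g y) = y := by
  have hpd : Differentiable ℝ p := hp.differentiable (by simp)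
  let f : E → E := fun x => x + p x
  have hf : ContDiff ℝ (⊤ : ℕ∞) f := contDiff_id.add hp
  have hlip : ∀ x y : E, ‖p x - p y‖ ≤ 1 / 2 * ‖x - y‖ := fun x y =>
    Convex.norm_image_sub_le_of_norm_fderiv_le (fun z _ => hpd z) (fun z _ => hb z) convex_univ
      (mem_univ y) (mem_univ x)
  have happ : ApproximatesLinearOn f ((ContinuousLinearEquiv.refl ℝ E : E ≃L[ℝ] E) : E →L[ℝ] E) univ
      (1 / 2 : NNReal) := by
    refine fun x _ y _ => ?_
    have : f x - f y - ((ContinuousLinearEquiv.refl ℝ E : E ≃L[ℝ] E) : E →L[ℝ] E) (x - y) = p x - p y := by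
      simp [f]
      abel
    rw [this]
    simpa using hlip x y
  have hc : Subsingleton E ∨ (1 / 2 : NNReal) <
      ‖((ContinuousLinearEquiv.refl ℝ E).symm : E →L[ℝ] E)‖₊⁻¹ := by
    rcases subsingleton_or_nontrivial E with h | h
    · exact Or.inl h
    · right
      have : ‖((ContinuousLinearEquiv.refl ℝ E).symm : E →L[ℝ] E)‖₊ = 1 := by
        have h2 : ‖ContinuousLinearMap.id ℝ E‖ = 1 := ContinuousLinearMap.norm_id
        exact NNReal.eq h2
      rw [this, inv_one]
      exact NNReal.half_lt_self one_ne_zero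
  let H : E ≃ₜ E := happ.toHomeomorph f hc
  have hH : ∀ x, H x = x + p x := fun x => rfl
  have hT : ∀ x, ‖-fderiv ℝ p x‖ < 1 := fun x => by
    rw [norm_neg]; exact (hb x).trans_lt (by norm_num)
  have hd : ∀ x, HasFDerivAt H ((ContinuousLinearEquiv.unitsEquiv ℝ E
      (Units.oneSub (-fderiv ℝ p x) (hT x)) : E ≃L[ℝ] E) : E →L[ℝ] E) x := by
    intro x
    have h1 : HasFDerivAt f (ContinuousLinearMap.id ℝ E + fderiv ℝ p x) x :=
      (hasFDerivAt_id x).add (hpd x).hasFDerivAt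
    refine h1.congr_fderiv ?_
    ext1 v
    simp
  refine ⟨H.symm, H.contDiff_symm hd hf, fun x => ?_, fun y => ?_⟩
  · rw [← hH]; exact H.symm_apply_apply x
  · rw [← hH]; exact H.apply_symm_apply y

/-- a smooth cutoff at scale `r` -/
lemma exists_cut : ∃ (χ : E → ℝ) (C : ℝ), ContDiff ℝ (⊤ : ℕ∞) χ ∧ 0 ≤ C ∧ (∀ x, ‖fderiv ℝ χ x‖ ≤ C) ∧
    (∀ x, 0 ≤ χ x ∧ χ x ≤ 1) ∧ (∀ x, ‖x‖ ≤ 1 → χ x = 1) ∧ ∀ x, 2 ≤ ‖x‖ → χ x = 0 := by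
  let b : ContDiffBump (0 : E) := ⟨1, 2, by norm_num, by norm_num⟩
  have hb : ContDiff ℝ (⊤ : ℕ∞) b := b.contDiff
  obtain ⟨C, hC⟩ := (b.hasCompactSupport.fderiv (𝕜 := ℝ)).exists_bound_of_continuous
    (hb.continuous_fderiv (by simp))
  refine ⟨b, C, hb, (norm_nonneg _).trans (hC 0), hC, fun x => ⟨b.nonneg, b.le_one⟩, fun x hx => ?_,
    fun x hx => ?_⟩
  · exact b.one_of_mem_closedBall (by simpa [b] using hx)
  · exact b.zero_of_le_dist (by simpa [b] using hx)

lemma cut_small {R : E → ℝ} (hR : ContDiff ℝ (⊤ : ℕ∞) R) {x0 : E} (h0 : R x0 = 0)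
    (h1 : fderiv ℝ R x0 = 0) {ε : ℝ} (hε : 0 < ε) :
    ∃ (P : E → ℝ) (r : ℝ), 0 < r ∧ ContDiff ℝ (⊤ : ℕ∞) P ∧ (∀ x, ‖fderiv ℝ P x‖ ≤ ε) ∧
      ∀ x ∈ Metric.ball x0 r, P x = R x := by
  obtain ⟨χ, C, hχ, hC, hχC, hχ01, hχ1, hχ0⟩ := exists_cut (n := n)
  have hRd : Differentiable ℝ R := hR.differentiable (by simp)
  have hχd : Differentiable ℝ χ := hχ.differentiable (by simp)
  set ε' := ε / (3 * C + 1) with hε'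
  have hε'0 : 0 < ε' := by positivity
  have hcont : ContinuousAt (fderiv ℝ R) x0 := (hR.continuous_fderiv (by simp)).continuousAt
  obtain ⟨s, hs, hsb⟩ := Metric.continuousAt_iff.1 hcont ε' hε'0
  have hsb' : ∀ x ∈ Metric.ball x0 s, ‖fderiv ℝ R x‖ ≤ ε' := fun x hx => by
    have := hsb hx
    rw [h1, dist_zero_right] at this
    exact this.le
  set r := s / 3 with hr
  have hr0 : 0 < r := by positivity
  have hRb : ∀ x ∈ Metric.ball x0 s, |R x| ≤ ε' * ‖x - x0‖ := fun x hx => by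
    have := Convex.norm_image_sub_le_of_norm_fderiv_le (fun z _ => hRd z) hsb' (convex_ball x0 s)
      (Metric.mem_ball_self hs) hx
    rwa [h0, sub_zero] at this
  let c : E → ℝ := fun x => χ (r⁻¹ • (x - x0))
  have hcd : ContDiff ℝ (⊤ : ℕ∞) c := hχ.comp (contDiff_const_smul r⁻¹ |>.comp (contDiff_id.sub contDiff_const))
  have hc0 : ∀ x, s < ‖x - x0‖ + r → c x = 0 := fun x hx => by
    refine hχ0 _ ?_
    rw [norm_smul, norm_inv, Real.norm_of_nonneg hr0.le, inv_mul_eq_div, le_div_iff₀ hr0]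
    linarith
  have hcf : ∀ x, ‖fderiv ℝ c x‖ ≤ C * r⁻¹ := fun x => by
    have e1 : HasFDerivAt (fun x : E => r⁻¹ • (x - x0)) (r⁻¹ • ContinuousLinearMap.id ℝ E) x :=
      ((hasFDerivAt_id x).sub_const x0).const_smul r⁻¹
    have e2 : HasFDerivAt c ((fderiv ℝ χ (r⁻¹ • (x - x0))).comp (r⁻¹ • ContinuousLinearMap.id ℝ E)) x :=
      HasFDerivAt.comp x (hχd (r⁻¹ • (x - x0))).hasFDerivAt e1
    rw [e2.fderiv, ContinuousLinearMap.comp_smul, ContinuousLinearMap.comp_id, norm_smul, norm_inv,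
      Real.norm_of_nonneg hr0.le, mul_comm]
    gcongr
    exact hχC _
  refine ⟨fun x => c x * R x, r, hr0, hcd.mul hR, fun x => ?_, fun x hx => ?_⟩
  · by_cases hx : x ∈ Metric.ball x0 s
    · have hx' := hx
      rw [Metric.mem_ball, dist_eq_norm] at hx'
      have e3 : fderiv ℝ (fun x => c x * R x) x = c x • fderiv ℝ R x + R x • fderiv ℝ c x :=
        fderiv_fun_mul (hcd.differentiable (by simp) x) (hRd x)
      rw [e3]
      refine (norm_add_le _ _).trans ?_
      rw [norm_smul, norm_smul, Real.norm_eq_abs, Real.norm_eq_abs]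
      have a1 : |c x| * ‖fderiv ℝ R x‖ ≤ 1 * ε' := by
        gcongr
        · rw [abs_of_nonneg (hχ01 _).1]; exact (hχ01 _).2
        · exact hsb' x hx
      have a2 : |R x| * ‖fderiv ℝ c x‖ ≤ (ε' * s) * (C * r⁻¹) := by
        gcongr
        · exact (hRb x hx).trans (by gcongr)
        · exact hcf x
      have a3 : (ε' * s) * (C * r⁻¹) = 3 * C * ε' := by
        rw [hr]; field_simp
      calc _ ≤ 1 * ε' + 3 * C * ε' := by rw [← a3]; exact add_le_add a1 a2
        _ = ε := by rw [hε']; field_simp; ring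
    · have : (fun x => c x * R x) =ᶠ[𝓝 x] fun _ => 0 := by
        have hx' : s < ‖x - x0‖ + r := by
          rw [Metric.mem_ball, dist_eq_norm] at hx; push Not at hx; linarith
        have hcn : Continuous fun y : E => ‖y - x0‖ + r :=
          (continuous_id.sub continuous_const).norm.add continuous_const
        filter_upwards [hcn.continuousAt.eventually (lt_mem_nhds hx')] with y hy
        rw [hc0 y hy, zero_mul]
      rw [this.fderiv_eq]
      simp [hε.le]
  · have : c x = 1 := by
      refine hχ1 _ ?_
      rw [norm_smul, norm_inv, Real.norm_of_nonneg hr0.le, inv_mul_eq_div, div_le_one hr0]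
      rw [Metric.mem_ball, dist_eq_norm] at hx
      exact hx.le
    simp only [this, one_mul]

set_option maxHeartbeats 1000000 in
lemma flow_of (D : SmoothDomain n) {x0 : E} {g : E → ℝ} (hg : ContDiff ℝ (⊤ : ℕ∞) g) {i : Fin n}
    (hi : fderiv ℝ g x0 (ee i) ≠ 0) {r0 : ℝ} (hr0 : 0 < r0)
    (hlev : ∀ x ∈ Metric.ball x0 r0, ∀ y ∈ Metric.ball x0 r0, g x = g y →
      (x ∈ D.carrier ↔ y ∈ D.carrier)) :
    ∃ (F : FlowD D) (V : Set E) (b : Fin n → E → ℝ) (δ : ℝ), 0 < δ ∧ IsOpen V ∧ x0 ∈ V ∧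
      (∀ j, ContDiff ℝ (⊤ : ℕ∞) (b j)) ∧ (∀ x ∈ V, b i x = 1) ∧
      ∀ h ∈ Metric.ball (0 : E) δ, ∀ x ∈ V, ∀ j, F.yf j h x = ee j - b j x • ee i := by
  set a := fderiv ℝ g x0 (ee i) with ha
  set ℓ : E →L[ℝ] ℝ := fderiv ℝ g x0 with hℓ
  have hgd : Differentiable ℝ g := hg.differentiable (by simp)
  let R : E → ℝ := fun x => a⁻¹ * (g x - g x0 - ℓ (x - x0))
  have hR : ContDiff ℝ (⊤ : ℕ∞) R :=
    contDiff_const.mul ((hg.sub contDiff_const).sub (ℓ.contDiff.comp (contDiff_id.sub contDiff_const)))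
  have hRf : ∀ x, HasFDerivAt R (a⁻¹ • (fderiv ℝ g x - ℓ)) x := fun x => by
    have e1 : HasFDerivAt (fun x : E => ℓ (x - x0)) ℓ x :=
      ℓ.hasFDerivAt.comp x ((hasFDerivAt_id x).sub_const x0)
    exact (((hgd x).hasFDerivAt.sub_const _).sub e1).const_mul a⁻¹
  obtain ⟨P, r1, hr1, hP, hPb, hPR⟩ := cut_small hR (x0 := x0) (by simp [R])
    (by rw [(hRf x0).fderiv]; simp [hℓ]) (show (0:ℝ) < 1 / 2 by norm_num)
  have hPd : Differentiable ℝ P := hP.differentiable (by simp)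
  -- the straightening diffeo
  let p : E → E := fun x => P x • ee i
  have hp : ContDiff ℝ (⊤ : ℕ∞) p := hP.smul contDiff_const
  have hpf : ∀ x, HasFDerivAt p ((fderiv ℝ P x).smulRight (ee i)) x := fun x =>
    (hPd x).hasFDerivAt.smul_const (ee i)
  obtain ⟨Φ, hΦ, hΦl, hΦr⟩ := pert_inv hp (fun x => by
    rw [(hpf x).fderiv, ContinuousLinearMap.norm_smulRight_apply, norm_ee, mul_one]
    exact hPb x)
  let Ψ : E → E := fun x => x + p x
  have hΨ : ContDiff ℝ (⊤ : ℕ∞) Ψ := contDiff_id.add hp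
  have hΨ0 : Ψ x0 = x0 := by
    have : P x0 = 0 := by rw [hPR x0 (Metric.mem_ball_self hr1)]; simp [R]
    simp [Ψ, p, this]
  set rN := min r0 r1 with hrN
  have hrN0 : 0 < rN := lt_min hr0 hr1
  have hN0 : Metric.ball x0 rN ⊆ Metric.ball x0 r0 := Metric.ball_subset_ball (min_le_left _ _)
  have hN1 : Metric.ball x0 rN ⊆ Metric.ball x0 r1 := Metric.ball_subset_ball (min_le_right _ _)
  have hgΨ : ∀ x ∈ Metric.ball x0 rN, g x = ℓ (Ψ x) + (g x0 - ℓ x0) := by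
    intro x hx
    have e1 : Ψ x = x + R x • ee i := by simp only [Ψ, p, hPR x (hN1 hx)]
    have e2 : R x * a = g x - g x0 - ℓ (x - x0) := by simp only [R]; field_simp
    rw [e1, map_add, map_smul, smul_eq_mul, ← ha, e2, map_sub]
    ring
  -- radius ρ
  have hΦ0 : Φ x0 = x0 := by
    have := hΦl x0
    rwa [show x0 + p x0 = x0 from hΨ0] at this
  obtain ⟨ρ, hρ, hρb⟩ : ∃ ρ > 0, ∀ y ∈ Metric.ball x0 (2 * ρ), Φ y ∈ Metric.ball x0 rN := by
    have := hΦ.continuous.continuousAt (x := x0)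
    obtain ⟨s, hs, hsb⟩ := Metric.continuousAt_iff.1 this rN hrN0
    refine ⟨s / 2, by positivity, fun y hy => ?_⟩
    have := hsb (x := y) (by rw [Metric.mem_ball] at hy; linarith)
    rwa [hΦ0] at this
  obtain ⟨χ, C, hχ, hC, hχC, hχ01, hχ1, hχ0⟩ := exists_cut (n := n)
  have hχd : Differentiable ℝ χ := hχ.differentiable (by simp)
  let η : E → ℝ := fun y => χ ((2 / ρ) • (y - x0))
  have hη : ContDiff ℝ (⊤ : ℕ∞) η :=
    hχ.comp ((contDiff_const_smul (2 / ρ)).comp (contDiff_id.sub contDiff_const))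
  have h2ρ : 0 < 2 / ρ := by positivity
  have hη0 : ∀ y, y ∉ Metric.ball x0 ρ → η y = 0 := fun y hy => by
    refine hχ0 _ ?_
    rw [Metric.mem_ball, dist_eq_norm] at hy; push Not at hy
    rw [norm_smul, Real.norm_of_nonneg h2ρ.le, div_mul_eq_mul_div, le_div_iff₀ hρ]
    linarith
  have hη1 : ∀ y ∈ Metric.ball x0 (ρ / 2), η y = 1 := fun y hy => by
    refine hχ1 _ ?_
    rw [Metric.mem_ball, dist_eq_norm] at hy
    rw [norm_smul, Real.norm_of_nonneg h2ρ.le, div_mul_eq_mul_div, div_le_one hρ]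
    linarith
  have hηf : ∀ y, HasFDerivAt η ((2 / ρ) • fderiv ℝ χ ((2 / ρ) • (y - x0))) y := fun y => by
    have e1 : HasFDerivAt (fun x : E => (2 / ρ) • (x - x0)) ((2 / ρ) • ContinuousLinearMap.id ℝ E) y :=
      ((hasFDerivAt_id y).sub_const x0).const_smul (2 / ρ)
    have e2 : HasFDerivAt η ((fderiv ℝ χ ((2 / ρ) • (y - x0))).comp ((2 / ρ) • ContinuousLinearMap.id ℝ E)) y :=
      HasFDerivAt.comp y (hχd ((2 / ρ) • (y - x0))).hasFDerivAt e1
    rwa [ContinuousLinearMap.comp_smul, ContinuousLinearMap.comp_id] at e2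
  -- directions
  let L : E →L[ℝ] E := ContinuousLinearMap.id ℝ E - (a⁻¹ • ℓ).smulRight (ee i)
  have hL : ∀ v, L v = v - (a⁻¹ * ℓ v) • ee i := fun v => rfl
  have hℓL : ∀ v, ℓ (L v) = 0 := fun v => by
    rw [hL, map_sub, map_smul, smul_eq_mul, ← ha]; field_simp; ring
  set K := ‖L‖ + 1 with hK
  have hK0 : 0 < K := by positivity
  obtain ⟨s, hs, hs1, hs2⟩ : ∃ s > 0, K * (2 * s) ≤ ρ ∧ (2 / ρ * C) * (K * (2 * s)) ≤ 1 / 2 := by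
    refine ⟨min (ρ / (2 * K)) (1 / (8 * K * (2 / ρ * (C + 1)))), by positivity, ?_, ?_⟩
    · calc K * (2 * min (ρ / (2 * K)) (1 / (8 * K * (2 / ρ * (C + 1))))) ≤ K * (2 * (ρ / (2 * K))) := by
            gcongr; exact min_le_left _ _
        _ = ρ := by field_simp
    · calc (2 / ρ * C) * (K * (2 * min (ρ / (2 * K)) (1 / (8 * K * (2 / ρ * (C + 1))))))
          ≤ (2 / ρ * (C + 1)) * (K * (2 * (1 / (8 * K * (2 / ρ * (C + 1)))))) := by
            gcongr
            · linarith
            · exact min_le_right _ _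
        _ = 1 / 4 := by field_simp; norm_num
        _ ≤ 1 / 2 := by norm_num
  let κ : E → E := fun h => χ (s⁻¹ • h) • h
  have hκ : ContDiff ℝ (⊤ : ℕ∞) κ := (hχ.comp (contDiff_const_smul s⁻¹)).smul contDiff_id
  have hκb : ∀ h, ‖κ h‖ ≤ 2 * s := fun h => by
    rw [norm_smul, Real.norm_of_nonneg (hχ01 _).1]
    by_cases hh : 2 ≤ ‖s⁻¹ • h‖
    · rw [hχ0 _ hh, zero_mul]; positivity
    · push Not at hh
      rw [norm_smul, norm_inv, Real.norm_of_nonneg hs.le, inv_mul_eq_div, div_lt_iff₀ hs] at hh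
      calc _ ≤ 1 * ‖h‖ := by gcongr; exact (hχ01 _).2
        _ ≤ 2 * s := by linarith
  have hκ1 : ∀ h ∈ Metric.ball (0 : E) s, κ h = h := fun h hh => by
    have : χ (s⁻¹ • h) = 1 := hχ1 _ (by
      rw [norm_smul, norm_inv, Real.norm_of_nonneg hs.le, inv_mul_eq_div, div_le_one hs]
      rw [mem_ball_zero_iff] at hh; exact hh.le)
    simp only [κ, this, one_smul]
  have hκ0 : κ 0 = 0 := by simp [κ]
  have hLκ : ∀ h, ‖L (κ h)‖ ≤ K * (2 * s) := fun h => by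
    refine (L.le_opNorm _).trans ?_
    gcongr
    · rw [hK]; linarith
    · exact hκb h
  have hTinv : ∀ h, ∃ t : E → E, ContDiff ℝ (⊤ : ℕ∞) t ∧ (∀ y, t (y + η y • L (κ h)) = y) ∧
      ∀ y, t y + η (t y) • L (κ h) = y := fun h => by
    refine pert_inv (p := fun y => η y • L (κ h)) (hη.smul contDiff_const) fun y => ?_
    rw [((hηf y).smul_const (L (κ h))).fderiv, ContinuousLinearMap.norm_smulRight_apply, norm_smul,
      Real.norm_of_nonneg h2ρ.le]
    refine le_trans ?_ hs2
    gcongr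
    · exact hχC _
    · exact hLκ h
  choose t ht htl htr using hTinv
  let θ : E → E → E := fun h x => Φ (Ψ x + η (Ψ x) • L (κ h))
  have hΨΦ : ∀ y, Ψ (Φ y) = y := hΦr
  have hΦΨ : ∀ x, Φ (Ψ x) = x := hΦl
  have hθ : ContDiff ℝ (⊤ : ℕ∞) (Function.uncurry θ) := by
    have h1 : ContDiff ℝ (⊤ : ℕ∞) (fun q : E × E => Ψ q.2) := hΨ.comp contDiff_snd
    exact hΦ.comp (h1.add ((hη.comp h1).smul (L.contDiff.comp (hκ.comp contDiff_fst))))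
  have hpres : ∀ h x, θ h x ∈ D.carrier ↔ x ∈ D.carrier := by
    intro h x
    by_cases hx : Ψ x ∈ Metric.ball x0 ρ
    · have m1 : x ∈ Metric.ball x0 rN := by
        have := hρb (Ψ x) (Metric.ball_subset_ball (by linarith) hx)
        rwa [hΦΨ] at this
      have m2 : θ h x ∈ Metric.ball x0 rN := by
        refine hρb _ ?_
        rw [Metric.mem_ball, dist_eq_norm] at hx ⊢
        have e1 : ‖η (Ψ x) • L (κ h)‖ ≤ 1 * ρ := by
          rw [norm_smul, Real.norm_of_nonneg (hχ01 _).1]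
          gcongr
          · exact (hχ01 _).2
          · exact (hLκ h).trans hs1
        calc ‖Ψ x + η (Ψ x) • L (κ h) - x0‖ = ‖(Ψ x - x0) + η (Ψ x) • L (κ h)‖ := by congr 1; abel
          _ ≤ ‖Ψ x - x0‖ + ‖η (Ψ x) • L (κ h)‖ := norm_add_le _ _
          _ < 2 * ρ := by linarith
      refine hlev _ (hN0 m2) _ (hN0 m1) ?_
      rw [hgΨ _ m2, hgΨ _ m1]
      simp only [θ]
      rw [hΨΦ, map_add, map_smul, hℓL, smul_zero, add_zero]
    · have : θ h x = x := by
        simp only [θ, hη0 _ hx, zero_smul, add_zero, hΦΨ]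
      rw [this]
  let F : FlowD D :=
    { th := θ
      ti := fun h x => Φ (t h (Ψ x))
      sm := hθ
      smi := fun h => hΦ.comp ((ht h).comp hΨ)
      left := fun h x => by simp only [θ]; rw [hΨΦ, htl, hΦΨ]
      right := fun h x => by simp only [θ]; rw [hΨΦ, htr, hΦΨ]
      zero := fun x => by simp only [θ]; rw [hκ0, map_zero, smul_zero, add_zero, hΦΨ]
      pres := hpres }
  -- coefficients
  let q : ContDiffBump a := ⟨|a| / 4, |a| / 2, by positivity, by have : 0 < |a| := abs_pos.2 hi; linarith⟩
  let den : E → ℝ := fun x => a + q (fderiv ℝ g x (ee i)) * (fderiv ℝ g x (ee i) - a)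
  have hgj : ∀ j : Fin n, ContDiff ℝ (⊤ : ℕ∞) (fun x => fderiv ℝ g x (ee j)) := fun j =>
    (hg.fderiv_right (m := (⊤ : ℕ∞)) (by exact_mod_cast le_top)).clm_apply contDiff_const
  have hden : ContDiff ℝ (⊤ : ℕ∞) den :=
    contDiff_const.add ((q.contDiff.comp (hgj i)).mul ((hgj i).sub contDiff_const))
  have hden0 : ∀ x, den x ≠ 0 := by
    intro x hx
    have ha' : 0 < |a| := abs_pos.2 hi
    have e1 : |q (fderiv ℝ g x (ee i)) * (fderiv ℝ g x (ee i) - a)| ≤ |a| / 2 := by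
      by_cases hd : q.rOut ≤ dist (fderiv ℝ g x (ee i)) a
      · rw [q.zero_of_le_dist hd, zero_mul, abs_zero]; positivity
      · push Not at hd
        rw [Real.dist_eq] at hd
        rw [abs_mul, abs_of_nonneg q.nonneg]
        calc _ ≤ 1 * (|a| / 2) := by exact mul_le_mul q.le_one hd.le (abs_nonneg _) zero_le_one
          _ = _ := one_mul _
    have e2 : a = -(q (fderiv ℝ g x (ee i)) * (fderiv ℝ g x (ee i) - a)) := by
      simp only [den] at hx; linarith
    have e3 : |a| = |q (fderiv ℝ g x (ee i)) * (fderiv ℝ g x (ee i) - a)| := by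
      conv_lhs => rw [e2]
      rw [abs_neg]
    linarith
  let W : Set E := {x | fderiv ℝ g x (ee i) ∈ Metric.ball a (|a| / 4)}
  have hWo : IsOpen W := Metric.isOpen_ball.preimage (hgj i).continuous
  have hWd : ∀ x ∈ W, den x = fderiv ℝ g x (ee i) := fun x hx => by
    have : q (fderiv ℝ g x (ee i)) = 1 := q.one_of_mem_closedBall (Metric.ball_subset_closedBall hx)
    simp only [den, this]; ring
  let V : Set E := (W ∩ Ψ ⁻¹' (Metric.ball x0 (ρ / 2))) ∩ Metric.ball x0 rN
  have hVo : IsOpen V := (hWo.inter (Metric.isOpen_ball.preimage hΨ.continuous)).inter Metric.isOpen_ball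
  have hbi : ∀ x ∈ V, fderiv ℝ g x (ee i) / den x = 1 := fun x hx => by
    rw [hWd x hx.1.1, div_self]
    rw [← hWd x hx.1.1]; exact hden0 x
  refine ⟨F, V, fun j x => fderiv ℝ g x (ee j) / den x, s, hs, hVo, ?_,
    fun j => (hgj j).div hden hden0, hbi, ?_⟩
  · refine ⟨⟨?_, ?_⟩, Metric.mem_ball_self hrN0⟩
    · change fderiv ℝ g x0 (ee i) ∈ Metric.ball a (|a| / 4)
      rw [← ha]; exact Metric.mem_ball_self (by positivity)
    · change Ψ x0 ∈ Metric.ball x0 (ρ / 2)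
      rw [hΨ0]; exact Metric.mem_ball_self (by positivity)
  intro h hh x hx j
  set X : E := ee j - (fderiv ℝ g x (ee j) / den x) • ee i with hX
  have hgX : fderiv ℝ g x X = 0 := by
    rw [hX, map_sub, map_smul, smul_eq_mul, ← hWd x hx.1.1, div_mul_cancel₀ _ (hden0 x), sub_self]
  have hΨf : HasFDerivAt Ψ (ContinuousLinearMap.id ℝ E + (fderiv ℝ P x).smulRight (ee i)) x :=
    (hasFDerivAt_id x).add (hpf x)
  have hPx : fderiv ℝ P x = a⁻¹ • (fderiv ℝ g x - ℓ) := by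
    have : P =ᶠ[𝓝 x] R := by
      filter_upwards [Metric.isOpen_ball.mem_nhds (hN1 hx.2)] with y hy using hPR y hy
    rw [this.fderiv_eq, (hRf x).fderiv]
  have hΨX : (ContinuousLinearMap.id ℝ E + (fderiv ℝ P x).smulRight (ee i)) X = L (ee j) := by
    have hℓX : ℓ X = ℓ (ee j) - fderiv ℝ g x (ee j) / den x * a := by
      rw [hX, map_sub, map_smul, smul_eq_mul, ha]
    have hPX : fderiv ℝ P x X = fderiv ℝ g x (ee j) / den x - a⁻¹ * ℓ (ee j) := by
      rw [hPx, smul_apply, sub_apply, hgX, hℓX, smul_eq_mul]; field_simp; ring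
    change X + fderiv ℝ P x X • ee i = _
    rw [hPX, hL, hX, sub_smul]
    abel
  have hΦd : HasFDerivAt Φ (fderiv ℝ Φ (Ψ x + L h)) (Ψ x + L h) :=
    (hΦ.differentiable (by simp) _).hasFDerivAt
  have d1 : F.dx h x X = fderiv ℝ Φ (Ψ x + L h) (L (ee j)) := by
    have e1 : F.th h =ᶠ[𝓝 x] fun x => Φ (Ψ x + L h) := by
      filter_upwards [hVo.mem_nhds hx] with y hy
      change Φ (Ψ y + η (Ψ y) • L (κ h)) = _
      rw [hη1 _ hy.1.2, hκ1 h hh, one_smul]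
    have e2 : HasFDerivAt (fun x => Φ (Ψ x + L h)) ((fderiv ℝ Φ (Ψ x + L h)).comp
        (ContinuousLinearMap.id ℝ E + (fderiv ℝ P x).smulRight (ee i))) x :=
      HasFDerivAt.comp x hΦd (hΨf.add_const (L h))
    rw [FlowD.dx, e1.fderiv_eq, e2.fderiv, ContinuousLinearMap.comp_apply, hΨX]
  have d2 : fderiv ℝ (fun h => F.th h x) h (ee j) = fderiv ℝ Φ (Ψ x + L h) (L (ee j)) := by
    have e1 : (fun h => F.th h x) =ᶠ[𝓝 h] fun h => Φ (Ψ x + L h) := by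
      filter_upwards [Metric.isOpen_ball.mem_nhds hh] with y hy
      change Φ (Ψ x + η (Ψ x) • L (κ y)) = _
      rw [hη1 _ hx.1.2, hκ1 y hy, one_smul]
    have e2 : HasFDerivAt (fun h => Φ (Ψ x + L h)) ((fderiv ℝ Φ (Ψ x + L h)).comp L) h :=
      HasFDerivAt.comp h hΦd (L.hasFDerivAt.const_add (Ψ x))
    rw [e1.fderiv_eq, e2.fderiv, ContinuousLinearMap.comp_apply]
  change F.ai h x (fderiv ℝ (fun h => F.th h x) h (ee j)) = X
  rw [d2, ← d1, F.ai_left]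

theorem exists_flow (hn : 0 < n) (D : SmoothDomain n) {x0 : E} (hx0 : x0 ∈ closure D.carrier) :
    ∃ (i : Fin n) (F : FlowD D) (V : Set E) (b : Fin n → E → ℝ) (δ : ℝ), 0 < δ ∧ IsOpen V ∧ x0 ∈ V ∧
      (∀ j, ContDiff ℝ (⊤ : ℕ∞) (b j)) ∧ (∀ x ∈ V, b i x = 1) ∧
      ∀ h ∈ Metric.ball (0 : E) δ, ∀ x ∈ V, ∀ j, F.yf j h x = ee j - b j x • ee i := by
  rcases ((mem_clos D).1 hx0).lt_or_eq with h | h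
  · obtain ⟨r, hr, hrb⟩ := Metric.isOpen_iff.1 D.isOpen x0 ((mem_carrier D).2 h)
    refine ⟨⟨0, hn⟩, flow_of D (g := fun x => x ⟨0, hn⟩) ?_ (i := ⟨0, hn⟩) ?_ hr ?_⟩
    · exact (EuclideanSpace.proj ⟨0, hn⟩ : E →L[ℝ] ℝ).contDiff
    · have : HasFDerivAt (fun x : E => x ⟨0, hn⟩) (EuclideanSpace.proj ⟨0, hn⟩ : E →L[ℝ] ℝ) x0 :=
        (EuclideanSpace.proj ⟨0, hn⟩ : E →L[ℝ] ℝ).hasFDerivAt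
      rw [this.fderiv]
      simp [ee]
    · intro x hx y hy _
      exact ⟨fun _ => hrb hy, fun _ => hrb hx⟩
  · have h1 := fderiv_rho_ne D h
    obtain ⟨i, hi⟩ : ∃ i, fderiv ℝ D.defining x0 (ee i) ≠ 0 := by
      by_contra hcon
      push Not at hcon
      apply h1
      ext v
      rw [clm_eq_sum]
      simp [hcon]
    refine ⟨i, flow_of D (rho_cd D) hi one_pos fun x _ y _ hxy => ?_⟩
    rw [mem_carrier, mem_carrier, hxy]
end D2
end BNS

namespace BNS
open MeasureTheory Set Filter Topology
section D3a

/-- functionals bounded with respect to a norm `N` -/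
def BdS {W : Type*} [AddCommGroup W] [Module ℝ W] (N : W → ℝ) : Submodule ℝ (W →ₗ[ℝ] ℝ) where
  carrier := {S | ∃ C, ∀ ψ, |S ψ| ≤ C * N ψ}
  zero_mem' := ⟨0, fun ψ => by simp⟩
  add_mem' := by
    rintro S S' ⟨C, hC⟩ ⟨C', hC'⟩
    refine ⟨C + C', fun ψ => ?_⟩
    rw [LinearMap.add_apply, add_mul]
    exact (abs_add_le _ _).trans (add_le_add (hC ψ) (hC' ψ))
  smul_mem' := by
    rintro c S ⟨C, hC⟩
    refine ⟨|c| * C, fun ψ => ?_⟩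
    rw [LinearMap.smul_apply, smul_eq_mul, abs_mul, mul_assoc]
    exact mul_le_mul_of_nonneg_left (hC ψ) (abs_nonneg _)

/-- abstract elliptic regularity data -/
structure Ell (ι W A : Type*) [Fintype ι] [AddCommGroup W] [Module ℝ W] [CommRing A] where
  Dd : ι → Module.End ℝ W
  Mm : A →+* Module.End ℝ W
  pd : ι → A → A
  leib : ∀ j a, Dd j * Mm a = Mm a * Dd j + Mm (pd j a)
  comm : ∀ j k, Dd j * Dd k = Dd k * Dd j
  N : W → ℝ
  bdM : ∀ a, ∃ C, ∀ ψ, N (Mm a ψ) ≤ C * N ψ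
  N0 : ∀ ψ, 0 ≤ N ψ
  i : ι
  b : ι → A
  γ : A
  hγ : (∑ j, b j * b j) * γ = 1

namespace Ell
variable {ι W A : Type*} [Fintype ι] [AddCommGroup W] [Module ℝ W] [CommRing A] (X : Ell ι W A)

def Y (j : ι) : Module.End ℝ W := X.Dd X.i * X.Mm (X.b j) - X.Dd j

/-- word -/
def Yw (w : List ι) : Module.End ℝ W := (w.map X.Y).prod
def Dw (w : List ι) : Module.End ℝ W := (w.map X.Dd).prod

def TY : Submodule ℝ (W →ₗ[ℝ] ℝ) where
  carrier := {S | ∀ w, S ∘ₗ X.Yw w ∈ BdS X.N}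
  zero_mem' := fun w => by rw [LinearMap.zero_comp]; exact zero_mem _
  add_mem' := fun h h' w => by rw [LinearMap.add_comp]; exact add_mem (h w) (h' w)
  smul_mem' := fun c S h w => by rw [LinearMap.smul_comp]; exact Submodule.smul_mem _ _ (h w)

variable {X}

lemma TY_Y {S : W →ₗ[ℝ] ℝ} (h : S ∈ X.TY) (j : ι) : S ∘ₗ X.Y j ∈ X.TY := fun w => by
  have := h (j :: w)
  rw [Yw, List.map_cons, List.prod_cons] at this
  exact this

lemma Bd_M {S : W →ₗ[ℝ] ℝ} (h : S ∈ BdS X.N) (a : A) : S ∘ₗ X.Mm a ∈ BdS X.N := by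
  obtain ⟨C, hC⟩ := h
  obtain ⟨C', hC'⟩ := X.bdM a
  refine ⟨|C| * C', fun ψ => ?_⟩
  calc _ ≤ C * X.N (X.Mm a ψ) := hC _
    _ ≤ |C| * X.N (X.Mm a ψ) := mul_le_mul_of_nonneg_right (le_abs_self C) (X.N0 _)
    _ ≤ |C| * (C' * X.N ψ) := mul_le_mul_of_nonneg_left (hC' ψ) (abs_nonneg _)
    _ = _ := by ring

lemma M_Y (a : A) (j : ι) : X.Mm a * X.Y j = X.Y j * X.Mm a +
    X.Mm (X.pd j a - X.pd X.i a * X.b j) := by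
  have h1 := X.leib j a
  have h2 := X.leib X.i a
  have h3 : X.Mm a * X.Mm (X.b j) = X.Mm (X.b j) * X.Mm a := by rw [← map_mul, ← map_mul, mul_comm]
  rw [map_sub, map_mul, Y, mul_sub, sub_mul, h1, mul_assoc, ← h3, ← mul_assoc _ (X.Mm a), h2]
  noncomm_ring

lemma TY_M {S : W →ₗ[ℝ] ℝ} (h : S ∈ X.TY) (a : A) : S ∘ₗ X.Mm a ∈ X.TY := by
  intro w
  induction w generalizing S a with
  | nil => exact Bd_M (h []) a
  | cons j w ih =>
    have e : (S ∘ₗ X.Mm a) ∘ₗ X.Yw (j :: w) = ((S ∘ₗ X.Y j) ∘ₗ X.Mm a) ∘ₗ X.Yw w +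
        (S ∘ₗ X.Mm (X.pd j a - X.pd X.i a * X.b j)) ∘ₗ X.Yw w := by
      have : X.Mm a * X.Yw (j :: w) = X.Y j * X.Mm a * X.Yw w +
          X.Mm (X.pd j a - X.pd X.i a * X.b j) * X.Yw w := by
        rw [← add_mul, ← M_Y, Yw, List.map_cons, List.prod_cons, mul_assoc]; rfl
      change S ∘ₗ (X.Mm a * X.Yw (j :: w)) = _
      rw [this, LinearMap.comp_add]; rfl
    rw [e]
    exact add_mem (ih (TY_Y h j) a) (ih h _)

lemma D_Y (k j : ι) : X.Dd k * X.Y j = X.Y j * X.Dd k + X.Dd X.i * X.Mm (X.pd k (X.b j)) := by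
  have h1 := X.leib k (X.b j)
  rw [Y, mul_sub, sub_mul, ← mul_assoc, X.comm k X.i, mul_assoc, h1, X.comm k j]
  noncomm_ring

lemma TY_D {S : W →ₗ[ℝ] ℝ} (h : ∀ w k, (S ∘ₗ X.Yw w) ∘ₗ X.Dd k ∈ BdS X.N) (k : ι) (a : A) :
    (S ∘ₗ X.Dd k) ∘ₗ X.Mm a ∈ X.TY := by
  intro w
  induction w generalizing S k a with
  | nil => exact Bd_M (h [] k) a
  | cons j w ih =>
    have h' : ∀ w k, ((S ∘ₗ X.Y j) ∘ₗ X.Yw w) ∘ₗ X.Dd k ∈ BdS X.N := fun w k => by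
      have := h (j :: w) k
      rw [Yw, List.map_cons, List.prod_cons] at this
      exact this
    have e : ((S ∘ₗ X.Dd k) ∘ₗ X.Mm a) ∘ₗ X.Yw (j :: w) =
        (((S ∘ₗ X.Y j) ∘ₗ X.Dd k) ∘ₗ X.Mm a) ∘ₗ X.Yw w +
        ((S ∘ₗ X.Dd X.i) ∘ₗ X.Mm (X.pd k (X.b j) * a)) ∘ₗ X.Yw w +
        ((S ∘ₗ X.Dd k) ∘ₗ X.Mm (X.pd j a - X.pd X.i a * X.b j)) ∘ₗ X.Yw w := by
      have : X.Dd k * X.Mm a * X.Yw (j :: w) = X.Y j * X.Dd k * X.Mm a * X.Yw w +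
          X.Dd X.i * X.Mm (X.pd k (X.b j) * a) * X.Yw w +
          X.Dd k * X.Mm (X.pd j a - X.pd X.i a * X.b j) * X.Yw w := by
        have e1 : X.Yw (j :: w) = X.Y j * X.Yw w := by rw [Yw, List.map_cons, List.prod_cons]; rfl
        rw [e1, ← mul_assoc, mul_assoc (X.Dd k), M_Y, mul_add, ← mul_assoc (X.Dd k), D_Y, map_mul]
        noncomm_ring
      change S ∘ₗ (X.Dd k * X.Mm a * X.Yw (j :: w)) = _
      rw [this, LinearMap.comp_add, LinearMap.comp_add]; rfl
    rw [e]
    exact add_mem (add_mem (ih h' k a) (ih h _ _)) (ih h k _)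

lemma lcomp_sum (S : W →ₗ[ℝ] ℝ) (f : ι → Module.End ℝ W) : S ∘ₗ (∑ j, f j) = ∑ j, S ∘ₗ f j := by
  ext ψ
  simp [_root_.sum_apply]

/-- the induction class -/
def GG (X : Ell ι W A) (lam : ℝ) (S : W →ₗ[ℝ] ℝ) : Prop :=
  S ∈ X.TY ∧ (∀ k, S ∘ₗ X.Dd k ∈ X.TY) ∧ S ∘ₗ (∑ k, X.Dd k * X.Dd k) = lam • S

lemma GG_step {lam : ℝ} {S : W →ₗ[ℝ] ℝ} (h : X.GG lam S) (j : ι) : X.GG lam (S ∘ₗ X.Dd j) := by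
  obtain ⟨h1, h2, h3⟩ := h
  have hD : ∀ j, X.Dd j = X.Dd X.i * X.Mm (X.b j) - X.Y j := fun j => by rw [Y]; noncomm_ring
  have hii0 : (S ∘ₗ (X.Dd X.i * X.Dd X.i)) ∘ₗ X.Mm (∑ j, X.b j * X.b j) =
      lam • S + ∑ j, ((S ∘ₗ X.Dd j) ∘ₗ X.Y j + ((S ∘ₗ X.Dd X.i) ∘ₗ X.Y j) ∘ₗ X.Mm (X.b j)) := by
    have e : ∀ j, X.Dd X.i * X.Dd X.i * X.Mm (X.b j * X.b j) =
        X.Dd j * X.Dd j + (X.Dd j * X.Y j + X.Dd X.i * X.Y j * X.Mm (X.b j)) := fun j => by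
      have e1 : X.Dd j * X.Dd j = X.Dd X.i * X.Dd j * X.Mm (X.b j) - X.Dd j * X.Y j := by
        conv_lhs => rw [hD j, mul_sub, ← hD j, ← mul_assoc, X.comm j]
      have e2 : X.Dd X.i * X.Dd j = X.Dd X.i * X.Dd X.i * X.Mm (X.b j) - X.Dd X.i * X.Y j := by
        conv_lhs => rw [hD j, mul_sub, ← mul_assoc]
      rw [e1, e2, map_mul]
      noncomm_ring
    have e' : X.Dd X.i * X.Dd X.i * X.Mm (∑ j, X.b j * X.b j) = (∑ k, X.Dd k * X.Dd k) +
        ∑ j, (X.Dd j * X.Y j + X.Dd X.i * X.Y j * X.Mm (X.b j)) := by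
      rw [map_sum, Finset.mul_sum, ← Finset.sum_add_distrib]
      exact Finset.sum_congr rfl fun j _ => e j
    change S ∘ₗ (X.Dd X.i * X.Dd X.i * X.Mm (∑ j, X.b j * X.b j)) = _
    rw [e', LinearMap.comp_add, h3, lcomp_sum]
    congr 1
    refine Finset.sum_congr rfl fun j _ => ?_
    rw [LinearMap.comp_add]; rfl
  have hii : S ∘ₗ (X.Dd X.i * X.Dd X.i) ∈ X.TY := by
    have m1 : (S ∘ₗ (X.Dd X.i * X.Dd X.i)) ∘ₗ X.Mm (∑ j, X.b j * X.b j) ∈ X.TY := by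
      rw [hii0]
      exact add_mem (Submodule.smul_mem _ _ h1) (sum_mem fun j _ =>
        add_mem (TY_Y (h2 j) j) (TY_M (TY_Y (h2 _) j) _))
    have m2 := TY_M m1 X.γ
    have : ((S ∘ₗ (X.Dd X.i * X.Dd X.i)) ∘ₗ X.Mm (∑ j, X.b j * X.b j)) ∘ₗ X.Mm X.γ =
        S ∘ₗ (X.Dd X.i * X.Dd X.i) := by
      change S ∘ₗ ((X.Dd X.i * X.Dd X.i) * (X.Mm (∑ j, X.b j * X.b j) * X.Mm X.γ)) = _
      rw [← map_mul, X.hγ, map_one, mul_one]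
    rwa [this] at m2
  have hik : ∀ k, S ∘ₗ (X.Dd X.i * X.Dd k) ∈ X.TY := fun k => by
    have : S ∘ₗ (X.Dd X.i * X.Dd k) = (S ∘ₗ (X.Dd X.i * X.Dd X.i)) ∘ₗ X.Mm (X.b k) -
        (S ∘ₗ X.Dd X.i) ∘ₗ X.Y k := by
      conv_lhs => rw [hD k, mul_sub, ← mul_assoc, LinearMap.comp_sub]
      rfl
    rw [this]
    exact sub_mem (TY_M hii _) (TY_Y (h2 _) k)
  refine ⟨h2 j, fun k => ?_, ?_⟩
  · have : (S ∘ₗ X.Dd j) ∘ₗ X.Dd k = (S ∘ₗ (X.Dd X.i * X.Dd j)) ∘ₗ X.Mm (X.b k) -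
        (S ∘ₗ X.Dd j) ∘ₗ X.Y k := by
      change S ∘ₗ (X.Dd j * X.Dd k) = _
      conv_lhs => rw [hD k, mul_sub, ← mul_assoc, X.comm j, LinearMap.comp_sub]
      rfl
    rw [this]
    exact sub_mem (TY_M (hik j) _) (TY_Y (h2 _) k)
  · have : X.Dd j * (∑ k, X.Dd k * X.Dd k) = (∑ k, X.Dd k * X.Dd k) * X.Dd j := by
      rw [Finset.mul_sum, Finset.sum_mul]
      refine Finset.sum_congr rfl fun k _ => ?_
      rw [← mul_assoc, X.comm j, mul_assoc, X.comm j, mul_assoc]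
    change S ∘ₗ (X.Dd j * (∑ k, X.Dd k * X.Dd k)) = _
    rw [this]
    change (S ∘ₗ (∑ k, X.Dd k * X.Dd k)) ∘ₗ X.Dd j = _
    rw [h3, LinearMap.smul_comp]

theorem elliptic {lam : ℝ} {T : W →ₗ[ℝ] ℝ} (h1 : ∀ w, T ∘ₗ X.Yw w ∈ BdS X.N)
    (h2 : ∀ w k, (T ∘ₗ X.Yw w) ∘ₗ X.Dd k ∈ BdS X.N)
    (h3 : T ∘ₗ (∑ k, X.Dd k * X.Dd k) = lam • T) (w : List ι) : T ∘ₗ X.Dw w ∈ BdS X.N := by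
  have hG : X.GG lam T := ⟨h1, fun k => by
    have := TY_D h2 k 1
    rw [map_one] at this
    exact this, h3⟩
  have : ∀ (w : List ι) (S : W →ₗ[ℝ] ℝ), X.GG lam S → S ∘ₗ X.Dw w ∈ BdS X.N := by
    intro w
    induction w with
    | nil => intro S hS; exact hS.1 []
    | cons j w ih =>
      intro S hS
      have := ih _ (GG_step hS j)
      have e : X.Dw (j :: w) = X.Dd j * X.Dw w := by rw [Dw, List.map_cons, List.prod_cons]; rfl
      rw [e]; exact this
  exact this w T hG

end Ell
end D3a
end BNS

namespace BNS
open MeasureTheory Set Filter Topology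
section D3b
variable {n : ℕ}
local notation "E" => EuclideanSpace ℝ (Fin n)

/-- smooth functions compactly supported in `O` -/
def TT (O : Set E) : Submodule ℝ (E → ℝ) where
  carrier := {ψ | ContDiff ℝ (⊤ : ℕ∞) ψ ∧ HasCompactSupport ψ ∧ tsupport ψ ⊆ O}
  zero_mem' := ⟨contDiff_const, HasCompactSupport.zero, by simp [tsupport]⟩
  add_mem' := by
    rintro f g ⟨h1, h2, h3⟩ ⟨h4, h5, h6⟩
    exact ⟨h1.add h4, h2.add h5, (tsupport_add f g).trans (union_subset h3 h6)⟩
  smul_mem' := by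
    rintro c f ⟨h1, h2, h3⟩
    exact ⟨h1.const_smul c, h2.smul_left (f := fun _ => c),
      (tsupport_smul_subset_right (fun _ => c) f).trans h3⟩

/-- the algebra of smooth functions -/
def SmA (n : ℕ) : Subalgebra ℝ (EuclideanSpace ℝ (Fin n) → ℝ) where
  carrier := {a | ContDiff ℝ (⊤ : ℕ∞) a}
  mul_mem' := fun {a b} h h' => by
    rw [Set.mem_setOf_eq] at h h' ⊢; exact ContDiff.mul h h'
  add_mem' := fun {a b} h h' => by
    rw [Set.mem_setOf_eq] at h h' ⊢; exact ContDiff.add h h'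
  algebraMap_mem' := fun r => by
    rw [Set.mem_setOf_eq]; exact contDiff_const

lemma SmA_cd (a : SmA n) : ContDiff ℝ (⊤ : ℕ∞) a.1 := by
  have h : a.1 ∈ {a : E → ℝ | ContDiff ℝ (⊤ : ℕ∞) a} := a.2
  rwa [Set.mem_setOf_eq] at h

noncomputable def dd (k : Fin n) (f : E → ℝ) : E → ℝ := fun x => fderiv ℝ f x (ee k)

lemma dd_cd {k : Fin n} {f : E → ℝ} (hf : ContDiff ℝ (⊤ : ℕ∞) f) : ContDiff ℝ (⊤ : ℕ∞) (dd k f) :=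
  (hf.fderiv_right (m := (⊤ : ℕ∞)) (by exact_mod_cast le_top)).clm_apply contDiff_const

lemma cdd {f : E → ℝ} (hf : ContDiff ℝ (⊤ : ℕ∞) f) : Differentiable ℝ f := hf.differentiable (by simp)

lemma dd_supp {k : Fin n} {f : E → ℝ} : tsupport (dd k f) ⊆ tsupport f :=
  (closure_mono (fun x hx => by
    contrapose! hx
    rw [Function.notMem_support] at hx ⊢
    simp [dd, hx])).trans (tsupport_fderiv_subset ℝ)

lemma dd_mem {O : Set E} {k : Fin n} {ψ : E → ℝ} (h : ψ ∈ TT O) : dd k ψ ∈ TT O :=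
  ⟨dd_cd h.1, h.2.1.mono' ((subset_tsupport _).trans dd_supp), dd_supp.trans h.2.2⟩

lemma mu_mem {O : Set E} {a ψ : E → ℝ} (ha : ContDiff ℝ (⊤ : ℕ∞) a) (h : ψ ∈ TT O) : a * ψ ∈ TT O :=
  ⟨ContDiff.mul ha h.1, h.2.1.mul_left, (tsupport_mul_subset_right).trans h.2.2⟩

lemma dd_comm {j k : Fin n} {f : E → ℝ} (hf : ContDiff ℝ (⊤ : ℕ∞) f) :
    dd j (dd k f) = dd k (dd j f) := by
  ext x
  have h2 : ContDiff ℝ 2 f := hf.of_le (by norm_cast)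
  have hd : DifferentiableAt ℝ (fderiv ℝ f) x :=
    (h2.fderiv_right (m := 1) (by norm_num)).differentiable one_ne_zero x
  have e : ∀ j k : Fin n, dd j (dd k f) x = fderiv ℝ (fderiv ℝ f) x (ee j) (ee k) := fun j k => by
    have h1 := hd.hasFDerivAt.clm_apply (hasFDerivAt_const (ee k) x)
    have h3 : dd k f = fun y => fderiv ℝ f y (ee k) := rfl
    rw [dd, h3, h1.fderiv]
    simp
  rw [e, e]
  exact (h2.contDiffAt.isSymmSndFDerivAt (by simp)).eq _ _

noncomputable def e1 (D : SmoothDomain n) (ψ : E → ℝ) : Lsp D := lpL D (cmc fun x => i1 (ψ x))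
noncomputable def e2 (D : SmoothDomain n) (k : Fin n) (ψ : E → ℝ) : Lsp D :=
  lpL D (cmc fun x => i2 (ψ x • ee k))

lemma i1c {ψ : E → ℝ} (h : Continuous ψ) : Continuous (fun x => (i1 (ψ x) : JJ n)) :=
  i1.continuous.comp h
lemma i2c {ψ : E → E} (h : Continuous ψ) : Continuous (fun x => (i2 (ψ x) : JJ n)) :=
  i2.continuous.comp h

lemma e1_add (D : SmoothDomain n) {φ ψ : E → ℝ} (hφ : Continuous φ) (hψ : Continuous ψ) :
    e1 D (φ + ψ) = e1 D φ + e1 D ψ := by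
  rw [e1, e1, e1, ← map_add, ← cmc_add (i1c hφ) (i1c hψ)]
  congr 2
  ext1 x
  exact map_add i1 _ _

lemma e1_smul (D : SmoothDomain n) (c : ℝ) {ψ : E → ℝ} (hψ : Continuous ψ) :
    e1 D (c • ψ) = c • e1 D ψ := by
  rw [e1, e1, ← map_smul, ← cmc_smul c (i1c hψ)]
  congr 2
  ext1 x
  exact map_smul i1 _ _

lemma e1_sub (D : SmoothDomain n) {φ ψ : E → ℝ} (hφ : Continuous φ) (hψ : Continuous ψ) :
    e1 D (φ - ψ) = e1 D φ - e1 D ψ := by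
  have : φ - ψ = φ + (-1 : ℝ) • ψ := by ext; simp; ring
  rw [this, e1_add D hφ (hψ.const_smul _), e1_smul D _ hψ]
  simp [sub_eq_add_neg]

/-- integration by parts, one test function of compact support in the domain -/
lemma ibp_jet (D : SmoothDomain n) {φ ψ : E → ℝ} (hφ : ContDiff ℝ 1 φ) (hψ : ψ ∈ TT D.carrier) (k : Fin n) :
    inner ℝ (jL D φ) (e2 D k ψ) = - inner ℝ (jL D φ) (e1 D (dd k ψ)) := by
  have hψ1 : ContDiff ℝ 1 ψ := hψ.1.of_le (by exact_mod_cast le_top)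
  rw [jL, e2, e1, lpL_inner, lpL_inner]
  rw [cmc_coe (jf_cont hφ), cmc_coe (i1c (dd_cd hψ.1).continuous),
    cmc_coe (i2c (ψ := fun x => ψ x • ee k) (hψ1.continuous.smul continuous_const))]
  simp only [jj_inner, p1_jf, p2_jf, p1_i1, p2_i1, p1_i2, p2_i2, mul_zero, zero_add, inner_zero_right,
    add_zero, inner_smul_right, grad_inner]
  have hz : ∀ x ∉ D.carrier, ψ x = 0 := fun x hx => image_eq_zero_of_notMem_tsupport fun h => hx (hψ.2.2 h)
  have hz' : ∀ x ∉ D.carrier, dd k ψ x = 0 := fun x hx =>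
    image_eq_zero_of_notMem_tsupport fun h => hx (hψ.2.2 (dd_supp h))
  rw [setIntegral_eq_integral_of_forall_compl_eq_zero (fun x hx => by rw [hz x hx, zero_mul]),
    setIntegral_eq_integral_of_forall_compl_eq_zero (fun x hx => by rw [hz' x hx, mul_zero])]
  have hφ' : Continuous fun x => fderiv ℝ φ x (ee k) :=
    (hφ.continuous_fderiv one_ne_zero).clm_apply continuous_const
  rw [integral_mul_fderiv_eq_neg_fderiv_mul_of_integrable (f := ψ) (g := φ) (v := ee k)]
  · congr 1
    exact integral_congr_ae (Eventually.of_forall fun x => mul_comm _ _)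
  · exact Continuous.integrable_of_hasCompactSupport ((dd_cd (k := k) hψ.1).continuous.mul hφ.continuous)
      ((dd_mem (k := k) hψ).2.1.mul_right)
  · exact Continuous.integrable_of_hasCompactSupport (hψ1.continuous.mul hφ') (hψ.2.1.mul_right)
  · exact Continuous.integrable_of_hasCompactSupport (hψ1.continuous.mul hφ.continuous) (hψ.2.1.mul_right)
  · exact fun x _ => hψ1.differentiable one_ne_zero x
  · exact fun x _ => hφ.differentiable one_ne_zero x

lemma ibp (D : SmoothDomain n) {U : Lsp D} (hU : U ∈ HH D) {ψ : E → ℝ} (hψ : ψ ∈ TT D.carrier) (k : Fin n) :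
    inner ℝ U (e2 D k ψ) = - inner ℝ U (e1 D (dd k ψ)) := by
  obtain ⟨φ, hφ, hl⟩ := HH_seq hU
  have h1 : Tendsto (fun m => inner ℝ (jL D (φ m)) (e2 D k ψ)) atTop (𝓝 (inner ℝ U (e2 D k ψ))) :=
    hl.inner tendsto_const_nhds
  have h2 : Tendsto (fun m => - inner ℝ (jL D (φ m)) (e1 D (dd k ψ))) atTop
      (𝓝 (- inner ℝ U (e1 D (dd k ψ)))) := (hl.inner tendsto_const_nhds).neg
  refine tendsto_nhds_unique h1 (h2.congr fun m => ?_)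
  rw [ibp_jet D (hφ m) hψ k]

lemma P0_e1 (D : SmoothDomain n) {ψ : E → ℝ} (hψ : Continuous ψ) (f : Lsp D) :
    inner ℝ (P0 D f) (e1 D ψ) = inner ℝ f (e1 D ψ) := by
  rw [L2.inner_def, L2.inner_def]
  refine integral_congr_ae ?_
  filter_upwards [mulL_coe D (cmc fun _ => i1.comp p1) f, lpL_coe D (cmc fun x => i1 (ψ x))] with x h1 h2
  rw [P0, h1, e1, h2, cmc_coe (i1c hψ), cmc_coe continuous_const]
  simp only [jj_inner, p1_i1, p2_i1, ContinuousLinearMap.comp_apply, inner_zero_right]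

lemma Wh_e1 {D : SmoothDomain n} (F : FlowD D) (j : Fin n) (h : E) {ψ : E → ℝ} (hψ : Continuous ψ) (f : Lsp D) :
    inner ℝ (F.Wh j h f) (e1 D ψ) = inner ℝ f (lpL D (cmc fun x => i2 (ψ x • F.yf j h x))) := by
  rw [L2.inner_def, L2.inner_def]
  have hy : Continuous (F.yf j h) := slice_cont (F.yf_sm j) h
  have hw : Continuous (F.wf j h) := slice_cont (F.wf_sm j) h
  refine integral_congr_ae ?_
  filter_upwards [mulL_coe D (cmc (F.wf j h)) f, lpL_coe D (cmc fun x => i1 (ψ x)),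
    lpL_coe D (cmc fun x => i2 (ψ x • F.yf j h x))] with x h1 h2 h3
  rw [FlowD.Wh, h1, e1, h2, h3, cmc_coe (i1c hψ), cmc_coe hw, cmc_coe (i2c (ψ := fun x => ψ x • F.yf j h x) (hψ.smul hy))]
  simp only [jj_inner, p1_i1, p2_i1, p1_i2, p2_i2, FlowD.wf, ContinuousLinearMap.comp_apply,
    innerSL_apply_apply, inner_zero_right, mul_zero, add_zero, zero_add, inner_smul_right]
  rw [real_inner_comm]
  ring

noncomputable def mulT {O : Set E} (a : SmA n) : Module.End ℝ (TT O) where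
  toFun ψ := ⟨a.1 * ψ.1, mu_mem (SmA_cd a) ψ.2⟩
  map_add' φ ψ := Subtype.ext (mul_add _ _ _)
  map_smul' c ψ := Subtype.ext (mul_smul_comm _ _ _)

noncomputable def ddT {O : Set E} (k : Fin n) : Module.End ℝ (TT O) where
  toFun ψ := ⟨dd k ψ.1, dd_mem ψ.2⟩
  map_add' φ ψ := Subtype.ext (by
    ext x
    change fderiv ℝ (φ.1 + ψ.1) x (ee k) = _
    rw [fderiv_add (cdd φ.2.1 x) (cdd ψ.2.1 x)]; rfl)
  map_smul' c ψ := Subtype.ext (by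
    ext x
    change fderiv ℝ (c • ψ.1) x (ee k) = _
    rw [fderiv_const_smul (cdd ψ.2.1 x)]; rfl)

lemma mulT_bd (D : SmoothDomain n) {O : Set E} (a : SmA n) :
    ∃ C, ∀ ψ : TT O, ‖e1 D (mulT a ψ).1‖ ≤ C * ‖e1 D ψ.1‖ := by
  have hac : Continuous a.1 := (SmA_cd a).continuous
  have hm : Continuous (fun x => a.1 x • ContinuousLinearMap.id ℝ (JJ n)) := hac.smul continuous_const
  refine ⟨‖mulL D (cmc fun x => a.1 x • ContinuousLinearMap.id ℝ (JJ n))‖, fun ψ => ?_⟩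
  have hc : Continuous ψ.1 := ψ.2.1.continuous
  have : mulL D (cmc fun x => a.1 x • ContinuousLinearMap.id ℝ (JJ n)) (e1 D ψ.1) = e1 D (mulT a ψ).1 := by
    refine mulL_lpL D _ _ _ fun x _ => ?_
    have h1 : Continuous fun x => (mulT a ψ).1 x := hac.mul hc
    rw [cmc_coe (i1c h1), cmc_coe hm, cmc_coe (i1c hc)]
    exact (map_smul i1 (a.1 x) (ψ.1 x))
  rw [← this]
  exact ContinuousLinearMap.le_opNorm _ _

noncomputable def ellOf (D : SmoothDomain n) (O : Set E) (i : Fin n) (b : Fin n → SmA n)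
    (hb : b i = 1) : Ell (Fin n) (TT O) (SmA n) where
  Dd := ddT
  Mm :=
    { toFun := mulT
      map_one' := by ext ψ; simp [mulT]
      map_mul' := fun a a' => by ext ψ x; simp [mulT, mul_assoc]
      map_zero' := by ext ψ; simp [mulT]
      map_add' := fun a a' => by ext ψ x; simp [mulT, add_mul] }
  pd k a := ⟨dd k a.1, dd_cd (SmA_cd a)⟩
  leib j a := by
    ext ψ x
    change fderiv ℝ (a.1 * ψ.1) x (ee j) = a.1 x * fderiv ℝ ψ.1 x (ee j) + fderiv ℝ a.1 x (ee j) * ψ.1 x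
    rw [fderiv_mul (cdd (SmA_cd a) x) (cdd ψ.2.1 x), add_apply, smul_apply, smul_apply, smul_eq_mul, smul_eq_mul]
    ring
  comm j k := by
    ext ψ : 2
    exact dd_comm ψ.2.1
  N ψ := ‖e1 D ψ.1‖
  bdM a := mulT_bd D a
  N0 ψ := norm_nonneg _
  i := i
  b := b
  γ := ⟨fun x => (∑ j, (b j).1 x * (b j).1 x)⁻¹, ContDiff.inv (ContDiff.sum fun j _ =>
    ContDiff.mul (SmA_cd (b j)) (SmA_cd (b j))) fun x => by
      have : (1 : ℝ) ≤ ∑ j, (b j).1 x * (b j).1 x := by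
        have h := Finset.single_le_sum (f := fun j => (b j).1 x * (b j).1 x)
          (fun j _ => mul_self_nonneg _) (Finset.mem_univ i)
        simpa [hb] using h
      exact (by linarith : (0:ℝ) < _).ne'⟩
  hγ := by
    ext x
    have : (1 : ℝ) ≤ ∑ j, (b j).1 x * (b j).1 x := by
      have h := Finset.single_le_sum (f := fun j => (b j).1 x * (b j).1 x)
        (fun j _ => mul_self_nonneg _) (Finset.mem_univ i)
      simpa [hb] using h
    have h2 : ((∑ j, b j * b j : SmA n) : E → ℝ) x = ∑ j, (b j).1 x * (b j).1 x := by
      simp [Finset.sum_apply]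
    change ((∑ j, b j * b j : SmA n) : E → ℝ) x * (∑ j, (b j).1 x * (b j).1 x)⁻¹ = 1
    rw [h2]
    exact mul_inv_cancel₀ (by linarith : (0:ℝ) < _).ne'

end D3b
end BNS

namespace BNS
open MeasureTheory Set Filter Topology
section D3c
variable {n : ℕ}
local notation "E" => EuclideanSpace ℝ (Fin n)

lemma P0_symm (D : SmoothDomain n) (f g : Lsp D) : inner ℝ (P0 D f) g = inner ℝ f (P0 D g) := by
  rw [L2.inner_def, L2.inner_def]
  refine integral_congr_ae ?_
  filter_upwards [mulL_coe D (cmc fun _ => i1.comp p1) f, mulL_coe D (cmc fun _ => i1.comp p1) g] with x h1 h2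
  rw [P0, h1, h2, cmc_coe continuous_const]
  simp only [jj_inner, p1_i1, p2_i1, ContinuousLinearMap.comp_apply, inner_zero_right, inner_zero_left]

lemma P0_jL_e1 (D : SmoothDomain n) {φ : E → ℝ} (hφ : ContDiff ℝ 1 φ) : P0 D (jL D φ) = e1 D φ :=
  P0_jL D hφ

lemma e2_bd (D : SmoothDomain n) (k : Fin n) : ∃ C, 0 ≤ C ∧ ∀ ψ : E → ℝ, Continuous ψ →
    ‖e2 D k ψ‖ ≤ C * ‖e1 D ψ‖ := by
  let m : JJ n →L[ℝ] JJ n := i2.comp ((ContinuousLinearMap.toSpanSingleton ℝ (ee k)).comp p1)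
  refine ⟨‖mulL D (cmc fun _ => m)‖, norm_nonneg _, fun ψ hψ => ?_⟩
  have : mulL D (cmc fun _ => m) (e1 D ψ) = e2 D k ψ := by
    refine mulL_lpL D _ _ _ fun x _ => ?_
    rw [cmc_coe (i2c (ψ := fun x => ψ x • ee k) (hψ.smul continuous_const)), cmc_coe continuous_const,
      cmc_coe (i1c hψ)]
    simp [m, p1_i1, -p1_i1]
    rfl
  rw [← this]
  exact ContinuousLinearMap.le_opNorm _ _

lemma lpL_sum (D : SmoothDomain n) {ι : Type*} (s : Finset ι) {f : ι → E → JJ n} (hf : ∀ k, Continuous (f k)) :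
    lpL D (cmc fun x => ∑ k ∈ s, f k x) = ∑ k ∈ s, lpL D (cmc (f k)) := by
  rw [← map_sum]
  congr 1
  ext1 x
  rw [cmc_coe (continuous_finsetSum s fun k _ => hf k), ContinuousMap.sum_apply]
  exact Finset.sum_congr rfl fun k _ => by rw [cmc_coe (hf k)]

lemma jL_split (D : SmoothDomain n) {ψ : E → ℝ} (hψ : ContDiff ℝ (⊤ : ℕ∞) ψ) :
    jL D ψ = e1 D ψ + ∑ k, e2 D k (dd k ψ) := by
  have h2 : ∀ k : Fin n, Continuous fun x => (i2 (dd k ψ x • ee k) : JJ n) := fun k =>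
    i2c (ψ := fun x => dd k ψ x • ee k) ((dd_cd hψ).continuous.smul continuous_const)
  have h3 : Continuous fun x => ∑ k : Fin n, (i2 (dd k ψ x • ee k) : JJ n) :=
    continuous_finsetSum _ fun k _ => h2 k
  rw [show (∑ k, e2 D k (dd k ψ)) = ∑ k, lpL D (cmc fun x => i2 (dd k ψ x • ee k)) from rfl,
    ← lpL_sum D Finset.univ h2, e1, ← map_add, ← cmc_add (i1c hψ.continuous) h3, jL]
  congr 2
  ext1 x
  change i1 (ψ x) + i2 (gradient ψ x) = i1 (ψ x) + ∑ k : Fin n, (i2 (dd k ψ x • ee k) : JJ n)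
  rw [← map_sum]
  congr 2
  refine ext_inner_right ℝ fun v => ?_
  rw [grad_inner, sum_inner, clm_eq_sum]
  refine Finset.sum_congr rfl fun k _ => ?_
  rw [inner_smul_left, dd, smul_eq_mul, mul_comm]
  congr 1
  rw [ee, EuclideanSpace.inner_single_left]; simp

lemma laplace_T (D : SmoothDomain n) {U : Lsp D} (hU : U ∈ HH D) {σ : ℝ}
    (hE : ∀ ψ : E → ℝ, ContDiff ℝ 1 ψ → inner ℝ U (jL D ψ) = σ * inner ℝ (P0 D U) (jL D ψ))
    {ψ : E → ℝ} (hψ : ψ ∈ TT D.carrier) :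
    ∑ k, inner ℝ U (e1 D (dd k (dd k ψ))) = (1 - σ) * inner ℝ U (e1 D ψ) := by
  have h1 : ContDiff ℝ 1 ψ := hψ.1.of_le (by norm_cast)
  have h := hE ψ h1
  rw [P0_symm, P0_jL_e1 D h1, jL_split D hψ.1, inner_add_right, inner_sum] at h
  have h2 : ∑ k, inner ℝ U (e2 D k (dd k ψ)) = - ∑ k, inner ℝ U (e1 D (dd k (dd k ψ))) := by
    rw [← Finset.sum_neg_distrib]
    exact Finset.sum_congr rfl fun k _ => ibp D hU (dd_mem hψ) k
  rw [h2] at h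
  linarith

lemma TT_mono {O O' : Set E} (h : O ⊆ O') : TT O ≤ TT O' := fun _ hψ => ⟨hψ.1, hψ.2.1, hψ.2.2.trans h⟩

set_option maxHeartbeats 1000000 in
theorem local_reg (hn : 0 < n) (D : SmoothDomain n) {U : Lsp D} (hU : U ∈ HH D) {σ : ℝ}
    (hE : ∀ ψ : E → ℝ, ContDiff ℝ 1 ψ → inner ℝ U (jL D ψ) = σ * inner ℝ (P0 D U) (jL D ψ))
    {x0 : E} (hx0 : x0 ∈ closure D.carrier) :
    ∃ V : Set E, IsOpen V ∧ x0 ∈ V ∧ ∀ w : List (Fin n), ∃ C, ∀ ψ ∈ TT (D.carrier ∩ V),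
      |inner ℝ U (e1 D (w.foldr dd ψ))| ≤ C * ‖e1 D ψ‖ := by
  obtain ⟨i, F, V, b, δ₁, hδ₁, hVo, hxV, hb, hbi, hy⟩ := exists_flow hn D hx0
  obtain ⟨δ₂, hδ₂, N, hN, hN0, hNH, hNd⟩ := F.orbit hU hE
  refine ⟨V, hVo, hxV, ?_⟩
  set O := D.carrier ∩ V with hO
  let b' : Fin n → SmA n := fun j => if j = i then 1 else ⟨b j, hb j⟩
  have hb'i : b' i = 1 := if_pos rfl
  have hb'V : ∀ j, ∀ x ∈ V, (b' j).1 x = b j x := fun j x hx => by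
    by_cases hj : j = i
    · subst hj; rw [hb'i, hbi x hx]; rfl
    · simp [b', hj]
  let X := ellOf D O i b' hb'i
  set δ := min δ₁ δ₂ with hδ
  have hδ0 : 0 < δ := lt_min hδ₁ hδ₂
  have hB1 : Metric.ball (0 : E) δ ⊆ Metric.ball 0 δ₁ := Metric.ball_subset_ball (min_le_left _ _)
  have hB2 : Metric.ball (0 : E) δ ⊆ Metric.ball 0 δ₂ := Metric.ball_subset_ball (min_le_right _ _)
  have hOD : O ⊆ D.carrier := inter_subset_left
  -- derivative identity
  have key : ∀ h ∈ Metric.ball (0 : E) δ, ∀ (ψ : TT O) (j : Fin n),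
      fderiv ℝ (fun h => (inner ℝ (N h) (e1 D ψ.1) : ℝ)) h (ee j) = inner ℝ (N h) (e1 D (X.Y j ψ).1) := by
    intro h hh ψ j
    have hc : Continuous ψ.1 := ψ.2.1.continuous
    have h1 : HasFDerivAt (fun h => innerSL ℝ (e1 D ψ.1) (P0 D (N h)))
        ((innerSL ℝ (e1 D ψ.1)).comp (F.Wc h (N h))) h :=
      (innerSL ℝ (e1 D ψ.1)).hasFDerivAt.comp h (hNd h (hB2 hh))
    have h2 : (fun h => (inner ℝ (N h) (e1 D ψ.1) : ℝ)) = fun h => innerSL ℝ (e1 D ψ.1) (P0 D (N h)) := by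
      ext h
      rw [innerSL_apply_apply, real_inner_comm (P0 D (N h)), P0_e1 D hc]
    have h3 : F.Wc h (N h) (ee j) = F.Wh j h (N h) := by
      rw [FlowD.Wc_apply, _root_.sum_apply, Finset.sum_eq_single j]
      · simp [ee]
      · intro k _ hk; simp [ee, hk]
      · simp
    rw [h2, h1.fderiv, ContinuousLinearMap.comp_apply, h3, innerSL_apply_apply, real_inner_comm, Wh_e1 F j h hc]
    have hbc : Continuous fun x => (b' j).1 x * ψ.1 x := (SmA_cd (b' j)).continuous.mul hc
    have hbm : (b' j).1 * ψ.1 ∈ TT O := mu_mem (SmA_cd (b' j)) ψ.2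
    have h4 : lpL D (cmc fun x => i2 (ψ.1 x • F.yf j h x)) = e2 D j ψ.1 - e2 D i ((b' j).1 * ψ.1) := by
      have c1 : Continuous fun x => (i2 (ψ.1 x • ee j) : JJ n) :=
        i2c (ψ := fun x => ψ.1 x • ee j) (hc.smul continuous_const)
      have c2 : Continuous fun x => (i2 (((b' j).1 * ψ.1) x • ee i) : JJ n) :=
        i2c (ψ := fun x => ((b' j).1 * ψ.1) x • ee i) (hbc.smul continuous_const)
      have c3 : Continuous fun x => (i2 (ψ.1 x • F.yf j h x) : JJ n) :=
        i2c (ψ := fun x => ψ.1 x • F.yf j h x) (hc.smul (slice_cont (F.yf_sm j) h))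
      rw [e2, e2, ← map_sub]
      congr 1
      ext1 x
      rw [ContinuousMap.sub_apply, cmc_coe c1, cmc_coe c2, cmc_coe c3, ← map_sub]
      change i2 (ψ.1 x • F.yf j h x) = _
      congr 1
      by_cases hx : x ∈ V
      · rw [hy h (hB1 hh) x hx j, ← hb'V j x hx, Pi.mul_apply, smul_sub, smul_smul, mul_comm]
      · have : ψ.1 x = 0 := image_eq_zero_of_notMem_tsupport fun h => hx (ψ.2.2.2 h).2
        rw [Pi.mul_apply, this]; simp
    rw [h4, inner_sub_right, ibp D (hNH h (hB2 hh)) (TT_mono hOD ψ.2), ibp D (hNH h (hB2 hh)) (TT_mono hOD hbm)]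
    have h5 : (X.Y j ψ).1 = dd i ((b' j).1 * ψ.1) - dd j ψ.1 := rfl
    rw [h5, e1_sub D (dd_cd hbm.1).continuous (dd_cd ψ.2.1).continuous, inner_sub_right]
    ring
  have words : ∀ (a : Module.End ℝ (TT O)) (e : TT O → Lsp D),
      (∀ h ∈ Metric.ball (0 : E) δ, ∀ ψ, (inner ℝ (N h) (e1 D (a ψ).1) : ℝ) = inner ℝ (N h) (e ψ)) →
      ∀ w, ∃ G : E → Lsp D, ContDiffOn ℝ (⊤ : ℕ∞) G (Metric.ball 0 δ) ∧ ∀ h ∈ Metric.ball (0 : E) δ, ∀ ψ,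
        (inner ℝ (N h) (e1 D (X.Yw w (a ψ)).1) : ℝ) = inner ℝ (G h) (e ψ) := by
    intro a e hbase w
    induction w with
    | nil => exact ⟨N, hN.mono hB2, hbase⟩
    | cons j w ih =>
      obtain ⟨G, hG, hGe⟩ := ih
      refine ⟨fun h => fderiv ℝ G h (ee j), (hG.fderiv_of_isOpen Metric.isOpen_ball
        (m := (⊤ : ℕ∞)) (by exact_mod_cast le_top)).clm_apply contDiffOn_const, fun h hh ψ => ?_⟩
      have e1' : X.Yw (j :: w) (a ψ) = X.Y j (X.Yw w (a ψ)) := by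
        rw [Ell.Yw, List.map_cons, List.prod_cons]; rfl
      rw [e1', ← key h hh]
      have hev : (fun h => (inner ℝ (N h) (e1 D (X.Yw w (a ψ)).1) : ℝ)) =ᶠ[𝓝 h]
          fun h => innerSL ℝ (e ψ) (G h) := by
        filter_upwards [Metric.isOpen_ball.mem_nhds hh] with h' hh'
        rw [hGe h' hh', innerSL_apply_apply, real_inner_comm]
      have hGd : DifferentiableAt ℝ G h :=
        (hG.differentiableOn (by simp)).differentiableAt (Metric.isOpen_ball.mem_nhds hh)
      have hd : HasFDerivAt (fun h => innerSL ℝ (e ψ) (G h)) ((innerSL ℝ (e ψ)).comp (fderiv ℝ G h)) h :=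
        (innerSL ℝ (e ψ)).hasFDerivAt.comp h hGd.hasFDerivAt
      rw [hev.fderiv_eq, hd.fderiv, ContinuousLinearMap.comp_apply, innerSL_apply_apply, real_inner_comm]
  let T : TT O →ₗ[ℝ] ℝ :=
    { toFun := fun ψ => inner ℝ U (e1 D ψ.1)
      map_add' := fun φ ψ => by
        rw [← inner_add_right, ← e1_add D φ.2.1.continuous ψ.2.1.continuous]; rfl
      map_smul' := fun c ψ => by
        rw [RingHom.id_apply, smul_eq_mul, ← inner_smul_right,
          ← e1_smul D c ψ.2.1.continuous]; rfl }
  have h0 : (0 : E) ∈ Metric.ball (0 : E) δ := Metric.mem_ball_self hδ0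
  have h1 : ∀ w, T ∘ₗ X.Yw w ∈ BdS X.N := fun w => by
    obtain ⟨G, -, hG⟩ := words 1 (fun ψ => e1 D ψ.1) (fun h _ ψ => rfl) w
    refine ⟨‖G 0‖, fun ψ => ?_⟩
    have e := hG 0 h0 ψ
    rw [hN0] at e
    change |(inner ℝ U (e1 D (X.Yw w ψ).1) : ℝ)| ≤ ‖G 0‖ * ‖e1 D ψ.1‖
    have e' : (inner ℝ U (e1 D (X.Yw w ψ).1) : ℝ) = inner ℝ (G 0) (e1 D ψ.1) := e
    rw [e']
    exact abs_real_inner_le_norm _ _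
  have h2 : ∀ w k, (T ∘ₗ X.Yw w) ∘ₗ X.Dd k ∈ BdS X.N := fun w k => by
    obtain ⟨G, -, hG⟩ := words (ddT k) (fun ψ => - e2 D k ψ.1) (fun h hh ψ => by
      rw [inner_neg_right, ibp D (hNH h (hB2 hh)) (TT_mono hOD ψ.2), neg_neg]; rfl) w
    obtain ⟨C, hC0, hC⟩ := e2_bd D k
    refine ⟨‖G 0‖ * C, fun ψ => ?_⟩
    have e := hG 0 h0 ψ
    rw [hN0] at e
    change |(inner ℝ U (e1 D (X.Yw w (ddT k ψ)).1) : ℝ)| ≤ ‖G 0‖ * C * ‖e1 D ψ.1‖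
    rw [e]
    refine (abs_real_inner_le_norm _ _).trans ?_
    rw [norm_neg, mul_assoc]
    exact mul_le_mul_of_nonneg_left (hC _ ψ.2.1.continuous) (norm_nonneg _)
  have h3 : T ∘ₗ (∑ k, X.Dd k * X.Dd k) = (1 - σ) • T := by
    rw [Ell.lcomp_sum]
    ext ψ
    rw [LinearMap.sum_apply]
    exact laplace_T D hU hE (TT_mono hOD ψ.2)
  intro w
  obtain ⟨C, hC⟩ := Ell.elliptic h1 h2 h3 w
  refine ⟨C, fun ψ hψ => ?_⟩
  have e : ∀ w : List (Fin n), (X.Dw w ⟨ψ, hψ⟩).1 = w.foldr dd ψ := by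
    intro w
    induction w with
    | nil => rfl
    | cons j w ih =>
      have : X.Dw (j :: w) = ddT j * X.Dw w := by rw [Ell.Dw, List.map_cons, List.prod_cons]; rfl
      rw [this, List.foldr_cons, ← ih]; rfl
  have := hC ⟨ψ, hψ⟩
  rw [← e w]
  exact this
end D3c
end BNS

namespace BNS
open MeasureTheory Set Filter Topology
section D4a
variable {n : ℕ}
local notation "E" => EuclideanSpace ℝ (Fin n)

lemma cd_of_dd {m : ℕ} {G : E → ℝ} (h1 : Differentiable ℝ G) (h2 : ∀ k, ContDiff ℝ m (dd k G)) :
    ContDiff ℝ (m + 1 : ℕ) G := by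
  have e : fderiv ℝ G = fun z => ∑ k, dd k G z • (EuclideanSpace.proj k : E →L[ℝ] ℝ) := by
    ext z v
    rw [clm_eq_sum, _root_.sum_apply]
    exact Finset.sum_congr rfl fun k _ => by simp [dd, mul_comm]
  have : ContDiff ℝ ((m : WithTop ℕ∞) + 1) G := by
    rw [contDiff_succ_iff_fderiv]
    refine ⟨h1, fun h => by simp at h, ?_⟩
    rw [e]
    exact ContDiff.sum fun k _ => (h2 k).smul contDiff_const
  exact_mod_cast this

/-- averaging operators -/
noncomputable def Cop {P : Type} [MeasurableSpace P] (ν : Measure P) (a : P → ℝ) (σ : P → E) (ψ : E → ℝ) (z : E) : ℝ :=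
  ∫ p, a p * ψ (z - σ p) ∂ν

lemma bdd_cs {F : Type*} [NormedAddCommGroup F] {ψ : E → F} (h : Continuous ψ) (hc : HasCompactSupport ψ) :
    ∃ C, 0 ≤ C ∧ ∀ x, ‖ψ x‖ ≤ C := by
  obtain ⟨C, hC⟩ := hc.exists_bound_of_continuous h
  exact ⟨C, (norm_nonneg _).trans (hC 0), hC⟩

lemma Cop_meas {P : Type} [MeasurableSpace P] {ν : Measure P} {σ : P → E}
    (hσ : Measurable σ) {F : Type} [NormedAddCommGroup F] [SecondCountableTopologyEither E F]
    {ψ : E → F} (h : Continuous ψ) (z : E) : AEStronglyMeasurable (fun p => ψ (z - σ p)) ν :=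
  h.aestronglyMeasurable.comp_measurable (μ := ν) (f := fun p => z - σ p) (measurable_const.sub hσ)

lemma Cop_int {P : Type} [MeasurableSpace P] {ν : Measure P} {a : P → ℝ} {σ : P → E} (ha : Integrable a ν)
    (hσ : Measurable σ) {ψ : E → ℝ} (h : Continuous ψ) (hc : HasCompactSupport ψ) (z : E) :
    Integrable (fun p => a p * ψ (z - σ p)) ν := by
  obtain ⟨C, _, hC⟩ := bdd_cs h hc
  exact ha.mul_bdd (c := C) (Cop_meas hσ h z) (Eventually.of_forall fun p => hC _)

lemma Cop_has {P : Type} [MeasurableSpace P] {ν : Measure P} {a : P → ℝ} {σ : P → E} (ha : Integrable a ν)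
    (hσ : Measurable σ) {ψ : E → ℝ} (h : ContDiff ℝ (⊤ : ℕ∞) ψ) (hc : HasCompactSupport ψ) (z : E) :
    HasFDerivAt (Cop ν a σ ψ) (∫ p, a p • fderiv ℝ ψ (z - σ p) ∂ν) z ∧
      Integrable (fun p => a p • fderiv ℝ ψ (z - σ p)) ν := by
  have hf : Continuous (fderiv ℝ ψ) := h.continuous_fderiv (by simp)
  obtain ⟨C, hC0, hC⟩ := bdd_cs hf (hc.fderiv ℝ)
  have hm : ∀ z, AEStronglyMeasurable (fun p => a p • fderiv ℝ ψ (z - σ p)) ν := fun z =>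
    ha.1.smul (Cop_meas hσ hf z)
  have hb : ∀ z, ∀ p, ‖a p • fderiv ℝ ψ (z - σ p)‖ ≤ |a p| * C := fun z p => by
    rw [norm_smul, Real.norm_eq_abs]; exact mul_le_mul_of_nonneg_left (hC _) (abs_nonneg _)
  have hbi : Integrable (fun p => |a p| * C) ν := ha.abs.mul_const C
  refine ⟨?_, hbi.mono' (hm z) (Eventually.of_forall (hb z))⟩
  refine hasFDerivAt_integral_of_dominated_of_fderiv_le (bound := fun p => |a p| * C) (s := univ)
    (F' := fun z p => a p • fderiv ℝ ψ (z - σ p)) univ_mem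
    (Eventually.of_forall fun z => (Cop_int ha hσ h.continuous hc z).1)
    (Cop_int ha hσ h.continuous hc z) (hm z) (Eventually.of_forall fun p z _ => hb z p) hbi
    (Eventually.of_forall fun p z _ => ?_)
  have h1 : HasFDerivAt (fun z => ψ (z - σ p)) (fderiv ℝ ψ (z - σ p)) z := by
    have := (cdd h (z - σ p)).hasFDerivAt.comp z ((hasFDerivAt_id z).sub_const (σ p))
    rw [ContinuousLinearMap.comp_id] at this
    exact this
  exact h1.const_mul (a p)

lemma Cop_dd {P : Type} [MeasurableSpace P] {ν : Measure P} {a : P → ℝ} {σ : P → E} (ha : Integrable a ν)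
    (hσ : Measurable σ) {ψ : E → ℝ} (h : ContDiff ℝ (⊤ : ℕ∞) ψ) (hc : HasCompactSupport ψ) (k : Fin n) :
    dd k (Cop ν a σ ψ) = Cop ν a σ (dd k ψ) := by
  ext z
  obtain ⟨h1, h2⟩ := Cop_has ha hσ h hc z
  rw [dd, h1.fderiv, ContinuousLinearMap.integral_apply h2]
  rfl

lemma dd_hc {ψ : E → ℝ} (hc : HasCompactSupport ψ) (k : Fin n) : HasCompactSupport (dd k ψ) :=
  hc.mono' ((subset_tsupport _).trans dd_supp)

lemma Cop_cd {P : Type} [MeasurableSpace P] {ν : Measure P} {a : P → ℝ} {σ : P → E} (ha : Integrable a ν)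
    (hσ : Measurable σ) {ψ : E → ℝ} (h : ContDiff ℝ (⊤ : ℕ∞) ψ) (hc : HasCompactSupport ψ) :
    ContDiff ℝ (⊤ : ℕ∞) (Cop ν a σ ψ) := by
  refine contDiff_infty.2 fun m => ?_
  induction m generalizing ψ with
  | zero =>
    have : Continuous (Cop ν a σ ψ) := continuous_iff_continuousAt.2 fun z =>
      (Cop_has ha hσ h hc z).1.continuousAt
    exact_mod_cast contDiff_zero.2 this
  | succ m ih =>
    refine cd_of_dd (fun z => (Cop_has ha hσ h hc z).1.differentiableAt) fun k => ?_
    rw [Cop_dd ha hσ h hc k]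
    exact ih (dd_cd h) (dd_hc hc k)

open scoped Pointwise in
lemma Cop_mem {P : Type} [MeasurableSpace P] {ν : Measure P} {a : P → ℝ} {σ : P → E} (ha : Integrable a ν)
    (hσ : Measurable σ) {K O O' : Set E} (hK : IsCompact K) (haK : ∀ p, a p ≠ 0 → σ p ∈ K)
    (hO : ∀ x ∈ O', ∀ s ∈ K, x + s ∈ O) {ψ : E → ℝ} (hψ : ψ ∈ TT O') : Cop ν a σ ψ ∈ TT O := by
  have hcomp : IsCompact (tsupport ψ + K) := hψ.2.1.isCompact.add hK
  have hs : Function.support (Cop ν a σ ψ) ⊆ tsupport ψ + K := by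
    intro z hz
    by_contra hcon
    apply hz
    refine integral_eq_zero_of_ae (Eventually.of_forall fun p => ?_)
    by_cases hp : a p = 0
    · simp [hp]
    · have : ψ (z - σ p) = 0 := by
        refine image_eq_zero_of_notMem_tsupport fun hm => hcon ?_
        exact ⟨z - σ p, hm, σ p, haK p hp, by simp⟩
      simp [this]
  have hts : tsupport (Cop ν a σ ψ) ⊆ tsupport ψ + K := closure_minimal hs hcomp.isClosed
  refine ⟨Cop_cd ha hσ hψ.1 hψ.2.1, hcomp.of_isClosed_subset (isClosed_tsupport _) hts, ?_⟩
  intro z hz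
  obtain ⟨x, hx, s, hs, rfl⟩ := hts hz
  exact hO x (hψ.2.2 hx) s hs

noncomputable def aA (ℓ : ℝ) (M : ℕ) (η : E → ℝ) (p : E × ℝ) : ℝ := η p.1 * (Ioc 0 ℓ).indicator (fun t => t ^ M) p.2
noncomputable def Aop (ℓ : ℝ) (M : ℕ) (η : E → ℝ) (ψ : E → ℝ) (z : E) : ℝ :=
  Cop (volume : Measure (E × ℝ)) (aA ℓ M η) (fun p => p.2 • p.1) ψ z
noncomputable def Bop (ℓ : ℝ) (η : E → ℝ) (ψ : E → ℝ) (z : E) : ℝ :=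
  Cop (volume : Measure E) η (fun v => ℓ • v) ψ z

lemma ind_int (ℓ : ℝ) (M : ℕ) : Integrable ((Ioc 0 ℓ).indicator (fun t : ℝ => t ^ M)) volume := by
  rw [integrable_indicator_iff measurableSet_Ioc]
  exact ((continuous_pow M).integrableOn_Icc (a := 0) (b := ℓ)).mono_set Ioc_subset_Icc_self

lemma aA_int (ℓ : ℝ) (M : ℕ) {η : E → ℝ} (hη : Continuous η) (hc : HasCompactSupport η) :
    Integrable (aA ℓ M η) (volume : Measure (E × ℝ)) :=
  (hη.integrable_of_hasCompactSupport hc).mul_prod (ind_int ℓ M)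

lemma sig_meas : Measurable (fun p : E × ℝ => p.2 • p.1) := (continuous_snd.smul continuous_fst).measurable
lemma sig_meas' (ℓ : ℝ) : Measurable (fun v : E => ℓ • v) := (continuous_const_smul ℓ).measurable

lemma Aop_eq {ℓ : ℝ} (hℓ : 0 < ℓ) (M : ℕ) {η ψ : E → ℝ} (hη : Continuous η) (hc : HasCompactSupport η)
    (h : Continuous ψ) (hψ : HasCompactSupport ψ) (z : E) :
    Aop ℓ M η ψ z = ∫ v, η v * ∫ t in (0:ℝ)..ℓ, t ^ M * ψ (z - t • v) := by
  have hi := Cop_int (aA_int ℓ M hη hc) sig_meas h hψ z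
  rw [Aop, Cop, Measure.volume_eq_prod, integral_prod _ hi]
  refine integral_congr_ae (Eventually.of_forall fun v => ?_)
  change ∫ t, aA ℓ M η (v, t) * ψ (z - t • v) = η v * _
  rw [intervalIntegral.integral_of_le hℓ.le, ← integral_indicator measurableSet_Ioc, ← integral_const_mul]
  refine integral_congr_ae (Eventually.of_forall fun t => ?_)
  by_cases ht : t ∈ Ioc 0 ℓ <;> simp only [aA, indicator, ht, if_true, if_false] <;> ring

lemma line_deriv {ψ : E → ℝ} (h : ContDiff ℝ (⊤ : ℕ∞) ψ) (z v : E) (t : ℝ) :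
    HasDerivAt (fun t : ℝ => ψ (z - t • v)) (-∑ k, v k * dd k ψ (z - t • v)) t := by
  have h1 : HasDerivAt (fun t : ℝ => z - t • v) (-v) t := by
    have := ((hasDerivAt_id t).smul_const v).const_sub z
    simpa using this
  have h2 := (cdd h (z - t • v)).hasFDerivAt.comp_hasDerivAt t h1
  rw [map_neg, clm_eq_sum] at h2
  exact h2

lemma line_cont {ψ : E → ℝ} (h : Continuous ψ) (z v : E) : Continuous (fun t : ℝ => ψ (z - t • v)) :=
  h.comp (continuous_const.sub (continuous_id.smul continuous_const))

lemma line0 {ψ : E → ℝ} (h : ContDiff ℝ (⊤ : ℕ∞) ψ) (z v : E) (ℓ : ℝ) :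
    ∑ k, v k * ∫ t in (0:ℝ)..ℓ, t ^ 0 * dd k ψ (z - t • v) = ψ z - ψ (z - ℓ • v) := by
  have hk : ∀ k : Fin n, Continuous fun t : ℝ => dd k ψ (z - t • v) := fun k => line_cont (dd_cd h).continuous z v
  have hk' : ∀ k : Fin n, Continuous fun t : ℝ => v k * dd k ψ (z - t • v) := fun k =>
    continuous_const.mul (hk k)
  have hs : Continuous fun t : ℝ => ∑ k, v k * dd k ψ (z - t • v) := continuous_finsetSum _ fun k _ => hk' k
  have h1 := intervalIntegral.integral_eq_sub_of_hasDerivAt (a := 0) (b := ℓ)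
    (fun t _ => line_deriv h z v t) (hs.neg.intervalIntegrable _ _)
  rw [intervalIntegral.integral_neg, intervalIntegral.integral_finsetSum
    (fun k _ => (hk' k).intervalIntegrable _ _)] at h1
  simp only [intervalIntegral.integral_const_mul, zero_smul, sub_zero] at h1
  simp only [pow_zero, one_mul]
  linarith

lemma line1 {ψ : E → ℝ} (h : ContDiff ℝ (⊤ : ℕ∞) ψ) (z v : E) (ℓ : ℝ) (M : ℕ) :
    ∑ k, v k * ∫ t in (0:ℝ)..ℓ, t ^ (M + 1) * dd k ψ (z - t • v) =
      (M + 1) * (∫ t in (0:ℝ)..ℓ, t ^ M * ψ (z - t • v)) - ℓ ^ (M + 1) * ψ (z - ℓ • v) := by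
  have hk : ∀ k : Fin n, Continuous fun t : ℝ => dd k ψ (z - t • v) := fun k => line_cont (dd_cd h).continuous z v
  have hk' : ∀ k : Fin n, Continuous fun t : ℝ => v k * (t ^ (M + 1) * dd k ψ (z - t • v)) := fun k =>
    continuous_const.mul ((continuous_pow _).mul (hk k))
  have hp : Continuous fun t : ℝ => ((M : ℝ) + 1) * (t ^ M * ψ (z - t • v)) :=
    continuous_const.mul ((continuous_pow _).mul (line_cont h.continuous z v))
  have hs : Continuous fun t : ℝ => ∑ k, v k * (t ^ (M + 1) * dd k ψ (z - t • v)) :=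
    continuous_finsetSum _ fun k _ => hk' k
  have hd : ∀ t : ℝ, HasDerivAt (fun t : ℝ => t ^ (M + 1) * ψ (z - t • v))
      (((M : ℝ) + 1) * (t ^ M * ψ (z - t • v)) - ∑ k, v k * (t ^ (M + 1) * dd k ψ (z - t • v))) t := fun t => by
    have := (hasDerivAt_pow (M + 1) t).mul (line_deriv h z v t)
    refine this.congr_deriv ?_
    symm
    rw [mul_neg, Finset.mul_sum, sub_eq_add_neg]
    congr 1
    · push_cast; ring_nf
    · congr 1
      exact Finset.sum_congr rfl fun k _ => by ring
  have h1 := intervalIntegral.integral_eq_sub_of_hasDerivAt (a := 0) (b := ℓ)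
    (fun t _ => hd t) ((hp.sub hs).intervalIntegrable _ _)
  rw [intervalIntegral.integral_sub (hp.intervalIntegrable _ _) (hs.intervalIntegrable _ _),
    intervalIntegral.integral_finsetSum (fun k _ => (hk' k).intervalIntegrable _ _)] at h1
  simp only [intervalIntegral.integral_const_mul] at h1
  rw [zero_pow (Nat.succ_ne_zero M), zero_mul, sub_zero] at h1
  linarith

/-- multiplication of the profile by a coordinate -/
def xm (k : Fin n) (η : E → ℝ) : E → ℝ := fun v => η v * v k

lemma xm_cd {k : Fin n} {η : E → ℝ} (h : ContDiff ℝ (⊤ : ℕ∞) η) : ContDiff ℝ (⊤ : ℕ∞) (xm k η) :=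
  h.mul (EuclideanSpace.proj k : E →L[ℝ] ℝ).contDiff

lemma xm_supp {k : Fin n} {η : E → ℝ} : Function.support (xm k η) ⊆ Function.support η := fun v hv h => by
  apply hv; simp [xm, h]

lemma xm_hc {k : Fin n} {η : E → ℝ} (h : HasCompactSupport η) : HasCompactSupport (xm k η) :=
  h.mono xm_supp

lemma inner_cont (ℓ : ℝ) (M : ℕ) {ψ : E → ℝ} (h : Continuous ψ) (z : E) :
    Continuous fun v : E => ∫ t in (0:ℝ)..ℓ, t ^ M * ψ (z - t • v) := by
  refine intervalIntegral.continuous_parametric_intervalIntegral_of_continuous' ?_ _ _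
  exact ((continuous_snd.pow M).mul (h.comp (continuous_const.sub (continuous_snd.smul continuous_fst))))

lemma sum_Aop {ℓ : ℝ} (hℓ : 0 < ℓ) (M : ℕ) {η ψ : E → ℝ} (hη : ContDiff ℝ (⊤ : ℕ∞) η) (hc : HasCompactSupport η)
    (h : ContDiff ℝ (⊤ : ℕ∞) ψ) (hψ : HasCompactSupport ψ) (z : E) :
    ∑ k, Aop ℓ M (xm k η) (dd k ψ) z =
      ∫ v, η v * ∑ k, v k * ∫ t in (0:ℝ)..ℓ, t ^ M * dd k ψ (z - t • v) := by
  simp only [Finset.mul_sum]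
  rw [integral_finsetSum]
  · refine Finset.sum_congr rfl fun k _ => ?_
    rw [Aop_eq hℓ M (xm_cd hη).continuous (xm_hc hc) (dd_cd h).continuous (dd_hc hψ k)]
    exact integral_congr_ae (Eventually.of_forall fun v => by simp only [xm]; ring)
  · intro k _
    refine Continuous.integrable_of_hasCompactSupport (hη.continuous.mul ?_) (hc.mul_right)
    exact ((EuclideanSpace.proj k : E →L[ℝ] ℝ).continuous).mul (inner_cont ℓ M (dd_cd h).continuous z)

lemma start_id {ℓ : ℝ} (hℓ : 0 < ℓ) {η ψ : E → ℝ} (hη : ContDiff ℝ (⊤ : ℕ∞) η) (hc : HasCompactSupport η)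
    (h1 : ∫ v, η v = 1) (h : ContDiff ℝ (⊤ : ℕ∞) ψ) (hψ : HasCompactSupport ψ) (z : E) :
    ψ z = Bop ℓ η ψ z + ∑ k, Aop ℓ 0 (xm k η) (dd k ψ) z := by
  rw [sum_Aop hℓ 0 hη hc h hψ]
  simp only [line0 h, mul_sub]
  have hi := hη.continuous.integrable_of_hasCompactSupport (μ := volume) hc
  rw [integral_sub (hi.mul_const _) (Cop_int hi (sig_meas' ℓ) h.continuous hψ z), integral_mul_const, h1, Bop, Cop]
  ring

lemma step_id {ℓ : ℝ} (hℓ : 0 < ℓ) (M : ℕ) {η ψ : E → ℝ} (hη : ContDiff ℝ (⊤ : ℕ∞) η) (hc : HasCompactSupport η)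
    (h : ContDiff ℝ (⊤ : ℕ∞) ψ) (hψ : HasCompactSupport ψ) (z : E) :
    ((M : ℝ) + 1) * Aop ℓ M η ψ z = ℓ ^ (M + 1) * Bop ℓ η ψ z + ∑ k, Aop ℓ (M + 1) (xm k η) (dd k ψ) z := by
  rw [sum_Aop hℓ (M + 1) hη hc h hψ]
  have hi := hη.continuous.integrable_of_hasCompactSupport (μ := volume) hc
  have e : ∀ v, η v * ∑ k, v k * ∫ t in (0:ℝ)..ℓ, t ^ (M + 1) * dd k ψ (z - t • v) =
      ((M : ℝ) + 1) * (η v * ∫ t in (0:ℝ)..ℓ, t ^ M * ψ (z - t • v)) - ℓ ^ (M + 1) * (η v * ψ (z - ℓ • v)) := by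
    intro v; rw [line1 h]; ring
  simp only [e]
  rw [integral_sub, integral_const_mul, integral_const_mul, ← Aop_eq hℓ M hη.continuous hc h.continuous hψ, Bop, Cop]
  · ring
  · refine Integrable.const_mul ?_ _
    exact Continuous.integrable_of_hasCompactSupport (hη.continuous.mul (inner_cont ℓ M h.continuous z)) hc.mul_right
  · exact (Cop_int hi (sig_meas' ℓ) h.continuous hψ z).const_mul _

end D4a
end BNS

namespace BNS
open MeasureTheory Set Filter Topology
section D4b
variable {n : ℕ}
local notation "E" => EuclideanSpace ℝ (Fin n)

/-- homogeneous kernels -/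
noncomputable def kA {F : Type} [NormedAddCommGroup F] [NormedSpace ℝ F] (ℓ : ℝ) (M : ℕ) (η : E → F) (s : E) : F :=
  ∫ t in Ioc 0 ℓ, t ^ M • η (t⁻¹ • s)

lemma kA_meas {F : Type} [NormedAddCommGroup F] [NormedSpace ℝ F] {ν : Measure ℝ} (M : ℕ) {η : E → F}
    (hη : Continuous η) (s : E) : AEStronglyMeasurable (fun t : ℝ => t ^ M • η (t⁻¹ • s)) ν := by
  refine (continuous_pow M).aestronglyMeasurable.smul (hη.comp_aestronglyMeasurable ?_)
  exact (measurable_inv.stronglyMeasurable.smul_const s).aestronglyMeasurable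

lemma kA_bd {F : Type} [NormedAddCommGroup F] [NormedSpace ℝ F] (ℓ : ℝ) (M : ℕ) {η : E → F}
    (hη : Continuous η) (hc : HasCompactSupport η) :
    ∃ C, 0 ≤ C ∧ ∀ s : E, ∀ t ∈ Ioc 0 ℓ, ‖t ^ M • η (t⁻¹ • s)‖ ≤ C := by
  obtain ⟨C, hC0, hC⟩ := bdd_cs hη hc
  refine ⟨|ℓ| ^ M * C, by positivity, fun s t ht => ?_⟩
  rw [norm_smul, norm_pow, Real.norm_eq_abs]
  have : |t| ≤ |ℓ| := by rw [abs_of_pos ht.1]; exact ht.2.trans (le_abs_self _)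
  gcongr
  exact hC _

lemma kA_cd {m : ℕ} : ∀ {F : Type} [NormedAddCommGroup F] [NormedSpace ℝ F] [CompleteSpace F] (ℓ : ℝ) (M : ℕ) {η : E → F},
    ContDiff ℝ (⊤ : ℕ∞) η → HasCompactSupport η → ContDiff ℝ m (kA ℓ (M + m) η) := by
  induction m with
  | zero =>
    intro F _ _ _ ℓ M η hη hc
    have : Continuous (kA ℓ (M + 0) η) := by
      obtain ⟨C, _, hC⟩ := kA_bd ℓ M hη.continuous hc
      refine continuous_of_dominated (bound := fun _ => C) (fun s => kA_meas M hη.continuous s)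
        (fun s => (ae_restrict_iff' measurableSet_Ioc).2 (Eventually.of_forall fun t ht => hC s t ht))
        (integrable_const C) (Eventually.of_forall fun t => ?_)
      exact (hη.continuous.comp (continuous_const_smul t⁻¹)).const_smul (t ^ M)
    exact_mod_cast contDiff_zero.2 this
  | succ m ih =>
    intro F _ _ _ ℓ M η hη hc
    have hη' : ContDiff ℝ (⊤ : ℕ∞) (fderiv ℝ η) := hη.fderiv_right (m := (⊤ : ℕ∞)) (by exact_mod_cast le_top)
    have hd : ∀ s, HasFDerivAt (kA ℓ (M + (m + 1)) η) (kA ℓ (M + m) (fderiv ℝ η) s) s := by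
      intro s
      obtain ⟨C, _, hC⟩ := kA_bd ℓ (M + m) hη'.continuous (hc.fderiv ℝ)
      obtain ⟨C', _, hC'⟩ := kA_bd ℓ (M + (m + 1)) hη.continuous hc
      refine hasFDerivAt_integral_of_dominated_of_fderiv_le (bound := fun _ => C) (s := univ)
        (F' := fun s t => t ^ (M + m) • fderiv ℝ η (t⁻¹ • s)) univ_mem
        (Eventually.of_forall fun s => kA_meas _ hη.continuous s) ?_ (kA_meas _ hη'.continuous s)
        ((ae_restrict_iff' measurableSet_Ioc).2 (Eventually.of_forall fun t ht s _ => hC s t ht))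
        (integrable_const C)
        ((ae_restrict_iff' measurableSet_Ioc).2 (Eventually.of_forall fun t ht s _ => ?_))
      · exact Integrable.mono' (integrable_const C') (kA_meas _ hη.continuous s)
          ((ae_restrict_iff' measurableSet_Ioc).2 (Eventually.of_forall fun t ht => hC' s t ht))
      · have h1 : HasFDerivAt (fun s : E => t⁻¹ • s) (t⁻¹ • ContinuousLinearMap.id ℝ E) s :=
          (hasFDerivAt_id s).const_smul t⁻¹
        have h2 := ((hη.differentiable (by simp) (t⁻¹ • s)).hasFDerivAt.comp s h1).const_smul (t ^ (M + (m + 1)))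
        have e : t ^ (M + (m + 1)) • (fderiv ℝ η (t⁻¹ • s)).comp (t⁻¹ • ContinuousLinearMap.id ℝ E) =
            t ^ (M + m) • fderiv ℝ η (t⁻¹ • s) := by
          rw [ContinuousLinearMap.comp_smul, ContinuousLinearMap.comp_id, smul_smul]
          congr 1
          have := ht.1.ne'
          field_simp
          ring
        rw [e] at h2
        exact h2
    have : ContDiff ℝ ((m : WithTop ℕ∞) + 1) (kA ℓ (M + (m + 1)) η) := by
      rw [contDiff_succ_iff_fderiv]
      refine ⟨fun s => (hd s).differentiableAt, fun h => by simp at h, ?_⟩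
      rw [show fderiv ℝ (kA ℓ (M + (m + 1)) η) = kA ℓ (M + m) (fderiv ℝ η) from funext fun s => (hd s).fderiv]
      exact ih ℓ M hη' (hc.fderiv ℝ)
    exact_mod_cast this

lemma kA_hc {ℓ : ℝ} (M : ℕ) {η : E → ℝ} (hc : HasCompactSupport η) : HasCompactSupport (kA ℓ M η) := by
  obtain ⟨r, hr⟩ := hc.isCompact.isBounded.subset_closedBall 0
  refine HasCompactSupport.of_support_subset_isCompact (isCompact_closedBall (0 : E) (ℓ * r)) fun s hs => ?_
  by_contra hcon
  apply hs
  refine setIntegral_eq_zero_of_forall_eq_zero fun t ht => ?_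
  have : η (t⁻¹ • s) = 0 := by
    refine image_eq_zero_of_notMem_tsupport fun hm => hcon ?_
    have h1 := hr hm
    rw [mem_closedBall_zero_iff, norm_smul, norm_inv, Real.norm_eq_abs, abs_of_pos ht.1, inv_mul_le_iff₀ ht.1] at h1
    rw [mem_closedBall_zero_iff]
    have : 0 ≤ r := by
      by_contra h
      have := norm_nonneg s
      have := mul_neg_of_pos_of_neg ht.1 (not_le.1 h)
      linarith
    exact h1.trans (mul_le_mul_of_nonneg_right ht.2 this)
  rw [this, smul_zero]

lemma Aop_kernel {ℓ : ℝ} (M : ℕ) {η ψ : E → ℝ} (hη : Continuous η) (hc : HasCompactSupport η)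
    (h : Continuous ψ) (hψ : HasCompactSupport ψ) (z : E) :
    Aop ℓ (M + n) η ψ z = ∫ s, kA ℓ M η s * ψ (z - s) := by
  have hi := Cop_int (aA_int ℓ (M + n) hη hc) sig_meas h hψ z
  rw [Aop, Cop, Measure.volume_eq_prod, integral_prod_symm _ hi]
  have e1 : ∀ t : ℝ, ∫ v : E, aA ℓ (M + n) η (v, t) * ψ (z - t • v) =
      (Ioc 0 ℓ).indicator (fun t => ∫ s : E, t ^ M * η (t⁻¹ • s) * ψ (z - s)) t := by
    intro t
    by_cases ht : t ∈ Ioc 0 ℓ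
    · have h2 := Measure.integral_comp_smul (volume : Measure E) (fun s => t ^ (M + n) * η (t⁻¹ • s) * ψ (z - s)) t
      simp only [aA, indicator_of_mem ht]
      have ht' := ht.1.ne'
      simp only [smul_smul, inv_mul_cancel₀ ht', one_smul] at h2
      rw [finrank_euclideanSpace_fin, abs_of_pos (by have := ht.1; positivity), smul_eq_mul, ← integral_const_mul] at h2
      rw [← (integral_congr_ae (Eventually.of_forall fun v => by ring) :
        ∫ v : E, t ^ (M + n) * η v * ψ (z - t • v) = ∫ v : E, η v * t ^ (M + n) * ψ (z - t • v)), h2]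
      refine integral_congr_ae (Eventually.of_forall fun s => ?_)
      simp only
      rw [pow_add]
      field_simp
    · simp [aA, ht]
  simp only [e1]
  rw [integral_indicator measurableSet_Ioc]
  obtain ⟨C, hC0, hC⟩ := kA_bd ℓ M hη hc
  rw [integral_integral_swap]
  · refine integral_congr_ae (Eventually.of_forall fun s => ?_)
    simp only [kA, smul_eq_mul]
    rw [integral_mul_const]
  · have hp : Integrable (fun s => ψ (z - s)) (volume : Measure E) :=
      (h.integrable_of_hasCompactSupport hψ).comp_sub_left z
    have hb : Integrable (fun p : ℝ × E => C * ψ (z - p.2)) ((volume.restrict (Ioc 0 ℓ)).prod volume) :=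
      (integrable_const C).mul_prod hp
    refine hb.norm.mono' ?_ ?_
    · refine Measurable.aestronglyMeasurable ?_
      exact ((measurable_fst.pow_const M).mul (hη.measurable.comp (measurable_fst.inv.smul measurable_snd))).mul
        (h.measurable.comp (measurable_const.sub measurable_snd))
    · have : ∀ᵐ p ∂((volume.restrict (Ioc 0 ℓ)).prod (volume : Measure E)), p.1 ∈ Ioc 0 ℓ :=
        Measure.quasiMeasurePreserving_fst.ae (ae_restrict_mem measurableSet_Ioc)
      filter_upwards [this] with p hp
      have := hC p.2 p.1 hp
      simp only [Function.uncurry_def]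
      rw [norm_mul, norm_mul C, Real.norm_of_nonneg hC0]
      gcongr
      exact this

lemma Bop_kernel {ℓ : ℝ} (hℓ : 0 < ℓ) {η ψ : E → ℝ} (z : E) :
    Bop ℓ η ψ z = ∫ s, ((ℓ ^ n)⁻¹ * η (ℓ⁻¹ • s)) * ψ (z - s) := by
  have h2 := Measure.integral_comp_smul (volume : Measure E) (fun s => η (ℓ⁻¹ • s) * ψ (z - s)) ℓ
  simp only [smul_smul, inv_mul_cancel₀ hℓ.ne', one_smul] at h2
  rw [Bop, Cop, h2, finrank_euclideanSpace_fin, abs_of_pos (by positivity), smul_eq_mul, ← integral_const_mul]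
  exact integral_congr_ae (Eventually.of_forall fun s => by simp only; ring)

lemma inner_e1 (D : SmoothDomain n) (Z : Lsp D) {ψ : E → ℝ} (h : Continuous ψ) :
    inner ℝ Z (e1 D ψ) = ∫ x in D.carrier, p1 (Z x) * ψ x := by
  rw [L2.inner_def]
  refine integral_congr_ae ?_
  filter_upwards [lpL_coe D (cmc fun x => i1 (ψ x))] with x hx
  rw [e1, hx, jj_inner, cmc_coe (i1c h), p1_i1, p2_i1, inner_zero_right, add_zero]

lemma Lsp_int (D : SmoothDomain n) (Z : Lsp D) : Integrable (fun x => p1 (Z x)) (volume.restrict D.carrier) := by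
  have := (Lp.memLp Z).integrable (by norm_num)
  exact p1.integrable_comp this

/-- pairing with a convolution -/
lemma conv_rep (D : SmoothDomain n) (Z : Lsp D) {m : ℕ} {k : E → ℝ} (hk : ContDiff ℝ m k) (hc : HasCompactSupport k) :
    ∃ f : E → ℝ, ContDiff ℝ m f ∧ ∀ ψ G : E → ℝ, Continuous ψ → HasCompactSupport ψ → Continuous G →
      (∀ z, G z = ∫ s, k s * ψ (z - s)) → inner ℝ Z (e1 D G) = ∫ x, f x * ψ x := by
  have hZ := Lsp_int D Z
  set g : E → ℝ := D.carrier.indicator fun x => p1 (Z x) with hg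
  have hgi : Integrable g volume := (integrable_indicator_iff (meas_carrier D)).2 hZ
  set k' : E → ℝ := fun s => k (-s) with hk'
  have hk'c : HasCompactSupport k' := hc.comp_homeomorph (Homeomorph.neg E)
  have hk'd : ContDiff ℝ m k' := hk.comp contDiff_neg
  refine ⟨convolution g k' (ContinuousLinearMap.mul ℝ ℝ) volume, ?_, ?_⟩
  · exact_mod_cast hk'c.contDiff_convolution_right (n := (m : ℕ∞)) (ContinuousLinearMap.mul ℝ ℝ) hgi.locallyIntegrable
      (by exact_mod_cast hk'd)
  · intro ψ G hψ hψc hG hGe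
    rw [inner_e1 D Z hG]
    have e : ∀ z, G z = ∫ x, k (z - x) * ψ x := fun z => by
      rw [hGe, ← integral_sub_left_eq_self (fun s => k s * ψ (z - s)) volume z]
      simp
    have hkb := bdd_cs hk.continuous hc
    obtain ⟨C, hC0, hC⟩ := hkb
    have hitg : Integrable (Function.uncurry fun z x : E => g z * (k (z - x) * ψ x)) (volume.prod volume) := by
      have h1 : Integrable (fun p : E × E => g p.1 * (C * ψ p.2)) (volume.prod volume) :=
        hgi.mul_prod ((hψ.integrable_of_hasCompactSupport hψc).const_mul C)
      refine h1.norm.mono' ?_ (Eventually.of_forall fun p => ?_)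
      · refine hgi.1.comp_fst.mul (Continuous.aestronglyMeasurable ?_)
        exact (hk.continuous.comp (continuous_fst.sub continuous_snd)).mul (hψ.comp continuous_snd)
      · simp only [Function.uncurry_def]
        rw [norm_mul, norm_mul, norm_mul (g p.1), norm_mul C, Real.norm_of_nonneg hC0]
        gcongr
        exact hC _
    calc ∫ x in D.carrier, p1 (Z x) * G x = ∫ z, g z * G z := by
          rw [← integral_indicator (meas_carrier D)]
          refine integral_congr_ae (Eventually.of_forall fun z => ?_)
          by_cases hz : z ∈ D.carrier <;> simp [hg, hz]
      _ = ∫ z, ∫ x, g z * (k (z - x) * ψ x) := by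
          refine integral_congr_ae (Eventually.of_forall fun z => ?_)
          simp only
          rw [e, integral_const_mul]
      _ = ∫ x, ∫ z, g z * (k (z - x) * ψ x) := integral_integral_swap hitg
      _ = _ := by
          refine integral_congr_ae (Eventually.of_forall fun x => ?_)
          simp only [convolution, ContinuousLinearMap.mul_apply', hk', neg_sub]
          rw [← integral_mul_const]
          exact integral_congr_ae (Eventually.of_forall fun z => by simp only; ring)

/-- Riesz representation of bounded functionals on test functions -/
lemma riesz_T (D : SmoothDomain n) {W : Type*} [AddCommGroup W] [Module ℝ W] (e : W →ₗ[ℝ] Lsp D) (T : W →ₗ[ℝ] ℝ) {C : ℝ}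
    (h : ∀ ψ, |T ψ| ≤ C * ‖e ψ‖) : ∃ Z : Lsp D, ∀ ψ, T ψ = inner ℝ Z (e ψ) := by
  have hker : LinearMap.ker e ≤ LinearMap.ker T := fun ψ hψ => by
    rw [LinearMap.mem_ker] at hψ ⊢
    have := h ψ
    rw [hψ, norm_zero, mul_zero] at this
    exact abs_nonpos_iff.1 this
  set f : LinearMap.range e →ₗ[ℝ] ℝ := ((LinearMap.ker e).liftQ T hker).comp e.quotKerEquivRange.symm.toLinearMap with hf
  have hfe : ∀ ψ, f ⟨e ψ, LinearMap.mem_range_self e ψ⟩ = T ψ := by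
    intro ψ
    have : e.quotKerEquivRange.symm ⟨e ψ, LinearMap.mem_range_self e ψ⟩ = (LinearMap.ker e).mkQ ψ := by
      rw [LinearEquiv.symm_apply_eq]; rfl
    simp only [hf, LinearMap.comp_apply, LinearEquiv.coe_coe, this]
    simp
  have hb : ∀ y, ‖f y‖ ≤ C * ‖y‖ := by
    rintro ⟨y, ψ, rfl⟩
    rw [hfe]; exact h ψ
  obtain ⟨g, hg, _⟩ := exists_extension_norm_eq _ (f.mkContinuous C hb)
  refine ⟨(InnerProductSpace.toDual ℝ (Lsp D)).symm g, fun ψ => ?_⟩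
  rw [InnerProductSpace.toDual_symm_apply, ← hfe ψ]
  exact (hg ⟨e ψ, LinearMap.mem_range_self e ψ⟩).symm

end D4b
end BNS

namespace BNS
open MeasureTheory Set Filter Topology
section D4c
variable {n : ℕ}
local notation "E" => EuclideanSpace ℝ (Fin n)

lemma fold_cd {f : E → ℝ} (w : List (Fin n)) (hf : ContDiff ℝ (⊤ : ℕ∞) f) : ContDiff ℝ (⊤ : ℕ∞) (w.foldr dd f) := by
  induction w with
  | nil => exact hf
  | cons k w ih => exact dd_cd ih

lemma dd_add {k : Fin n} {f g : E → ℝ} (hf : ContDiff ℝ (⊤ : ℕ∞) f) (hg : ContDiff ℝ (⊤ : ℕ∞) g) :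
    dd k (f + g) = dd k f + dd k g := by
  ext x
  rw [dd, fderiv_add (cdd hf x) (cdd hg x)]; rfl

lemma dd_smul {k : Fin n} {f : E → ℝ} (c : ℝ) (hf : ContDiff ℝ (⊤ : ℕ∞) f) : dd k (c • f) = c • dd k f := by
  ext x
  rw [dd, fderiv_const_smul (cdd hf x)]; rfl

/-- derivative functionals -/
noncomputable def fU (D : SmoothDomain n) (U : Lsp D) (w : List (Fin n)) (ψ : E → ℝ) : ℝ :=
  inner ℝ U (e1 D (w.foldr dd ψ))

lemma fold_add {f g : E → ℝ} (w : List (Fin n)) (hf : ContDiff ℝ (⊤ : ℕ∞) f) (hg : ContDiff ℝ (⊤ : ℕ∞) g) :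
    w.foldr dd (f + g) = w.foldr dd f + w.foldr dd g := by
  induction w with
  | nil => rfl
  | cons k w ih => simp only [List.foldr_cons, ih]; exact dd_add (fold_cd w hf) (fold_cd w hg)

lemma fold_smul {f : E → ℝ} (c : ℝ) (w : List (Fin n)) (hf : ContDiff ℝ (⊤ : ℕ∞) f) :
    w.foldr dd (c • f) = c • w.foldr dd f := by
  induction w with
  | nil => rfl
  | cons k w ih => simp only [List.foldr_cons, ih]; exact dd_smul c (fold_cd w hf)

lemma fU_add (D : SmoothDomain n) (U : Lsp D) (w : List (Fin n)) {f g : E → ℝ} (hf : ContDiff ℝ (⊤ : ℕ∞) f)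
    (hg : ContDiff ℝ (⊤ : ℕ∞) g) : fU D U w (f + g) = fU D U w f + fU D U w g := by
  rw [fU, fold_add w hf hg, e1_add D (fold_cd w hf).continuous (fold_cd w hg).continuous, inner_add_right]; rfl

lemma fU_smul (D : SmoothDomain n) (U : Lsp D) (w : List (Fin n)) (c : ℝ) {f : E → ℝ} (hf : ContDiff ℝ (⊤ : ℕ∞) f) :
    fU D U w (c • f) = c * fU D U w f := by
  rw [fU, fold_smul c w hf, e1_smul D c (fold_cd w hf).continuous, inner_smul_right]; rfl

lemma fU_sum (D : SmoothDomain n) (U : Lsp D) (w : List (Fin n)) {ι : Type} (s : Finset ι) {f : ι → E → ℝ}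
    (hf : ∀ i, ContDiff ℝ (⊤ : ℕ∞) (f i)) : fU D U w (∑ i ∈ s, f i) = ∑ i ∈ s, fU D U w (f i) := by
  classical
  induction s using Finset.induction_on with
  | empty =>
    have := fU_smul D U w 0 (contDiff_const (c := (0:ℝ)) : ContDiff ℝ (⊤ : ℕ∞) fun _ : E => (0:ℝ))
    rw [zero_smul, zero_mul] at this
    simpa using this
  | insert a s ha ih =>
    have hs : ContDiff ℝ (⊤ : ℕ∞) (∑ i ∈ s, f i) := by
      have : ContDiff ℝ (⊤ : ℕ∞) (fun x => ∑ i ∈ s, f i x) := ContDiff.sum fun i _ => hf i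
      convert this using 1
      ext x; simp
    rw [Finset.sum_insert ha, Finset.sum_insert ha, fU_add D U w (hf a) hs, ih]

/-- functionals represented by a `C^m` density -/
def Rep (m : ℕ) (O : Set (EuclideanSpace ℝ (Fin n))) (S : (EuclideanSpace ℝ (Fin n) → ℝ) → ℝ) : Prop :=
  ∃ f : E → ℝ, ContDiff ℝ m f ∧ ∀ ψ ∈ TT O, S ψ = ∫ x, f x * ψ x

lemma Rep.int {m : ℕ} {f ψ : E → ℝ} (hf : ContDiff ℝ m f) {O : Set E} (hψ : ψ ∈ TT O) :
    Integrable (fun x => f x * ψ x) volume :=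
  (hf.continuous.mul hψ.1.continuous).integrable_of_hasCompactSupport hψ.2.1.mul_left

lemma Rep.add {m : ℕ} {O : Set E} {S T : (E → ℝ) → ℝ} (hS : Rep m O S) (hT : Rep m O T) :
    Rep m O (fun ψ => S ψ + T ψ) := by
  obtain ⟨f, hf, h1⟩ := hS
  obtain ⟨g, hg, h2⟩ := hT
  refine ⟨fun x => f x + g x, hf.add hg, fun ψ hψ => ?_⟩
  simp only
  rw [h1 ψ hψ, h2 ψ hψ, ← integral_add (Rep.int hf hψ) (Rep.int hg hψ)]
  exact integral_congr_ae (Eventually.of_forall fun x => by simp only; ring)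

lemma Rep.smul {m : ℕ} {O : Set E} {S : (E → ℝ) → ℝ} (c : ℝ) (hS : Rep m O S) : Rep m O (fun ψ => c * S ψ) := by
  obtain ⟨f, hf, h1⟩ := hS
  refine ⟨fun x => c * f x, contDiff_const.mul hf, fun ψ hψ => ?_⟩
  simp only
  rw [h1 ψ hψ, ← integral_const_mul]
  exact integral_congr_ae (Eventually.of_forall fun x => by simp only; ring)

lemma Rep.sum {m : ℕ} {O : Set E} {ι : Type} (s : Finset ι) {S : ι → (E → ℝ) → ℝ} (hS : ∀ i, Rep m O (S i)) :
    Rep m O (fun ψ => ∑ i ∈ s, S i ψ) := by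
  classical
  induction s using Finset.induction_on with
  | empty => exact ⟨fun _ => 0, contDiff_const, fun ψ _ => by simp⟩
  | insert a s ha ih => simp only [Finset.sum_insert ha]; exact (hS a).add ih

lemma Rep.congr {m : ℕ} {O : Set E} {S T : (E → ℝ) → ℝ} (hS : Rep m O S) (h : ∀ ψ ∈ TT O, T ψ = S ψ) : Rep m O T := by
  obtain ⟨f, hf, h1⟩ := hS
  exact ⟨f, hf, fun ψ hψ => (h ψ hψ).trans (h1 ψ hψ)⟩

/-- bounded derivative functionals have an `L²` density -/
lemma fU_riesz (D : SmoothDomain n) (U : Lsp D) (w : List (Fin n)) {O : Set E} {C : ℝ}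
    (h : ∀ ψ ∈ TT O, |fU D U w ψ| ≤ C * ‖e1 D ψ‖) : ∃ Z : Lsp D, ∀ ψ ∈ TT O, fU D U w ψ = inner ℝ Z (e1 D ψ) := by
  let e : TT O →ₗ[ℝ] Lsp D :=
    { toFun := fun ψ => e1 D ψ.1
      map_add' := fun φ ψ => e1_add D φ.2.1.continuous ψ.2.1.continuous
      map_smul' := fun c ψ => e1_smul D c ψ.2.1.continuous }
  let T : TT O →ₗ[ℝ] ℝ :=
    { toFun := fun ψ => fU D U w ψ.1
      map_add' := fun φ ψ => fU_add D U w φ.2.1 ψ.2.1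
      map_smul' := fun c ψ => fU_smul D U w c ψ.2.1 }
  obtain ⟨Z, hZ⟩ := riesz_T D e T (C := C) (fun ψ => h ψ.1 ψ.2)
  exact ⟨Z, fun ψ hψ => hZ ⟨ψ, hψ⟩⟩

section core
variable (D : SmoothDomain n) (U : Lsp D) {O O' : Set (EuclideanSpace ℝ (Fin n))} {ℓ ε : ℝ} {e : EuclideanSpace ℝ (Fin n)}

lemma coneK (ℓ ε : ℝ) (e : E) : IsCompact ((fun p : ℝ × E => p.1 • p.2) '' (Icc 0 ℓ ×ˢ Metric.closedBall e ε)) :=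
  (isCompact_Icc.prod (isCompact_closedBall e ε)).image (continuous_fst.smul continuous_snd)

lemma Aop_mem (hO : ∀ x ∈ O', ∀ t ∈ Icc 0 ℓ, ∀ v ∈ Metric.closedBall e ε, x + t • v ∈ O) (M : ℕ) {η ψ : E → ℝ}
    (hη : Continuous η) (hc : HasCompactSupport η) (hs : Function.support η ⊆ Metric.closedBall e ε)
    (hψ : ψ ∈ TT O') : Aop ℓ M η ψ ∈ TT O := by
  refine Cop_mem (aA_int ℓ M hη hc) sig_meas (coneK ℓ ε e) ?_ ?_ hψ
  · rintro ⟨v, t⟩ hp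
    have h1 : η v ≠ 0 := left_ne_zero_of_mul hp
    have h2 : t ∈ Ioc 0 ℓ := by
      by_contra h; exact right_ne_zero_of_mul hp (by simp [h])
    exact ⟨(t, v), ⟨⟨h2.1.le, h2.2⟩, hs h1⟩, rfl⟩
  · rintro x hx _ ⟨⟨t, v⟩, ⟨ht, hv⟩, rfl⟩
    exact hO x hx t ht v hv

lemma Bop_mem (hℓ : 0 < ℓ) (hO : ∀ x ∈ O', ∀ t ∈ Icc 0 ℓ, ∀ v ∈ Metric.closedBall e ε, x + t • v ∈ O) {η ψ : E → ℝ}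
    (hη : Continuous η) (hc : HasCompactSupport η) (hs : Function.support η ⊆ Metric.closedBall e ε)
    (hψ : ψ ∈ TT O') : Bop ℓ η ψ ∈ TT O := by
  refine Cop_mem (hη.integrable_of_hasCompactSupport hc) (sig_meas' ℓ) (coneK ℓ ε e) ?_ ?_ hψ
  · intro v hv
    exact ⟨(ℓ, v), ⟨⟨hℓ.le, le_rfl⟩, hs hv⟩, rfl⟩
  · rintro x hx _ ⟨⟨t, v⟩, ⟨ht, hv⟩, rfl⟩
    exact hO x hx t ht v hv

lemma rep_B (hb : ∀ w, ∃ C, ∀ ψ ∈ TT O, |fU D U w ψ| ≤ C * ‖e1 D ψ‖) (hℓ : 0 < ℓ)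
    (hO : ∀ x ∈ O', ∀ t ∈ Icc 0 ℓ, ∀ v ∈ Metric.closedBall e ε, x + t • v ∈ O) (m : ℕ) (w : List (Fin n)) {η : E → ℝ}
    (hη : ContDiff ℝ (⊤ : ℕ∞) η) (hc : HasCompactSupport η) (hs : Function.support η ⊆ Metric.closedBall e ε) :
    Rep m O' (fun ψ => fU D U w (Bop ℓ η ψ)) := by
  obtain ⟨C, hC⟩ := hb w
  obtain ⟨Z, hZ⟩ := fU_riesz D U w hC
  have hk : ContDiff ℝ m (fun s : E => (ℓ ^ n)⁻¹ * η (ℓ⁻¹ • s)) :=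
    contDiff_const.mul ((hη.of_le (by exact_mod_cast le_top)).comp (contDiff_const_smul ℓ⁻¹))
  have hkc : HasCompactSupport (fun s : E => (ℓ ^ n)⁻¹ * η (ℓ⁻¹ • s)) :=
    (hc.comp_homeomorph (Homeomorph.smulOfNeZero ℓ⁻¹ (inv_ne_zero hℓ.ne'))).mul_left
  obtain ⟨f, hf, h⟩ := conv_rep D Z hk hkc
  refine ⟨f, hf, fun ψ hψ => ?_⟩
  have hm := Bop_mem hℓ hO hη.continuous hc hs hψ
  simp only
  rw [hZ _ hm]
  exact h ψ _ hψ.1.continuous hψ.2.1 hm.1.continuous fun z => Bop_kernel hℓ z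

lemma rep_A (hb : ∀ w, ∃ C, ∀ ψ ∈ TT O, |fU D U w ψ| ≤ C * ‖e1 D ψ‖) (hℓ : 0 < ℓ)
    (hO : ∀ x ∈ O', ∀ t ∈ Icc 0 ℓ, ∀ v ∈ Metric.closedBall e ε, x + t • v ∈ O) (m : ℕ) (j : ℕ) :
    ∀ (M : ℕ) (w : List (Fin n)) (η : E → ℝ), m + n ≤ M + j →
    ContDiff ℝ (⊤ : ℕ∞) η → HasCompactSupport η → Function.support η ⊆ Metric.closedBall e ε →
    Rep m O' (fun ψ => fU D U w (Aop ℓ M η ψ)) := by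
  induction j with
  | zero =>
    intro M w η hM hη hc hs
    obtain ⟨M', rfl⟩ : ∃ M', M = M' + m + n := ⟨M - (m + n), by omega⟩
    obtain ⟨C, hC⟩ := hb w
    obtain ⟨Z, hZ⟩ := fU_riesz D U w hC
    obtain ⟨f, hf, h⟩ := conv_rep D Z (kA_cd ℓ M' hη hc) (kA_hc (ℓ := ℓ) (M' + m) hc)
    refine ⟨f, hf, fun ψ hψ => ?_⟩
    have hm := Aop_mem hO (M' + m + n) hη.continuous hc hs hψ
    simp only
    rw [hZ _ hm]
    exact h ψ _ hψ.1.continuous hψ.2.1 hm.1.continuous fun z =>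
      Aop_kernel (M' + m) hη.continuous hc hψ.1.continuous hψ.2.1 z
  | succ j ih =>
    intro M w η hM hη hc hs
    have h1 := (rep_B D U hb hℓ hO m w hη hc hs).smul (ℓ ^ (M + 1))
    have h2 := Rep.sum Finset.univ fun k : Fin n =>
      ih (M + 1) (w ++ [k]) (xm k η) (by omega) (xm_cd hη) (xm_hc hc) (xm_supp.trans hs)
    refine ((h1.add h2).smul ((M : ℝ) + 1)⁻¹).congr fun ψ hψ => ?_
    have hA := fun k : Fin n => Aop_mem hO (M + 1) (xm_cd (k := k) hη).continuous (xm_hc hc) (xm_supp.trans hs) hψ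
    have hB := Bop_mem hℓ hO hη.continuous hc hs hψ
    have hA0 := Aop_mem hO M hη.continuous hc hs hψ
    have hAk : ∀ k : Fin n, Aop ℓ (M + 1) (xm k η) (dd k ψ) = dd k (Aop ℓ (M + 1) (xm k η) ψ) := fun k =>
      (Cop_dd (aA_int ℓ (M + 1) (xm_cd hη).continuous (xm_hc hc)) sig_meas hψ.1 hψ.2.1 k).symm
    have e0 : ((M : ℝ) + 1) • Aop ℓ M η ψ = ℓ ^ (M + 1) • Bop ℓ η ψ + ∑ k, dd k (Aop ℓ (M + 1) (xm k η) ψ) := by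
      ext z
      simp only [Pi.smul_apply, Pi.add_apply, smul_eq_mul, Finset.sum_apply, ← hAk]
      exact step_id hℓ M hη hc hψ.1 hψ.2.1 z
    have e1 := congrArg (fU D U w) e0
    have hsum : ContDiff ℝ (⊤ : ℕ∞) (∑ k, dd k (Aop ℓ (M + 1) (xm k η) ψ)) := by
      have : ContDiff ℝ (⊤ : ℕ∞) (fun x => ∑ k, dd k (Aop ℓ (M + 1) (xm k η) ψ) x) :=
        ContDiff.sum fun k _ => dd_cd (hA k).1
      convert this using 1
      ext x; simp
    rw [fU_smul D U w _ hA0.1, fU_add D U w (f := ℓ ^ (M + 1) • Bop ℓ η ψ) ((TT O).smul_mem _ hB).1 hsum, fU_smul D U w _ hB.1,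
      fU_sum D U w _ fun k => dd_cd (hA k).1] at e1
    have hw : ∀ k : Fin n, fU D U (w ++ [k]) (Aop ℓ (M + 1) (xm k η) ψ) = fU D U w (dd k (Aop ℓ (M + 1) (xm k η) ψ)) :=
      fun k => by rw [fU, fU, List.foldr_append]; rfl
    simp only [hw]
    rw [← e1]
    have : (M : ℝ) + 1 ≠ 0 := by positivity
    field_simp

lemma rep_core (hb : ∀ w, ∃ C, ∀ ψ ∈ TT O, |fU D U w ψ| ≤ C * ‖e1 D ψ‖) (hℓ : 0 < ℓ) (hε : 0 < ε)
    (hO : ∀ x ∈ O', ∀ t ∈ Icc 0 ℓ, ∀ v ∈ Metric.closedBall e ε, x + t • v ∈ O) (m : ℕ) :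
    Rep m O' (fun ψ => inner ℝ U (e1 D ψ)) := by
  let β : ContDiffBump e := ⟨ε / 2, ε, by positivity, by linarith⟩
  set η : E → ℝ := β.normed volume with hηd
  have hη : ContDiff ℝ (⊤ : ℕ∞) η := β.contDiff_normed
  have hc : HasCompactSupport η := β.hasCompactSupport_normed
  have hs : Function.support η ⊆ Metric.closedBall e ε := by
    rw [hηd, β.support_normed_eq]; exact Metric.ball_subset_closedBall
  have h1 : ∫ v, η v = 1 := β.integral_normed
  have hB := rep_B D U hb hℓ hO m [] hη hc hs
  have hA := Rep.sum Finset.univ fun k : Fin n =>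
    rep_A D U hb hℓ hO m (m + n) 0 [k] (xm k η) (by omega) (xm_cd hη) (xm_hc hc) (xm_supp.trans hs)
  refine (hB.add hA).congr fun ψ hψ => ?_
  have hA := fun k : Fin n => Aop_mem hO 0 (xm_cd (k := k) hη).continuous (xm_hc hc) (xm_supp.trans hs) hψ
  have hBm := Bop_mem hℓ hO hη.continuous hc hs hψ
  have hAk : ∀ k : Fin n, Aop ℓ 0 (xm k η) (dd k ψ) = dd k (Aop ℓ 0 (xm k η) ψ) := fun k =>
    (Cop_dd (aA_int ℓ 0 (xm_cd hη).continuous (xm_hc hc)) sig_meas hψ.1 hψ.2.1 k).symm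
  have e0 : ψ = Bop ℓ η ψ + ∑ k, dd k (Aop ℓ 0 (xm k η) ψ) := by
    ext z
    simp only [Pi.add_apply, Finset.sum_apply, ← hAk]
    exact start_id hℓ hη hc h1 hψ.1 hψ.2.1 z
  have e1 := congrArg (fU D U []) e0
  have hsum : ContDiff ℝ (⊤ : ℕ∞) (∑ k, dd k (Aop ℓ 0 (xm k η) ψ)) := by
    have : ContDiff ℝ (⊤ : ℕ∞) (fun x => ∑ k, dd k (Aop ℓ 0 (xm k η) ψ) x) :=
      ContDiff.sum fun k _ => dd_cd (hA k).1
    convert this using 1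
    ext x; simp
  rw [fU_add D U [] hBm.1 hsum, fU_sum D U [] _ fun k => dd_cd (hA k).1] at e1
  exact e1
end core

/-- pointwise form on a neighbourhood -/
lemma rep_ae (D : SmoothDomain n) (U : Lsp D) {O : Set E} (hO : IsOpen O) (hOD : O ⊆ D.carrier) {m : ℕ}
    (h : Rep m O (fun ψ => inner ℝ U (e1 D ψ))) :
    ∃ f : E → ℝ, ContDiff ℝ m f ∧ ∀ᵐ x, x ∈ O → p1 (U x) = f x := by
  obtain ⟨f, hf, h1⟩ := h
  refine ⟨f, hf, ?_⟩
  have hi : IntegrableOn (fun x => p1 (U x)) D.carrier := Lsp_int D U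
  have := hO.ae_eq_zero_of_integral_contDiff_smul_eq_zero (μ := volume) (f := fun x => p1 (U x) - f x)
    ((hi.mono_set hOD).locallyIntegrableOn.sub (hf.continuous.locallyIntegrable.locallyIntegrableOn _)) ?_
  · filter_upwards [this] with x hx hxO
    exact sub_eq_zero.1 (hx hxO)
  · intro g hg hgc hgs
    have hψ : g ∈ TT O := ⟨hg, hgc, hgs⟩
    have h2 := h1 g hψ
    simp only at h2
    rw [inner_e1 D U hg.continuous, ← integral_indicator (meas_carrier D)] at h2
    have hg1 : (fun x => D.carrier.indicator (fun x => p1 (U x) * g x) x) = fun x => g x * D.carrier.indicator (fun x => p1 (U x)) x := by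
      ext x
      by_cases hx : x ∈ D.carrier <;> simp [hx, mul_comm]
    have hg2 : (fun x => g x • (p1 (U x) - f x)) = fun x => D.carrier.indicator (fun x => p1 (U x) * g x) x - f x * g x := by
      ext x
      by_cases hx : x ∈ D.carrier
      · simp [hx]; ring
      · have : g x = 0 := image_eq_zero_of_notMem_tsupport fun hm => hx (hOD (hgs hm))
        simp [hx, this]
    rw [hg2, integral_sub, h2, sub_self]
    · refine Integrable.congr ?_ (Eventually.of_forall fun x => (congrFun hg1 x).symm)
      obtain ⟨C, _, hC⟩ := bdd_cs hg.continuous hgc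
      exact ((integrable_indicator_iff (meas_carrier D)).2 hi).bdd_mul (c := C) hg.continuous.aestronglyMeasurable
        (Eventually.of_forall hC)
    · exact Rep.int hf hψ

/-- interior cone property -/
lemma cone_geom (D : SmoothDomain n) {x0 : E} (hx0 : x0 ∈ closure D.carrier) {V : Set E} (hV : IsOpen V) (hx : x0 ∈ V) :
    ∃ e : E, ∃ ε : ℝ, 0 < ε ∧ ∃ ℓ : ℝ, 0 < ℓ ∧ ∃ r : ℝ, 0 < r ∧ ∀ x ∈ D.carrier ∩ Metric.ball x0 r, ∀ t ∈ Icc 0 ℓ,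
      ∀ v ∈ Metric.closedBall e ε, x + t • v ∈ D.carrier ∩ V := by
  have key : ∃ e : E, ∃ ε > 0, ∃ δ > 0, ∀ x ∈ D.carrier ∩ Metric.ball x0 δ, ∀ t : ℝ, 0 ≤ t →
      ∀ v ∈ Metric.closedBall e ε, x + t • v ∈ Metric.ball x0 δ → x + t • v ∈ D.carrier := by
    by_cases hc : x0 ∈ D.carrier
    · obtain ⟨δ, hδ, h⟩ := Metric.isOpen_iff.1 D.isOpen x0 hc
      exact ⟨0, 1, one_pos, δ, hδ, fun x _ t _ v _ hm => h hm⟩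
    · have hf : x0 ∈ frontier D.carrier := ⟨hx0, by rwa [D.isOpen.interior_eq]⟩
      have hne := fderiv_rho_ne D ((mem_front D).1 hf)
      obtain ⟨e, he⟩ : ∃ e, fderiv ℝ D.defining x0 e < 0 := by
        by_contra! hcon
        apply hne
        ext v
        have h1 := hcon v
        have h2 := hcon (-v)
        rw [map_neg] at h2
        simp; linarith
      have hcont : Continuous fun p : E × E => fderiv ℝ D.defining p.1 p.2 :=
        (((rho_cd1 D).continuous_fderiv (by simp)).comp continuous_fst).clm_apply continuous_snd
      have hev : ∀ᶠ p : E × E in 𝓝 (x0, e), fderiv ℝ D.defining p.1 p.2 < 0 :=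
        hcont.continuousAt.eventually_lt continuousAt_const he
      obtain ⟨δ, hδ, h⟩ := Metric.eventually_nhds_iff_ball.1 hev
      refine ⟨e, δ / 2, by positivity, δ, hδ, fun x hx t ht v hv hm => ?_⟩
      have hx1 := (mem_carrier D).1 hx.1
      rw [mem_carrier]
      have hseg : ∀ y ∈ segment ℝ x (x + t • v), fderiv ℝ D.defining y (t • v) ≤ 0 := by
        intro y hy
        have hy' : y ∈ Metric.ball x0 δ := (convex_ball x0 δ).segment_subset hx.2 hm hy
        have := h (y, v) (by
          rw [← ball_prod_same]
          exact ⟨hy', Metric.closedBall_subset_ball (by linarith) hv⟩)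
        rw [map_smul, smul_eq_mul]
        exact mul_nonpos_of_nonneg_of_nonpos ht this.le
      obtain ⟨y, hy, hye⟩ := domain_mvt (f := D.defining) (f' := fun y => fderiv ℝ D.defining y)
        (s := segment ℝ x (x + t • v)) (x := x) (y := x + t • v)
        (fun y _ => (rho_diff D y).hasFDerivAt.hasFDerivWithinAt) (convex_segment _ _)
        (left_mem_segment ℝ _ _) (right_mem_segment ℝ _ _)
      have := hseg y hy
      rw [add_sub_cancel_left] at hye
      linarith [hx1]
  obtain ⟨e, ε, hε, δ, hδ, h⟩ := key
  obtain ⟨δ', hδ', hV'⟩ := Metric.isOpen_iff.1 hV x0 hx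
  set r := min δ δ' with hr
  have hrp : 0 < r := lt_min hδ hδ'
  have hN : 0 < ‖e‖ + ε := by positivity
  refine ⟨e, ε, hε, r / 2 / (‖e‖ + ε), by positivity, r / 2, by positivity, fun x hx t ht v hv => ?_⟩
  have hv' : ‖v‖ ≤ ‖e‖ + ε := by
    have h1 : ‖v - e‖ ≤ ε := by rwa [mem_closedBall_iff_norm] at hv
    calc ‖v‖ = ‖e + (v - e)‖ := by congr 1; abel
      _ ≤ _ := (norm_add_le _ _).trans (by linarith)
  have hm : x + t • v ∈ Metric.ball x0 r := by
    rw [mem_ball_iff_norm]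
    have h1 : ‖x - x0‖ < r / 2 := by rw [← mem_ball_iff_norm]; exact hx.2
    have h2 : ‖t • v‖ ≤ r / 2 := by
      rw [norm_smul, Real.norm_of_nonneg ht.1]
      calc t * ‖v‖ ≤ r / 2 / (‖e‖ + ε) * (‖e‖ + ε) := by gcongr; exact ht.2
        _ = r / 2 := by field_simp
    calc ‖x + t • v - x0‖ = ‖(x - x0) + t • v‖ := by congr 1; abel
      _ ≤ _ := norm_add_le _ _
      _ < r := by linarith
  refine ⟨h x ⟨hx.1, ?_⟩ t ht.1 v hv (Metric.ball_subset_ball (min_le_left _ _) hm), hV' (Metric.ball_subset_ball (min_le_right _ _) hm)⟩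
  exact Metric.ball_subset_ball (by linarith [min_le_left δ δ']) hx.2

/-- local smooth representatives up to the boundary -/
theorem local_rep (hn : 0 < n) (D : SmoothDomain n) {U : Lsp D} (hU : U ∈ HH D) {σ : ℝ}
    (hE : ∀ ψ : E → ℝ, ContDiff ℝ 1 ψ → inner ℝ U (jL D ψ) = σ * inner ℝ (P0 D U) (jL D ψ)) {x0 : E}
    (hx0 : x0 ∈ closure D.carrier) :
    ∃ r : ℝ, 0 < r ∧ ∀ m : ℕ, ∃ f : E → ℝ, ContDiff ℝ m f ∧ ∀ᵐ x, x ∈ D.carrier ∩ Metric.ball x0 r → p1 (U x) = f x := by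
  obtain ⟨V, hV, hx, hb⟩ := local_reg hn D hU hE hx0
  obtain ⟨e, ε, hε, ℓ, hℓ, r, hr, hO⟩ := cone_geom D hx0 hV hx
  exact ⟨r, hr, fun m => rep_ae D U (D.isOpen.inter Metric.isOpen_ball) inter_subset_left
    (rep_core D U hb hℓ hε hO m)⟩

end D4c
end BNS

namespace BNS
open MeasureTheory Set Filter Topology
section D5a
variable {n : ℕ}
local notation "E" => EuclideanSpace ℝ (Fin n)

lemma jens {P : Type} [MeasurableSpace P] {ν : Measure P} {a g : P → ℝ} (ha : Integrable a ν) (h0 : ∀ p, 0 ≤ a p)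
    (h1 : ∫ p, a p ∂ν = 1) (hg : Integrable (fun p => a p * g p) ν) (hg2 : Integrable (fun p => a p * g p ^ 2) ν) :
    (∫ p, a p * g p ∂ν) ^ 2 ≤ ∫ p, a p * g p ^ 2 ∂ν := by
  set T := ∫ p, a p * g p ∂ν with hT
  have h : 0 ≤ ∫ p, a p * (g p - T) ^ 2 ∂ν := integral_nonneg fun p => mul_nonneg (h0 p) (sq_nonneg _)
  have e : ∀ p, a p * (g p - T) ^ 2 = a p * g p ^ 2 - 2 * T * (a p * g p) + T ^ 2 * a p := fun p => by ring
  simp only [e] at h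
  have i12 : Integrable (fun p => a p * g p ^ 2 - 2 * T * (a p * g p)) ν := hg2.sub (hg.const_mul _)
  rw [integral_add i12 (ha.const_mul _), integral_sub hg2 (hg.const_mul _),
    integral_const_mul, integral_const_mul, h1, ← hT] at h
  linarith

lemma trans_pt {φ : E → ℝ} (hφ : ContDiff ℝ 1 φ) {r : ℝ} {v : E} (hv : ‖v‖ ≤ r) (x : E) :
    (φ x - φ (x - v)) ^ 2 ≤ r ^ 2 * ∫ t in Ioc (0:ℝ) 1, ‖fderiv ℝ φ (x - t • v)‖ ^ 2 := by
  have hc : Continuous (fderiv ℝ φ) := hφ.continuous_fderiv (by simp)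
  have hl : Continuous fun t : ℝ => x - t • v := continuous_const.sub (continuous_id.smul continuous_const)
  have hcg : Continuous fun t : ℝ => fderiv ℝ φ (x - t • v) v := (hc.comp hl).clm_apply continuous_const
  have hcn : Continuous fun t : ℝ => ‖fderiv ℝ φ (x - t • v)‖ ^ 2 := (hc.comp hl).norm.pow 2
  have hd : ∀ t : ℝ, HasDerivAt (fun t : ℝ => -φ (x - t • v)) (fderiv ℝ φ (x - t • v) v) t := fun t => by
    have h1 : HasDerivAt (fun t : ℝ => x - t • v) (-v) t := by
      have := ((hasDerivAt_id t).smul_const v).const_sub x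
      simpa using this
    have h2 := ((hφ.differentiable (by simp) (x - t • v)).hasFDerivAt.comp_hasDerivAt t h1).neg
    rw [map_neg, neg_neg] at h2
    exact h2
  have h1 := intervalIntegral.integral_eq_sub_of_hasDerivAt (a := 0) (b := 1) (fun t _ => hd t)
    (hcg.intervalIntegrable _ _)
  rw [intervalIntegral.integral_of_le zero_le_one] at h1
  simp only [one_smul, zero_smul, sub_zero] at h1
  have hio : ∀ g : ℝ → ℝ, Continuous g → IntegrableOn g (Ioc 0 1) := fun g hg =>
    (hg.integrableOn_Icc (a := 0) (b := 1)).mono_set Ioc_subset_Icc_self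
  have hcg2 : Continuous fun t : ℝ => (fderiv ℝ φ (x - t • v) v) ^ 2 := hcg.pow 2
  have hj := jens (ν := volume.restrict (Ioc (0:ℝ) 1)) (a := fun _ => 1) (g := fun t => fderiv ℝ φ (x - t • v) v)
    (integrable_const 1) (fun _ => zero_le_one) (by simp) (by simp only [one_mul]; exact hio _ hcg)
    (by simp only [one_mul]; exact hio _ hcg2)
  simp only [one_mul] at hj
  rw [h1] at hj
  rw [← integral_const_mul]
  calc (φ x - φ (x - v)) ^ 2 = (-φ (x - v) - -φ x) ^ 2 := by ring
    _ ≤ _ := hj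
    _ ≤ _ := by
      refine integral_mono (hio _ hcg2) (hio _ (continuous_const.mul hcn)) fun t => ?_
      have h3 := (fderiv ℝ φ (x - t • v)).le_opNorm v
      have h4 : |fderiv ℝ φ (x - t • v) v| ≤ r * ‖fderiv ℝ φ (x - t • v)‖ := by
        rw [mul_comm]; exact h3.trans (by gcongr)
      simp only
      rw [← mul_pow, ← sq_abs]
      gcongr

lemma trans_est (D : SmoothDomain n) {φ : E → ℝ} (hφ : ContDiff ℝ 1 φ) (hφc : HasCompactSupport φ) {r : ℝ} {A : Set E} (hAm : MeasurableSet A)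
    (hA : ∀ x ∈ A, ∀ w : E, ‖w‖ ≤ r → x - w ∈ D.carrier) (hAD : A ⊆ D.carrier) {v : E} (hv : ‖v‖ ≤ r) :
    ∫ x in A, (φ x - φ (x - v)) ^ 2 ≤ r ^ 2 * ∫ x in D.carrier, ‖fderiv ℝ φ x‖ ^ 2 := by
  have hr : 0 ≤ r := (norm_nonneg v).trans hv
  have hc : Continuous (fderiv ℝ φ) := hφ.continuous_fderiv (by simp)
  have hcg : Continuous fun x => ‖fderiv ℝ φ x‖ ^ 2 := hc.norm.pow 2
  have hgc : HasCompactSupport fun x => ‖fderiv ℝ φ x‖ ^ 2 := by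
    refine (hφc.fderiv ℝ).comp_left (g := fun l : E →L[ℝ] ℝ => ‖l‖ ^ 2) ?_
    simp
  have hgi := hcg.integrable_of_hasCompactSupport (μ := (volume : Measure E)) hgc
  obtain ⟨C, hC0, hC⟩ := bdd_cs hcg hgc
  obtain ⟨C', hC'0, hC'⟩ := bdd_cs hφ.continuous hφc
  haveI : IsFiniteMeasure (volume.restrict A) := isFiniteMeasure_restrict.2
    ((measure_mono hAD).trans_lt (vol_lt_top D)).ne
  have hj : Continuous fun p : E × ℝ => ‖fderiv ℝ φ (p.1 - p.2 • v)‖ ^ 2 :=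
    hcg.comp (continuous_fst.sub (continuous_snd.smul continuous_const))
  have hitg : Integrable (Function.uncurry fun (x : E) (t : ℝ) => ‖fderiv ℝ φ (x - t • v)‖ ^ 2)
      ((volume.restrict A).prod (volume.restrict (Ioc (0:ℝ) 1))) :=
    (integrable_const C).mono' hj.aestronglyMeasurable (Eventually.of_forall fun p => hC _)
  have h1 : ∫ x in A, (φ x - φ (x - v)) ^ 2 ≤
      ∫ x in A, r ^ 2 * ∫ t in Ioc (0:ℝ) 1, ‖fderiv ℝ φ (x - t • v)‖ ^ 2 := by
    refine integral_mono ?_ (hitg.integral_prod_left.const_mul _) fun x => trans_pt hφ hv x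
    have hcc : Continuous fun x => (φ x - φ (x - v)) ^ 2 :=
      (hφ.continuous.sub (hφ.continuous.comp (continuous_id.sub continuous_const))).pow 2
    refine (integrable_const ((C' + C') ^ 2)).mono' hcc.aestronglyMeasurable (Eventually.of_forall fun x => ?_)
    rw [norm_pow]
    gcongr
    exact (norm_sub_le _ _).trans (add_le_add (hC' _) (hC' _))
  refine h1.trans ?_
  rw [integral_const_mul, integral_integral_swap hitg]
  gcongr
  calc ∫ t in Ioc (0:ℝ) 1, ∫ x in A, ‖fderiv ℝ φ (x - t • v)‖ ^ 2
      ≤ ∫ t in Ioc (0:ℝ) 1, ∫ x in D.carrier, ‖fderiv ℝ φ x‖ ^ 2 := by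
        refine setIntegral_mono_on hitg.integral_prod_right (integrable_const _) measurableSet_Ioc fun t ht => ?_
        rw [← integral_indicator hAm, ← integral_indicator (meas_carrier D),
          ← integral_sub_right_eq_self (D.carrier.indicator fun x => ‖fderiv ℝ φ x‖ ^ 2) (t • v)]
        have hi2 : Integrable (D.carrier.indicator fun x => ‖fderiv ℝ φ x‖ ^ 2) volume := hgi.indicator (meas_carrier D)
        refine integral_mono ((hgi.comp_sub_right (t • v)).indicator hAm) (hi2.comp_sub_right (t • v)) fun x => ?_
        by_cases hx : x ∈ A
        · have : x - t • v ∈ D.carrier := hA x hx _ (by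
            rw [norm_smul, Real.norm_of_nonneg ht.1.le]
            calc t * ‖v‖ ≤ 1 * r := by gcongr; exact ht.2
              _ = r := one_mul r)
          simp only [indicator_of_mem hx, indicator_of_mem this]; exact le_rfl
        · simp only [indicator_of_notMem hx]
          exact indicator_nonneg (fun _ _ => sq_nonneg _) _
    _ = _ := by simp

/-- local averages -/
noncomputable def cvl (D : SmoothDomain n) (χ : E → ℝ) (W : Lsp D) (x : E) : ℝ := inner ℝ W (e1 D fun y => χ (x - y))

lemma cvl_eq (D : SmoothDomain n) {χ : E → ℝ} (h : Continuous χ) (W : Lsp D) (x : E) :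
    cvl D χ W x = ∫ y in D.carrier, p1 (W y) * χ (x - y) :=
  inner_e1 D W (h.comp (continuous_const.sub continuous_id))

lemma cvl_cont (D : SmoothDomain n) {χ : E → ℝ} (h : Continuous χ) (hc : HasCompactSupport χ) (W : Lsp D) :
    Continuous (cvl D χ W) := by
  obtain ⟨C, _, hC⟩ := bdd_cs h hc
  have hW := Lsp_int D W
  rw [show cvl D χ W = fun x => ∫ y in D.carrier, p1 (W y) * χ (x - y) from funext fun x => cvl_eq D h W x]
  refine continuous_of_dominated (bound := fun y => |p1 (W y)| * C) (fun x => ?_) (fun x => ?_) (hW.abs.mul_const C)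
    (Eventually.of_forall fun y => ?_)
  · exact hW.1.mul (h.comp (continuous_const.sub continuous_id)).aestronglyMeasurable
  · refine Eventually.of_forall fun y => ?_
    rw [norm_mul, Real.norm_eq_abs]
    gcongr
    exact hC _
  · exact continuous_const.mul (h.comp (continuous_id.sub continuous_const))

lemma cvl_bd (D : SmoothDomain n) {χ : E → ℝ} (h : Continuous χ) (hc : HasCompactSupport χ) :
    ∃ C, 0 ≤ C ∧ ∀ W x, |cvl D χ W x| ≤ ‖W‖ * C := by
  obtain ⟨C, hC0, hC⟩ := bdd_cs h hc
  refine ⟨√(volume.real D.carrier) * (‖(i1 : ℝ →L[ℝ] JJ n)‖ * C), by positivity, fun W x => ?_⟩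
  refine (abs_real_inner_le_norm _ _).trans ?_
  gcongr
  refine lpL_bound D _ (fun y _ => ?_) (by positivity)
  have hcy : Continuous fun y => χ (x - y) := h.comp (continuous_const.sub continuous_id)
  rw [cmc_coe (i1c hcy)]
  refine (i1.le_opNorm _).trans ?_
  gcongr
  exact hC _

lemma jL_p1 (D : SmoothDomain n) {φ : E → ℝ} (hφ : ContDiff ℝ 1 φ) :
    ∀ᵐ x ∂(volume.restrict D.carrier), p1 (jL D φ x) = φ x := by
  filter_upwards [lpL_coe D (cmc (jf φ))] with x hx
  rw [jL, hx, cmc_coe (jf_cont hφ), p1_jf]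

lemma avg_est (D : SmoothDomain n) {φ χ : E → ℝ} (hφ : ContDiff ℝ 1 φ) (hφc : HasCompactSupport φ) {r : ℝ} {A : Set E} (hAm : MeasurableSet A)
    (hA : ∀ x ∈ A, ∀ w : E, ‖w‖ ≤ r → x - w ∈ D.carrier) (hAD : A ⊆ D.carrier)
    (hχ : Continuous χ) (hχc : HasCompactSupport χ) (hχ0 : ∀ v, 0 ≤ χ v) (hχ1 : ∫ v, χ v = 1)
    (hχs : ∀ v, χ v ≠ 0 → ‖v‖ ≤ r) :
    ∫ x in A, φ x ^ 2 ≤ 2 * (∫ x in A, cvl D χ (jL D φ) x ^ 2) + 2 * (r ^ 2 * ∫ x in D.carrier, ‖fderiv ℝ φ x‖ ^ 2) := by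
  obtain ⟨C, hC0, hC⟩ := bdd_cs hφ.continuous hφc
  have hχi := hχ.integrable_of_hasCompactSupport (μ := (volume : Measure E)) hχc
  haveI : IsFiniteMeasure (volume.restrict A) := isFiniteMeasure_restrict.2
    ((measure_mono hAD).trans_lt (vol_lt_top D)).ne
  have hcv : ∀ x ∈ A, cvl D χ (jL D φ) x = ∫ v, χ v * φ (x - v) := by
    intro x hx
    have e1 : cvl D χ (jL D φ) x = ∫ y in D.carrier, φ y * χ (x - y) := by
      rw [cvl_eq D hχ]
      refine integral_congr_ae ?_
      filter_upwards [jL_p1 D hφ] with y hy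
      rw [hy]
    rw [e1, ← integral_indicator (meas_carrier D), ← integral_sub_left_eq_self (fun v => χ v * φ (x - v)) volume x]
    refine integral_congr_ae (Eventually.of_forall fun y => ?_)
    simp only [sub_sub_cancel]
    by_cases hy : y ∈ D.carrier
    · simp [hy, mul_comm]
    · have : χ (x - y) = 0 := by
        by_contra h
        exact hy (by simpa using hA x hx _ (hχs _ h))
      simp [hy, this]
  have hd : Continuous fun p : E × E => (φ p.1 - φ (p.1 - p.2)) ^ 2 :=
    ((hφ.continuous.comp continuous_fst).sub (hφ.continuous.comp (continuous_fst.sub continuous_snd))).pow 2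
  have hdb : ∀ p : E × E, (φ p.1 - φ (p.1 - p.2)) ^ 2 ≤ (C + C) ^ 2 := fun p => by
    rw [← sq_abs]
    gcongr
    exact (norm_sub_le _ _).trans (add_le_add (hC _) (hC _))
  have hitg : Integrable (Function.uncurry fun (x : E) (v : E) => χ v * (φ x - φ (x - v)) ^ 2)
      ((volume.restrict A).prod volume) := by
    have h1 : Integrable (fun p : E × E => (C + C) ^ 2 * χ p.2) ((volume.restrict A).prod volume) :=
      (integrable_const ((C + C) ^ 2)).mul_prod hχi
    refine h1.mono' ((hχ.comp continuous_snd).mul hd).aestronglyMeasurable (Eventually.of_forall fun p => ?_)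
    simp only [Function.uncurry_def]
    rw [Real.norm_of_nonneg (mul_nonneg (hχ0 _) (sq_nonneg _)), mul_comm]
    exact mul_le_mul_of_nonneg_right (hdb p) (hχ0 _)
  have hpt : ∀ x ∈ A, φ x ^ 2 ≤ 2 * cvl D χ (jL D φ) x ^ 2 + 2 * ∫ v, χ v * (φ x - φ (x - v)) ^ 2 := by
    intro x hx
    have hcx : Continuous fun v => φ x - φ (x - v) :=
      continuous_const.sub (hφ.continuous.comp (continuous_const.sub continuous_id))
    have i1 : Integrable (fun v => χ v * (φ x - φ (x - v))) volume :=
      (hχ.mul hcx).integrable_of_hasCompactSupport hχc.mul_right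
    have i2 : Integrable (fun v => χ v * (φ x - φ (x - v)) ^ 2) volume :=
      (hχ.mul (hcx.pow 2)).integrable_of_hasCompactSupport hχc.mul_right
    have i3 : Integrable (fun v => χ v * φ (x - v)) volume :=
      (hχ.mul (hφ.continuous.comp (continuous_const.sub continuous_id))).integrable_of_hasCompactSupport hχc.mul_right
    have hj := jens hχi hχ0 hχ1 i1 i2
    have e : ∫ v, χ v * (φ x - φ (x - v)) = φ x - cvl D χ (jL D φ) x := by
      rw [hcv x hx]
      simp only [mul_sub]
      rw [integral_sub (hχi.mul_const _) i3, integral_mul_const, hχ1, one_mul]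
    rw [e] at hj
    nlinarith [sq_nonneg (φ x - 2 * cvl D χ (jL D φ) x)]
  have iA1 : IntegrableOn (fun x => cvl D χ (jL D φ) x ^ 2) A := by
    obtain ⟨C', _, hC'⟩ := cvl_bd D hχ hχc
    refine (integrable_const ((‖jL D φ‖ * C') ^ 2)).mono' ((cvl_cont D hχ hχc _).pow 2).aestronglyMeasurable
      (Eventually.of_forall fun x => ?_)
    rw [norm_pow]
    gcongr
    exact hC' _ _
  have iA2 : IntegrableOn (fun x => φ x ^ 2) A := by
    refine (integrable_const (C ^ 2)).mono' (hφ.continuous.pow 2).aestronglyMeasurable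
      (Eventually.of_forall fun x => ?_)
    rw [norm_pow]
    gcongr
    exact hC _
  have iA3 : Integrable (fun x => ∫ v, χ v * (φ x - φ (x - v)) ^ 2) (volume.restrict A) := hitg.integral_prod_left
  have iA4 : Integrable (fun x => 2 * cvl D χ (jL D φ) x ^ 2 + 2 * ∫ v, χ v * (φ x - φ (x - v)) ^ 2) (volume.restrict A) :=
    (iA1.const_mul 2).add (iA3.const_mul 2)
  calc ∫ x in A, φ x ^ 2 ≤ ∫ x in A, (2 * cvl D χ (jL D φ) x ^ 2 + 2 * ∫ v, χ v * (φ x - φ (x - v)) ^ 2) :=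
        setIntegral_mono_on iA2 iA4 hAm hpt
    _ = 2 * (∫ x in A, cvl D χ (jL D φ) x ^ 2) + 2 * ∫ x in A, ∫ v, χ v * (φ x - φ (x - v)) ^ 2 := by
        rw [integral_add (iA1.const_mul 2) (iA3.const_mul 2), integral_const_mul, integral_const_mul]
    _ ≤ _ := by
        gcongr
        rw [integral_integral_swap hitg]
        calc ∫ v, ∫ x in A, χ v * (φ x - φ (x - v)) ^ 2
            ≤ ∫ v, χ v * (r ^ 2 * ∫ x in D.carrier, ‖fderiv ℝ φ x‖ ^ 2) := by
              refine integral_mono hitg.integral_prod_right (hχi.mul_const _) fun v => ?_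
              simp only
              rw [integral_const_mul]
              by_cases hv : χ v = 0
              · simp [hv]
              · exact mul_le_mul_of_nonneg_left (trans_est D hφ hφc hAm hA hAD (hχs v hv)) (hχ0 v)
          _ = _ := by rw [integral_mul_const, hχ1, one_mul]

lemma jL_sq (D : SmoothDomain n) {φ : E → ℝ} (hφ : ContDiff ℝ 1 φ) :
    ‖jL D φ‖ ^ 2 = ∫ x in D.carrier, (φ x ^ 2 + ‖fderiv ℝ φ x‖ ^ 2) := by
  rw [jL_norm_sq D hφ]
  refine integral_congr_ae (Eventually.of_forall fun x => ?_)
  simp only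
  rw [jj_norm, p1_jf, p2_jf, grad_norm]

lemma P0_jL_sq (D : SmoothDomain n) {φ : E → ℝ} (hφ : ContDiff ℝ 1 φ) :
    ‖P0 D (jL D φ)‖ ^ 2 = ∫ x in D.carrier, φ x ^ 2 := by
  rw [P0_jL D hφ, ← real_inner_self_eq_norm_sq, lpL_inner]
  refine integral_congr_ae (Eventually.of_forall fun x => ?_)
  simp only
  rw [cmc_coe (i1c hφ.continuous), jj_inner, p1_i1, p2_i1, inner_zero_left, add_zero, sq]

/-- compact cut-off does not change the jet -/
lemma jL_cut (D : SmoothDomain n) {φ : E → ℝ} (hφ : ContDiff ℝ 1 φ) :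
    ∃ φ' : E → ℝ, ContDiff ℝ 1 φ' ∧ HasCompactSupport φ' ∧ jL D φ' = jL D φ := by
  obtain ⟨R, hR⟩ := D.isBounded.subset_ball (0 : E)
  let β : ContDiffBump (0 : E) := ⟨|R| + 1, |R| + 2, by positivity, by linarith⟩
  have hβ : ContDiff ℝ 1 β := β.contDiff
  have h1 : ContDiff ℝ 1 (fun x => β x * φ x) := hβ.mul hφ
  refine ⟨fun x => β x * φ x, h1, β.hasCompactSupport.mul_right, ?_⟩
  have he : ∀ x ∈ D.carrier, (fun x => β x * φ x) =ᶠ[𝓝 x] φ := by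
    intro x hx
    filter_upwards [Metric.isOpen_ball.mem_nhds (hR hx)] with y hy
    rw [β.one_of_mem_closedBall, one_mul]
    exact Metric.ball_subset_closedBall (Metric.ball_subset_ball (by simp only [β]; linarith [le_abs_self R]) hy)
  apply Lp.ext
  filter_upwards [lpL_coe D (cmc (jf fun x => β x * φ x)), lpL_coe D (cmc (jf φ)), ae_carrier D] with x h2 h3 h4
  rw [jL, jL, h2, h3, cmc_coe (jf_cont h1), cmc_coe (jf_cont hφ), jj_ext (v := jf _ x) (w := jf φ x)]
  · rw [p1_jf, p1_jf]; exact (he x h4).eq_of_nhds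
  · rw [p2_jf, p2_jf, gradient, gradient, (he x h4).fderiv_eq]

/-- compactness estimate -/
lemma rellich_jet (D : SmoothDomain n) {ε : ℝ} (hε : 0 < ε) : ∃ χ : E → ℝ, Continuous χ ∧ HasCompactSupport χ ∧
    ∀ φ : E → ℝ, ContDiff ℝ 1 φ →
      ‖P0 D (jL D φ)‖ ^ 2 ≤ ε * ‖jL D φ‖ ^ 2 + 2 * ∫ x in D.carrier, cvl D χ (jL D φ) x ^ 2 := by
  obtain ⟨C, hC, ε₀, hε₀, hst⟩ := strip_est D
  set δ := min ε₀ (ε / (2 * C)) with hδ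
  have hδp : 0 < δ := lt_min hε₀ (by positivity)
  have hCδ : C * δ ≤ ε / 2 := by
    calc C * δ ≤ C * (ε / (2 * C)) := by gcongr; exact min_le_right _ _
      _ = ε / 2 := by field_simp
  set A : Set E := {x | D.defining x ≤ -δ} with hAd
  have hAcl : IsClosed A := isClosed_le (rho_cont D) continuous_const
  have hAD : A ⊆ D.carrier := fun x hx => by
    rw [hAd, Set.mem_setOf_eq] at hx
    rw [mem_carrier]; linarith
  have hAc : IsCompact A := (compact_clos D).of_isClosed_subset hAcl (hAD.trans subset_closure)
  obtain ⟨r₀, hr₀, hth⟩ := hAc.exists_cthickening_subset_open D.isOpen hAD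
  set r := min r₀ (√(ε / 4)) with hr
  have hrp : 0 < r := lt_min hr₀ (by positivity)
  have hr2 : r ^ 2 ≤ ε / 4 := by
    calc r ^ 2 ≤ √(ε / 4) ^ 2 := by gcongr; exact min_le_right _ _
      _ = _ := Real.sq_sqrt (by positivity)
  have hA : ∀ x ∈ A, ∀ w : E, ‖w‖ ≤ r → x - w ∈ D.carrier := fun x hx w hw => by
    refine hth (Metric.mem_cthickening_of_dist_le _ x _ _ hx ?_)
    rw [dist_eq_norm, sub_sub_cancel_left, norm_neg]
    exact hw.trans (min_le_left _ _)
  let β : ContDiffBump (0 : E) := ⟨r / 2, r, by positivity, by linarith⟩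
  refine ⟨β.normed volume, β.continuous_normed, β.hasCompactSupport_normed, fun φ₀ hφ₀ => ?_⟩
  obtain ⟨φ, hφ, hφc, he⟩ := jL_cut D hφ₀
  rw [← he]
  have hav := avg_est D hφ hφc hAcl.measurableSet hA hAD β.continuous_normed β.hasCompactSupport_normed
    (fun v => β.nonneg_normed v) β.integral_normed (fun v hv => by
      have : v ∈ Function.support (β.normed volume) := hv
      rw [β.support_normed_eq, mem_ball_zero_iff] at this
      exact this.le)
  have hs := hst δ hδp (min_le_left _ _) φ hφ
  set χ := β.normed (volume : Measure E) with hχ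
  rw [← jL_sq D hφ] at hs
  have hφ2 : IntegrableOn (fun x => φ x ^ 2) D.carrier := cont_intOn D (hφ.continuous.pow 2).continuousOn
  have hc2 : IntegrableOn (fun x => cvl D χ (jL D φ) x ^ 2) D.carrier :=
    cont_intOn D ((cvl_cont D β.continuous_normed β.hasCompactSupport_normed _).pow 2).continuousOn
  have hd2 : IntegrableOn (fun x => ‖fderiv ℝ φ x‖ ^ 2) D.carrier :=
    cont_intOn D ((hφ.continuous_fderiv (by simp)).norm.pow 2).continuousOn
  have hsplit : ∫ x in D.carrier, φ x ^ 2 = (∫ x in A, φ x ^ 2) +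
      ∫ x in {x | x ∈ D.carrier ∧ -δ < D.defining x}, φ x ^ 2 := by
    have hset : D.carrier = A ∪ {x | x ∈ D.carrier ∧ -δ < D.defining x} := by
      ext x
      simp only [mem_union, hAd, Set.mem_setOf_eq]
      constructor
      · intro h
        rcases le_or_gt (D.defining x) (-δ) with h' | h'
        · exact Or.inl h'
        · exact Or.inr ⟨h, h'⟩
      · rintro (h | h)
        · exact hAD h
        · exact h.1
    conv_lhs => rw [hset]
    refine setIntegral_union ?_ ?_ (hφ2.mono_set hAD) (hφ2.mono_set fun x hx => hx.1)
    · rw [Set.disjoint_left]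
      intro x hx hx'
      rw [hAd, Set.mem_setOf_eq] at hx
      exact absurd hx'.2 (not_lt.2 hx)
    · exact (meas_carrier D).inter (measurableSet_lt measurable_const (rho_cont D).measurable)
  have hm : ∫ x in A, cvl D χ (jL D φ) x ^ 2 ≤ ∫ x in D.carrier, cvl D χ (jL D φ) x ^ 2 :=
    setIntegral_mono_set hc2 (Eventually.of_forall fun x => sq_nonneg _) (HasSubset.Subset.eventuallyLE hAD)
  have hG : ∫ x in D.carrier, ‖fderiv ℝ φ x‖ ^ 2 ≤ ‖jL D φ‖ ^ 2 := by
    rw [jL_sq D hφ]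
    exact integral_mono hd2 (hφ2.add hd2) fun x => by simp only; nlinarith [sq_nonneg (φ x)]
  have hG0 : 0 ≤ ∫ x in D.carrier, ‖fderiv ℝ φ x‖ ^ 2 := integral_nonneg fun x => sq_nonneg _
  rw [P0_jL_sq D hφ, hsplit]
  have hN : 0 ≤ ‖jL D φ‖ ^ 2 := sq_nonneg _
  have h5 : C * δ * ‖jL D φ‖ ^ 2 ≤ ε / 2 * ‖jL D φ‖ ^ 2 := by gcongr
  have h6 : r ^ 2 * (∫ x in D.carrier, ‖fderiv ℝ φ x‖ ^ 2) ≤ ε / 4 * ‖jL D φ‖ ^ 2 := by gcongr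
  linarith

end D5a
end BNS

namespace BNS
open MeasureTheory Set Filter Topology
section D5b
variable {n : ℕ}
local notation "E" => EuclideanSpace ℝ (Fin n)

lemma weak_seq {X : Type*} [NormedAddCommGroup X] [InnerProductSpace ℝ X] [CompleteSpace X]
    [TopologicalSpace.SeparableSpace X] (x : ℕ → X) (hx : ∀ k, ‖x k‖ ≤ 1) :
    ∃ (U : X) (θ : ℕ → ℕ), StrictMono θ ∧ ‖U‖ ≤ 1 ∧
      ∀ v, Tendsto (fun k => inner ℝ (x (θ k)) v) atTop (𝓝 (inner ℝ U v)) := by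
  have hc := WeakDual.isSeqCompact_closedBall ℝ X 0 1
  obtain ⟨a, ha, θ, hθ, hl⟩ := hc (x := fun k => StrongDual.toWeakDual (InnerProductSpace.toDual ℝ X (x k))) (fun k => by
    rw [Set.mem_preimage, mem_closedBall_zero_iff]
    refine le_trans (le_of_eq ?_) (hx k)
    exact (InnerProductSpace.toDual ℝ X).norm_map (x k))
  rw [Set.mem_preimage, mem_closedBall_zero_iff] at ha
  refine ⟨(InnerProductSpace.toDual ℝ X).symm (WeakDual.toStrongDual a), θ, hθ, ?_, fun v => ?_⟩
  · rw [LinearIsometryEquiv.norm_map]; exact ha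
  · rw [InnerProductSpace.toDual_symm_apply]
    exact ((WeakDual.eval_continuous v).tendsto a).comp hl

lemma spectral_max {X : Type*} [NormedAddCommGroup X] [InnerProductSpace ℝ X] [CompleteSpace X]
    [TopologicalSpace.SeparableSpace X] (K : Submodule ℝ X) (hK : IsClosed (K : Set X)) (P : X →L[ℝ] X)
    (hP : ∀ x y, inner ℝ (P x) y = inner ℝ x (P y))
    (hcpt : ∀ W : ℕ → X, (∀ k, W k ∈ K) → (∀ k, ‖W k‖ ≤ 2) → (∀ v, Tendsto (fun k => inner ℝ (W k) v) atTop (𝓝 0)) →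
      Tendsto (fun k => inner ℝ (P (W k)) (W k)) atTop (𝓝 0))
    {v0 : X} (hv0 : v0 ∈ K) (hpos : 0 < inner ℝ (P v0) v0) :
    ∃ U ∈ K, ∃ M : ℝ, 0 < M ∧ U ≠ 0 ∧ (∀ V ∈ K, inner ℝ (P V) V ≤ M * ‖V‖ ^ 2) ∧
      ∀ V ∈ K, inner ℝ (P U) V = M * inner ℝ U V := by
  set S : Set ℝ := (fun V => inner ℝ (P V) V) '' {V | V ∈ K ∧ ‖V‖ ≤ 1} with hS
  have hbd : BddAbove S := by
    refine ⟨‖P‖, ?_⟩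
    rintro _ ⟨V, ⟨_, hV⟩, rfl⟩
    simp only
    calc inner ℝ (P V) V ≤ ‖P V‖ * ‖V‖ := real_inner_le_norm _ _
      _ ≤ ‖P‖ * ‖V‖ * ‖V‖ := by gcongr; exact P.le_opNorm V
      _ ≤ ‖P‖ * 1 * 1 := by gcongr
      _ = ‖P‖ := by ring
  have hne : S.Nonempty := ⟨_, ⟨0, ⟨K.zero_mem, by simp⟩, rfl⟩⟩
  set M := sSup S with hM
  have hscale : ∀ V ∈ K, inner ℝ (P V) V ≤ M * ‖V‖ ^ 2 := by
    intro V hV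
    by_cases h0 : V = 0
    · simp [h0]
    have hn : 0 < ‖V‖ := norm_pos_iff.2 h0
    have h1 : inner ℝ (P (‖V‖⁻¹ • V)) (‖V‖⁻¹ • V) ≤ M := le_csSup hbd ⟨_, ⟨K.smul_mem _ hV, by
      rw [norm_smul, norm_inv, norm_norm, inv_mul_cancel₀ hn.ne']⟩, rfl⟩
    rw [map_smul, real_inner_smul_left, real_inner_smul_right] at h1
    calc inner ℝ (P V) V = (‖V‖⁻¹ * (‖V‖⁻¹ * inner ℝ (P V) V)) * ‖V‖ ^ 2 := by field_simp
      _ ≤ M * ‖V‖ ^ 2 := by gcongr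
  have hMpos : 0 < M := by
    by_contra h
    have := hscale v0 hv0
    nlinarith [sq_nonneg ‖v0‖]
  obtain ⟨s, _, hs1, hs2⟩ := exists_seq_tendsto_sSup hne hbd
  choose V hV1 hV2 using hs2
  obtain ⟨U, θ, hθ, hU1, hUw⟩ := weak_seq V fun k => (hV1 k).2
  have hUK : U ∈ K := by
    have hcl : K.topologicalClosure = K := hK.submodule_topologicalClosure_eq
    rw [← hcl, ← Submodule.orthogonal_orthogonal_eq_closure, Submodule.mem_orthogonal']
    intro w hw
    refine tendsto_nhds_unique (hUw w) ?_
    have : (fun k => inner ℝ (V (θ k)) w) = fun _ => (0:ℝ) := funext fun k => (Submodule.mem_orthogonal K w).1 hw _ (hV1 _).1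
    rw [this]
    exact tendsto_const_nhds
  have hW := hcpt (fun k => V (θ k) - U) (fun k => K.sub_mem (hV1 _).1 hUK)
    (fun k => (norm_sub_le _ _).trans (by linarith [(hV1 (θ k)).2])) (fun v => by
      have := (hUw v).sub_const (inner ℝ U v)
      rw [sub_self] at this
      simpa only [inner_sub_left] using this)
  have hlim : Tendsto (fun k => inner ℝ (P (V (θ k))) (V (θ k))) atTop (𝓝 (inner ℝ (P U) U)) := by
    have h1 := (hW.add ((hUw (P U)).const_mul 2)).sub_const (inner ℝ (P U) U)
    have e : (0 : ℝ) + 2 * inner ℝ U (P U) - inner ℝ (P U) U = inner ℝ (P U) U := by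
      rw [hP U U]; ring
    rw [e] at h1
    refine h1.congr fun k => ?_
    rw [map_sub, inner_sub_left, inner_sub_right, inner_sub_right, hP U (V (θ k)), hP (V (θ k)) U,
      real_inner_comm (P (V (θ k))) U, hP (V (θ k)) U, hP U U]
    ring
  have hUM : inner ℝ (P U) U = M := by
    refine tendsto_nhds_unique hlim ?_
    have := hs1.comp hθ.tendsto_atTop
    refine this.congr fun k => ?_
    exact (hV2 (θ k)).symm
  have hUn : ‖U‖ ^ 2 ≤ 1 := by
    calc ‖U‖ ^ 2 ≤ 1 ^ 2 := by gcongr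
      _ = 1 := one_pow 2
  refine ⟨U, hUK, M, hMpos, ?_, hscale, fun Y hY => ?_⟩
  · rintro rfl
    simp at hUM
    exact hMpos.ne hUM
  · have hq : ∀ t : ℝ, 0 ≤ (M * ‖Y‖ ^ 2 - inner ℝ (P Y) Y) * (t * t) + 2 * (M * inner ℝ U Y - inner ℝ (P U) Y) * t + 0 := by
      intro t
      have h1 := hscale (U + t • Y) (K.add_mem hUK (K.smul_mem t hY))
      rw [map_add, map_smul, inner_add_left, inner_add_right, inner_add_right, real_inner_smul_left, real_inner_smul_left,
        real_inner_smul_right, real_inner_smul_right, hUM, norm_add_sq_real, norm_smul, real_inner_smul_right, mul_pow,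
        Real.norm_eq_abs, sq_abs, hP Y U, real_inner_comm (P U) Y] at h1
      nlinarith
    have := discrim_le_zero hq
    rw [discrim] at this
    have h2 : (M * inner ℝ U Y - inner ℝ (P U) Y) ^ 2 ≤ 0 := by nlinarith
    have h3 := pow_eq_zero_iff (two_ne_zero) |>.1 (le_antisymm h2 (sq_nonneg _))
    linarith

lemma cvl_lim (D : SmoothDomain n) {χ : E → ℝ} (h : Continuous χ) (hc : HasCompactSupport χ) {W : ℕ → Lsp D} {U : Lsp D}
    {B : ℝ} (hB : ∀ k, ‖W k‖ ≤ B) (hw : ∀ v, Tendsto (fun k => inner ℝ (W k) v) atTop (𝓝 (inner ℝ U v))) :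
    Tendsto (fun k => ∫ x in D.carrier, cvl D χ (W k) x ^ 2) atTop (𝓝 (∫ x in D.carrier, cvl D χ U x ^ 2)) := by
  obtain ⟨C, hC0, hC⟩ := cvl_bd D h hc
  refine tendsto_integral_of_dominated_convergence (fun _ => (B * C) ^ 2)
    (fun k => ((cvl_cont D h hc _).pow 2).aestronglyMeasurable) (integrable_const _)
    (fun k => Eventually.of_forall fun x => ?_) (Eventually.of_forall fun x => ?_)
  · rw [norm_pow]
    gcongr
    exact (hC _ _).trans (by gcongr; exact hB k)
  · exact (hw _).pow 2

lemma P0_sq (D : SmoothDomain n) (W : Lsp D) : inner ℝ (P0 D W) W = ‖P0 D W‖ ^ 2 := by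
  have h2 : P0 D (P0 D W) = P0 D W := by
    rw [P0, mulL_mulL D continuous_const continuous_const]
    congr 2
  rw [← real_inner_self_eq_norm_sq, P0_symm D W (P0 D W), h2, P0_symm]

lemma rellich (D : SmoothDomain n) {ε : ℝ} (hε : 0 < ε) : ∃ χ : E → ℝ, Continuous χ ∧ HasCompactSupport χ ∧
    ∀ W ∈ HH D, ‖P0 D W‖ ^ 2 ≤ ε * ‖W‖ ^ 2 + 2 * ∫ x in D.carrier, cvl D χ W x ^ 2 := by
  obtain ⟨χ, h1, h2, h3⟩ := rellich_jet D hε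
  refine ⟨χ, h1, h2, fun W hW => ?_⟩
  obtain ⟨φ, hφ, hl⟩ := HH_seq hW
  obtain ⟨B, hB⟩ := (Metric.isBounded_range_of_tendsto _ hl).exists_norm_le
  have hw : ∀ v, Tendsto (fun k => inner ℝ (jL D (φ k)) v) atTop (𝓝 (inner ℝ W v)) := fun v =>
    hl.inner tendsto_const_nhds
  have hcv := cvl_lim D h1 h2 (fun k => hB _ ⟨k, rfl⟩) hw
  exact le_of_tendsto_of_tendsto' ((((P0 D).continuous.tendsto W).comp hl).norm.pow 2)
    (((hl.norm.pow 2).const_mul ε).add (hcv.const_mul 2)) fun k => h3 _ (hφ k)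

lemma P0_cpt (D : SmoothDomain n) {W : ℕ → Lsp D} (hW : ∀ k, W k ∈ HH D) (hB : ∀ k, ‖W k‖ ≤ 2)
    (hw : ∀ v, Tendsto (fun k => inner ℝ (W k) v) atTop (𝓝 0)) :
    Tendsto (fun k => inner ℝ (P0 D (W k)) (W k)) atTop (𝓝 0) := by
  rw [Metric.tendsto_atTop]
  intro ε hε
  obtain ⟨χ, h1, h2, h3⟩ := rellich D (ε := ε / 8) (by positivity)
  have hcv := cvl_lim D h1 h2 (U := 0) hB (fun v => by rw [inner_zero_left]; exact hw v)
  have h0 : ∫ x in D.carrier, cvl D χ (0 : Lsp D) x ^ 2 = 0 := by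
    simp only [cvl, inner_zero_left]
    simp
  rw [h0, Metric.tendsto_atTop] at hcv
  obtain ⟨N, hN⟩ := hcv (ε / 4) (by positivity)
  refine ⟨N, fun k hk => ?_⟩
  have h4 := hN k hk
  rw [dist_zero_right] at h4 ⊢
  have h5 := h3 _ (hW k)
  have h6 : ‖W k‖ ^ 2 ≤ 2 ^ 2 := by gcongr; exact hB k
  rw [P0_sq, Real.norm_of_nonneg (sq_nonneg _)]
  have h7 := (le_abs_self _).trans_lt h4
  nlinarith

/-- existence of a weak eigenvector below a test quotient -/
lemma exists_weak (D : SmoothDomain n) {φ : E → ℝ} (hφ : ContDiff ℝ 1 φ) (hφ0 : ∫ x in D.carrier, φ x = 0)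
    {s : ℝ} (hs : ∫ x in D.carrier, ‖fderiv ℝ φ x‖ ^ 2 < s * ∫ x in D.carrier, φ x ^ 2) :
    ∃ U ∈ HH D, U ≠ 0 ∧ inner ℝ U (e1 D fun _ => 1) = 0 ∧ ∃ σ : ℝ, σ < 1 + s ∧
      ∀ ψ : E → ℝ, ContDiff ℝ 1 ψ → inner ℝ U (jL D ψ) = σ * inner ℝ (P0 D U) (jL D ψ) := by
  haveI : Fact ((2 : ENNReal) ≠ ⊤) := ⟨by norm_num⟩
  haveI : TopologicalSpace.SeparableSpace (JJ n) := inferInstance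
  haveI : SecondCountableTopology (Lsp D) := Lp.SecondCountableTopology
  have hc1 : ContDiff ℝ 1 fun _ : E => (1 : ℝ) := contDiff_const
  set o := jL D fun _ => (1 : ℝ) with ho
  have hoP : P0 D o = o := by
    rw [ho, P0_jL D hc1, jL]
    congr 2
    ext1 x
    refine jj_ext ?_ ?_
    · rw [p1_i1, p1_jf]
    · rw [p2_i1, p2_jf, grad_eq, fderiv_fun_const]; simp
  have hoe : o = e1 D fun _ => 1 := by rw [← hoP, ho, P0_jL_e1 D hc1]
  set K : Submodule ℝ (Lsp D) := HH D ⊓ (Submodule.span ℝ {o})ᗮ with hKd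
  have hKc : IsClosed (K : Set (Lsp D)) :=
    (Submodule.isClosed_topologicalClosure _).inter (Submodule.isClosed_orthogonal _)
  have hKo : ∀ V ∈ K, inner ℝ V o = 0 := fun V hV => by
    rw [real_inner_comm]
    exact (Submodule.mem_orthogonal_singleton_iff_inner_right).1 hV.2
  have hjo : ∀ ψ : E → ℝ, ContDiff ℝ 1 ψ → inner ℝ (jL D ψ) o = ∫ x in D.carrier, ψ x := fun ψ hψ => by
    rw [← hoP, ← P0_symm, ho, P0_inner D hψ hc1]
    simp
  have hmemK : ∀ V ∈ HH D, inner ℝ V o = 0 → V ∈ K := fun V hV h =>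
    ⟨hV, (Submodule.mem_orthogonal_singleton_iff_inner_right).2 (by rw [real_inner_comm]; exact h)⟩
  have hφK : jL D φ ∈ K := hmemK _ (jL_mem D hφ) (by rw [hjo φ hφ, hφ0])
  have hφ2 : IntegrableOn (fun x => φ x ^ 2) D.carrier := cont_intOn D (hφ.continuous.pow 2).continuousOn
  have hd2 : IntegrableOn (fun x => ‖fderiv ℝ φ x‖ ^ 2) D.carrier :=
    cont_intOn D ((hφ.continuous_fderiv (by simp)).norm.pow 2).continuousOn
  have hG0 : 0 ≤ ∫ x in D.carrier, ‖fderiv ℝ φ x‖ ^ 2 := integral_nonneg fun x => sq_nonneg _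
  have hF0 : 0 ≤ ∫ x in D.carrier, φ x ^ 2 := integral_nonneg fun x => sq_nonneg _
  have hFp : 0 < ∫ x in D.carrier, φ x ^ 2 := by
    rcases hF0.lt_or_eq with h | h
    · exact h
    · rw [← h] at hs; linarith
  have hN : ‖jL D φ‖ ^ 2 = (∫ x in D.carrier, φ x ^ 2) + ∫ x in D.carrier, ‖fderiv ℝ φ x‖ ^ 2 := by
    rw [jL_sq D hφ]; exact integral_add hφ2 hd2
  obtain ⟨U, hUK, M, hM, hU0, hsc, hU⟩ := spectral_max K hKc (P0 D) (P0_symm D)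
    (fun W hW hB hw => P0_cpt D (fun k => (hW k).1) hB hw) hφK (by rw [P0_sq, P0_jL_sq D hφ]; exact hFp)
  refine ⟨U, hUK.1, hU0, by rw [← hoe]; exact hKo U hUK, M⁻¹, ?_, fun ψ hψ => ?_⟩
  · have h1 := hsc _ hφK
    rw [P0_sq, P0_jL_sq D hφ, hN] at h1
    rw [inv_lt_iff_one_lt_mul₀ hM]
    nlinarith
  · have hoo : inner ℝ o o = volume.real D.carrier := by
      rw [ho, hjo _ hc1]; simp
    set c := (∫ x in D.carrier, ψ x) / volume.real D.carrier with hcd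
    have hvp : volume.real D.carrier ≠ 0 := by
      intro h
      rw [measureReal_eq_zero_iff (vol_lt_top D).ne] at h
      rw [setIntegral_measure_zero _ h] at hFp
      exact hFp.ne rfl
    have hin : jL D ψ - c • o ∈ K := by
      refine hmemK _ ((HH D).sub_mem (jL_mem D hψ) ((HH D).smul_mem _ (jL_mem D hc1))) ?_
      rw [inner_sub_left, real_inner_smul_left, hjo ψ hψ, hoo, hcd]
      field_simp
      simp
    have h1 := hU _ hin
    have h2 : inner ℝ (P0 D U) o = 0 := by rw [P0_symm, hoP]; exact hKo U hUK
    rw [inner_sub_right, inner_sub_right, real_inner_smul_right, real_inner_smul_right, h2, hKo U hUK] at h1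
    rw [mul_zero, sub_zero, sub_zero] at h1
    rw [h1]
    field_simp

end D5b
end BNS

namespace BNS
open MeasureTheory Set Filter Topology
section D6
variable {n : ℕ}
local notation "E" => EuclideanSpace ℝ (Fin n)

lemma eq_clos (D : SmoothDomain n) {O : Set E} (hO : IsOpen O) {f g : E → ℝ} (hf : Continuous f) (hg : Continuous g)
    (h : ∀ᵐ x, x ∈ D.carrier ∩ O → f x = g x) : ∀ x ∈ closure D.carrier ∩ O, f x = g x := by
  have hop : IsOpen (D.carrier ∩ O) := D.isOpen.inter hO
  have h1 : EqOn f g (D.carrier ∩ O) := by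
    refine Measure.eqOn_open_of_ae_eq (μ := (volume : Measure E)) ?_ hop hf.continuousOn hg.continuousOn
    rw [EventuallyEq, ae_restrict_iff' hop.measurableSet]
    exact h
  intro x hx
  exact h1.closure hf hg (hO.closure_inter ⟨hx.1, hx.2⟩)

/-- smooth representative up to the boundary -/
lemma exists_rep (hn : 0 < n) (D : SmoothDomain n) {U : Lsp D} (hU : U ∈ HH D) {σ : ℝ}
    (hE : ∀ ψ : E → ℝ, ContDiff ℝ 1 ψ → inner ℝ U (jL D ψ) = σ * inner ℝ (P0 D U) (jL D ψ)) :
    ∃ u : E → ℝ, ContDiffOn ℝ (⊤ : ℕ∞) u (closure D.carrier) ∧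
      (∀ᵐ x ∂(volume.restrict D.carrier), p1 (U x) = u x) ∧
      ∀ x0 ∈ closure D.carrier, ∃ r : ℝ, 0 < r ∧ ∃ f : E → ℝ, ContDiff ℝ 2 f ∧
        ∀ x ∈ closure D.carrier ∩ Metric.ball x0 r, u x = f x := by
  choose! r hr f hf hfe using fun (x0 : E) (hx0 : x0 ∈ closure D.carrier) => local_rep hn D hU hE hx0
  set u : E → ℝ := fun x => f x 0 x with hu
  have key : ∀ x0 ∈ closure D.carrier, ∀ m : ℕ, ∀ x ∈ closure D.carrier ∩ Metric.ball x0 (r x0), u x = f x0 m x := by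
    intro x0 hx0 m x hx
    refine eq_clos D (O := Metric.ball x (r x) ∩ Metric.ball x0 (r x0)) (Metric.isOpen_ball.inter Metric.isOpen_ball)
      (hf x hx.1 0).continuous (hf x0 hx0 m).continuous ?_ x ⟨hx.1, Metric.mem_ball_self (hr x hx.1), hx.2⟩
    filter_upwards [hfe x hx.1 0, hfe x0 hx0 m] with y h1 h2 h3
    rw [← h1 ⟨h3.1, h3.2.1⟩, ← h2 ⟨h3.1, h3.2.2⟩]
  refine ⟨u, ?_, ?_, fun x0 hx0 => ⟨r x0, hr x0 hx0, f x0 2, hf x0 hx0 2, key x0 hx0 2⟩⟩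
  · refine contDiffOn_infty.2 fun m x0 hx0 => ?_
    refine ((hf x0 hx0 m).contDiffAt.contDiffWithinAt (s := closure D.carrier)).congr_of_eventuallyEq ?_
      (key x0 hx0 m x0 ⟨hx0, Metric.mem_ball_self (hr x0 hx0)⟩)
    filter_upwards [self_mem_nhdsWithin, mem_nhdsWithin_of_mem_nhds (Metric.ball_mem_nhds x0 (hr x0 hx0))] with x h1 h2
    exact key x0 hx0 m x ⟨h1, h2⟩
  · rw [ae_restrict_iff' (meas_carrier D), ae_iff]
    refine measure_null_of_locally_null _ fun x0 hx0 => ?_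
    rw [Set.mem_setOf_eq, Classical.not_imp] at hx0
    have hx0' := subset_closure hx0.1
    refine ⟨_, inter_mem_nhdsWithin _ (Metric.ball_mem_nhds x0 (hr x0 hx0')), ?_⟩
    have h1 := hfe x0 hx0' 0
    rw [ae_iff] at h1
    refine measure_mono_null (fun x hx => ?_) h1
    have h2 := hx.1
    rw [Set.mem_setOf_eq, Classical.not_imp] at h2 ⊢
    refine ⟨⟨h2.1, hx.2⟩, ?_⟩
    rw [← key x0 hx0' 0 x ⟨subset_closure h2.1, hx.2⟩]
    exact h2.2

lemma test_zero (D : SmoothDomain n) {f : E → ℝ} (hf : IntegrableOn f D.carrier)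
    (h : ∀ ψ ∈ TT D.carrier, ∫ x in D.carrier, f x * ψ x = 0) : ∀ᵐ x ∂(volume.restrict D.carrier), f x = 0 := by
  rw [ae_restrict_iff' (meas_carrier D)]
  refine D.isOpen.ae_eq_zero_of_integral_contDiff_smul_eq_zero hf.locallyIntegrableOn fun g h1 h2 h3 => ?_
  rw [← h g ⟨h1, h2, h3⟩, ← setIntegral_eq_integral_of_forall_compl_eq_zero (s := D.carrier)]
  · simp only [smul_eq_mul, mul_comm]
  · intro x hx
    rw [image_eq_zero_of_notMem_tsupport fun h => hx (h3 h), zero_smul]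

lemma inner_e2 (D : SmoothDomain n) (Z : Lsp D) {ψ : E → ℝ} (h : Continuous ψ) (k : Fin n) :
    inner ℝ Z (e2 D k ψ) = ∫ x in D.carrier, p2 (Z x) k * ψ x := by
  rw [L2.inner_def]
  refine integral_congr_ae ?_
  filter_upwards [lpL_coe D (cmc fun x => i2 (ψ x • ee k))] with x hx
  rw [e2, hx, cmc_coe (i2c (ψ := fun x => ψ x • ee k) (h.smul continuous_const)), jj_inner, p1_i2, p2_i2, mul_zero, zero_add,
    inner_smul_right, ee, EuclideanSpace.inner_single_right]
  simp [mul_comm]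

lemma TT_front (D : SmoothDomain n) {ψ : E → ℝ} (h : ψ ∈ TT D.carrier) {x : E} (hx : x ∈ frontier D.carrier) : ψ x = 0 := by
  refine image_eq_zero_of_notMem_tsupport fun h' => ?_
  rw [D.isOpen.frontier_eq] at hx
  exact hx.2 (h.2.2 h')

lemma ibp_smooth (D : SmoothDomain n) {u : E → ℝ} (hu : ContDiffOn ℝ 1 u (closure D.carrier)) {ψ : E → ℝ}
    (hψ : ψ ∈ TT D.carrier) (k : Fin n) :
    ∫ x in D.carrier, u x * dd k ψ x = - ∫ x in D.carrier, gW (closure D.carrier) u x k * ψ x := by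
  set K := closure D.carrier with hK
  have hψ1 : ContDiff ℝ 1 ψ := hψ.1.of_le (by norm_cast)
  have hh : ContDiffOn ℝ 1 (fun x => u x * ψ x) K := hu.mul hψ1.contDiffOn
  have hdv : ∀ x ∈ D.carrier, dv (fun y => (u y * ψ y) • ee k) x = u x * dd k ψ x + gW K u x k * ψ x := by
    intro x hx
    have d1 := (hu.contDiffAt (clos_nhds D hx)).differentiableAt one_ne_zero
    have d2 := hψ1.differentiable one_ne_zero x
    rw [dv_smul (a := fun y => u y * ψ y) (d1.mul d2) (differentiableAt_const _), fderiv_fun_mul d1 d2, gW_apply, hK, fdW_eq D hx]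
    simp [dv, dd, mul_comm]
  have c1 : ContinuousOn (fun x => u x * dd k ψ x) K := hu.continuousOn.mul (dd_cd hψ.1).continuous.continuousOn
  have c2 : ContinuousOn (fun x => gW K u x k * ψ x) K :=
    (gWi_cd D hu (m := 0) (by norm_num) k).continuousOn.mul hψ1.continuous.continuousOn
  have := div_thm D (F := fun y => (u y * ψ y) • ee k) ((hh.smul contDiffOn_const).mono subset_closure)
    (hh.smul contDiffOn_const).continuousOn
    ((cont_intOn D (c1.add c2)).congr_fun (fun x hx => (hdv x hx).symm) (meas_carrier D))
    (by intro x hx; rw [TT_front D hψ hx, mul_zero, zero_smul, map_zero])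
  rw [setIntegral_congr_fun (meas_carrier D) hdv, integral_add (cont_intOn D c1) (cont_intOn D c2)] at this
  linarith

lemma p2_ae (D : SmoothDomain n) {U : Lsp D} (hU : U ∈ HH D) {u : E → ℝ} (hu : ContDiffOn ℝ 1 u (closure D.carrier))
    (he : ∀ᵐ x ∂(volume.restrict D.carrier), p1 (U x) = u x) :
    ∀ᵐ x ∂(volume.restrict D.carrier), p2 (U x) = gW (closure D.carrier) u x := by
  have hk : ∀ k : Fin n, ∀ᵐ x ∂(volume.restrict D.carrier), p2 (U x) k - gW (closure D.carrier) u x k = 0 := by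
    intro k
    have hi1 : IntegrableOn (fun x => p2 (U x) k) D.carrier := by
      have := (Lp.memLp U).integrable (by norm_num)
      exact ((EuclideanSpace.proj k : E →L[ℝ] ℝ).comp p2).integrable_comp this
    have hi2 : IntegrableOn (fun x => gW (closure D.carrier) u x k) D.carrier :=
      cont_intOn D (gWi_cd D hu (m := 0) (by norm_num) k).continuousOn
    refine test_zero D (hi1.sub hi2) fun ψ hψ => ?_
    have h1 := ibp D hU hψ k
    rw [inner_e2 D U hψ.1.continuous, inner_e1 D U (dd_cd hψ.1).continuous] at h1
    have h2 : ∫ x in D.carrier, p1 (U x) * dd k ψ x = ∫ x in D.carrier, u x * dd k ψ x :=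
      integral_congr_ae (by filter_upwards [he] with x hx; rw [hx])
    rw [h2, ibp_smooth D hu hψ k, neg_neg] at h1
    obtain ⟨C, _, hC⟩ := bdd_cs hψ.1.continuous hψ.2.1
    simp only [sub_mul]
    rw [integral_sub, h1, sub_self]
    · exact hi1.mul_bdd hψ.1.continuous.aestronglyMeasurable (Eventually.of_forall hC)
    · exact hi2.mul_bdd hψ.1.continuous.aestronglyMeasurable (Eventually.of_forall hC)
  filter_upwards [ae_all_iff.2 hk] with x hx
  ext k
  exact sub_eq_zero.1 (hx k)

/-- weak form for the smooth representative -/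
lemma weak_form (D : SmoothDomain n) {U : Lsp D} (hU : U ∈ HH D) {σ : ℝ}
    (hE : ∀ ψ : E → ℝ, ContDiff ℝ 1 ψ → inner ℝ U (jL D ψ) = σ * inner ℝ (P0 D U) (jL D ψ))
    {u : E → ℝ} (hu : ContDiffOn ℝ 1 u (closure D.carrier))
    (he : ∀ᵐ x ∂(volume.restrict D.carrier), p1 (U x) = u x) {ψ : E → ℝ} (hψ : ContDiff ℝ 1 ψ) :
    ∫ x in D.carrier, fderiv ℝ ψ x (gW (closure D.carrier) u x) = (σ - 1) * ∫ x in D.carrier, u x * ψ x := by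
  have h1 := hE ψ hψ
  rw [P0_symm, P0_jL_e1 D hψ, inner_e1 D U hψ.continuous, L2.inner_def] at h1
  have h2 : ∫ x in D.carrier, p1 (U x) * ψ x = ∫ x in D.carrier, u x * ψ x :=
    integral_congr_ae (by filter_upwards [he] with x hx; rw [hx])
  have h3 : ∫ x in D.carrier, inner ℝ (U x) (jL D ψ x) =
      ∫ x in D.carrier, (u x * ψ x + fderiv ℝ ψ x (gW (closure D.carrier) u x)) := by
    refine integral_congr_ae ?_
    filter_upwards [he, p2_ae D hU hu he, lpL_coe D (cmc (jf ψ))] with x e1 e2 e3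
    rw [jL, e3, cmc_coe (jf_cont hψ), jj_inner, p1_jf, p2_jf, e1, e2, real_inner_comm, grad_inner]
  rw [h3, h2, integral_add] at h1
  · linarith
  · exact cont_intOn D (hu.continuousOn.mul hψ.continuous.continuousOn)
  · exact cont_intOn D ((hψ.continuous_fderiv one_ne_zero).continuousOn.clm_apply
      (gW_cd D hu (m := 0) (by norm_num)).continuousOn)

lemma lap_eq (D : SmoothDomain n) {u : E → ℝ} (hu : ContDiffOn ℝ 2 u (closure D.carrier)) {lam : ℝ}
    (hw : ∀ ψ : E → ℝ, ContDiff ℝ 1 ψ → ∫ x in D.carrier, fderiv ℝ ψ x (gW (closure D.carrier) u x)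
      = lam * ∫ x in D.carrier, u x * ψ x) :
    ∀ x ∈ closure D.carrier, lapWithin (closure D.carrier) u x = - lam * u x := by
  set K := closure D.carrier with hK
  have hc : ContinuousOn (fun x => lapWithin K u x + lam * u x) K :=
    (lapW_cd D hu (m := 0) (by norm_num)).continuousOn.add (continuousOn_const.mul hu.continuousOn)
  have hz : ∀ᵐ x ∂(volume.restrict D.carrier), lapWithin K u x + lam * u x = 0 := by
    refine test_zero D (cont_intOn D hc) fun ψ hψ => ?_
    have hψ1 : ContDiff ℝ 1 ψ := hψ.1.of_le (by norm_cast)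
    have h1 := green D hu hψ1.contDiffOn (fun x hx => by rw [TT_front D hψ hx, zero_mul])
    have h2 : ∫ x in D.carrier, inner ℝ (gW K ψ x) (gW K u x) = ∫ x in D.carrier, fderiv ℝ ψ x (gW K u x) :=
      setIntegral_congr_fun (meas_carrier D) fun x hx => by rw [gW_inner, hK, fdW_eq D hx]
    rw [h2, hw ψ hψ1] at h1
    have c1 : IntegrableOn (fun x => ψ x * lapWithin K u x) D.carrier :=
      cont_intOn D (hψ1.continuous.continuousOn.mul (lapW_cd D hu (m := 0) (by norm_num)).continuousOn)
    have c2 : IntegrableOn (fun x => u x * ψ x) D.carrier :=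
      cont_intOn D (hu.continuousOn.mul hψ1.continuous.continuousOn)
    have e : ∀ x, (lapWithin K u x + lam * u x) * ψ x = ψ x * lapWithin K u x + lam * (u x * ψ x) := fun x => by ring
    simp only [e]
    rw [integral_add c1 (c2.const_mul _), integral_const_mul]
    linarith
  intro x hx
  have := zero_of_int_sq D hc (le_of_eq (by
    rw [integral_congr_ae (g := fun _ => (0:ℝ)) (by filter_upwards [hz] with x hx; rw [hx]; simp)]
    simp)) x hx
  linarith

end D6
end BNS

namespace BNS
open MeasureTheory Set Filter Topology
section D7
variable {n : ℕ}
local notation "E" => EuclideanSpace ℝ (Fin n)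

/-- the indicator of a smooth domain is not locally constant near a boundary point -/
lemma no_const (D : SmoothDomain n) {x0 : E} (hx0 : x0 ∈ frontier D.carrier) {r : ℝ} (hr : 0 < r)
    (h : ∀ φ : E → ℝ, ContDiff ℝ 1 φ → tsupport φ ⊆ Metric.ball x0 r → ∀ e : E, ∫ x in D.carrier, fderiv ℝ φ x e = 0) :
    False := by
  have h0 : D.defining x0 = 0 := (mem_front D).1 hx0
  obtain ⟨v, hv⟩ := exists_neg_dir D h0
  obtain ⟨t₀, ht₀, hs⟩ := sign_along D h0 hv
  set t := min t₀ (r / (2 * (‖v‖ + 1))) with ht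
  have htp : 0 < t := lt_min ht₀ (by positivity)
  have htv : t * ‖v‖ ≤ r / 2 := by
    calc t * ‖v‖ ≤ r / (2 * (‖v‖ + 1)) * (‖v‖ + 1) := by
          gcongr
          · exact min_le_right _ _
          · linarith
      _ = r / 2 := by field_simp
  obtain ⟨ha, hb⟩ := hs t htp (min_le_left _ _)
  obtain ⟨δ₁, hδ₁, hB1⟩ := Metric.isOpen_iff.1 (isOpen_lt (rho_cont D) continuous_const) (x0 + t • v) ha
  obtain ⟨δ₂, hδ₂, hB2⟩ := Metric.isOpen_iff.1 (isOpen_lt continuous_const (rho_cont D)) (x0 - t • v) hb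
  set δ := min (r / 4) (min δ₁ δ₂) with hδ
  have hδp : 0 < δ := lt_min (by positivity) (lt_min hδ₁ hδ₂)
  let β : ContDiffBump (0 : E) := ⟨δ / 2, δ, by positivity, by linarith⟩
  have hβ : ContDiff ℝ 1 β := β.contDiff
  have hβz : ∀ z : E, β z ≠ 0 → ‖z‖ < δ := fun z hz => by
    have : z ∈ Function.support β := hz
    rw [β.support_eq, mem_ball_zero_iff] at this
    exact this
  obtain ⟨C, hC0, hC⟩ := bdd_cs (hβ.continuous_fderiv one_ne_zero).norm
    ((β.hasCompactSupport.fderiv ℝ).norm)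
  have hβi : Integrable (fun x => β x) (volume : Measure E) := β.integrable
  set G : ℝ → ℝ := fun s => ∫ x in D.carrier, β (x - (x0 + s • v)) with hG
  have hsh : ∀ s : ℝ, ContDiff ℝ 1 fun x : E => β (x - (x0 + s • v)) := fun s =>
    hβ.comp (contDiff_id.sub contDiff_const)
  have hfd : ∀ (s : ℝ) (x : E), fderiv ℝ (fun x : E => β (x - (x0 + s • v))) x = fderiv ℝ β (x - (x0 + s • v)) :=
    fun s x => fderiv_comp_sub _
  have hder : ∀ s : ℝ, HasDerivAt G (∫ x in D.carrier, - fderiv ℝ β (x - (x0 + s • v)) v) s := by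
    intro s
    refine (hasDerivAt_integral_of_dominated_loc_of_deriv_le (μ := volume.restrict D.carrier) (bound := fun _ => C * ‖v‖)
      (F := fun s x => β (x - (x0 + s • v))) (F' := fun s x => - fderiv ℝ β (x - (x0 + s • v)) v) (s := univ) univ_mem
      (Eventually.of_forall fun s => (hsh s).continuous.aestronglyMeasurable)
      (cont_intOn D (hsh s).continuous.continuousOn) ?_ (Eventually.of_forall fun x s _ => ?_) (integrable_const _)
      (Eventually.of_forall fun x s _ => ?_)).2
    · have : Continuous fun x : E => - fderiv ℝ β (x - (x0 + s • v)) v :=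
        (((hβ.continuous_fderiv one_ne_zero).comp (continuous_id.sub continuous_const)).clm_apply continuous_const).neg
      exact this.aestronglyMeasurable
    · rw [norm_neg]
      refine (ContinuousLinearMap.le_opNorm _ _).trans ?_
      gcongr
      simpa using hC (x - (x0 + s • v))
    · have h1 : HasDerivAt (fun s : ℝ => x - (x0 + s • v)) (-v) s := by
        have := (((hasDerivAt_id s).smul_const v).const_add x0).const_sub x
        simpa using this
      have h2 := (hβ.differentiable one_ne_zero (x - (x0 + s • v))).hasFDerivAt.comp_hasDerivAt s h1
      rw [map_neg] at h2
      exact h2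
  have hz : ∀ s ∈ Ioo (-t) t, ∫ x in D.carrier, - fderiv ℝ β (x - (x0 + s • v)) v = 0 := by
    intro s hs
    have h1 := h _ (hsh s) (by
      refine (closure_minimal (fun x hx => ?_) Metric.isClosed_closedBall).trans
        (Metric.closedBall_subset_ball (show r / 2 + r / 4 < r by linarith))
      have h2 := hβz _ hx
      rw [mem_closedBall_iff_norm]
      calc ‖x - x0‖ = ‖s • v + (x - (x0 + s • v))‖ := by congr 1; abel
        _ ≤ ‖s • v‖ + ‖x - (x0 + s • v)‖ := norm_add_le _ _
        _ ≤ t * ‖v‖ + δ := by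
          rw [norm_smul, Real.norm_eq_abs]
          gcongr
          exact (abs_lt.2 hs).le
        _ ≤ r / 2 + r / 4 := add_le_add htv (min_le_left _ _)) v
    simp only [hfd] at h1
    rw [integral_neg, h1, neg_zero]
  obtain ⟨c, hc, hce⟩ := exists_hasDerivAt_eq_slope G _ (show -t < t by linarith)
    (fun s _ => (hder s).continuousAt.continuousWithinAt) (fun s _ => hder s)
  rw [hz c hc] at hce
  have hGe : G t - G (-t) = 0 := by
    rcases (div_eq_zero_iff.1 hce.symm) with h | h
    · exact h
    · linarith
  have hG1 : 0 < G t := by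
    have : G t = ∫ x, β x := by
      rw [← integral_sub_right_eq_self (fun x => β x) (x0 + t • v)]
      refine setIntegral_eq_integral_of_forall_compl_eq_zero fun x hx => ?_
      by_contra hne
      refine hx ((mem_carrier D).2 (hB1 ?_))
      rw [mem_ball_iff_norm]
      exact (hβz _ hne).trans_le ((min_le_right _ _).trans (min_le_left _ _))
    rw [this]
    exact β.integral_pos
  have hG2 : G (-t) = 0 := by
    refine setIntegral_eq_zero_of_forall_eq_zero fun x hx => ?_
    by_contra hne
    have h1 : x ∈ {x | 0 < D.defining x} := hB2 (by
      rw [mem_ball_iff_norm]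
      have := hβz _ hne
      rw [neg_smul, ← sub_eq_add_neg] at this
      exact this.trans_le ((min_le_right _ _).trans (min_le_right _ _)))
    rw [Set.mem_setOf_eq] at h1
    linarith [(mem_carrier D).1 hx]
  linarith

lemma neumann_bc (D : SmoothDomain n) {u : E → ℝ} (hu : ContDiffOn ℝ 2 u (closure D.carrier)) {lam : ℝ}
    (hw : ∀ ψ : E → ℝ, ContDiff ℝ 1 ψ → ∫ x in D.carrier, fderiv ℝ ψ x (gW (closure D.carrier) u x)
      = lam * ∫ x in D.carrier, u x * ψ x)
    {x0 : E} (hx0 : x0 ∈ frontier D.carrier) {r : ℝ} (hr : 0 < r) {f : E → ℝ} (hf : ContDiff ℝ 2 f)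
    (hfu : ∀ x ∈ closure D.carrier ∩ Metric.ball x0 r, u x = f x) :
    fderivWithin ℝ u (closure D.carrier) x0 (gradient D.defining x0) = 0 := by
  by_contra hne
  set K := closure D.carrier with hK
  have hx0K : x0 ∈ K := frontier_subset_closure hx0
  have hgr : ∀ x ∈ K ∩ Metric.ball x0 r, fderivWithin ℝ u K x = fderiv ℝ f x := by
    intro x hx
    rw [Filter.EventuallyEq.fderivWithin_eq (f := f) _ (hfu x hx)]
    · exact fderivWithin_eq_fderiv (uniqueDiff D x hx.1) (hf.differentiable (by norm_num) x)
    · filter_upwards [self_mem_nhdsWithin, mem_nhdsWithin_of_mem_nhds (Metric.isOpen_ball.mem_nhds hx.2)] with y h1 h2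
      exact hfu y ⟨h1, h2⟩
  set g : E → ℝ := fun x => fderiv ℝ f x (gradient D.defining x) with hg
  have hgc : ContDiff ℝ 1 g := (hf.fderiv_right (m := 1) (by norm_num)).clm_apply ((grad_cd D).of_le (by norm_cast))
  have hg0 : g x0 ≠ 0 := by
    rw [hg]; simp only
    rw [← hgr x0 ⟨hx0K, Metric.mem_ball_self hr⟩]; exact hne
  obtain ⟨r₁, hr₁, hB⟩ := Metric.isOpen_iff.1 (isOpen_ne.preimage hgc.continuous) x0 hg0
  set r' := min r r₁ with hr'
  refine no_const D hx0 (lt_min hr hr₁ : 0 < r') fun φ hφ hs e => ?_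
  have hφb : ∀ x, x ∉ Metric.ball x0 r' → φ x = 0 := fun x hx => image_eq_zero_of_notMem_tsupport fun h => hx (hs h)
  set ψ : E → ℝ := fun x => φ x * fderiv ℝ D.defining x e * (g x)⁻¹ with hψd
  have hψ : ContDiff ℝ 1 ψ := by
    rw [contDiff_iff_contDiffAt]
    intro x
    by_cases hx : x ∈ tsupport φ
    · have h1 : g x ≠ 0 := hB (Metric.ball_subset_ball (min_le_right _ _) (hs hx))
      have h2 : ContDiff ℝ 1 fun x => fderiv ℝ D.defining x e :=
        (D.smooth_defining.fderiv_right (m := 1) (by norm_cast)).clm_apply contDiff_const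
      exact (hφ.contDiffAt.mul h2.contDiffAt).mul (hgc.contDiffAt.inv h1)
    · have h1 : ψ =ᶠ[𝓝 x] fun _ => 0 := by
        filter_upwards [(isClosed_tsupport φ).isOpen_compl.mem_nhds hx] with y hy
        rw [hψd]; simp only
        rw [image_eq_zero_of_notMem_tsupport hy]; simp
      exact contDiffAt_const.congr_of_eventuallyEq h1
  have g1 := gW_cd D hu (m := 1) (by norm_num)
  have l1 := lapW_cd D hu (m := 0) (by norm_num)
  have hF1 : ContDiffOn ℝ 1 (fun y => ψ y • gW K u y) D.carrier := (hψ.contDiffOn.smul g1).mono subset_closure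
  have hF2 : ContDiffOn ℝ 1 (fun y => φ y • e) D.carrier := (hφ.smul contDiff_const).contDiffOn
  have hl := lap_eq D hu hw
  have d1 : ∀ x ∈ D.carrier, dv (fun y => ψ y • gW K u y) x = - lam * (u x * ψ x) + fderiv ℝ ψ x (gW K u x) := by
    intro x hx
    rw [dv_smul (hψ.differentiable one_ne_zero x)
      ((g1.contDiffAt (clos_nhds D hx)).differentiableAt one_ne_zero), dv_gW D hu hx, hl x (subset_closure hx)]
    ring
  have d2 : ∀ x ∈ D.carrier, dv (fun y => φ y • e) x = fderiv ℝ φ x e := by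
    intro x hx
    rw [dv_smul (hφ.differentiable one_ne_zero x) (differentiableAt_const _)]
    simp [dv]
  have i1 : IntegrableOn (fun x => u x * ψ x) D.carrier := cont_intOn D (hu.continuousOn.mul hψ.continuous.continuousOn)
  have i2 : IntegrableOn (fun x => fderiv ℝ ψ x (gW K u x)) D.carrier :=
    cont_intOn D ((hψ.continuous_fderiv one_ne_zero).continuousOn.clm_apply g1.continuousOn)
  have i3 : IntegrableOn (fun x => fderiv ℝ φ x e) D.carrier :=
    cont_intOn D ((hφ.continuous_fderiv one_ne_zero).clm_apply continuous_const).continuousOn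
  have i4 : IntegrableOn (fun x => -lam * (u x * ψ x) + fderiv ℝ ψ x (gW K u x)) D.carrier :=
    (i1.const_mul (-lam)).add i2
  have j1 : IntegrableOn (dv fun y => ψ y • gW K u y) D.carrier :=
    i4.congr_fun (fun x hx => (d1 x hx).symm) (meas_carrier D)
  have j2 : IntegrableOn (dv fun y => φ y • e) D.carrier := i3.congr_fun (fun x hx => (d2 x hx).symm) (meas_carrier D)
  have t1 := core_tendsto D j1
  have t2 := core_tendsto D j2
  simp_rw [core_k D hF1] at t1
  simp_rw [core_k D hF2] at t2
  have hpt : ∀ x ∈ D.carrier, fderiv ℝ D.defining x (ψ x • gW K u x) = fderiv ℝ D.defining x (φ x • e) := by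
    intro x hx
    by_cases hxb : x ∈ Metric.ball x0 r'
    · have h1 : g x ≠ 0 := hB (Metric.ball_subset_ball (min_le_right _ _) hxb)
      have h2 : fderiv ℝ D.defining x (gW K u x) = g x := by
        rw [fderiv_eq_inner, real_inner_comm, gW_inner, hgr x ⟨subset_closure hx, Metric.ball_subset_ball (min_le_left _ _) hxb⟩]
      rw [map_smul, map_smul, h2, smul_eq_mul, smul_eq_mul, hψd]
      field_simp
    · have h1 := hφb x hxb
      have h2 : ψ x = 0 := by rw [hψd]; simp [h1]
      rw [h1, h2, zero_smul, zero_smul]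
  have heq : ∫ x in D.carrier, dv (fun y => ψ y • gW K u y) x = ∫ x in D.carrier, dv (fun y => φ y • e) x := by
    refine tendsto_nhds_unique t1 (t2.congr fun k => ?_)
    congr 1
    refine setIntegral_congr_fun (meas_carrier D) fun x hx => ?_
    simp only [hpt x hx]
  rw [setIntegral_congr_fun (meas_carrier D) d1, setIntegral_congr_fun (meas_carrier D) d2,
    integral_add (i1.const_mul _) i2, integral_const_mul, hw ψ hψ] at heq
  linarith

/-- variational characterisation: a test quotient below `s` gives a biharmonic eigenvalue below `s²` -/
theorem exists_eig (hn : 0 < n) (D : SmoothDomain n) (hconn : IsConnected D.carrier) {φ : E → ℝ} (hφ : ContDiff ℝ 1 φ)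
    (hφ0 : ∫ x in D.carrier, φ x = 0) {s : ℝ}
    (hs : ∫ x in D.carrier, ‖fderiv ℝ φ x‖ ^ 2 < s * ∫ x in D.carrier, φ x ^ 2) :
    ∃ lam : ℝ, 0 < lam ∧ lam < s ∧ IsBiharmonicNeumannEigenvalue D (lam ^ 2) := by
  obtain ⟨U, hU, hU0, hU1, σ, hσ, hE⟩ := exists_weak D hφ hφ0 hs
  obtain ⟨u, hu, he, hloc⟩ := exists_rep hn D hU hE
  set K := closure D.carrier with hK
  have hu2 : ContDiffOn ℝ 2 u K := hu.of_le (by norm_cast)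
  have hu1 : ContDiffOn ℝ 1 u K := hu.of_le (by norm_cast)
  have hw : ∀ ψ : E → ℝ, ContDiff ℝ 1 ψ → ∫ x in D.carrier, fderiv ℝ ψ x (gW K u x)
      = (σ - 1) * ∫ x in D.carrier, u x * ψ x := fun ψ hψ => weak_form D hU hE hu1 he hψ
  set lam := σ - 1 with hlam
  have hl : ∀ x ∈ K, lapWithin K u x = - lam * u x := lap_eq D hu2 hw
  have hbc : ∀ x ∈ frontier D.carrier, fderivWithin ℝ u K x (gradient D.defining x) = 0 := fun x hx => by
    obtain ⟨r, hr, f, hf, hfu⟩ := hloc x (frontier_subset_closure hx)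
    exact neumann_bc D hu2 hw hx hr hf hfu
  have hne : ∃ x ∈ K, u x ≠ 0 := by
    by_contra hcon
    push Not at hcon
    apply hU0
    apply Lp.ext
    filter_upwards [he, p2_ae D hU hu1 he, ae_carrier D, Lp.coeFn_zero (JJ n) 2 (volume.restrict D.carrier)] with x h1 h2 h3 h4
    rw [h4]
    refine jj_ext ?_ ?_
    · rw [h1, hcon x (subset_closure h3)]; simp
    · rw [h2, gW, fderivWithin_congr (f := fun _ => (0:ℝ)) (fun y hy => hcon y hy) (hcon x (subset_closure h3))]
      simp
  have hu0 : ∫ x in D.carrier, u x = 0 := by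
    rw [inner_e1 D U continuous_const] at hU1
    rw [← hU1]
    refine integral_congr_ae ?_
    filter_upwards [he] with x hx
    rw [hx, mul_one]
  have hG := int_gW_sq D hu2 (μ := lam) (fun x hx => hl x (subset_closure hx)) (fun x hx => by rw [hbc x hx, mul_zero])
  have hup : 0 < ∫ x in D.carrier, u x ^ 2 := by
    by_contra hcon
    obtain ⟨x, hx, hxn⟩ := hne
    exact hxn (zero_of_int_sq D hu.continuousOn (not_lt.1 hcon) x hx)
  have hlp : 0 < lam := by
    by_contra hcon
    have hz : ∫ x in D.carrier, ‖gW K u x‖ ^ 2 ≤ 0 := by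
      rw [hG]; exact mul_nonpos_of_nonpos_of_nonneg (not_lt.1 hcon) hup.le
    have hgz := zero_of_int_sq D (gW_cd D hu1 (m := 0) (by norm_num)).continuousOn.norm hz
    obtain ⟨a, ha⟩ := hconn.nonempty
    have hcst : ∀ x ∈ D.carrier, u x = u a := by
      intro x hx
      refine D.isOpen.is_const_of_fderiv_eq_zero hconn.isPreconnected
        ((hu1.differentiableOn one_ne_zero).mono subset_closure) (fun y hy => ?_) hx ha
      have h1 := hgz y (subset_closure hy)
      rw [gW_norm, fdW_eq D hy, norm_eq_zero] at h1
      rw [h1]; rfl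
    rw [setIntegral_congr_fun (g := fun _ => u a) (meas_carrier D) hcst, setIntegral_const, smul_eq_mul] at hu0
    have hvp : volume.real D.carrier ≠ 0 := by
      rw [Ne, measureReal_eq_zero_iff (vol_lt_top D).ne]
      exact (D.isOpen.measure_pos _ hconn.nonempty).ne'
    have hua : u a = 0 := (mul_eq_zero.1 hu0).resolve_left hvp
    rw [setIntegral_congr_fun (g := fun _ => (0:ℝ)) (meas_carrier D) (fun x hx => by simp only; rw [hcst x hx, hua]; simp)] at hup
    simp at hup
  have hlapE : ∀ x ∈ K, fderivWithin ℝ (lapWithin K u) K x = (-lam) • fderivWithin ℝ u K x := fun x hx => by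
    rw [fderivWithin_congr (f := fun y => -lam * u y) (fun y hy => hl y hy) (hl x hx)]
    exact fderivWithin_const_mul (uniqueDiff D x hx) (hu1.differentiableOn one_ne_zero x hx) _
  refine ⟨lam, hlp, by rw [hlam]; linarith, u, hu, hne, fun x hx => ?_, fun x hx => normalDeriv_of D (hbc x hx),
    fun x hx => normalDeriv_of D ?_⟩
  · have h1 : ∀ y ∈ K, ∀ i : Fin n, gW K (lapWithin K u) y i = -lam * gW K u y i := fun y hy i => by
      rw [gW_apply, gW_apply, hlapE y hy]; rfl
    rw [lapW_eq_sum D]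
    have h2 : ∀ i : Fin n, fderivWithin ℝ (fun y => gW K (lapWithin K u) y i) K x (ee i)
        = -lam * fderivWithin ℝ (fun y => gW K u y i) K x (ee i) := fun i => by
      rw [fderivWithin_congr (f := fun y => -lam * gW K u y i) (fun y hy => h1 y hy i) (h1 x (subset_closure hx) i),
        fderivWithin_const_mul (uniqueDiff D x (subset_closure hx)) ((gWi_cd D hu2 (m := 1) (by norm_num) i).differentiableOn one_ne_zero x (subset_closure hx)) _]
      rfl
    rw [Finset.sum_congr rfl fun i _ => h2 i, ← Finset.mul_sum, ← lapW_eq_sum D, hl x (subset_closure hx)]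
    ring
  · rw [hlapE x (frontier_subset_closure hx), smul_apply, hbc x hx, smul_zero]

lemma poincare (hn : 0 < n) (D : SmoothDomain n) (hconn : IsConnected D.carrier) {Υ : ℝ}
    (h : IsLeast {Υ : ℝ | 0 < Υ ∧ IsBiharmonicNeumannEigenvalue D Υ} Υ) {φ : E → ℝ} (hφ : ContDiff ℝ 1 φ)
    (hφ0 : ∫ x in D.carrier, φ x = 0) :
    √Υ * ∫ x in D.carrier, φ x ^ 2 ≤ ∫ x in D.carrier, ‖fderiv ℝ φ x‖ ^ 2 := by
  by_contra hcon
  obtain ⟨lam, h1, h2, h3⟩ := exists_eig hn D hconn hφ hφ0 (not_le.1 hcon)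
  have h4 : Υ ≤ lam ^ 2 := h.2 ⟨by positivity, h3⟩
  have h5 := Real.sqrt_le_sqrt h4
  rw [Real.sqrt_sq h1.le] at h5
  linarith

end D7
end BNS

/-- **Szegő–Weinberger inequality for the bi-harmonic operator.**
Let `n ≥ 2` and let `Ω` be a bounded connected open set in `ℝⁿ` with smooth boundary. Then the
first nonzero Neumann eigenvalue of the bi-harmonic operator satisfies `Υ₁(Ω) ≤ Υ₁(B_Ω)`, where
`B_Ω` is an open ball with the same Lebesgue volume as `Ω`; equality holds iff `Ω` is itself a
ball of that volume. -/
theorem biharmonic_neumann_szegoWeinberger {n : ℕ} (hn : 2 ≤ n)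
    (Ω B : SmoothDomain n) (hconn : IsConnected Ω.carrier)
    (c : EuclideanSpace ℝ (Fin n)) (R : ℝ) (hR : 0 < R)
    (hBall : B.carrier = Metric.ball c R)
    (hvol : volume B.carrier = volume Ω.carrier)
    (Υ₁Ω Υ₁B : ℝ)
    (hΥΩ : IsLeast {Υ : ℝ | 0 < Υ ∧ IsBiharmonicNeumannEigenvalue Ω Υ} Υ₁Ω)
    (hΥB : IsLeast {Υ : ℝ | 0 < Υ ∧ IsBiharmonicNeumannEigenvalue B Υ} Υ₁B) :
    Υ₁Ω ≤ Υ₁B ∧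
      (Υ₁Ω = Υ₁B ↔ ∃ c' : EuclideanSpace ℝ (Fin n), Ω.carrier = Metric.ball c' R) := by
  obtain ⟨rd⟩ := BNS.exists_radial (n := n) (by omega) hR
  have hn0 : 0 < n := by omega
  have hvB : MeasureTheory.volume B.carrier = MeasureTheory.volume (Metric.ball (0 : EuclideanSpace ℝ (Fin n)) R) := by
    rw [hBall, MeasureTheory.Measure.addHaar_ball_center]
  have hcB : IsConnected B.carrier := by
    rw [hBall]
    exact ⟨⟨c, Metric.mem_ball_self hR⟩, (convex_ball c R).isPreconnected⟩
  have hW := BNS.weinberger rd hn hR Ω (hvol.symm.trans hvB) (Real.sqrt_nonneg Υ₁Ω)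
    (fun φ h1 h2 => BNS.poincare hn0 Ω hconn hΥΩ h1 h2)
  have hWB := BNS.weinberger rd hn hR B hvB (Real.sqrt_nonneg Υ₁B)
    (fun φ h1 h2 => BNS.poincare hn0 B hcB hΥB h1 h2)
  have hb := BNS.ball_bound B hR hBall rd hΥB.1.1 hΥB.1.2
  have hle : Υ₁Ω ≤ Υ₁B := (Real.sqrt_le_sqrt_iff hΥB.1.1.le).1 (hW.1.trans hb)
  refine ⟨hle, fun h => hW.2 ?_, ?_⟩
  · refine le_antisymm hW.1 ?_
    rw [h]; exact hb
  · rintro ⟨c', hc'⟩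
    have hb' := BNS.ball_bound Ω hR hc' rd hΥΩ.1.1 hΥΩ.1.2
    exact le_antisymm hle ((Real.sqrt_le_sqrt_iff hΥΩ.1.1.le).1 (hWB.1.trans hb'))
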